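/- Let α, β > 0, let 1/(1+α) < s₁ < ∞ and max(1/(1+α), 1/(1+β)) < s₂ < ∞, and let 1 < p_j, q_j ≤ ∞ for 1 ≤ j ≤ 8 satisfy 1/p_j + 1/q_j = 1/s₁ for j ∈ {1,3,5,7} and 1/p_j + 1/q_j = 1/s₂ for j ∈ {2,4,6,8}. Then there is a constant C, depending only on α, β and all the exponents, such that for all Schwartz functions f, g : ℝ² → ℂ: ‖D₁^α D₂^β (f·g)‖_{L^{s₁}_x L^{s₂}_y} ≤ C ( ‖D₁^α D₂^β f‖_{L^{p₁}_x L^{p₂}_y} ‖g‖_{L^{q₁}_x L^{q₂}_y} + ‖f‖_{L^{p₃}_x L^{p₄}_y} ‖D₁^α D₂^β g‖_{L^{q₃}_x L^{q₄}_y} + ‖D₁^α f‖_{L^{p₅}_x L^{p₆}_y} ‖D₂^β g‖_{L^{q₅}_x L^{q₆}_y} + ‖D₂^β f‖_{L^{p₇}_x L^{p₈}_y} ‖D₁^α g‖_{L^{q₇}_x L^{q₈}_y} ). -/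

import Mathlib

open MeasureTheory ENNReal NNReal

/-- The Fourier transform on `ℝ²`:
`ĥ(ξ₁,ξ₂) = ∫ h(x,y) e^{−2πi(xξ₁+yξ₂)} dx dy`. -/
noncomputable def ft2 (h : ℝ × ℝ → ℂ) (ξ : ℝ × ℝ) : ℂ :=
  ∫ z : ℝ × ℝ, h z * Complex.exp (((-2) * Real.pi * (z.1 * ξ.1 + z.2 * ξ.2) : ℝ) * Complex.I)

/-- The biparameter fractional derivative `D₁^α D₂^β h`, defined by the inverse Fourier
integral with weight `|ξ₁|^α |ξ₂|^β` (for `α = 0` resp. `β = 0` this is `D₂^β`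
resp. `D₁^α`). -/
noncomputable def fracD (α β : ℝ) (h : ℝ × ℝ → ℂ) : ℝ × ℝ → ℂ := fun z =>
  ∫ ξ : ℝ × ℝ, ((|ξ.1| ^ α * |ξ.2| ^ β : ℝ) : ℂ) * ft2 h ξ *
    Complex.exp ((2 * Real.pi * (z.1 * ξ.1 + z.2 * ξ.2) : ℝ) * Complex.I)

/-- The Lebesgue (quasi)norm with exponent `t ∈ (0, ∞]` of an `ℝ≥0∞`-valued function,
interpreted as the essential supremum when `t = ∞`. -/
noncomputable def LqNorm {X : Type*} [MeasurableSpace X] (μ : Measure X) (t : ℝ≥0∞)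
    (φ : X → ℝ≥0∞) : ℝ≥0∞ :=
  if t = ∞ then essSup φ μ else (∫⁻ x, φ x ^ t.toReal ∂μ) ^ (1 / t.toReal)

/-- The mixed quasinorm `‖h‖_{L^{a}_x L^{b}_y}` of a function on `ℝ²`. -/
noncomputable def mixedNorm (a b : ℝ≥0∞) (h : ℝ × ℝ → ℂ) : ℝ≥0∞ :=
  LqNorm volume a (fun x => LqNorm volume b (fun y => (‖h (x, y)‖₊ : ℝ≥0∞)))

/-- The Lebesgue (quasi)norm indexed by the reciprocal exponent `a = 1 / p`. -/
noncomputable def nrm {X : Type*} [MeasurableSpace X] (μ : Measure X) (a : ℝ)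
    (φ : X → ℝ≥0∞) : ℝ≥0∞ :=
  if a = 0 then essSup φ μ else (∫⁻ x, φ x ^ (1 / a) ∂μ) ^ a

section NormTools

variable {X Y : Type*} [MeasurableSpace X] [MeasurableSpace Y] {μ : Measure X} {ν : Measure Y}

lemma nrm_zero (φ : X → ℝ≥0∞) : nrm μ 0 φ = essSup φ μ := by simp [nrm]

lemma nrm_pos {a : ℝ} (ha : a ≠ 0) (φ : X → ℝ≥0∞) :
    nrm μ a φ = (∫⁻ x, φ x ^ (1 / a) ∂μ) ^ a := by simp [nrm, ha]

lemma nrm_mono_ae {a : ℝ} (ha : 0 ≤ a) {φ ψ : X → ℝ≥0∞} (h : φ ≤ᵐ[μ] ψ) :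
    nrm μ a φ ≤ nrm μ a ψ := by
  unfold nrm
  split_ifs with h0
  · exact essSup_mono_ae h
  · gcongr 1
    apply lintegral_mono_ae
    filter_upwards [h] with x hx
    exact ENNReal.rpow_le_rpow hx (by positivity)

lemma nrm_mono {a : ℝ} (ha : 0 ≤ a) {φ ψ : X → ℝ≥0∞} (h : ∀ x, φ x ≤ ψ x) :
    nrm μ a φ ≤ nrm μ a ψ := nrm_mono_ae ha (Filter.Eventually.of_forall h)

lemma nrm_congr_ae {a : ℝ} {φ ψ : X → ℝ≥0∞} (h : φ =ᵐ[μ] ψ) :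
    nrm μ a φ = nrm μ a ψ := by
  unfold nrm
  split_ifs with h0
  · exact essSup_congr_ae h
  · congr 1
    apply lintegral_congr_ae
    filter_upwards [h] with x hx
    rw [hx]

lemma nrm_rpow {a σ : ℝ} (hσ : 0 < σ) (φ : X → ℝ≥0∞) :
    nrm μ a (fun x => φ x ^ σ) = (nrm μ (a / σ) φ) ^ σ := by
  by_cases h0 : a = 0
  · subst h0
    simp only [zero_div, nrm_zero]
    exact ((ENNReal.orderIsoRpow σ hσ).essSup_apply φ μ).symm
  · have : a / σ ≠ 0 := div_ne_zero h0 hσ.ne'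
    rw [nrm_pos h0, nrm_pos this, ← ENNReal.rpow_mul]
    simp_rw [← ENNReal.rpow_mul]
    congr 1
    · congr 1; ext x; congr 1; field_simp
    · field_simp

lemma nrm_const_mul {a : ℝ} (ha : 0 ≤ a) (c : ℝ≥0∞) {φ : X → ℝ≥0∞} (hφ : AEMeasurable φ μ) :
    nrm μ a (fun x => c * φ x) = c * nrm μ a φ := by
  unfold nrm
  split_ifs with h0
  · exact ENNReal.essSup_const_mul
  · have ha' : 0 < a := lt_of_le_of_ne ha (Ne.symm h0)
    simp_rw [ENNReal.mul_rpow_of_nonneg _ _ (by positivity : (0:ℝ) ≤ 1 / a)]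
    rw [lintegral_const_mul'' _ (hφ.pow_const _), ENNReal.mul_rpow_of_nonneg _ _ ha,
      ← ENNReal.rpow_mul]
    simp [h0]

lemma nrm_eq_zero {a : ℝ} (ha : 0 ≤ a) {φ : X → ℝ≥0∞} (hφ : AEMeasurable φ μ)
    (h : nrm μ a φ = 0) : φ =ᵐ[μ] 0 := by
  unfold nrm at h
  split_ifs at h with h0
  · exact ENNReal.essSup_eq_zero_iff.1 h
  · have ha' : 0 < a := lt_of_le_of_ne ha (Ne.symm h0)
    rw [ENNReal.rpow_eq_zero_iff_of_pos ha', lintegral_eq_zero_iff' (hφ.pow_const _)] at h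
    filter_upwards [h] with x hx
    have h1 : (0:ℝ) < 1 / a := by positivity
    exact (ENNReal.rpow_eq_zero_iff_of_pos h1).1 hx

lemma nrm_zero_fun {a : ℝ} (ha : 0 ≤ a) : nrm μ a (fun _ : X => 0) = 0 := by
  unfold nrm
  split_ifs with h0
  · exact essSup_const_bot
  · have ha' : 0 < a := lt_of_le_of_ne ha (Ne.symm h0)
    simp [ENNReal.zero_rpow_of_pos ha', ENNReal.zero_rpow_of_pos (inv_pos.2 ha')]

lemma measurable_nrm [SFinite ν] {b : ℝ} {F : X × Y → ℝ≥0∞} (hF : Measurable F) :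
    Measurable (fun x => nrm ν b (fun y => F (x, y))) := by
  unfold nrm
  split_ifs with h0
  · apply measurable_of_Iic
    intro c
    have : (fun x => essSup (fun y => F (x, y)) ν) ⁻¹' Set.Iic c =
        (fun x => ν (Prod.mk x ⁻¹' {z | c < F z})) ⁻¹' {0} := by
      ext x
      simp only [Set.mem_preimage, Set.mem_Iic, Set.mem_singleton_iff]
      constructor
      · intro h
        have h1 : ∀ᵐ y ∂ν, F (x, y) ≤ c := by
          filter_upwards [ENNReal.ae_le_essSup (μ := ν) (fun y => F (x, y))] with y hy
          exact hy.trans h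
        rw [ae_iff] at h1
        simpa using h1
      · intro h
        refine essSup_le_of_ae_le _ ?_
        rw [Filter.EventuallyLE, ae_iff]
        simpa using h
    rw [this]
    exact measurable_measure_prodMk_left (measurableSet_lt measurable_const hF)
      (measurableSet_singleton _)
  · exact ((hF.pow_const _).lintegral_prod_right').pow_const _

/-- Hölder's inequality for products of powers. -/
lemma lintegral_prod_rpow_le_nrm {ι : Type*} [Fintype ι] {φ : ι → X → ℝ≥0∞} {θ a : ι → ℝ}
    (hφ : ∀ i, AEMeasurable (φ i) μ) (hθ : ∀ i, 0 ≤ θ i) (ha : ∀ i, 0 ≤ a i)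
    (hs : ∑ i, θ i * a i = 1) :
    ∫⁻ x, ∏ i, φ i x ^ θ i ∂μ ≤ ∏ i, nrm μ (a i) (φ i) ^ θ i := by
  classical
  have hb : ∀ i, ∀ᵐ x ∂μ, φ i x ^ θ i ≤
      (if a i = 0 then essSup (φ i) μ ^ θ i else 1) *
        ((if a i = 0 then 1 else φ i x ^ (1 / a i))) ^ (θ i * a i) := by
    intro i
    filter_upwards [ENNReal.ae_le_essSup (μ := μ) (φ i)] with x hx
    split_ifs with h0
    · rw [ENNReal.one_rpow, mul_one]
      exact ENNReal.rpow_le_rpow hx (hθ i)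
    · rw [one_mul, ← ENNReal.rpow_mul]
      apply le_of_eq; congr 1; field_simp
  calc ∫⁻ x, ∏ i, φ i x ^ θ i ∂μ
      ≤ ∫⁻ x, (∏ i, (if a i = 0 then essSup (φ i) μ ^ θ i else 1)) *
          ∏ i, ((if a i = 0 then 1 else φ i x ^ (1 / a i))) ^ (θ i * a i) ∂μ := by
        apply lintegral_mono_ae
        filter_upwards [ae_all_iff.2 hb] with x hx
        rw [← Finset.prod_mul_distrib]
        exact Finset.prod_le_prod' fun i _ => hx i
    _ = (∏ i, (if a i = 0 then essSup (φ i) μ ^ θ i else 1)) *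
          ∫⁻ x, ∏ i, ((if a i = 0 then 1 else φ i x ^ (1 / a i))) ^ (θ i * a i) ∂μ := by
        apply lintegral_const_mul''
        refine Finset.aemeasurable_fun_prod _ fun i _ => ?_
        by_cases h0 : a i = 0
        · simp [h0]
        · simp only [h0, if_false]
          exact ((hφ i).pow_const _).pow_const _
    _ ≤ (∏ i, (if a i = 0 then essSup (φ i) μ ^ θ i else 1)) *
          ∏ i, (∫⁻ x, (if a i = 0 then 1 else φ i x ^ (1 / a i)) ∂μ) ^ (θ i * a i) := by
        gcongr
        apply ENNReal.lintegral_prod_norm_pow_le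
        · intro i _
          by_cases h0 : a i = 0
          · simp [h0]
          · simp only [h0, if_false]
            exact ((hφ i).pow_const _)
        · exact hs
        · intro i _; exact mul_nonneg (hθ i) (ha i)
    _ = _ := by
        rw [← Finset.prod_mul_distrib]
        refine Finset.prod_congr rfl fun i _ => ?_
        by_cases h0 : a i = 0
        · simp [h0, nrm_zero]
        · simp only [h0, if_false, one_mul]
          rw [nrm_pos h0, ← ENNReal.rpow_mul, mul_comm (θ i)]

lemma nrm_prod_rpow_le {ι : Type*} [Fintype ι] {φ : ι → X → ℝ≥0∞} {θ a : ι → ℝ} {c : ℝ}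
    (hc : 0 < c)
    (hφ : ∀ i, AEMeasurable (φ i) μ) (hθ : ∀ i, 0 ≤ θ i) (ha : ∀ i, 0 ≤ a i)
    (hs : ∑ i, θ i * a i = c) :
    nrm μ c (fun x => ∏ i, φ i x ^ θ i) ≤ ∏ i, nrm μ (a i) (φ i) ^ θ i := by
  rw [nrm_pos hc.ne']
  have h1 : ∀ x, (∏ i, φ i x ^ θ i) ^ (1 / c) = ∏ i, φ i x ^ (θ i / c) := by
    intro x
    rw [← ENNReal.prod_rpow_of_nonneg (by positivity)]
    refine Finset.prod_congr rfl fun i _ => ?_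
    rw [← ENNReal.rpow_mul]; congr 1; ring
  simp_rw [h1]
  have := lintegral_prod_rpow_le_nrm (θ := fun i => θ i / c) (a := a) hφ
    (fun i => div_nonneg (hθ i) hc.le) ha (by
      have : ∑ i, θ i / c * a i = (∑ i, θ i * a i) / c := by
        rw [Finset.sum_div]; exact Finset.sum_congr rfl fun i _ => by ring
      rw [this, hs, div_self hc.ne'])
  refine (ENNReal.rpow_le_rpow this hc.le).trans (le_of_eq ?_)
  rw [← ENNReal.prod_rpow_of_nonneg hc.le]
  refine Finset.prod_congr rfl fun i _ => ?_
  rw [← ENNReal.rpow_mul]; congr 1; field_simp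

/-- The mixed norm with reciprocal exponents. -/
noncomputable def nrm2 (μ : Measure X) (ν : Measure Y) (a b : ℝ) (F : X × Y → ℝ≥0∞) : ℝ≥0∞ :=
  nrm μ a (fun x => nrm ν b (fun y => F (x, y)))

lemma nrm2_mono {a b : ℝ} (ha : 0 ≤ a) (hb : 0 ≤ b) {F G : X × Y → ℝ≥0∞}
    (h : ∀ z, F z ≤ G z) : nrm2 μ ν a b F ≤ nrm2 μ ν a b G :=
  nrm_mono ha fun _ => nrm_mono hb fun _ => h _

lemma nrm2_rpow {a b σ : ℝ} (hσ : 0 < σ) (F : X × Y → ℝ≥0∞) :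
    nrm2 μ ν a b (fun z => F z ^ σ) = (nrm2 μ ν (a / σ) (b / σ) F) ^ σ := by
  unfold nrm2
  simp_rw [nrm_rpow hσ]

lemma nrm2_const_mul [SFinite ν] {a b : ℝ} (ha : 0 ≤ a) (hb : 0 ≤ b) (c : ℝ≥0∞)
    {F : X × Y → ℝ≥0∞} (hF : Measurable F) :
    nrm2 μ ν a b (fun z => c * F z) = c * nrm2 μ ν a b F := by
  unfold nrm2
  rw [← nrm_const_mul ha c (measurable_nrm hF).aemeasurable]
  congr 1
  ext x
  exact nrm_const_mul hb c (hF.comp measurable_prodMk_left).aemeasurable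

lemma nrm2_prod_rpow_le [SFinite ν] {ι : Type*} [Fintype ι] {F : ι → X × Y → ℝ≥0∞}
    {θ a b : ι → ℝ} {c d : ℝ} (hc : 0 < c) (hd : 0 < d)
    (hF : ∀ i, Measurable (F i)) (hθ : ∀ i, 0 ≤ θ i) (ha : ∀ i, 0 ≤ a i) (hb : ∀ i, 0 ≤ b i)
    (hsa : ∑ i, θ i * a i = c) (hsb : ∑ i, θ i * b i = d) :
    nrm2 μ ν c d (fun z => ∏ i, F i z ^ θ i) ≤ ∏ i, nrm2 μ ν (a i) (b i) (F i) ^ θ i := by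
  unfold nrm2
  refine le_trans (nrm_mono hc.le fun x => ?_) (nrm_prod_rpow_le hc
    (fun i => (measurable_nrm (hF i)).aemeasurable) hθ ha hsa)
  exact nrm_prod_rpow_le hd (fun i => ((hF i).comp measurable_prodMk_left).aemeasurable) hθ hb hsb

end NormTools

section Duality

variable {X Y : Type*} [MeasurableSpace X] [MeasurableSpace Y] {μ : Measure X} {ν : Measure Y}

lemma nrm_iSup_nat {a : ℝ} (ha : 0 < a) {φ : ℕ → X → ℝ≥0∞} (hφ : ∀ n, Measurable (φ n))
    (hm : ∀ x, Monotone fun n => φ n x) :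
    nrm μ a (fun x => ⨆ n, φ n x) = ⨆ n, nrm μ a (φ n) := by
  have key : ∀ {c : ℝ} (hc : 0 < c) (f : ℕ → ℝ≥0∞), (⨆ n, f n) ^ c = ⨆ n, f n ^ c := by
    intro c hc f
    exact (ENNReal.orderIsoRpow c hc).map_iSup f
  simp_rw [nrm_pos ha.ne', key (by positivity : 0 < 1 / a)]
  rw [lintegral_iSup (fun n => (hφ n).pow_const _), key ha]
  intro i j hij x
  exact ENNReal.rpow_le_rpow (hm x hij) (by positivity)

lemma nrm2_iSup_nat [SFinite ν] {a b : ℝ} (ha : 0 < a) (hb : 0 < b) {F : ℕ → X × Y → ℝ≥0∞}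
    (hF : ∀ n, Measurable (F n)) (hm : ∀ z, Monotone fun n => F n z) :
    nrm2 μ ν a b (fun z => ⨆ n, F n z) = ⨆ n, nrm2 μ ν a b (F n) := by
  unfold nrm2
  rw [← nrm_iSup_nat ha (fun n => measurable_nrm (hF n))
    (fun x i j hij => nrm_mono hb.le fun y => hm _ hij)]
  congr 1
  ext x
  exact nrm_iSup_nat hb (fun n => (hF n).comp measurable_prodMk_left) (fun y => hm _)

/-- A test function for the mixed norm of `Z`. -/
lemma exists_test [SFinite μ] [SFinite ν] {A B : ℝ} (hA : 0 < A) (hA1 : A ≤ 1)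
    (hB : 0 < B) (hB1 : B ≤ 1) {Z : X × Y → ℝ≥0∞} (hZ : Measurable Z)
    (hfin : ∀ x, nrm ν B (fun y => Z (x, y)) ≠ ∞) :
    ∃ u : X × Y → ℝ≥0∞, Measurable u ∧
      (∫⁻ x, nrm ν B (fun y => Z (x, y)) ^ (1 / A) ∂μ ≤ ∫⁻ x, ∫⁻ y, Z (x, y) * u (x, y) ∂ν ∂μ) ∧
      nrm2 μ ν (1 - A) (1 - B) u ≤
        (∫⁻ x, nrm ν B (fun y => Z (x, y)) ^ (1 / A) ∂μ) ^ (1 - A) := by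
  classical
  set N : X → ℝ≥0∞ := fun x => nrm ν B (fun y => Z (x, y)) with hN
  have hNm : Measurable N := measurable_nrm hZ
  have hZN : ∀ x, ∫⁻ y, Z (x, y) ^ (1 / B) ∂ν = N x ^ (1 / B) := by
    intro x
    rw [hN]; simp only
    rw [nrm_pos hB.ne', ← ENNReal.rpow_mul, mul_one_div_cancel hB.ne', ENNReal.rpow_one]
  have hZx : ∀ x, Measurable fun y => Z (x, y) := fun x => hZ.comp measurable_prodMk_left
  refine ⟨fun z => if N z.1 = 0 then 0 else N z.1 ^ (1 / A - 1 / B) * Z z ^ (1 / B - 1),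
    ?_, ?_, ?_⟩
  · refine Measurable.ite ?_ measurable_const ?_
    · exact (hNm.comp measurable_fst) (measurableSet_singleton 0)
    · exact ((hNm.comp measurable_fst).pow_const _).mul (hZ.pow_const _)
  · apply lintegral_mono
    intro x
    by_cases h0 : N x = 0
    · have : (0:ℝ) < 1 / A := by positivity
      have h0' : nrm ν B (fun y => Z (x, y)) = 0 := h0
      beta_reduce
      rw [h0', ENNReal.zero_rpow_of_pos this]; exact zero_le
    · simp only [h0, if_false]
      have h1 : ∀ᵐ y ∂ν, Z (x, y) ^ (1 / B) * N x ^ (1 / A - 1 / B) =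
          Z (x, y) * (N x ^ (1 / A - 1 / B) * Z (x, y) ^ (1 / B - 1)) := by
        have : ∀ᵐ y ∂ν, Z (x, y) ^ (1 / B) < ∞ := by
          apply ae_lt_top ((hZx x).pow_const _)
          rw [hZN]
          exact ENNReal.rpow_ne_top_of_nonneg (by positivity) (hfin x)
        filter_upwards [this] with y hy
        have hy' : Z (x, y) ≠ ∞ := by
          intro h
          rw [h, ENNReal.top_rpow_of_pos (by positivity)] at hy
          exact lt_irrefl _ hy
        by_cases hz : Z (x, y) = 0
        · rw [hz, ENNReal.zero_rpow_of_pos (by positivity)]; simp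
        · rw [mul_left_comm, mul_comm]
          congr 1
          nth_rewrite 2 [← ENNReal.rpow_one (Z (x, y))]
          rw [← ENNReal.rpow_add _ _ hz hy']; congr 1; ring
      rw [← lintegral_congr_ae h1, lintegral_mul_const _ ((hZx x).pow_const _), hZN,
        ← ENNReal.rpow_add _ _ h0 (hfin x)]
      apply le_of_eq; congr 1; ring
  · have h1 : ∀ x, nrm ν (1 - B) (fun y => if N x = 0 then 0 else
        N x ^ (1 / A - 1 / B) * Z (x, y) ^ (1 / B - 1)) ≤ if N x = 0 then 0 else N x ^ (1 / A - 1) := by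
      intro x
      by_cases h0 : N x = 0
      · simp only [h0, if_true]; rw [nrm_zero_fun (by linarith)]
      · simp only [h0, if_false]
        rw [nrm_const_mul (by linarith) _ ((hZx x).pow_const _).aemeasurable]
        rcases eq_or_lt_of_le hB1 with hB1 | hB1
        · subst hB1
          simp only [sub_self, div_one, ENNReal.rpow_zero]
          rw [nrm_zero]
          calc _ ≤ N x ^ (1 / A - 1) * 1 := by
                gcongr
                exact essSup_le_of_ae_le _ (Filter.Eventually.of_forall fun _ => le_rfl)
            _ = _ := by rw [mul_one]
        · rw [nrm_pos (by linarith)]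
          have : ∀ y, (Z (x, y) ^ (1 / B - 1)) ^ (1 / (1 - B)) = Z (x, y) ^ (1 / B) := by
            intro y
            rw [← ENNReal.rpow_mul]; congr 1
            have : 1 - B ≠ 0 := by linarith
            field_simp
          simp_rw [this]
          rw [hZN, ← ENNReal.rpow_mul, ← ENNReal.rpow_add _ _ h0 (hfin x)]
          apply le_of_eq; congr 1; field_simp; ring
    unfold nrm2
    refine (nrm_mono (by linarith) h1).trans ?_
    rcases eq_or_lt_of_le hA1 with hA1 | hA1
    · subst hA1
      simp only [sub_self, div_one, ENNReal.rpow_zero]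
      rw [nrm_zero]
      refine essSup_le_of_ae_le _ (Filter.Eventually.of_forall fun x => ?_)
      simp only
      split_ifs <;> simp
    · rw [nrm_pos (by linarith)]
      refine ENNReal.rpow_le_rpow ?_ (by linarith)
      · apply lintegral_mono
        intro x
        simp only
        split_ifs with h0
        · rw [ENNReal.zero_rpow_of_pos (by apply one_div_pos.2; linarith)]; exact zero_le
        · rw [← ENNReal.rpow_mul]
          apply le_of_eq; congr 1
          have : 1 - A ≠ 0 := by linarith
          field_simp

/-- Converse to Hölder's inequality in mixed norm spaces; it suffices to test on bounded
functions. -/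
lemma nrm2_le_of_forall_test [SigmaFinite μ] [SigmaFinite ν] {A B : ℝ} (hA : 0 < A) (hA1 : A ≤ 1)
    (hB : 0 < B) (hB1 : B ≤ 1) {Z : X × Y → ℝ≥0∞} (hZ : Measurable Z) {C : ℝ≥0∞}
    (h : ∀ u : X × Y → ℝ≥0∞, Measurable u → (∃ M : ℝ≥0, ∀ z, u z ≤ M) →
      ∫⁻ x, ∫⁻ y, Z (x, y) * u (x, y) ∂ν ∂μ ≤ C * nrm2 μ ν (1 - A) (1 - B) u) :
    nrm2 μ ν A B Z ≤ C := by
  have h' : ∀ u : X × Y → ℝ≥0∞, Measurable u →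
      ∫⁻ x, ∫⁻ y, Z (x, y) * u (x, y) ∂ν ∂μ ≤ C * nrm2 μ ν (1 - A) (1 - B) u := by
    intro u hu
    have e1 : ∀ z, Z z * u z = ⨆ n : ℕ, Z z * min (u z) n := by
      intro z
      rw [← ENNReal.mul_iSup]
      congr 1
      apply le_antisymm
      · rcases eq_or_ne (u z) ∞ with h | h
        · rw [h]; simp [ENNReal.iSup_natCast]
        · obtain ⟨n, hn⟩ := ENNReal.exists_nat_gt h
          exact le_iSup_of_le n (le_min le_rfl hn.le)
      · exact iSup_le fun n => min_le_left _ _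
    have e2 : ∫⁻ x, ∫⁻ y, Z (x, y) * u (x, y) ∂ν ∂μ =
        ⨆ n : ℕ, ∫⁻ x, ∫⁻ y, Z (x, y) * min (u (x, y)) n ∂ν ∂μ := by
      have mono : ∀ z, Monotone fun n : ℕ => Z z * min (u z) n := by
        intro z i j hij
        simp only
        gcongr
      have mz : ∀ n : ℕ, Measurable fun z => Z z * min (u z) n := fun n =>
        hZ.mul (hu.min measurable_const)
      rw [← lintegral_iSup (fun n => (mz n).lintegral_prod_right')]
      · apply lintegral_congr; intro x
        rw [← lintegral_iSup (f := fun (n : ℕ) y => Z (x, y) * min (u (x, y)) n)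
          (fun n => (mz n).comp measurable_prodMk_left)]
        · exact lintegral_congr fun y => e1 _
        · intro i j hij y; exact mono _ hij
      · intro i j hij x
        exact lintegral_mono fun y => mono _ hij
    rw [e2]
    refine iSup_le fun n => ?_
    refine (h (fun z => min (u z) n) (hu.min measurable_const) ⟨n, fun z => ?_⟩).trans ?_
    · simp
    · gcongr
      exact nrm2_mono (by linarith) (by linarith) fun z => min_le_left _ _
  set S := spanningSets μ
  set T := spanningSets ν
  set Zn : ℕ → X × Y → ℝ≥0∞ := fun n z =>
    (S n ×ˢ T n).indicator (fun z => min (Z z) n) z with hZn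
  have mZn : ∀ n, Measurable (Zn n) := fun n =>
    (hZ.min measurable_const).indicator
      ((measurableSet_spanningSets μ n).prod (measurableSet_spanningSets ν n))
  have hmono : ∀ z, Monotone fun n => Zn n z := by
    intro z i j hij
    simp only [hZn]
    by_cases hz : z ∈ S i ×ˢ T i
    · have : z ∈ S j ×ˢ T j := ⟨monotone_spanningSets μ hij hz.1, monotone_spanningSets ν hij hz.2⟩
      rw [Set.indicator_of_mem hz, Set.indicator_of_mem this]
      gcongr
    · rw [Set.indicator_of_notMem hz]; exact zero_le
  have hsup : Z = fun z => ⨆ n, Zn n z := by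
    ext z
    apply le_antisymm
    · have : ∀ m : ℕ, min (Z z) m ≤ ⨆ n, Zn n z := by
        intro m
        obtain ⟨i, hi⟩ : ∃ i, z.1 ∈ S i := ⟨_, mem_spanningSetsIndex μ z.1⟩
        obtain ⟨j, hj⟩ : ∃ j, z.2 ∈ T j := ⟨_, mem_spanningSetsIndex ν z.2⟩
        refine le_iSup_of_le (max m (max i j)) ?_
        simp only [hZn]
        rw [Set.indicator_of_mem]
        · gcongr; exact le_max_left _ _
        · exact ⟨monotone_spanningSets μ (by omega) hi, monotone_spanningSets ν (by omega) hj⟩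
      rcases eq_or_ne (Z z) ∞ with hz | hz
      · rw [hz] at this ⊢
        simp only [le_top, inf_of_le_right] at this
        rw [← ENNReal.iSup_natCast]; exact iSup_le this
      · obtain ⟨n, hn⟩ := ENNReal.exists_nat_gt hz
        have := this n
        rwa [min_eq_left hn.le] at this
    · exact iSup_le fun n => (Set.indicator_apply_le' (fun _ => min_le_left _ _) fun _ => zero_le)
  rw [hsup, nrm2_iSup_nat hA hB mZn hmono]
  refine iSup_le fun n => ?_
  have hb : ∀ x, nrm ν B (fun y => Zn n (x, y)) ≤ (S n).indicator (fun _ => (n : ℝ≥0∞) * ν (T n) ^ B) x := by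
    intro x
    by_cases hx : x ∈ S n
    · rw [Set.indicator_of_mem hx]
      calc _ ≤ nrm ν B ((T n).indicator (fun _ => (n : ℝ≥0∞))) := by
            apply nrm_mono hB.le
            intro y
            simp only [hZn]
            by_cases hy : y ∈ T n
            · rw [Set.indicator_of_mem (show (x, y) ∈ S n ×ˢ T n from ⟨hx, hy⟩), Set.indicator_of_mem hy]
              exact min_le_right _ _
            · rw [Set.indicator_of_notMem (fun h => hy h.2)]; exact zero_le
        _ = _ := by
            rw [nrm_pos hB.ne']
            have : ∀ y, (T n).indicator (fun _ => (n : ℝ≥0∞)) y ^ (1 / B) =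
                (T n).indicator (fun _ => (n : ℝ≥0∞) ^ (1 / B)) y := by
              intro y
              by_cases hy : y ∈ T n
              · simp [hy]
              · simp only [hy, not_false_eq_true, Set.indicator_of_notMem]
                exact ENNReal.zero_rpow_of_pos (by positivity)
            simp_rw [this]
            rw [lintegral_indicator (measurableSet_spanningSets ν n), setLIntegral_const,
              ENNReal.mul_rpow_of_nonneg _ _ hB.le, ← ENNReal.rpow_mul, one_div_mul_cancel hB.ne',
              ENNReal.rpow_one]
    · rw [Set.indicator_of_notMem hx]
      apply le_of_eq
      rw [← nrm_zero_fun (μ := ν) hB.le]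
      congr 1; ext y
      simp only [hZn]
      rw [Set.indicator_of_notMem (fun h => hx h.1)]
  have hT : (n : ℝ≥0∞) * ν (T n) ^ B ≠ ∞ :=
    ENNReal.mul_ne_top (by simp) (ENNReal.rpow_ne_top_of_nonneg hB.le
      (measure_spanningSets_lt_top ν n).ne)
  have hfin : ∀ x, nrm ν B (fun y => Zn n (x, y)) ≠ ∞ := by
    intro x
    refine ne_top_of_le_ne_top ?_ (hb x)
    by_cases hx : x ∈ S n
    · rwa [Set.indicator_of_mem hx]
    · rw [Set.indicator_of_notMem hx]; simp
  obtain ⟨u, hu, hu1, hu2⟩ := exists_test (μ := μ) hA hA1 hB hB1 (mZn n) hfin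
  set I := ∫⁻ x, nrm ν B (fun y => Zn n (x, y)) ^ (1 / A) ∂μ with hI
  have hIfin : I ≠ ∞ := by
    have : I ≤ ∫⁻ x, (S n).indicator (fun _ => ((n : ℝ≥0∞) * ν (T n) ^ B) ^ (1 / A)) x ∂μ := by
      apply lintegral_mono
      intro x
      by_cases hx : x ∈ S n
      · have := hb x
        rw [Set.indicator_of_mem hx] at this ⊢
        exact ENNReal.rpow_le_rpow this (by positivity)
      · have := hb x
        rw [Set.indicator_of_notMem hx] at this ⊢
        simp only [nonpos_iff_eq_zero] at this
        simp only [this]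
        rw [ENNReal.zero_rpow_of_pos (by positivity)]
    refine ne_top_of_le_ne_top ?_ this
    rw [lintegral_indicator (measurableSet_spanningSets μ n), setLIntegral_const]
    exact ENNReal.mul_ne_top (ENNReal.rpow_ne_top_of_nonneg (by positivity) hT)
      (measure_spanningSets_lt_top μ n).ne
  have hle : I ≤ C * I ^ (1 - A) := by
    calc I ≤ ∫⁻ x, ∫⁻ y, Zn n (x, y) * u (x, y) ∂ν ∂μ := hu1
      _ ≤ ∫⁻ x, ∫⁻ y, Z (x, y) * u (x, y) ∂ν ∂μ := by
          gcongr with x y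
          exact Set.indicator_apply_le' (fun _ => min_le_left _ _) fun _ => zero_le
      _ ≤ _ := h' u hu
      _ ≤ _ := by gcongr
  have : nrm2 μ ν A B (Zn n) = I ^ A := by
    unfold nrm2; rw [nrm_pos hA.ne']
  rw [this]
  by_cases hI0 : I = 0
  · rw [hI0, ENNReal.zero_rpow_of_pos hA]; exact zero_le
  · have h3 : I ^ A * I ^ (1 - A) ≤ C * I ^ (1 - A) := by
      rw [← ENNReal.rpow_add _ _ hI0 hIfin]; simpa using hle
    have h4 : I ^ (1 - A) ≠ 0 := by
      intro h0
      rcases (ENNReal.rpow_eq_zero_iff.1 h0) with h | h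
      · exact hI0 h.1
      · exact hIfin h.1
    exact (ENNReal.mul_le_mul_iff_left h4
      (ENNReal.rpow_ne_top_of_nonneg (by linarith) hIfin)).1 h3

end Duality

section Minkowski

variable {X Y T : Type*} [MeasurableSpace X] [MeasurableSpace Y] [MeasurableSpace T]
  {μ : Measure X} {ν : Measure Y} {τ : Measure T}

lemma nrm_dirac {b : ℝ} (hb : 0 ≤ b) (φ : Unit → ℝ≥0∞) :
    nrm (Measure.dirac ()) b φ = φ () := by
  unfold nrm
  split_ifs with h
  · have : (fun x : Unit => φ x) = fun _ => φ () := by ext x; rfl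
    rw [show φ = fun _ => φ () from this]
    have : (Measure.dirac () : Measure Unit) ≠ 0 := by
      intro h
      have := congrArg (fun m => m Set.univ) h
      simp at this
    exact essSup_const _ this
  · rw [lintegral_dirac, ← ENNReal.rpow_mul, one_div_mul_cancel h, ENNReal.rpow_one]

lemma nrm_le_of_forall_test [SigmaFinite μ] {A : ℝ} (hA : 0 < A) (hA1 : A ≤ 1)
    {Z : X → ℝ≥0∞} (hZ : Measurable Z) {C : ℝ≥0∞}
    (h : ∀ u : X → ℝ≥0∞, Measurable u → ∫⁻ x, Z x * u x ∂μ ≤ C * nrm μ (1 - A) u) :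
    nrm μ A Z ≤ C := by
  have := nrm2_le_of_forall_test (μ := μ) (ν := Measure.dirac ()) hA hA1 one_pos le_rfl
    (Z := fun z : X × Unit => Z z.1) (hZ.comp measurable_fst) (C := C) (fun u hu _ => by
      unfold nrm2
      simp only [lintegral_dirac, nrm_dirac (b := 1 - 1) (by norm_num)]
      exact h (fun x => u (x, ())) (hu.comp (measurable_id.prodMk measurable_const)))
  unfold nrm2 at this
  simpa only [nrm_dirac zero_le_one] using this

/-- Minkowski's integral inequality. -/
lemma nrm_lintegral_le [SigmaFinite μ] [SFinite τ] {a : ℝ} (ha : 0 ≤ a) (ha1 : a ≤ 1)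
    {F : X × T → ℝ≥0∞} (hF : Measurable F) :
    nrm μ a (fun x => ∫⁻ t, F (x, t) ∂τ) ≤ ∫⁻ t, nrm μ a (fun x => F (x, t)) ∂τ := by
  have hF' : Measurable fun z : T × X => F (z.2, z.1) := hF.comp measurable_swap
  have hn := measurable_nrm (ν := μ) (b := a) hF'
  rcases eq_or_lt_of_le ha with h0 | h0
  · subst h0
    simp only [nrm_zero] at hn ⊢
    have h1 : ∀ᵐ t ∂τ, ∀ᵐ x ∂μ, F (x, t) ≤ essSup (fun x => F (x, t)) μ :=
      Filter.Eventually.of_forall fun t => ENNReal.ae_le_essSup _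
    have hms : MeasurableSet {z : T × X | F (z.2, z.1) ≤ essSup (fun x => F (x, z.1)) μ} :=
      measurableSet_le hF' (hn.comp measurable_fst)
    have h2 : ∀ᵐ x ∂μ, ∀ᵐ t ∂τ, F (x, t) ≤ essSup (fun x => F (x, t)) μ := by
      rw [← Measure.ae_prod_iff_ae_ae hms] at h1
      have h3 := (Measure.measurePreserving_swap (μ := μ) (ν := τ)).quasiMeasurePreserving.ae h1
      exact Measure.ae_ae_of_ae_prod h3
    refine essSup_le_of_ae_le _ ?_
    filter_upwards [h2] with x hx
    exact lintegral_mono_ae hx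
  · refine nrm_le_of_forall_test h0 ha1 hF.lintegral_prod_right' fun u hu => ?_
    calc ∫⁻ x, (∫⁻ t, F (x, t) ∂τ) * u x ∂μ = ∫⁻ x, ∫⁻ t, F (x, t) * u x ∂τ ∂μ := by
          apply lintegral_congr; intro x
          exact (lintegral_mul_const _ (hF.comp measurable_prodMk_left)).symm
      _ = ∫⁻ t, ∫⁻ x, F (x, t) * u x ∂μ ∂τ := by
          apply lintegral_lintegral_swap
          exact (hF.mul (hu.comp measurable_fst)).aemeasurable
      _ ≤ ∫⁻ t, nrm μ a (fun x => F (x, t)) * nrm μ (1 - a) u ∂τ := by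
          apply lintegral_mono; intro t
          have := lintegral_prod_rpow_le_nrm (μ := μ) (ι := Fin 2)
            (φ := ![fun x => F (x, t), u]) (θ := ![1, 1]) (a := ![a, 1 - a])
            (by
              intro i; fin_cases i
              · exact (hF.comp measurable_prodMk_right).aemeasurable
              · exact hu.aemeasurable)
            (by intro i; fin_cases i <;> simp)
            (by intro i; fin_cases i <;> simp [ha, ha1])
            (by simp)
          simpa [Fin.prod_univ_two] using this
      _ = _ := lintegral_mul_const _ hn

lemma nrm2_lintegral_le [SigmaFinite μ] [SigmaFinite ν] [SFinite τ] {a b : ℝ} (ha : 0 ≤ a)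
    (ha1 : a ≤ 1) (hb : 0 ≤ b) (hb1 : b ≤ 1) {F : (X × Y) × T → ℝ≥0∞} (hF : Measurable F) :
    nrm2 μ ν a b (fun z => ∫⁻ t, F (z, t) ∂τ) ≤ ∫⁻ t, nrm2 μ ν a b (fun z => F (z, t)) ∂τ := by
  unfold nrm2
  calc _ ≤ nrm μ a (fun x => ∫⁻ t, nrm ν b (fun y => F ((x, y), t)) ∂τ) := by
        apply nrm_mono ha
        intro x
        exact nrm_lintegral_le (F := fun z : Y × T => F ((x, z.1), z.2)) hb hb1 (by fun_prop)
    _ ≤ _ := by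
        apply nrm_lintegral_le (F := fun w : X × T => nrm ν b (fun y => F ((w.1, y), w.2))) ha ha1
        exact measurable_nrm (F := fun w : (X × T) × Y => F ((w.1.1, w.2), w.1.2)) (by fun_prop)

lemma measurable_of_uncurry_countable {ι : Type*} [Countable ι] [MeasurableSpace ι]
    [MeasurableSingletonClass ι] {F : ι → X → ℝ≥0∞} (hF : ∀ i, Measurable (F i)) :
    Measurable fun w : X × ι => F w.2 w.1 :=
  measurable_from_prod_countable_left hF

lemma nrm2_tsum_le [SigmaFinite μ] [SigmaFinite ν] {ι : Type*} [Countable ι] {a b : ℝ}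
    (ha : 0 ≤ a) (ha1 : a ≤ 1) (hb : 0 ≤ b) (hb1 : b ≤ 1) {F : ι → X × Y → ℝ≥0∞}
    (hF : ∀ i, Measurable (F i)) :
    nrm2 μ ν a b (fun z => ∑' i, F i z) ≤ ∑' i, nrm2 μ ν a b (F i) := by
  letI : MeasurableSpace ι := ⊤
  haveI : MeasurableSingletonClass ι := ⟨fun _ => trivial⟩
  have := nrm2_lintegral_le (μ := μ) (ν := ν) (τ := (Measure.count : Measure ι)) ha ha1 hb hb1
    (measurable_of_uncurry_countable hF)
  simpa only [lintegral_count] using this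

lemma nrm_tsum_le [SigmaFinite μ] {ι : Type*} [Countable ι] {a : ℝ}
    (ha : 0 ≤ a) (ha1 : a ≤ 1) {F : ι → X → ℝ≥0∞} (hF : ∀ i, Measurable (F i)) :
    nrm μ a (fun z => ∑' i, F i z) ≤ ∑' i, nrm μ a (F i) := by
  letI : MeasurableSpace ι := ⊤
  haveI : MeasurableSingletonClass ι := ⟨fun _ => trivial⟩
  have := nrm_lintegral_le (μ := μ) (τ := (Measure.count : Measure ι)) ha ha1
    (measurable_of_uncurry_countable hF)
  simpa only [lintegral_count] using this

lemma sum_rpow_le {ι : Type*} (s : Finset ι) (f : ι → ℝ≥0∞) {σ : ℝ} (hσ : 0 < σ) (hσ1 : σ ≤ 1) :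
    (∑ i ∈ s, f i) ^ σ ≤ ∑ i ∈ s, f i ^ σ := by
  classical
  induction s using Finset.induction_on with
  | empty => simp [hσ]
  | insert i s hi ih =>
    rw [Finset.sum_insert hi, Finset.sum_insert hi]
    exact (ENNReal.rpow_add_le_add_rpow _ _ hσ.le hσ1).trans (by gcongr)

lemma tsum_rpow_le {ι : Type*} (f : ι → ℝ≥0∞) {σ : ℝ} (hσ : 0 < σ) (hσ1 : σ ≤ 1) :
    (∑' i, f i) ^ σ ≤ ∑' i, f i ^ σ := by
  rw [ENNReal.tsum_eq_iSup_sum]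
  have := (ENNReal.orderIsoRpow σ hσ).map_iSup (fun s : Finset ι => ∑ i ∈ s, f i)
  simp only [ENNReal.orderIsoRpow_apply] at this
  rw [this]
  exact iSup_le fun s => (sum_rpow_le s f hσ hσ1).trans (ENNReal.sum_le_tsum s)

/-- Quasi-triangle inequality for reciprocal exponents at most two. -/
lemma nrm2_tsum_rpow_half_le [SigmaFinite μ] [SigmaFinite ν] {ι : Type*} [Countable ι] {a b : ℝ}
    (ha : 0 ≤ a) (ha2 : a ≤ 2) (hb : 0 ≤ b) (hb2 : b ≤ 2) {F : ι → X × Y → ℝ≥0∞}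
    (hF : ∀ i, Measurable (F i)) :
    nrm2 μ ν a b (fun z => ∑' i, F i z) ^ (1 / 2 : ℝ) ≤
      ∑' i, nrm2 μ ν a b (F i) ^ (1 / 2 : ℝ) := by
  have e : ∀ G : X × Y → ℝ≥0∞, nrm2 μ ν a b G ^ (1 / 2 : ℝ) =
      nrm2 μ ν (a / 2) (b / 2) (fun z => G z ^ (1 / 2 : ℝ)) := by
    intro G
    rw [nrm2_rpow (by norm_num)]
    congr 2 <;> ring
  simp_rw [e]
  refine le_trans (nrm2_mono (by linarith) (by linarith) fun z =>
    tsum_rpow_le _ (by norm_num) (by norm_num)) ?_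
  exact nrm2_tsum_le (by linarith) (by linarith) (by linarith) (by linarith)
    fun i => (hF i).pow_const _

end Minkowski

section Numeric

/-- The dyadic power `2 ^ x` as an extended nonnegative real. -/
noncomputable def t2 (x : ℝ) : ℝ≥0∞ := (2 : ℝ≥0∞) ^ x

lemma t2_ne_zero (x : ℝ) : t2 x ≠ 0 := by
  unfold t2; exact (ENNReal.rpow_pos (by norm_num) (by norm_num)).ne'

lemma t2_ne_top (x : ℝ) : t2 x ≠ ∞ := by
  unfold t2; exact ENNReal.rpow_ne_top_of_ne_zero (by norm_num) (by norm_num)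

lemma t2_add (x y : ℝ) : t2 (x + y) = t2 x * t2 y := by
  unfold t2; exact ENNReal.rpow_add _ _ (by norm_num) (by norm_num)

lemma t2_rpow (x y : ℝ) : t2 x ^ y = t2 (x * y) := by
  unfold t2; rw [ENNReal.rpow_mul]

lemma t2_zero : t2 0 = 1 := by simp [t2]
lemma t2_one : t2 1 = 2 := by simp [t2]

lemma t2_le {x y : ℝ} : t2 x ≤ t2 y ↔ x ≤ y := by
  unfold t2
  refine ⟨fun h => ?_, fun h => ENNReal.rpow_le_rpow_of_exponent_le (by norm_num) h⟩
  by_contra hc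
  exact absurd h (not_le.2 (ENNReal.rpow_lt_rpow_of_exponent_lt (by norm_num) (by norm_num)
    (not_le.1 hc)))

lemma t2_mono {x y : ℝ} (h : x ≤ y) : t2 x ≤ t2 y := t2_le.2 h

lemma t2_lt {x y : ℝ} : t2 x < t2 y ↔ x < y := by
  rw [← not_le, ← not_le, t2_le]

lemma t2_eq_ofReal (x : ℝ) : t2 x = ENNReal.ofReal ((2 : ℝ) ^ x) := by
  unfold t2
  rw [← ENNReal.ofReal_rpow_of_pos (by norm_num)]; simp

lemma exists_t2_eq {X : ℝ≥0∞} (h0 : X ≠ 0) (h1 : X ≠ ∞) : ∃ x, X = t2 x := by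
  refine ⟨Real.logb 2 X.toReal, ?_⟩
  rw [t2_eq_ofReal, Real.rpow_logb (by norm_num) (by norm_num) (ENNReal.toReal_pos h0 h1),
    ENNReal.ofReal_toReal h1]

lemma tsum_int_le (f : ℤ → ℝ≥0∞) (m : ℤ) :
    ∑' k, f k ≤ (∑' n : ℕ, f (m - n)) + ∑' n : ℕ, f (m + 1 + n) := by
  have e : ∑' k, f k = ∑' k, f (m + 1 + k) := ((Equiv.addLeft (m + 1)).tsum_eq f).symm
  rw [e, tsum_of_nat_of_neg_add_one (f := fun k => f (m + 1 + k)) ENNReal.summable ENNReal.summable,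
    add_comm]
  apply le_of_eq
  congr 1
  congr 1; ext n; congr 1; ring

/-- The geometric series `∑ 2 ^ (- θ n)`. -/
noncomputable def geomC (θ : ℝ) : ℝ≥0∞ := ∑' n : ℕ, t2 (-θ * n)

lemma geomC_ne_top {θ : ℝ} (hθ : 0 < θ) : geomC θ ≠ ∞ := by
  unfold geomC
  have : ∀ n : ℕ, t2 (-θ * n) = (t2 (-θ)) ^ n := by
    intro n; rw [← t2_rpow]; simp
  simp_rw [this]
  rw [ENNReal.tsum_geometric]
  have h : t2 (-θ) < 1 := by rw [← t2_zero, t2_lt]; linarith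
  exact ENNReal.inv_ne_top.2 (tsub_pos_of_lt h).ne'

lemma geomC_ge_one (θ : ℝ) : 1 ≤ geomC θ := by
  unfold geomC
  refine le_trans ?_ (ENNReal.le_tsum 0)
  simp [t2_zero]

open Classical in
lemma tsum_dyadic_le {θ : ℝ} (hθ : 0 < θ) (v : ℝ≥0∞) :
    ∑' m : ℤ, (if t2 m ≤ v then t2 (m * θ) else 0) ≤ geomC θ * v ^ θ := by
  rcases eq_or_ne v 0 with h0 | h0
  · subst h0
    have : ∀ m : ℤ, ¬ t2 m ≤ 0 := fun m h => t2_ne_zero m (by simpa using h)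
    simp [this]
  rcases eq_or_ne v ∞ with h1 | h1
  · subst h1
    rw [ENNReal.top_rpow_of_pos hθ, ENNReal.mul_top]
    · exact le_top
    · exact (lt_of_lt_of_le one_pos (geomC_ge_one θ)).ne'
  obtain ⟨y, rfl⟩ := exists_t2_eq h0 h1
  refine (tsum_int_le _ ⌊y⌋).trans ?_
  have e2 : ∀ n : ℕ, (if t2 ((⌊y⌋ + 1 + n : ℤ) : ℝ) ≤ t2 y then
      t2 (((⌊y⌋ + 1 + n : ℤ) : ℝ) * θ) else 0) = 0 := by
    intro n
    rw [if_neg]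
    rw [t2_le]; push_cast
    have := Int.lt_floor_add_one y
    have h2 : (0:ℝ) ≤ n := by positivity
    linarith
  simp_rw [e2]
  rw [tsum_zero, add_zero]
  unfold geomC
  rw [← ENNReal.tsum_mul_right]
  apply ENNReal.tsum_le_tsum
  intro n
  split_ifs
  · rw [t2_rpow, ← t2_add]
    apply t2_mono
    push_cast
    have := Int.floor_le y
    nlinarith
  · exact zero_le

lemma tsum_min_le {ε : ℝ} (hε : 0 < ε) (X Y : ℝ≥0∞) :
    ∑' k : ℤ, min (t2 (ε * k) * X) (t2 (-ε * k) * Y) ≤ 2 * geomC ε * (X * Y) ^ (1 / 2 : ℝ) := by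
  rcases eq_or_ne X 0 with hX | hX
  · simp [hX]
  rcases eq_or_ne Y 0 with hY | hY
  · simp [hY]
  have hC : 2 * geomC ε ≠ 0 := by
    have := (lt_of_lt_of_le one_pos (geomC_ge_one ε)).ne'
    simp [this]
  have htop : X * Y = ∞ → ∑' k : ℤ, min (t2 (ε * k) * X) (t2 (-ε * k) * Y) ≤
      2 * geomC ε * (X * Y) ^ (1 / 2 : ℝ) := by
    intro h
    rw [h, ENNReal.top_rpow_of_pos (by norm_num), ENNReal.mul_top hC]; exact le_top
  rcases eq_or_ne X ∞ with hX' | hX'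
  · exact htop (by rw [hX', ENNReal.top_mul hY])
  rcases eq_or_ne Y ∞ with hY' | hY'
  · exact htop (by rw [hY', ENNReal.mul_top hX])
  obtain ⟨x, rfl⟩ := exists_t2_eq hX hX'
  obtain ⟨y, rfl⟩ := exists_t2_eq hY hY'
  set c := (y - x) / (2 * ε) with hc
  have hcε : ε * c = (y - x) / 2 := by rw [hc]; field_simp
  refine (tsum_int_le _ ⌊c⌋).trans ?_
  rw [mul_assoc, two_mul]
  unfold geomC
  rw [← ENNReal.tsum_mul_right]
  rw [← t2_add, t2_rpow]
  have f1 := Int.floor_le c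
  have f2 := Int.lt_floor_add_one c
  gcongr with n n
  · refine (min_le_left _ _).trans ?_
    rw [← t2_add, ← t2_add]; apply t2_mono
    push_cast
    nlinarith
  · refine (min_le_right _ _).trans ?_
    rw [← t2_add, ← t2_add]; apply t2_mono
    push_cast
    nlinarith

lemma tsum_pi_prod_le {ι : Type*} [Fintype ι] {κ : Type*} (f : ι → κ → ℝ≥0∞) :
    ∑' m : ι → κ, ∏ i, f i (m i) ≤ ∏ i, ∑' k, f i k := by
  classical
  rw [ENNReal.tsum_eq_iSup_sum]
  refine iSup_le fun s => ?_
  calc ∑ m ∈ s, ∏ i, f i (m i)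
      ≤ ∑ m ∈ Fintype.piFinset (fun i => s.image (fun m => m i)), ∏ i, f i (m i) := by
        apply Finset.sum_le_sum_of_subset
        intro m hm
        rw [Fintype.mem_piFinset]
        intro i
        exact Finset.mem_image_of_mem _ hm
    _ = ∏ i, ∑ k ∈ s.image (fun m => m i), f i k := (Finset.prod_univ_sum _ _).symm
    _ ≤ _ := Finset.prod_le_prod' fun i _ => ENNReal.sum_le_tsum _

end Numeric

section Holder

variable {X : Type*} [MeasurableSpace X] {μ : Measure X}

lemma lintegral_mul_le_nrm {a : ℝ} (ha : 0 ≤ a) (ha1 : a ≤ 1) {f g : X → ℝ≥0∞}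
    (hf : AEMeasurable f μ) (hg : AEMeasurable g μ) :
    ∫⁻ x, f x * g x ∂μ ≤ nrm μ a f * nrm μ (1 - a) g := by
  have := lintegral_prod_rpow_le_nrm (μ := μ) (ι := Fin 2)
    (φ := ![f, g]) (θ := ![1, 1]) (a := ![a, 1 - a])
    (by intro i; fin_cases i <;> simp [hf, hg])
    (by intro i; fin_cases i <;> simp)
    (by intro i; fin_cases i <;> simp [ha, ha1])
    (by simp)
  simpa [Fin.prod_univ_two] using this

/-- Jensen's inequality with respect to a subprobability density. -/
lemma lintegral_mul_le_jensen {a : ℝ} (ha : 0 < a) (ha1 : a ≤ 1) {κ f : X → ℝ≥0∞}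
    (hκ : Measurable κ) (hf : Measurable f) (h1 : ∫⁻ x, κ x ∂μ ≤ 1) :
    ∫⁻ x, κ x * f x ∂μ ≤ (∫⁻ x, κ x * f x ^ (1 / a) ∂μ) ^ a := by
  have e : ∀ g : X → ℝ≥0∞, Measurable g → ∫⁻ x, κ x * g x ∂μ = ∫⁻ x, g x ∂(μ.withDensity κ) := by
    intro g hg
    rw [lintegral_withDensity_eq_lintegral_mul _ hκ hg]; rfl
  rw [e f hf, e _ (hf.pow_const _)]
  have := lintegral_mul_le_nrm (μ := μ.withDensity κ) (a := a) ha.le ha1 (f := f) (g := fun _ => 1)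
    hf.aemeasurable aemeasurable_const
  simp only [mul_one] at this
  refine this.trans ?_
  rw [nrm_pos ha.ne']
  calc _ ≤ (∫⁻ x, f x ^ (1 / a) ∂(μ.withDensity κ)) ^ a * 1 := by
        gcongr
        unfold nrm
        split_ifs with h
        · exact essSup_le_of_ae_le _ (Filter.Eventually.of_forall fun _ => le_rfl)
        · apply ENNReal.rpow_le_one _ (by linarith)
          simp only [ENNReal.one_rpow, lintegral_const, one_mul]
          rw [withDensity_apply _ MeasurableSet.univ]
          simpa using h1
    _ = _ := mul_one _

end Holder

section Dyadic

/-- The index of the dyadic interval of length `2 ^ (-k)` containing `x`. -/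
noncomputable def cell (k : ℤ) (x : ℝ) : ℤ := ⌊(2 : ℝ) ^ k * x⌋

lemma measurable_cell (k : ℤ) : Measurable (cell k) :=
  Int.measurable_floor.comp (measurable_const.mul measurable_id)

lemma cell_nested {l k : ℤ} (h : l ≤ k) {x x' : ℝ} (hx : cell k x = cell k x') :
    cell l x = cell l x' := by
  obtain ⟨n, rfl⟩ := Int.le.dest h
  have key : ∀ z : ℝ, cell l z = cell (l + n) z / ((2 ^ n : ℕ) : ℤ) := by
    intro z
    unfold cell
    rw [← Int.floor_div_natCast]
    congr 1
    rw [zpow_add₀ (by norm_num : (2:ℝ) ≠ 0)]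
    push_cast
    rw [zpow_natCast]
    field_simp
  rw [key, key, hx]

open Classical in
/-- The kernel of the dyadic averaging operator. -/
noncomputable def dker (k : ℤ) (x x' : ℝ) : ℝ≥0∞ := if cell k x = cell k x' then t2 k else 0

lemma measurable_dker (k : ℤ) : Measurable fun z : ℝ × ℝ => dker k z.1 z.2 := by
  unfold dker
  refine Measurable.ite ?_ measurable_const measurable_const
  exact measurableSet_eq_fun ((measurable_cell k).comp measurable_fst)
    ((measurable_cell k).comp measurable_snd)

lemma measurable_dker_right (k : ℤ) (x : ℝ) : Measurable fun x' => dker k x x' :=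
  (measurable_dker k).comp measurable_prodMk_left

lemma dker_symm (k : ℤ) (x x' : ℝ) : dker k x x' = dker k x' x := by
  unfold dker; simp only [eq_comm]

lemma dker_congr {l k : ℤ} (h : l ≤ k) {x x' : ℝ} (hx : cell k x = cell k x') (z : ℝ) :
    dker l x z = dker l x' z := by
  unfold dker; rw [cell_nested h hx]

lemma dker_succ_le (k : ℤ) (x x' : ℝ) : dker (k + 1) x x' ≤ 2 * dker k x x' := by
  unfold dker
  split_ifs with h1 h2 h2
  · push_cast; rw [t2_add, t2_one, mul_comm]
  · exact absurd (cell_nested (by omega) h1) h2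
  · exact zero_le
  · exact zero_le

lemma lintegral_dker (k : ℤ) (x : ℝ) : ∫⁻ x', dker k x x' = 1 := by
  have hp : (0:ℝ) < 2 ^ k := by positivity
  have : {x' | cell k x = cell k x'} =
      Set.Ico ((cell k x : ℝ) / 2 ^ k) (((cell k x : ℝ) + 1) / 2 ^ k) := by
    ext x'
    simp only [Set.mem_setOf_eq, Set.mem_Ico]
    rw [eq_comm]
    conv_lhs => unfold cell
    rw [Int.floor_eq_iff, div_le_iff₀ hp, lt_div_iff₀ hp, mul_comm x']
    rfl
  have h2 : ∀ x', dker k x x' = {x' | cell k x = cell k x'}.indicator (fun _ => t2 k) x' := by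
    intro x'; unfold dker; simp [Set.indicator_apply]
  simp_rw [h2, this]
  rw [lintegral_indicator measurableSet_Ico, setLIntegral_const, Real.volume_Ico]
  have : ((cell k x : ℝ) + 1) / 2 ^ k - (cell k x : ℝ) / 2 ^ k = (2 : ℝ) ^ (-(k:ℝ)) := by
    rw [Real.rpow_neg (by norm_num), Real.rpow_intCast]; field_simp; ring
  rw [this, ← t2_eq_ofReal, ← t2_add, add_neg_cancel, t2_zero]

/-- The dyadic averaging operator at scale `2 ^ (-k)`. -/
noncomputable def dE (k : ℤ) (f : ℝ → ℝ≥0∞) (x : ℝ) : ℝ≥0∞ := ∫⁻ x', dker k x x' * f x'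

lemma dE_le_of_ae_le (k : ℤ) {f : ℝ → ℝ≥0∞} {c : ℝ≥0∞} (h : ∀ᵐ x, f x ≤ c) (x : ℝ) :
    dE k f x ≤ c := by
  calc dE k f x ≤ ∫⁻ x', dker k x x' * c := by
        apply lintegral_mono_ae
        filter_upwards [h] with x' hx'
        gcongr
    _ = c := by rw [lintegral_mul_const _ (measurable_dker_right k x), lintegral_dker, one_mul]

lemma dE_congr {l k : ℤ} (h : l ≤ k) {x x' : ℝ} (hx : cell k x = cell k x') (f : ℝ → ℝ≥0∞) :
    dE l f x = dE l f x' := by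
  unfold dE; simp_rw [dker_congr h hx]

lemma dE_succ_le (k : ℤ) {f : ℝ → ℝ≥0∞} (x : ℝ) : dE (k + 1) f x ≤ 2 * dE k f x := by
  unfold dE
  rw [← lintegral_const_mul' _ _ (by norm_num)]
  apply lintegral_mono
  intro x'
  simp only
  rw [← mul_assoc]
  gcongr
  exact dker_succ_le k x x'

lemma measurable_dE_prod {Y : Type*} [MeasurableSpace Y] (k : ℤ) {F : ℝ × Y → ℝ≥0∞}
    (hF : Measurable F) : Measurable fun z : ℝ × Y => dE k (fun x' => F (x', z.2)) z.1 := by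
  unfold dE
  apply Measurable.lintegral_prod_right' (f := fun w : (ℝ × Y) × ℝ =>
    dker k w.1.1 w.2 * F (w.2, w.1.2))
  exact ((measurable_dker k).comp (g := fun z : ℝ × ℝ => dker k z.1 z.2)
    (f := fun w : (ℝ × Y) × ℝ => (w.1.1, w.2)) (by fun_prop)).mul (by fun_prop)

lemma measurable_dE (k : ℤ) {f : ℝ → ℝ≥0∞} (hf : Measurable f) : Measurable (dE k f) := by
  have := measurable_dE_prod (Y := Unit) k (F := fun z => f z.1) (hf.comp measurable_fst)
  exact this.comp (f := fun x : ℝ => (x, ())) (by fun_prop)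

/-- The averaging operator is self-adjoint against functions constant on cells. -/
lemma lintegral_mul_dE (k : ℤ) {f w : ℝ → ℝ≥0∞} (hf : Measurable f) (hw : Measurable w)
    (hinv : ∀ x x', cell k x = cell k x' → w x = w x') :
    ∫⁻ x, w x * dE k f x = ∫⁻ x, w x * f x := by
  calc ∫⁻ x, w x * dE k f x = ∫⁻ x, ∫⁻ x', w x * (dker k x x' * f x') := by
        apply lintegral_congr; intro x
        exact (lintegral_const_mul _ ((measurable_dker_right k x).mul hf)).symm
    _ = ∫⁻ x', ∫⁻ x, w x * (dker k x x' * f x') := by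
        apply lintegral_lintegral_swap
        refine Measurable.aemeasurable ?_
        exact (hw.comp measurable_fst).mul ((measurable_dker k).mul (hf.comp measurable_snd))
    _ = ∫⁻ x', ∫⁻ x, dker k x' x * (w x' * f x') := by
        apply lintegral_congr; intro x'
        apply lintegral_congr; intro x
        rw [dker_symm k x']
        by_cases h : cell k x = cell k x'
        · rw [hinv x x' h]; ring
        · simp [dker, h]
    _ = _ := by
        apply lintegral_congr; intro x'
        rw [lintegral_mul_const _ (measurable_dker_right k x'), lintegral_dker, one_mul]

lemma nrm_dE_le {Y : Type*} [MeasurableSpace Y] {ν : Measure Y} [SigmaFinite ν] {b : ℝ}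
    (hb : 0 ≤ b) (hb1 : b ≤ 1) (k : ℤ) {F : ℝ × Y → ℝ≥0∞} (hF : Measurable F) (x : ℝ) :
    nrm ν b (fun y => dE k (fun x' => F (x', y)) x) ≤
      dE k (fun x' => nrm ν b (fun y => F (x', y))) x := by
  unfold dE
  refine (nrm_lintegral_le (μ := ν) (τ := volume)
    (F := fun w : Y × ℝ => dker k x w.2 * F (w.2, w.1)) hb hb1
    (((measurable_dker_right k x).comp measurable_snd).mul (by fun_prop))).trans ?_
  apply lintegral_mono
  intro x'
  simp only
  rw [nrm_const_mul hb]
  exact (hF.comp measurable_prodMk_left).aemeasurable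

lemma nrm_dE_le' {a : ℝ} (ha : 0 ≤ a) (ha1 : a ≤ 1) (k : ℤ) {f : ℝ → ℝ≥0∞} (hf : Measurable f) :
    nrm volume a (dE k f) ≤ nrm volume a f := by
  rcases eq_or_lt_of_le ha with h0 | h0
  · subst h0
    rw [nrm_zero, nrm_zero]
    exact essSup_le_of_ae_le _ (Filter.Eventually.of_forall
      fun x => dE_le_of_ae_le k (ENNReal.ae_le_essSup f) x)
  rw [nrm_pos h0.ne', nrm_pos h0.ne']
  gcongr 1
  calc ∫⁻ x, dE k f x ^ (1 / a) ≤ ∫⁻ x, 1 * dE k (fun x' => f x' ^ (1 / a)) x := by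
        apply lintegral_mono
        intro x
        have := lintegral_mul_le_jensen h0 ha1 (measurable_dker_right k x) hf
          (lintegral_dker k x).le
        have h2 := ENNReal.rpow_le_rpow this (by positivity : 0 ≤ 1 / a)
        rw [← ENNReal.rpow_mul, mul_one_div_cancel h0.ne', ENNReal.rpow_one] at h2
        beta_reduce
        rw [one_mul]
        exact h2
    _ = ∫⁻ x, 1 * f x ^ (1 / a) := lintegral_mul_dE k (hf.pow_const _) measurable_const
        (fun _ _ _ => rfl)
    _ = _ := by simp

end Dyadic

section DyadicMaximal

/-- The maximal function over the scales in `L`. -/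
noncomputable def dmax (L : Finset ℤ) (f : ℝ → ℝ≥0∞) (x : ℝ) : ℝ≥0∞ := L.sup fun l => dE l f x

lemma measurable_dmax_prod {Y : Type*} [MeasurableSpace Y] (L : Finset ℤ) {F : ℝ × Y → ℝ≥0∞}
    (hF : Measurable F) : Measurable fun z : ℝ × Y => dmax L (fun x' => F (x', z.2)) z.1 := by
  unfold dmax
  induction L using Finset.induction_on with
  | empty => simpa using measurable_const
  | insert l L _ ih =>
    simp only [Finset.sup_insert]
    exact (measurable_dE_prod l hF).sup ih

lemma measurable_dmax (L : Finset ℤ) {f : ℝ → ℝ≥0∞} (hf : Measurable f) :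
    Measurable (dmax L f) := by
  have := measurable_dmax_prod (Y := Unit) L (F := fun z => f z.1) (hf.comp measurable_fst)
  exact this.comp (f := fun x : ℝ => (x, ())) (by fun_prop)

lemma dE_le_dmax {L : Finset ℤ} {l : ℤ} (hl : l ∈ L) (f : ℝ → ℝ≥0∞) (x : ℝ) :
    dE l f x ≤ dmax L f x := Finset.le_sup (f := fun l => dE l f x) hl

/-- The weak type inequality for the dyadic maximal function. -/
lemma dmax_weak (L : Finset ℤ) {f : ℝ → ℝ≥0∞} (hf : Measurable f) (lam : ℝ≥0∞) :
    lam * volume {x | lam < dmax L f x} ≤ ∫⁻ x in {x | lam < dmax L f x}, f x := by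
  classical
  set S : ℤ → Set ℝ := fun l => {x | lam < dE l f x ∧ ∀ l' ∈ L, l' < l → dE l' f x ≤ lam} with hS
  have mS : ∀ l, MeasurableSet (S l) := by
    intro l
    have : S l = {x | lam < dE l f x} ∩ ⋂ l' ∈ L, {x | l' < l → dE l' f x ≤ lam} := by
      ext x; simp [hS]
    rw [this]
    refine (measurableSet_lt measurable_const (measurable_dE l hf)).inter ?_
    refine Finset.measurableSet_biInter _ fun l' _ => ?_
    by_cases h : l' < l
    · simp only [h, true_imp_iff]
      exact measurableSet_le (measurable_dE l' hf) measurable_const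
    · simp [h]
  have hU : {x | lam < dmax L f x} = ⋃ l ∈ L, S l := by
    ext x
    simp only [Set.mem_setOf_eq, Set.mem_iUnion, hS, exists_prop]
    constructor
    · intro h
      unfold dmax at h
      rw [Finset.lt_sup_iff] at h
      obtain ⟨l, hl, hlt⟩ := h
      have hne : (L.filter fun l => lam < dE l f x).Nonempty := ⟨l, by simp [hl, hlt]⟩
      refine ⟨(L.filter fun l => lam < dE l f x).min' hne, ?_, ?_, ?_⟩
      · exact (Finset.mem_filter.1 (Finset.min'_mem _ hne)).1
      · exact (Finset.mem_filter.1 (Finset.min'_mem _ hne)).2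
      · intro l' hl' hlt'
        by_contra hcon
        have := Finset.min'_le (L.filter fun l => lam < dE l f x) l' (by simp [hl', not_le.1 hcon])
        omega
    · rintro ⟨l, hl, h, -⟩
      exact h.trans_le (dE_le_dmax hl f x)
  have hd : Set.PairwiseDisjoint (↑L : Set ℤ) S := by
    intro l hl l' hl' hne
    rw [Function.onFun, Set.disjoint_left]
    intro x hx hx'
    rcases lt_or_gt_of_ne hne with h | h
    · exact absurd hx.1 (not_lt.2 (hx'.2 l hl h))
    · exact absurd hx'.1 (not_lt.2 (hx.2 l' hl' h))
  rw [hU, measure_biUnion_finset hd (fun l _ => mS l), lintegral_biUnion_finset hd (fun l _ => mS l),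
    Finset.mul_sum]
  apply Finset.sum_le_sum
  intro l hl
  have hinv : ∀ x x', cell l x = cell l x' → (S l).indicator (1 : ℝ → ℝ≥0∞) x = (S l).indicator 1 x' := by
    intro x x' h
    have : x ∈ S l ↔ x' ∈ S l := by
      simp only [hS, Set.mem_setOf_eq]
      rw [dE_congr le_rfl h]
      refine and_congr Iff.rfl (forall₂_congr fun l' _ => ?_)
      constructor
      · intro h1 h2; rw [← dE_congr h2.le h]; exact h1 h2
      · intro h1 h2; rw [dE_congr h2.le h]; exact h1 h2
    simp only [Set.indicator_apply, this, Pi.one_apply]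
  have := lintegral_mul_dE l hf (measurable_one.indicator (mS l)) hinv
  have e : ∀ g : ℝ → ℝ≥0∞, ∫⁻ x, (S l).indicator (1 : ℝ → ℝ≥0∞) x * g x = ∫⁻ x in S l, g x := by
    intro g
    rw [← lintegral_indicator (mS l)]
    apply lintegral_congr; intro x
    by_cases h : x ∈ S l <;> simp [h]
  rw [e, e] at this
  rw [← this, ← setLIntegral_const]
  exact setLIntegral_mono' (mS l) fun x hx => hx.1.le

lemma nrm_dmax_ne_top {a : ℝ} (ha : 0 ≤ a) (ha1 : a ≤ 1) (L : Finset ℤ) {f : ℝ → ℝ≥0∞}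
    (hf : Measurable f) (hfin : nrm volume a f ≠ ∞) : nrm volume a (dmax L f) ≠ ∞ := by
  have h1 : nrm volume a (dmax L f) ≤ nrm volume a (fun x => ∑' l : L, dE l f x) := by
    apply nrm_mono ha
    intro x
    refine Finset.sup_le fun l hl => ?_
    exact ENNReal.le_tsum (⟨l, hl⟩ : L)
  have h2 := nrm_tsum_le (μ := volume) (ι := L) (F := fun l => dE l f) ha ha1
    (fun l => measurable_dE l hf)
  refine ne_top_of_le_ne_top ?_ (h1.trans h2)
  rw [tsum_fintype]
  exact ENNReal.sum_ne_top.2 fun l _ => ne_top_of_le_ne_top hfin (nrm_dE_le' ha ha1 l hf)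

/-- The constant in the dyadic maximal theorem. -/
noncomputable def dmaxC (a : ℝ) : ℝ≥0∞ :=
  if a = 0 then 1 else t2 (1 / a) * geomC (1 / a - 1)

lemma dmaxC_ne_top {a : ℝ} (ha : 0 ≤ a) (ha1 : a < 1) : dmaxC a ≠ ∞ := by
  unfold dmaxC
  split_ifs with h
  · simp
  · have ha' : 0 < a := lt_of_le_of_ne ha (Ne.symm h)
    refine ENNReal.mul_ne_top (t2_ne_top _) (geomC_ne_top ?_)
    rw [sub_pos, one_lt_div ha']; exact ha1

open Classical in
lemma rpow_le_tsum_dyadic {p : ℝ} (hp : 0 < p) (v : ℝ≥0∞) :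
    v ^ p ≤ t2 p * ∑' m : ℤ, (if t2 m < v then t2 (m * p) else 0) := by
  rcases eq_or_ne v 0 with h0 | h0
  · subst h0; rw [ENNReal.zero_rpow_of_pos hp]; exact zero_le
  rcases eq_or_ne v ∞ with h1 | h1
  · subst h1
    have : ∑' m : ℤ, (if t2 m < ∞ then t2 (m * p) else 0) = ∞ := by
      rw [← top_le_iff]
      calc ∞ = ∑' n : ℕ, (1 : ℝ≥0∞) := by
            rw [ENNReal.tsum_const_eq_top_of_ne_zero one_ne_zero]
        _ ≤ ∑' n : ℕ, (if t2 ((n : ℤ) : ℝ) < ∞ then t2 (((n : ℤ) : ℝ) * p) else 0) := by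
            apply ENNReal.tsum_le_tsum
            intro n
            rw [if_pos (lt_top_iff_ne_top.2 (t2_ne_top _)), ← t2_zero]
            apply t2_mono; positivity
        _ ≤ _ := ENNReal.tsum_comp_le_tsum_of_injective Nat.cast_injective
            (fun m : ℤ => if t2 m < ∞ then t2 (m * p) else 0)
    rw [this, ENNReal.mul_top (t2_ne_zero _)]; exact le_top
  obtain ⟨y, rfl⟩ := exists_t2_eq h0 h1
  refine le_trans ?_ (mul_le_mul_right (ENNReal.le_tsum (⌈y⌉ - 1)) _)
  have c1 := Int.ceil_lt_add_one y
  have c2 := Int.le_ceil y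
  rw [if_pos (by rw [t2_lt]; push_cast; linarith), t2_rpow, ← t2_add]
  apply t2_mono
  push_cast
  nlinarith

/-- The dyadic maximal theorem. -/
lemma nrm_dmax_le {a : ℝ} (ha : 0 ≤ a) (ha1 : a < 1) (L : Finset ℤ) {f : ℝ → ℝ≥0∞}
    (hf : Measurable f) : nrm volume a (dmax L f) ≤ dmaxC a * nrm volume a f := by
  classical
  unfold dmaxC
  split_ifs with h0
  · subst h0
    rw [one_mul, nrm_zero, nrm_zero]
    refine essSup_le_of_ae_le _ (Filter.Eventually.of_forall fun x => ?_)
    exact Finset.sup_le fun l _ => dE_le_of_ae_le l (ENNReal.ae_le_essSup f) x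
  have ha' : 0 < a := lt_of_le_of_ne ha (Ne.symm h0)
  have hp : 1 < 1 / a := by rw [one_lt_div ha']; exact ha1
  by_cases hfin : nrm volume a f = ∞
  · rw [hfin, ENNReal.mul_top]
    · exact le_top
    · exact mul_ne_zero (t2_ne_zero _) (lt_of_lt_of_le one_pos (geomC_ge_one _)).ne'
  set M := dmax L f with hM
  have mM : Measurable M := measurable_dmax L hf
  have mlt : ∀ m : ℤ, MeasurableSet {x | t2 m < M x} := fun m => measurableSet_lt measurable_const mM
  have hNfin := nrm_dmax_ne_top ha ha1.le L hf hfin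
  set I := ∫⁻ x, M x ^ (1 / a) with hI
  have hN : nrm volume a M = I ^ a := nrm_pos h0 _
  have key : I ≤ t2 (1 / a) * geomC (1 / a - 1) * (nrm volume a f * I ^ (1 - a)) := by
    calc I ≤ ∫⁻ x, t2 (1 / a) * ∑' m : ℤ, (if t2 m < M x then t2 (m * (1 / a)) else 0) :=
          lintegral_mono fun x => rpow_le_tsum_dyadic (by positivity) _
      _ = t2 (1 / a) * ∑' m : ℤ, t2 (m * (1 / a)) * volume {x | t2 m < M x} := by
          rw [lintegral_const_mul' _ _ (t2_ne_top _), lintegral_tsum]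
          · congr 1
            congr 1; ext m
            have : ∀ x, (if t2 m < M x then t2 (m * (1 / a)) else 0) =
              {x | t2 m < M x}.indicator (fun _ => t2 (m * (1 / a))) x := by
              intro x; simp [Set.indicator_apply]
            simp_rw [this]
            rw [lintegral_indicator (mlt m), setLIntegral_const]
          · intro m
            exact (Measurable.ite (mlt m) measurable_const measurable_const).aemeasurable
      _ ≤ t2 (1 / a) * ∑' m : ℤ, t2 (m * (1 / a - 1)) * ∫⁻ x in {x | t2 m < M x}, f x := by
          refine mul_le_mul_right (ENNReal.tsum_le_tsum fun m => ?_) _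
          have : (m : ℝ) * (1 / a) = m * (1 / a - 1) + m := by ring
          rw [this, t2_add, mul_assoc]
          exact mul_le_mul_right (dmax_weak L hf _) _
      _ = t2 (1 / a) * ∫⁻ x, f x * ∑' m : ℤ, (if t2 m < M x then t2 (m * (1 / a - 1)) else 0) := by
          congr 1
          simp_rw [← ENNReal.tsum_mul_left]
          rw [lintegral_tsum]
          · congr 1; ext m
            rw [← lintegral_indicator (mlt m), ← lintegral_const_mul _ (hf.indicator (mlt m))]
            apply lintegral_congr
            intro x
            by_cases h : t2 m < M x
            · simp [h, mul_comm]
            · simp [h]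
          · intro m
            exact (hf.mul (Measurable.ite (mlt m) measurable_const measurable_const)).aemeasurable
      _ ≤ t2 (1 / a) * ∫⁻ x, f x * (geomC (1 / a - 1) * M x ^ (1 / a - 1)) := by
          gcongr with x
          refine le_trans ?_ (tsum_dyadic_le (by linarith) (M x))
          apply ENNReal.tsum_le_tsum
          intro m
          split_ifs with h1 h2 h2
          · exact le_rfl
          · exact absurd h1.le h2
          · exact zero_le
          · exact le_rfl
      _ = t2 (1 / a) * geomC (1 / a - 1) * ∫⁻ x, f x * M x ^ (1 / a - 1) := by
          simp_rw [mul_left_comm (f _)]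
          rw [lintegral_const_mul' _ _ (geomC_ne_top (by linarith)), mul_assoc]
      _ ≤ t2 (1 / a) * geomC (1 / a - 1) * (nrm volume a f * nrm volume (1 - a) (fun x => M x ^ (1 / a - 1))) := by
          gcongr
          exact lintegral_mul_le_nrm ha ha1.le hf.aemeasurable (mM.pow_const _).aemeasurable
      _ = _ := by
          congr 2
          rw [nrm_pos (by linarith)]
          congr 2; ext x
          rw [← ENNReal.rpow_mul]; congr 1
          have : 1 - a ≠ 0 := by linarith
          field_simp
  rw [hN]
  have hIfin : I ≠ ∞ := by
    intro h
    apply hNfin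
    rw [hN, h, ENNReal.top_rpow_of_pos ha']
  by_cases hI0 : I = 0
  · rw [hI0, ENNReal.zero_rpow_of_pos ha']; exact zero_le
  · have h3 : I ^ a * I ^ (1 - a) ≤ t2 (1 / a) * geomC (1 / a - 1) * nrm volume a f * I ^ (1 - a) := by
      rw [← ENNReal.rpow_add _ _ hI0 hIfin, mul_assoc _ (nrm volume a f)]; simpa using key
    have h4 : I ^ (1 - a) ≠ 0 := by
      intro h0
      rcases (ENNReal.rpow_eq_zero_iff.1 h0) with h | h
      · exact hI0 h.1
      · exact hIfin h.1
    exact (ENNReal.mul_le_mul_iff_left h4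
      (ENNReal.rpow_ne_top_of_nonneg (by linarith) hIfin)).1 h3

/-- Iterated form of a norm on a product space. -/
lemma nrm_prod_le {X Y : Type*} [MeasurableSpace X] [MeasurableSpace Y] {μ : Measure X}
    {ν : Measure Y} [SFinite μ] [SFinite ν] {b : ℝ} {G H : X × Y → ℝ≥0∞}
    (hb : 0 ≤ b) (hG : Measurable G) (hH : Measurable H) {C : ℝ≥0∞}
    (h : ∀ᵐ y ∂ν, nrm μ b (fun x => G (x, y)) ≤ C * nrm μ b (fun x => H (x, y))) :
    nrm (μ.prod ν) b G ≤ C * nrm (μ.prod ν) b H := by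
  rcases eq_or_lt_of_le hb with h0 | h0
  · subst h0
    simp only [nrm_zero] at h ⊢
    have hm : MeasurableSet {z : X × Y | G z ≤ C * essSup H (μ.prod ν)} :=
      measurableSet_le hG measurable_const
    refine essSup_le_of_ae_le _ ?_
    have hH' : ∀ᵐ y ∂ν, ∀ᵐ x ∂μ, H (x, y) ≤ essSup H (μ.prod ν) :=
      (Measure.ae_ae_comm (p := fun x y => H (x, y) ≤ essSup H (μ.prod ν))
        (measurableSet_le hH measurable_const)).1
        (Measure.ae_ae_of_ae_prod (ENNReal.ae_le_essSup H))
    have : ∀ᵐ y ∂ν, ∀ᵐ x ∂μ, G (x, y) ≤ C * essSup H (μ.prod ν) := by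
      filter_upwards [h, hH'] with y hy hy'
      filter_upwards [ENNReal.ae_le_essSup (μ := μ) fun x => G (x, y)] with x hx
      refine hx.trans (hy.trans ?_)
      gcongr
      exact essSup_le_of_ae_le _ hy'
    exact (Measure.ae_prod_iff_ae_ae hm).2 ((Measure.ae_ae_comm hm).2 this)
  · by_cases hC : C = ∞
    · by_cases hz : nrm (μ.prod ν) b H = 0
      · have h1 := nrm_eq_zero hb hH.aemeasurable hz
        have hm : MeasurableSet {z : X × Y | H z = 0} := hH (measurableSet_singleton 0)
        have h2 : ∀ᵐ y ∂ν, ∀ᵐ x ∂μ, H (x, y) = 0 :=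
          (Measure.ae_ae_comm hm).1 (Measure.ae_ae_of_ae_prod h1)
        have h3 : ∀ᵐ y ∂ν, ∀ᵐ x ∂μ, G (x, y) = 0 := by
          filter_upwards [h, h2] with y hy hy2
          have : nrm μ b (fun x => H (x, y)) = 0 := by
            rw [← nrm_zero_fun (μ := μ) hb]; exact nrm_congr_ae hy2
          rw [this, mul_zero, nonpos_iff_eq_zero] at hy
          exact nrm_eq_zero hb (hG.comp measurable_prodMk_right).aemeasurable hy
        have hm' : MeasurableSet {z : X × Y | G z = 0} := hG (measurableSet_singleton 0)
        have h4 : G =ᵐ[μ.prod ν] fun _ => 0 :=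
          (Measure.ae_prod_iff_ae_ae hm').2 ((Measure.ae_ae_comm hm').2 h3)
        rw [nrm_congr_ae h4, nrm_zero_fun hb]; exact zero_le
      · rw [hC, ENNReal.top_mul hz]; exact le_top
    rw [nrm_pos h0.ne', nrm_pos h0.ne']
    have e : C = (C ^ (1 / b)) ^ b := by
      rw [← ENNReal.rpow_mul, one_div_mul_cancel h0.ne', ENNReal.rpow_one]
    rw [e, ← ENNReal.mul_rpow_of_nonneg _ _ hb]
    gcongr 1
    rw [lintegral_prod_symm' _ (hG.pow_const _), lintegral_prod_symm' _ (hH.pow_const _),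
      ← lintegral_const_mul' _ _ (ENNReal.rpow_ne_top_of_nonneg (by positivity) hC)]
    apply lintegral_mono_ae
    filter_upwards [h] with y hy
    have h2 := ENNReal.rpow_le_rpow hy (by positivity : 0 ≤ 1 / b)
    rw [ENNReal.mul_rpow_of_nonneg _ _ (by positivity), nrm_pos h0.ne', nrm_pos h0.ne',
      ← ENNReal.rpow_mul, ← ENNReal.rpow_mul, mul_one_div_cancel h0.ne', ENNReal.rpow_one,
      ENNReal.rpow_one] at h2
    exact h2

lemma nrm_prod_dmax_le {Y : Type*} [MeasurableSpace Y] {ν : Measure Y} [SFinite ν]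
    {a : ℝ} (ha : 0 ≤ a) (ha1 : a < 1) (L : Finset ℤ) {F : ℝ × Y → ℝ≥0∞}
    (hF : Measurable F) :
    nrm (volume.prod ν) a (fun z => dmax L (fun x' => F (x', z.2)) z.1) ≤
      dmaxC a * nrm (volume.prod ν) a F := by
  have h1 := measurable_dmax_prod L hF
  have h2 : ∀ y : Y, nrm volume a (fun x => dmax L (fun x' => F (x', y)) x) ≤
      dmaxC a * nrm volume a (fun x => F (x, y)) := fun y =>
    nrm_dmax_le ha ha1 L (hF.comp measurable_prodMk_right)
  generalize dmaxC a = C at h2 ⊢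
  exact nrm_prod_le ha h1 hF (Filter.Eventually.of_forall h2)

end DyadicMaximal

section Stopping

lemma nrm_prod_le_nrm2 {X Y : Type*} [MeasurableSpace X] [MeasurableSpace Y] {μ : Measure X}
    {ν : Measure Y} [SFinite μ] [SFinite ν] {b : ℝ} {G : X × Y → ℝ≥0∞}
    (hb : 0 ≤ b) (hG : Measurable G) :
    nrm (μ.prod ν) b G ≤ nrm2 μ ν b b G := by
  unfold nrm2
  rcases eq_or_lt_of_le hb with h0 | h0
  · subst h0
    simp only [nrm_zero]
    refine essSup_le_of_ae_le _ ?_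
    refine (Measure.ae_prod_iff_ae_ae (measurableSet_le hG measurable_const)).2 ?_
    filter_upwards [ENNReal.ae_le_essSup (μ := μ) fun x => essSup (fun y => G (x, y)) ν] with x hx
    filter_upwards [ENNReal.ae_le_essSup (μ := ν) fun y => G (x, y)] with y hy
    exact hy.trans hx
  · simp only [nrm_pos h0.ne', ← ENNReal.rpow_mul, mul_one_div_cancel h0.ne', ENNReal.rpow_one]
    rw [lintegral_prod _ (hG.pow_const _).aemeasurable]

lemma nrm_prod_le_of_fiber {X Y : Type*} [MeasurableSpace X] [MeasurableSpace Y] {μ : Measure X}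
    {ν : Measure Y} [SFinite μ] [SFinite ν] {b : ℝ} {G : X × Y → ℝ≥0∞} {S : Set X} {c : ℝ≥0∞}
    (hb : 0 ≤ b) (hG : Measurable G) (hS : MeasurableSet S)
    (h : ∀ x, nrm ν b (fun y => G (x, y)) ≤ c * S.indicator 1 x) :
    nrm (μ.prod ν) b G ≤ c * μ S ^ b := by
  refine (nrm_prod_le_nrm2 hb hG).trans ?_
  unfold nrm2
  refine (nrm_mono hb h).trans ?_
  rw [nrm_const_mul hb _ (measurable_one.indicator hS).aemeasurable]
  refine mul_le_mul_right ?_ _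
  rcases eq_or_lt_of_le hb with h0 | h0
  · subst h0
    rw [nrm_zero, ENNReal.rpow_zero]
    exact essSup_le_of_ae_le _ (Filter.Eventually.of_forall fun x =>
      Set.indicator_le_self' (fun _ _ => zero_le) x)
  · rw [nrm_pos h0.ne']
    have : ∀ x, S.indicator (1 : X → ℝ≥0∞) x ^ (1 / b) = S.indicator 1 x := by
      intro x
      by_cases hx : x ∈ S <;> simp [hx, h0]
    simp only [this]
    rw [lintegral_indicator_one hS]

/-- The part of the stopping sum before the first scale of the family. -/
lemma nrm_early_le {Y : Type*} [MeasurableSpace Y] {ν : Measure Y} [SigmaFinite ν]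
    {b : ℝ} (hb : 0 ≤ b) (hb1 : b ≤ 1) {F : ℝ × Y → ℝ≥0∞} (hF : Measurable F)
    {R : ℤ → Set ℝ} {K : ℤ} (j : ℕ) {lam : ℝ≥0∞} (hRK : ∀ k x, x ∈ R k → -K ≤ k)
    (hstp : ∀ k x, x ∈ R k → dE (k - j) (fun x' => nrm ν b fun y => F (x', y)) x ≤ lam) (x : ℝ) :
    nrm ν b (fun y => ⨆ k : ℤ, (R k \ ⋃ k' ≤ k - j, R k').indicator 1 x *
      dE (k - j) (fun x' => F (x', y)) x) ≤ (j * lam) * (⋃ k, R k).indicator 1 x := by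
  classical
  by_cases hx : x ∈ ⋃ k, R k
  · rw [Set.indicator_of_mem hx, Pi.one_apply, mul_one]
    obtain ⟨k0, hk0, hmin⟩ : ∃ k0, x ∈ R k0 ∧ ∀ k, x ∈ R k → k0 ≤ k := by
      obtain ⟨k1, hk1⟩ := Set.mem_iUnion.1 hx
      have := Int.exists_least_of_bdd (P := fun k => x ∈ R k) ⟨-K, fun k hk => hRK k x hk⟩ ⟨k1, hk1⟩
      exact this
    set n : ℝ → ℝ≥0∞ := fun x' => nrm ν b fun y => F (x', y) with hn
    set g : Fin j → Y → ℝ≥0∞ := fun i y =>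
      if dE (k0 - 1 - i) n x ≤ lam then dE (k0 - 1 - i) (fun x' => F (x', y)) x else 0 with hg
    have mE : ∀ l, Measurable fun y => dE l (fun x' => F (x', y)) x := fun l =>
      (measurable_dE_prod l hF).comp measurable_prodMk_left
    have mg : ∀ i, Measurable (g i) := by
      intro i
      simp only [hg]
      split_ifs
      · exact mE _
      · exact measurable_const
    calc _ ≤ nrm ν b (fun y => ∑' i, g i y) := by
          refine nrm_mono hb fun y => iSup_le fun k => ?_
          by_cases hk : x ∈ R k \ ⋃ k' ≤ k - j, R k'
          · rw [Set.indicator_of_mem hk, Pi.one_apply, one_mul]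
            have h1 : k0 ≤ k := hmin k hk.1
            have h2 : k - j < k0 := by
              by_contra h
              exact hk.2 (Set.mem_iUnion₂.2 ⟨k0, not_lt.1 h, hk0⟩)
            have hi : (k0 - 1 - (k - j)).toNat < j := by omega
            have hi' : k0 - 1 - (((⟨(k0 - 1 - (k - j)).toNat, hi⟩ : Fin j) : ℕ) : ℤ) = k - j := by
              simp only
              omega
            refine le_trans ?_ (ENNReal.le_tsum ⟨(k0 - 1 - (k - j)).toNat, hi⟩)
            simp only [hg, hi']
            rw [if_pos (hstp k x hk.1)]
          · rw [Set.indicator_of_notMem hk, zero_mul]; exact zero_le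
      _ ≤ ∑' i, nrm ν b (g i) := nrm_tsum_le hb hb1 mg
      _ ≤ ∑' i : Fin j, lam := by
          refine ENNReal.tsum_le_tsum fun i => ?_
          simp only [hg]
          split_ifs with h
          · exact (nrm_dE_le hb hb1 _ hF x).trans h
          · rw [nrm_zero_fun hb]; exact zero_le
      _ = j * lam := by simp
  · have : ∀ k, x ∉ R k \ ⋃ k' ≤ k - j, R k' := fun k hk => hx (Set.mem_iUnion.2 ⟨k, hk.1⟩)
    simp only [Set.indicator_of_notMem (this _), zero_mul, iSup_const]
    rw [nrm_zero_fun hb]; exact zero_le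

/-- The part of the stopping sum after the first scale of the family. -/
lemma nrm_late_le {Y : Type*} [MeasurableSpace Y] {ν : Measure Y} [SigmaFinite ν]
    {b : ℝ} (hb : 0 ≤ b) (hb1 : b < 1) {F : ℝ × Y → ℝ≥0∞} (hF : Measurable F)
    {R : ℤ → Set ℝ} {K : ℤ} (j : ℕ) {lam : ℝ≥0∞} (hRK : ∀ k x, x ∈ R k → -K ≤ k ∧ k ≤ K)
    (hR : ∀ k, MeasurableSet (R k))
    (hRinv : ∀ k x x', cell k x = cell k x' → x ∈ R k → x' ∈ R k)
    (hstp : ∀ k x, x ∈ R k → ∀ l', -K - j ≤ l' → l' ≤ k - j →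
      dE l' (fun x' => nrm ν b fun y => F (x', y)) x ≤ lam) :
    nrm (volume.prod ν) b (fun z : ℝ × Y => ⨆ k : ℤ, (R k ∩ ⋃ k' ≤ k - j, R k').indicator 1 z.1 *
      dE (k - j) (fun x' => F (x', z.2)) z.1) ≤
      dmaxC b * (2 * lam * volume (⋃ k, R k) ^ b) := by
  classical
  set n : ℝ → ℝ≥0∞ := fun x' => nrm ν b fun y => F (x', y) with hn
  have mn : Measurable n := measurable_nrm hF
  set Act : ℤ → Set ℝ := fun l => {x | l ≤ K ∧ (∃ k' ≤ l, x ∈ R k') ∧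
    ∀ l', -K - j ≤ l' → l' ≤ l → dE l' n x ≤ lam} with hAct
  have mAct : ∀ l, MeasurableSet (Act l) := by
    intro l
    have : Act l = {x | l ≤ K} ∩ ((⋃ k', ⋃ (_ : k' ≤ l), R k') ∩
        ⋂ l', ⋂ (_ : -K - j ≤ l'), ⋂ (_ : l' ≤ l), {x | dE l' n x ≤ lam}) := by
      ext x; simp [hAct]
    rw [this]
    refine (MeasurableSet.const _).inter ((MeasurableSet.iUnion fun k' => MeasurableSet.iUnion
      fun _ => hR k').inter ?_)
    exact MeasurableSet.iInter fun l' => MeasurableSet.iInter fun _ => MeasurableSet.iInter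
      fun _ => measurableSet_le (measurable_dE l' mn) measurable_const
  have invAct : ∀ l x x', cell l x = cell l x' → x ∈ Act l → x' ∈ Act l := by
    rintro l x x' h ⟨h0, ⟨k', hk', hx⟩, h2⟩
    refine ⟨h0, ⟨k', hk', hRinv k' x x' (cell_nested hk' h) hx⟩, fun l' h3 h4 => ?_⟩
    rw [← dE_congr h4 h]; exact h2 l' h3 h4
  have upAct : ∀ l l' x, x ∈ Act l → l ≤ l' → x ∈ Act (l' + 1) → x ∈ Act l' := by
    rintro l l' x ⟨h0, ⟨k', hk', hx⟩, h2⟩ hl ⟨h0', -, h2'⟩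
    exact ⟨by omega, ⟨k', by omega, hx⟩, fun m hm hm' => h2' m hm (by omega)⟩
  have midAct : ∀ l m l' x, x ∈ Act l → l ≤ m → m ≤ l' → x ∈ Act l' → x ∈ Act m := by
    rintro l m l' x ⟨h0, ⟨k', hk', hx⟩, h2⟩ hl hl' ⟨h0', -, h2'⟩
    exact ⟨by omega, ⟨k', by omega, hx⟩, fun m hm hm' => h2' m hm (by omega)⟩
  set T : ℤ → Set ℝ := fun l => Act l \ Act (l + 1) with hT
  have mT : ∀ l, MeasurableSet (T l) := fun l => (mAct l).diff (mAct _)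
  have disjT : ∀ l l' x, l < l' → x ∈ T l → x ∉ T l' := by
    rintro l l' x h ⟨h1, h2⟩ ⟨h3, -⟩
    exact h2 (midAct l (l + 1) l' x h1 (by omega) (by omega) h3)
  have exT : ∀ l x, x ∈ Act l → ∃ t, l ≤ t ∧ t ≤ K ∧ x ∈ T t := by
    intro l x hx
    obtain ⟨t, ht, hmax⟩ := Int.exists_greatest_of_bdd (P := fun t => l ≤ t ∧ x ∈ Act t)
      ⟨K, fun t ht => ht.2.1⟩ ⟨l, le_rfl, hx⟩
    refine ⟨t, ht.1, ht.2.1, ht.2, fun h => ?_⟩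
    have := hmax (t + 1) ⟨by have := ht.1; omega, h⟩
    omega
  have rangeT : ∀ l x, x ∈ T l → l ∈ Finset.Icc (-K) K := by
    rintro l x ⟨⟨h0, ⟨k', hk', hx⟩, -⟩, -⟩
    have := (hRK k' x hx).1
    rw [Finset.mem_Icc]; omega
  set Ft : ℝ × Y → ℝ≥0∞ := fun z => ∑ t ∈ Finset.Icc (-K) K,
    (T t).indicator 1 z.1 * dE (t + 1) (fun x' => F (x', z.2)) z.1 with hFt
  have mind : ∀ S : Set ℝ, MeasurableSet S →
      Measurable fun z : ℝ × Y => S.indicator (1 : ℝ → ℝ≥0∞) z.1 := fun S hS =>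
    (measurable_one.indicator hS).comp measurable_fst
  have mFt : Measurable Ft := Finset.measurable_fun_sum _ fun t _ =>
    (mind _ (mT t)).mul (measurable_dE_prod _ hF)
  have hFtnrm : ∀ x, nrm ν b (fun y => Ft (x, y)) ≤ 2 * lam * (⋃ k, R k).indicator 1 x := by
    intro x
    by_cases hx : ∃ t, x ∈ T t
    · obtain ⟨t, ht⟩ := hx
      have e : ∀ y, Ft (x, y) = dE (t + 1) (fun x' => F (x', y)) x := by
        intro y
        simp only [hFt]
        rw [Finset.sum_eq_single_of_mem t (rangeT t x ht)]
        · rw [Set.indicator_of_mem ht, Pi.one_apply, one_mul]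
        · intro t' _ hne
          have : x ∉ T t' := by
            rcases lt_or_gt_of_ne hne with h | h
            · exact fun h' => disjT t' t x h h' ht
            · exact disjT t t' x h ht
          rw [Set.indicator_of_notMem this, zero_mul]
      simp only [e]
      have hxU : x ∈ ⋃ k, R k := by
        obtain ⟨⟨-, ⟨k', -, hx⟩, -⟩, -⟩ := ht
        exact Set.mem_iUnion.2 ⟨k', hx⟩
      rw [Set.indicator_of_mem hxU, Pi.one_apply, mul_one]
      refine (nrm_dE_le hb hb1.le _ hF x).trans ((dE_succ_le t x).trans ?_)
      refine mul_le_mul_right (ht.1.2.2 t ?_ le_rfl) _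
      have := Finset.mem_Icc.1 (rangeT t x ht)
      omega
    · have e : ∀ y, Ft (x, y) = 0 := by
        intro y
        refine Finset.sum_eq_zero fun t _ => ?_
        rw [Set.indicator_of_notMem fun h => hx ⟨t, h⟩, zero_mul]
      simp only [e]; rw [nrm_zero_fun hb]; exact zero_le
  have key : ∀ l x y, x ∈ Act l → dE l (fun x' => F (x', y)) x ≤ dE l (fun x' => Ft (x', y)) x := by
    intro l x y hx
    have mF : Measurable fun x' => F (x', y) := hF.comp measurable_prodMk_right
    have step : ∀ t, l ≤ t → ∫⁻ x', (dker l x x' * (T t).indicator 1 x') * F (x', y) =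
        ∫⁻ x', (dker l x x' * (T t).indicator 1 x') * dE (t + 1) (fun x' => F (x', y)) x' := by
      intro t hlt
      refine (lintegral_mul_dE (t + 1) mF
        ((measurable_dker_right l x).mul (measurable_one.indicator (mT t))) ?_).symm
      intro x₁ x₂ h12
      have e1 : dker l x x₁ = dker l x x₂ := by
        rw [dker_symm l x, dker_symm l x]; exact dker_congr (by omega) h12 x
      have e2 : x₁ ∈ T t ↔ x₂ ∈ T t := by
        have a1 : ∀ u v : ℝ, cell (t + 1) u = cell (t + 1) v → u ∈ T t → v ∈ T t := by
          rintro u v huv ⟨hu1, hu2⟩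
          exact ⟨invAct t u v (cell_nested (by omega) huv) hu1,
            fun h => hu2 (invAct (t + 1) v u huv.symm h)⟩
        exact ⟨a1 _ _ h12, a1 _ _ h12.symm⟩
      change dker l x x₁ * (T t).indicator 1 x₁ = dker l x x₂ * (T t).indicator 1 x₂
      simp only [Set.indicator_apply, e1, e2, Pi.one_apply]
    calc dE l (fun x' => F (x', y)) x
        ≤ ∫⁻ x', ∑ t ∈ Finset.Icc l K, (dker l x x' * (T t).indicator 1 x') * F (x', y) := by
          refine lintegral_mono fun x' => ?_
          beta_reduce
          by_cases hc : cell l x = cell l x'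
          · obtain ⟨t, h1, h2, h3⟩ := exT l x' (invAct l x x' hc hx)
            refine le_trans (le_of_eq ?_) (Finset.single_le_sum
              (f := fun t => (dker l x x' * (T t).indicator 1 x') * F (x', y))
              (fun _ _ => zero_le) (Finset.mem_Icc.2 ⟨h1, h2⟩))
            rw [Set.indicator_of_mem h3, Pi.one_apply, mul_one]
          · rw [dker, if_neg hc, zero_mul]; exact zero_le
      _ = ∑ t ∈ Finset.Icc l K, ∫⁻ x', (dker l x x' * (T t).indicator 1 x') *
            dE (t + 1) (fun x' => F (x', y)) x' := by
          rw [lintegral_finset_sum]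
          · refine Finset.sum_congr rfl fun t ht => step t (Finset.mem_Icc.1 ht).1
          · intro t _
            exact ((measurable_dker_right l x).mul (measurable_one.indicator (mT t))).mul mF
      _ = ∫⁻ x', ∑ t ∈ Finset.Icc l K, (dker l x x' * (T t).indicator 1 x') *
            dE (t + 1) (fun x' => F (x', y)) x' := by
          rw [lintegral_finset_sum]
          intro t _
          exact ((measurable_dker_right l x).mul (measurable_one.indicator (mT t))).mul
            (measurable_dE _ mF)
      _ ≤ dE l (fun x' => Ft (x', y)) x := by
          refine lintegral_mono fun x' => ?_
          beta_reduce
          simp only [mul_assoc]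
          rw [← Finset.mul_sum]
          refine mul_le_mul_right (Finset.sum_le_sum_of_ne_zero fun t _ hne => ?_) _
          by_contra hcon
          apply hne
          rw [Set.indicator_of_notMem fun h => hcon (rangeT t x' h), zero_mul]
  have hle : ∀ z : ℝ × Y, (⨆ k : ℤ, (R k ∩ ⋃ k' ≤ k - j, R k').indicator 1 z.1 *
      dE (k - j) (fun x' => F (x', z.2)) z.1) ≤
      dmax (Finset.Icc (-K) K) (fun x' => Ft (x', z.2)) z.1 := by
    intro z
    refine iSup_le fun k => ?_
    by_cases hk : z.1 ∈ R k ∩ ⋃ k' ≤ k - j, R k'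
    · rw [Set.indicator_of_mem hk, Pi.one_apply, one_mul]
      obtain ⟨k', hk', hx'⟩ := Set.mem_iUnion₂.1 hk.2
      have h1 := hRK _ _ hk.1
      have h2 := hRK _ _ hx'
      have hact : z.1 ∈ Act (k - j) := ⟨by omega, ⟨k', hk', hx'⟩, fun l' h3 h4 =>
        hstp k z.1 hk.1 l' h3 h4⟩
      exact (key _ _ z.2 hact).trans (dE_le_dmax (Finset.mem_Icc.2 ⟨by omega, by omega⟩) _ _)
    · rw [Set.indicator_of_notMem hk, zero_mul]; exact zero_le
  refine (nrm_mono hb hle).trans ((nrm_prod_dmax_le hb hb1 _ mFt).trans ?_)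
  exact mul_le_mul_right (nrm_prod_le_of_fiber hb mFt (MeasurableSet.iUnion hR) hFtnrm) _

/-- The stopping time estimate. -/
lemma nrm_stopping_le {Y : Type*} [MeasurableSpace Y] {ν : Measure Y} [SigmaFinite ν]
    {b : ℝ} (hb : 0 ≤ b) (hb1 : b < 1) {F : ℝ × Y → ℝ≥0∞} (hF : Measurable F)
    {R : ℤ → Set ℝ} {K : ℤ} (j : ℕ) {lam : ℝ≥0∞} (hRK : ∀ k x, x ∈ R k → -K ≤ k ∧ k ≤ K)
    (hR : ∀ k, MeasurableSet (R k))
    (hRinv : ∀ k x x', cell k x = cell k x' → x ∈ R k → x' ∈ R k)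
    (hstp : ∀ k x, x ∈ R k → ∀ l', -K - j ≤ l' → l' ≤ k - j →
      dE l' (fun x' => nrm ν b fun y => F (x', y)) x ≤ lam) :
    nrm (volume.prod ν) b (fun z : ℝ × Y => ⨆ k : ℤ, (R k).indicator 1 z.1 *
      dE (k - j) (fun x' => F (x', z.2)) z.1) ≤
      (j + 2 * dmaxC b) * lam * volume (⋃ k, R k) ^ b := by
  classical
  set A₁ : ℝ × Y → ℝ≥0∞ := fun z => ⨆ k : ℤ, (R k \ ⋃ k' ≤ k - j, R k').indicator 1 z.1 *
      dE (k - j) (fun x' => F (x', z.2)) z.1 with hA₁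
  set A₂ : ℝ × Y → ℝ≥0∞ := fun z => ⨆ k : ℤ, (R k ∩ ⋃ k' ≤ k - j, R k').indicator 1 z.1 *
      dE (k - j) (fun x' => F (x', z.2)) z.1 with hA₂
  have mU : ∀ k : ℤ, MeasurableSet (⋃ k' ≤ k - j, R k') := fun k => MeasurableSet.iUnion fun k' =>
    MeasurableSet.iUnion fun _ => hR k'
  have mA : ∀ S : ℤ → Set ℝ, (∀ k, MeasurableSet (S k)) → Measurable fun z : ℝ × Y =>
      ⨆ k : ℤ, (S k).indicator (1 : ℝ → ℝ≥0∞) z.1 * dE (k - j) (fun x' => F (x', z.2)) z.1 := by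
    intro S hS
    exact Measurable.iSup fun k => ((measurable_one.indicator (hS k)).comp measurable_fst).mul
      (measurable_dE_prod _ hF)
  have m₁ : Measurable A₁ := mA _ fun k => (hR k).diff (mU k)
  have m₂ : Measurable A₂ := mA _ fun k => (hR k).inter (mU k)
  have h₁ : nrm (volume.prod ν) b A₁ ≤ j * lam * volume (⋃ k, R k) ^ b := by
    refine nrm_prod_le_of_fiber hb m₁ (MeasurableSet.iUnion hR) fun x => ?_
    refine nrm_early_le (K := K) hb hb1.le hF j (fun k x h => (hRK k x h).1) (fun k x h => ?_) x
    exact hstp k x h (k - j) (by have := hRK k x h; omega) le_rfl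
  have h₂ := nrm_late_le hb hb1 hF j hRK hR hRinv hstp
  calc _ ≤ nrm (volume.prod ν) b (fun z => ∑' i : Fin 2, (![A₁, A₂] i) z) := by
        refine nrm_mono hb fun z => iSup_le fun k => ?_
        rw [tsum_fintype, Fin.sum_univ_two]
        by_cases hk : z.1 ∈ R k
        · by_cases hk2 : z.1 ∈ ⋃ k' ≤ k - j, R k'
          · refine le_trans ?_ le_add_self
            refine le_trans (le_of_eq ?_) (le_iSup _ k)
            rw [Set.indicator_of_mem hk, Set.indicator_of_mem (Set.mem_inter hk hk2)]
          · refine le_trans ?_ le_self_add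
            refine le_trans (le_of_eq ?_) (le_iSup _ k)
            rw [Set.indicator_of_mem hk, Set.indicator_of_mem (show z.1 ∈ _ \ _ from ⟨hk, hk2⟩)]
        · rw [Set.indicator_of_notMem hk, zero_mul]; exact zero_le
    _ ≤ ∑' i : Fin 2, nrm (volume.prod ν) b (![A₁, A₂] i) := by
        refine nrm_tsum_le hb hb1.le fun i => ?_
        fin_cases i
        · exact m₁
        · exact m₂
    _ = nrm (volume.prod ν) b A₁ + nrm (volume.prod ν) b A₂ := by
        rw [tsum_fintype, Fin.sum_univ_two]; rfl
    _ ≤ _ := by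
        refine (add_le_add h₁ h₂).trans (le_of_eq ?_)
        ring

end Stopping

section DyadicCarleson

lemma dmaxC_ne_zero (a : ℝ) : dmaxC a ≠ 0 := by
  unfold dmaxC
  split_ifs
  · simp
  · exact mul_ne_zero (t2_ne_zero _) (lt_of_lt_of_le one_pos (geomC_ge_one _)).ne'

lemma dE_ne_top {a : ℝ} (ha : 0 ≤ a) (ha1 : a < 1) (l : ℤ) {f : ℝ → ℝ≥0∞} (hf : Measurable f)
    (hfin : nrm volume a f ≠ ∞) (x : ℝ) : dE l f x ≠ ∞ := by
  have h := lintegral_mul_le_nrm (μ := volume) ha ha1.le hf.aemeasurable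
    (measurable_dker_right l x).aemeasurable
  have h2 : nrm volume (1 - a) (dker l x) ≠ ∞ := by
    have hpos : 0 < 1 - a := by linarith
    rw [nrm_pos hpos.ne']
    refine ENNReal.rpow_ne_top_of_nonneg hpos.le ?_
    have : ∀ x', dker l x x' ^ (1 / (1 - a)) ≤ t2 (l * (1 / (1 - a) - 1)) * dker l x x' := by
      intro x'
      unfold dker
      split_ifs
      · rw [t2_rpow, ← t2_add]; apply t2_mono; apply le_of_eq; ring
      · rw [ENNReal.zero_rpow_of_pos (by positivity), mul_zero]
    refine ne_top_of_le_ne_top ?_ (lintegral_mono this)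
    rw [lintegral_const_mul _ (measurable_dker_right l x), lintegral_dker, mul_one]
    exact t2_ne_top _
  have e : dE l f x = ∫⁻ x', f x' * dker l x x' := by
    unfold dE; simp_rw [mul_comm]
  rw [e]
  exact ne_top_of_le_ne_top (ENNReal.mul_ne_top hfin h2) h

lemma exists_int_t2_le {v : ℝ≥0∞} (h0 : v ≠ 0) (h1 : v ≠ ∞) :
    ∃ m : ℤ, t2 m ≤ v ∧ v < t2 (m + 1) := by
  obtain ⟨y, rfl⟩ := exists_t2_eq h0 h1
  exact ⟨⌊y⌋, t2_mono (Int.floor_le y), t2_lt.2 (Int.lt_floor_add_one y)⟩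

/-- The summand in the dyadic Carleson estimate, built from averages `e i` at scale `k`. -/
noncomputable def mixMin {ι : Type*} [Fintype ι] (ε : ℝ) (θp θm : ι → ℝ) (k : ℤ) (e : ι → ℝ≥0∞) :
    ℝ≥0∞ :=
  min (t2 (ε * k) * ∏ i, e i ^ θp i) (t2 (-ε * k) * ∏ i, e i ^ θm i)

section MixMin

variable {ι : Type*} [Fintype ι] {ε : ℝ} {θp θm : ι → ℝ}

lemma mixMin_mono (hp : ∀ i, 0 < θp i) (hm : ∀ i, 0 < θm i) (k : ℤ) {e e' : ι → ℝ≥0∞}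
    (h : ∀ i, e i ≤ e' i) : mixMin ε θp θm k e ≤ mixMin ε θp θm k e' := by
  unfold mixMin
  refine min_le_min (mul_le_mul_right (Finset.prod_le_prod' fun i _ => ?_) _)
    (mul_le_mul_right (Finset.prod_le_prod' fun i _ => ?_) _)
  · exact ENNReal.rpow_le_rpow (h i) (hp i).le
  · exact ENNReal.rpow_le_rpow (h i) (hm i).le

lemma mixMin_eq_zero (hp : ∀ i, 0 < θp i) (k : ℤ) {e : ι → ℝ≥0∞} {i : ι} (h : e i = 0) :
    mixMin ε θp θm k e = 0 := by
  unfold mixMin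
  rw [Finset.prod_eq_zero (Finset.mem_univ i) (by rw [h, ENNReal.zero_rpow_of_pos (hp i)]),
    mul_zero]
  simp

lemma measurable_mixMin {X : Type*} [MeasurableSpace X] (k : ℤ) {e : ι → X → ℝ≥0∞}
    (h : ∀ i, Measurable (e i)) : Measurable fun x => mixMin ε θp θm k fun i => e i x := by
  unfold mixMin
  exact (measurable_const.mul (Finset.measurable_fun_prod _ fun i _ => (h i).pow_const _)).min
    (measurable_const.mul (Finset.measurable_fun_prod _ fun i _ => (h i).pow_const _))

lemma tsum_mixMin_le (hε : 0 < ε) {θ : ι → ℝ} (hθ : ∀ i, θp i + θm i = 2 * θ i)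
    (hp : ∀ i, 0 < θp i) (hm : ∀ i, 0 < θm i) (e : ι → ℝ≥0∞) :
    ∑' k : ℤ, mixMin ε θp θm k e ≤ 2 * geomC ε * ∏ i, e i ^ θ i := by
  refine (tsum_min_le hε _ _).trans (mul_le_mul_right (le_of_eq ?_) _)
  rw [← Finset.prod_mul_distrib, ← ENNReal.prod_rpow_of_nonneg (by norm_num)]
  refine Finset.prod_congr rfl fun i _ => ?_
  rw [← ENNReal.rpow_add_of_nonneg _ _ (hp i).le (hm i).le, hθ, ← ENNReal.rpow_mul]
  congr 1; ring

end MixMin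

/-- The constant in the dyadic Carleson estimate. -/
noncomputable def carlC {ι : Type*} [Fintype ι] (ε : ℝ) (θ a b : ι → ℝ) (j : ι → ℕ) : ℝ≥0∞ :=
  2 * geomC ε * ∏ i, ((2 * (j i + 2 * dmaxC (b i))) ^ θ i * (geomC (θ i) * dmaxC (a i) ^ θ i))

/-- The dyadic Carleson type estimate. -/
lemma dyadic_carleson {ι : Type*} [Fintype ι] {Y : Type*} [MeasurableSpace Y] {ν : Measure Y}
    [SigmaFinite ν] {F : ι → ℝ × Y → ℝ≥0∞} (hF : ∀ i, Measurable (F i)) (j : ι → ℕ)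
    {a b θ θp θm : ι → ℝ} {ε : ℝ} (hε : 0 < ε) (ha : ∀ i, 0 ≤ a i) (ha1 : ∀ i, a i < 1)
    (hb : ∀ i, 0 ≤ b i) (hb1 : ∀ i, b i < 1) (hp : ∀ i, 0 < θp i) (hm : ∀ i, 0 < θm i)
    (hθ : ∀ i, θp i + θm i = 2 * θ i) (hsa : ∑ i, θ i * a i = 1) (hsb : ∑ i, θ i * b i = 1)
    (K : ℤ) :
    ∫⁻ z : ℝ × Y, ∑ k ∈ Finset.Icc (-K) K,
        mixMin ε θp θm k (fun i => dE (k - j i) (fun x' => F i (x', z.2)) z.1) ∂(volume.prod ν) ≤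
      carlC ε θ a b j * ∏ i, nrm2 volume ν (a i) (b i) (F i) ^ θ i := by
  classical
  have hθ0 : ∀ i, 0 < θ i := fun i => by linarith [hp i, hm i, hθ i]
  set n : ι → ℝ → ℝ≥0∞ := fun i x => nrm ν (b i) (fun y => F i (x, y)) with hn
  have mn : ∀ i, Measurable (n i) := fun i => measurable_nrm (hF i)
  have enrm : ∀ i, nrm2 volume ν (a i) (b i) (F i) = nrm volume (a i) (n i) := fun i => rfl
  set h : ℤ → ℝ × Y → ℝ≥0∞ := fun k z =>
    mixMin ε θp θm k (fun i => dE (k - j i) (fun x' => F i (x', z.2)) z.1) with hh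
  have mdE : ∀ i l, Measurable fun z : ℝ × Y => dE l (fun x' => F i (x', z.2)) z.1 :=
    fun i l => measurable_dE_prod l (hF i)
  have mh : ∀ k, Measurable (h k) := fun k => measurable_mixMin k fun i => mdE i _
  have hzero : ∀ (k : ℤ) (i : ι) (x : ℝ), dE (k - j i) (n i) x = 0 →
      ∀ᵐ y ∂ν, h k (x, y) = 0 := by
    intro k i x hx
    have h1 : nrm ν (b i) (fun y => dE (k - j i) (fun x' => F i (x', y)) x) = 0 := by
      have := nrm_dE_le (ν := ν) (hb i) (hb1 i).le (k - j i) (hF i) x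
      rw [hx, nonpos_iff_eq_zero] at this
      exact this
    filter_upwards [nrm_eq_zero (hb i) ((mdE i _).comp measurable_prodMk_left).aemeasurable h1]
      with y hy
    exact mixMin_eq_zero hp k (i := i) hy
  by_cases hz : ∃ i, nrm volume (a i) (n i) = 0
  · obtain ⟨i, hi⟩ := hz
    have h1 := nrm_eq_zero (ha i) (mn i).aemeasurable hi
    have h2 : ∀ l x, dE l (n i) x = 0 := fun l x => nonpos_iff_eq_zero.1
      (dE_le_of_ae_le l (h1.mono fun x hx => hx.le) x)
    have h3 : ∫⁻ z : ℝ × Y, ∑ k ∈ Finset.Icc (-K) K, h k z ∂(volume.prod ν) = 0 := by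
      rw [lintegral_finset_sum _ fun k _ => mh k]
      refine Finset.sum_eq_zero fun k _ => ?_
      rw [lintegral_prod _ (mh k).aemeasurable]
      simp only [fun x => lintegral_eq_zero_of_ae_eq_zero (hzero k i x (h2 _ x)), lintegral_zero]
    rw [h3]; exact zero_le
  push Not at hz
  by_cases ht : ∃ i, nrm volume (a i) (n i) = ∞
  · obtain ⟨i, hi⟩ := ht
    have h1 : ∏ i, nrm2 volume ν (a i) (b i) (F i) ^ θ i = ∞ := by
      rw [← Finset.mul_prod_erase _ _ (Finset.mem_univ i), enrm, hi,
        ENNReal.top_rpow_of_pos (hθ0 i), ENNReal.top_mul]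
      refine Finset.prod_ne_zero_iff.2 fun i' _ => ?_
      · rw [enrm, Ne, ENNReal.rpow_eq_zero_iff]
        rintro (h | h)
        · exact hz _ h.1
        · linarith [hθ0 i', h.2]
    have h2 : carlC ε θ a b j ≠ 0 := by
      have g : ∀ θ, geomC θ ≠ 0 := fun θ => (lt_of_lt_of_le one_pos (geomC_ge_one θ)).ne'
      unfold carlC
      refine mul_ne_zero (mul_ne_zero two_ne_zero (g _)) (Finset.prod_ne_zero_iff.2 fun i _ => ?_)
      refine mul_ne_zero ?_ (mul_ne_zero (g _) ?_)
      · rw [Ne, ENNReal.rpow_eq_zero_iff_of_pos (hθ0 i)]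
        refine mul_ne_zero two_ne_zero ?_
        simp [dmaxC_ne_zero]
      · rw [Ne, ENNReal.rpow_eq_zero_iff_of_pos (hθ0 i)]
        exact dmaxC_ne_zero _
    rw [h1, ENNReal.mul_top h2]; exact le_top
  push Not at ht
  have nfin : ∀ i l x, dE l (n i) x ≠ ∞ := fun i l x => dE_ne_top (ha i) (ha1 i) l (mn i) (ht i) x
  set N : ι → ℤ → ℝ → ℝ≥0∞ := fun i k x => dmax (Finset.Icc (-K - j i) (k - j i)) (n i) x with hN
  have mN : ∀ i k, Measurable (N i k) := fun i k => measurable_dmax _ (mn i)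
  have Nfin : ∀ i k x, N i k x ≠ ∞ := by
    intro i k x
    simp only [hN, dmax]
    rw [← lt_top_iff_ne_top, Finset.sup_lt_iff (by simp)]
    exact fun l _ => lt_top_iff_ne_top.2 (nfin i l x)
  set R : (ι → ℤ) → ℤ → Set ℝ := fun m k => {x | (-K ≤ k ∧ k ≤ K) ∧
    ∀ i, t2 (m i) ≤ N i k x ∧ N i k x < t2 (m i + 1)} with hR
  have mR : ∀ m k, MeasurableSet (R m k) := by
    intro m k
    have : R m k = {x | -K ≤ k ∧ k ≤ K} ∩
        ⋂ i, ({x | t2 (m i) ≤ N i k x} ∩ {x | N i k x < t2 (m i + 1)}) := by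
      ext x; simp [hR]
    rw [this]
    exact (MeasurableSet.const _).inter (MeasurableSet.iInter fun i =>
      (measurableSet_le measurable_const (mN i k)).inter
        (measurableSet_lt (mN i k) measurable_const))
  have Rinv : ∀ m k x x', cell k x = cell k x' → x ∈ R m k → x' ∈ R m k := by
    rintro m k x x' hc ⟨h1, h2⟩
    refine ⟨h1, fun i => ?_⟩
    have : N i k x' = N i k x := by
      simp only [hN, dmax]
      refine Finset.sup_congr rfl fun l hl => ?_
      have := (Finset.mem_Icc.1 hl).2
      exact (dE_congr (by omega) hc _).symm
    rw [this]; exact h2 i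
  have mA : ∀ m i, Measurable fun z : ℝ × Y => ⨆ k : ℤ, (R m k).indicator (1 : ℝ → ℝ≥0∞) z.1 *
      dE (k - j i) (fun x' => F i (x', z.2)) z.1 := fun m i => Measurable.iSup fun k =>
    ((measurable_one.indicator (mR m k)).comp measurable_fst).mul (mdE i _)
  set A : (ι → ℤ) → ι → ℝ × Y → ℝ≥0∞ := fun m i z =>
    ⨆ k : ℤ, (R m k).indicator (1 : ℝ → ℝ≥0∞) z.1 * dE (k - j i) (fun x' => F i (x', z.2)) z.1
    with hA
  set Om : (ι → ℤ) → Set ℝ := fun m => ⋃ k, R m k with hOm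
  have mOm : ∀ m, MeasurableSet (Om m) := fun m => MeasurableSet.iUnion (mR m)
  have hAn : ∀ m i, nrm (volume.prod ν) (b i) (A m i) ≤
      (j i + 2 * dmaxC (b i)) * t2 (m i + 1) * volume (Om m) ^ b i := by
    intro m i
    refine nrm_stopping_le (hb i) (hb1 i) (hF i) (j i) (R := R m) (K := K) (fun k x hx => hx.1)
      (mR m) (Rinv m) ?_
    intro k x hx l' h1 h2
    exact (dE_le_dmax (Finset.mem_Icc.2 ⟨h1, h2⟩) (n i) x).trans (hx.2 i).2.le
  have mRind : ∀ m k, Measurable fun z : ℝ × Y => (R m k).indicator (1 : ℝ → ℝ≥0∞) z.1 * h k z :=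
    fun m k => ((measurable_one.indicator (mR m k)).comp measurable_fst).mul (mh k)
  have hcov : ∀ k ∈ Finset.Icc (-K) K, ∀ᵐ z ∂(volume.prod ν),
      h k z ≤ ∑' m, (R m k).indicator 1 z.1 * h k z := by
    intro k hk
    have mS : MeasurableSet {z : ℝ × Y | h k z ≤ ∑' m, (R m k).indicator 1 z.1 * h k z} :=
      measurableSet_le (mh k) (Measurable.ennreal_tsum fun m => mRind m k)
    refine (Measure.ae_prod_iff_ae_ae mS).2 (Filter.Eventually.of_forall fun x => ?_)
    by_cases h0 : ∃ i, N i k x = 0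
    · obtain ⟨i, hi⟩ := h0
      have : dE (k - j i) (n i) x = 0 := nonpos_iff_eq_zero.1 <| by
        rw [← hi]
        exact dE_le_dmax (Finset.mem_Icc.2 ⟨by have := Finset.mem_Icc.1 hk; omega, le_rfl⟩) _ _
      filter_upwards [hzero k i x this] with y hy
      rw [hy]; exact zero_le
    · push Not at h0
      choose m hm1 hm2 using fun i => exists_int_t2_le (h0 i) (Nfin i k x)
      refine Filter.Eventually.of_forall fun y => ?_
      refine le_trans ?_ (ENNReal.le_tsum m)
      rw [Set.indicator_of_mem (show (x, y).1 ∈ R m k from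
        ⟨Finset.mem_Icc.1 hk, fun i => ⟨hm1 i, hm2 i⟩⟩), Pi.one_apply, one_mul]
  have hloc : ∀ m z, ∑ k ∈ Finset.Icc (-K) K, (R m k).indicator 1 z.1 * h k z ≤
      2 * geomC ε * ∏ i, A m i z ^ θ i := by
    intro m z
    refine le_trans ?_ (tsum_mixMin_le hε hθ hp hm _)
    refine le_trans (Finset.sum_le_sum fun k _ => ?_) (ENNReal.sum_le_tsum _)
    by_cases hk : z.1 ∈ R m k
    · rw [Set.indicator_of_mem hk, Pi.one_apply, one_mul]
      refine mixMin_mono hp hm k fun i => ?_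
      refine le_trans (le_of_eq ?_) (le_iSup _ k)
      rw [Set.indicator_of_mem hk, Pi.one_apply, one_mul]
    · rw [Set.indicator_of_notMem hk, zero_mul]; exact zero_le
  set c : ι → ℝ≥0∞ := fun i => (2 * (j i + 2 * dmaxC (b i))) ^ θ i with hc
  have hhol : ∀ m, ∫⁻ z, ∏ i, A m i z ^ θ i ∂(volume.prod ν) ≤
      (∏ i, c i) * (volume (Om m) * ∏ i, t2 (m i * θ i)) := by
    intro m
    refine (lintegral_prod_rpow_le_nrm (fun i => (mA m i).aemeasurable) (fun i => (hθ0 i).le) hb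
      hsb).trans ?_
    have hvol : volume (Om m) = ∏ i, volume (Om m) ^ (θ i * b i) := by
      have : ∀ s : Finset ι, volume (Om m) ^ (∑ i ∈ s, θ i * b i) =
          ∏ i ∈ s, volume (Om m) ^ (θ i * b i) := by
        intro s
        induction s using Finset.induction_on with
        | empty => simp
        | insert i s hi ih =>
          rw [Finset.sum_insert hi, Finset.prod_insert hi, ENNReal.rpow_add_of_nonneg, ih]
          · exact mul_nonneg (hθ0 i).le (hb i)
          · exact Finset.sum_nonneg fun i _ => mul_nonneg (hθ0 i).le (hb i)
      rw [← this, hsb, ENNReal.rpow_one]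
    rw [hvol, ← Finset.prod_mul_distrib, ← Finset.prod_mul_distrib]
    refine Finset.prod_le_prod' fun i _ => ?_
    refine (ENNReal.rpow_le_rpow (hAn m i) (hθ0 i).le).trans (le_of_eq ?_)
    simp only [hc]
    rw [t2_add, t2_one, ENNReal.mul_rpow_of_nonneg _ _ (hθ0 i).le,
      ENNReal.mul_rpow_of_nonneg _ _ (hθ0 i).le, ENNReal.mul_rpow_of_nonneg _ _ (hθ0 i).le,
      ENNReal.mul_rpow_of_nonneg _ _ (hθ0 i).le, t2_rpow, ← ENNReal.rpow_mul, mul_comm (b i)]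
    ring
  have hsum : ∑' m : ι → ℤ, volume (Om m) * ∏ i, t2 (m i * θ i) ≤
      ∏ i, (geomC (θ i) * dmaxC (a i) ^ θ i * nrm volume (a i) (n i) ^ θ i) := by
    calc ∑' m : ι → ℤ, volume (Om m) * ∏ i, t2 (m i * θ i)
        = ∫⁻ x, ∑' m : ι → ℤ, (Om m).indicator 1 x * ∏ i, t2 (m i * θ i) := by
          rw [lintegral_tsum fun m =>
            ((measurable_one.indicator (mOm m)).mul_const _).aemeasurable]
          congr 1; ext m
          rw [lintegral_mul_const _ (measurable_one.indicator (mOm m)),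
            lintegral_indicator_one (mOm m)]
      _ ≤ ∫⁻ x, ∏ i, (geomC (θ i) * N i K x ^ θ i) := by
          refine lintegral_mono fun x => ?_
          beta_reduce
          calc _ ≤ ∑' m : ι → ℤ, ∏ i, (if t2 (m i) ≤ N i K x then t2 (m i * θ i) else 0) := by
                refine ENNReal.tsum_le_tsum fun m => ?_
                by_cases hx : x ∈ Om m
                · rw [Set.indicator_of_mem hx, Pi.one_apply, one_mul]
                  obtain ⟨k, hk⟩ := Set.mem_iUnion.1 hx
                  refine Finset.prod_le_prod' fun i _ => ?_
                  rw [if_pos]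
                  refine (hk.2 i).1.trans (Finset.sup_mono ?_)
                  exact Finset.Icc_subset_Icc le_rfl (by have := hk.1.2; omega)
                · rw [Set.indicator_of_notMem hx, zero_mul]; exact zero_le
            _ ≤ ∏ i, ∑' m : ℤ, (if t2 m ≤ N i K x then t2 (m * θ i) else 0) :=
                tsum_pi_prod_le fun i (m : ℤ) => if t2 m ≤ N i K x then t2 (m * θ i) else 0
            _ ≤ _ := Finset.prod_le_prod' fun i _ => tsum_dyadic_le (hθ0 i) _
      _ = (∏ i, geomC (θ i)) * ∫⁻ x, ∏ i, N i K x ^ θ i := by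
          simp_rw [Finset.prod_mul_distrib]
          exact lintegral_const_mul _ (Finset.measurable_fun_prod _ fun i _ => (mN i K).pow_const _)
      _ ≤ (∏ i, geomC (θ i)) * ∏ i, nrm volume (a i) (N i K) ^ θ i := by
          refine mul_le_mul_right ?_ _
          exact lintegral_prod_rpow_le_nrm (fun i => (mN i K).aemeasurable)
            (fun i => (hθ0 i).le) ha hsa
      _ ≤ _ := by
          rw [← Finset.prod_mul_distrib]
          refine Finset.prod_le_prod' fun i _ => ?_
          rw [mul_assoc, ← ENNReal.mul_rpow_of_nonneg _ _ (hθ0 i).le]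
          exact mul_le_mul_right (ENNReal.rpow_le_rpow (nrm_dmax_le (ha i) (ha1 i) _ (mn i))
            (hθ0 i).le) _
  calc ∫⁻ z, ∑ k ∈ Finset.Icc (-K) K, h k z ∂(volume.prod ν)
      ≤ ∫⁻ z, ∑' m, ∑ k ∈ Finset.Icc (-K) K, (R m k).indicator 1 z.1 * h k z ∂(volume.prod ν) := by
        refine lintegral_mono_ae ?_
        have : ∀ᵐ z ∂(volume.prod ν), ∀ k ∈ Finset.Icc (-K) K,
            h k z ≤ ∑' m, (R m k).indicator 1 z.1 * h k z :=
          (ae_ball_iff (Finset.Icc (-K) K).countable_toSet).2 hcov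
        filter_upwards [this] with z hz
        refine (Finset.sum_le_sum hz).trans (le_of_eq ?_)
        exact (Summable.tsum_finsetSum fun _ _ => ENNReal.summable).symm
    _ = ∑' m, ∫⁻ z, ∑ k ∈ Finset.Icc (-K) K, (R m k).indicator 1 z.1 * h k z ∂(volume.prod ν) :=
        lintegral_tsum fun m => (Finset.measurable_fun_sum _ fun k _ => mRind m k).aemeasurable
    _ ≤ ∑' m : ι → ℤ, 2 * geomC ε * ((∏ i, c i) * (volume (Om m) * ∏ i, t2 (m i * θ i))) := by
        refine ENNReal.tsum_le_tsum fun m => ?_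
        refine (lintegral_mono (hloc m)).trans ?_
        have m1 : Measurable fun z => ∏ i, A m i z ^ θ i :=
          Finset.measurable_fun_prod _ fun i _ => (mA m i).pow_const _
        rw [lintegral_const_mul _ m1]
        exact mul_le_mul_right (hhol m) _
    _ ≤ 2 * geomC ε * ((∏ i, c i) *
          ∏ i, (geomC (θ i) * dmaxC (a i) ^ θ i * nrm volume (a i) (n i) ^ θ i)) := by
        rw [ENNReal.tsum_mul_left, ENNReal.tsum_mul_left]
        exact mul_le_mul_right (mul_le_mul_right hsum _) _
    _ = _ := by
        unfold carlC
        simp only [enrm, Finset.prod_mul_distrib, hc]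
        ring

end DyadicCarleson

section ShiftedGrids

lemma nrm_comp_add_right {a : ℝ} (φ : ℝ → ℝ≥0∞) (τ : ℝ) :
    nrm volume a (fun x => φ (x + τ)) = nrm volume a φ := by
  unfold nrm
  split_ifs
  · have h := (measurableEmbedding_addRight τ).essSup_map_measure (μ := volume) (g := φ)
    rw [(measurePreserving_add_right volume τ).map_eq] at h
    exact h.symm
  · rw [lintegral_add_right_eq_self (fun x => φ x ^ (1 / a)) τ]

lemma nrm2_comp_add_right {Y : Type*} [MeasurableSpace Y] {ν : Measure Y} {a b : ℝ}
    (F : ℝ × Y → ℝ≥0∞) (τ : ℝ) :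
    nrm2 volume ν a b (fun z => F (z.1 + τ, z.2)) = nrm2 volume ν a b F :=
  nrm_comp_add_right (fun x => nrm ν b fun y => F (x, y)) τ

lemma lintegral_prod_comp_add_right {Y : Type*} [MeasurableSpace Y] {ν : Measure Y} [SFinite ν]
    {G : ℝ × Y → ℝ≥0∞} (hG : Measurable G) (τ : ℝ) :
    ∫⁻ z, G (z.1 + τ, z.2) ∂(volume.prod ν) = ∫⁻ z, G z ∂(volume.prod ν) := by
  have h2 : Measurable fun z : ℝ × Y => G (z.1 + τ, z.2) := hG.comp (by fun_prop)
  rw [lintegral_prod_symm' _ hG, lintegral_prod_symm' _ h2]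
  congr 1; ext y
  exact lintegral_add_right_eq_self (fun x => G (x, y)) τ

/-- The normalised indicator of the ball of radius `2 ^ (-l)`. -/
noncomputable def box (l : ℤ) (z : ℝ) : ℝ≥0∞ := if |z| ≤ (2 : ℝ) ^ (-l) then t2 l else 0

lemma measurable_box (l : ℤ) : Measurable (box l) := by
  unfold box
  exact Measurable.ite (measurableSet_le (by fun_prop) measurable_const) measurable_const
    measurable_const

/-- Convolution with a nonnegative kernel. -/
noncomputable def cnv (κ u : ℝ → ℝ≥0∞) (x : ℝ) : ℝ≥0∞ := ∫⁻ x', κ (x - x') * u x'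

lemma measurable_cnv_prod {Y : Type*} [MeasurableSpace Y] {κ : ℝ → ℝ≥0∞} (hκ : Measurable κ)
    {F : ℝ × Y → ℝ≥0∞} (hF : Measurable F) :
    Measurable fun z : ℝ × Y => cnv κ (fun x' => F (x', z.2)) z.1 := by
  unfold cnv
  refine Measurable.lintegral_prod_right' (f := fun w : (ℝ × Y) × ℝ =>
    κ (w.1.1 - w.2) * F (w.2, w.1.2)) ?_
  exact (hκ.comp (by fun_prop)).mul (hF.comp (by fun_prop))

lemma measurable_cnv {κ u : ℝ → ℝ≥0∞} (hκ : Measurable κ) (hu : Measurable u) :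
    Measurable (cnv κ u) := by
  have := measurable_cnv_prod (Y := Unit) hκ (F := fun z => u z.1) (hu.comp measurable_fst)
  exact this.comp (f := fun x : ℝ => (x, ())) (by fun_prop)

/-- The ball of radius `2 ^ (-l)` about `x` lies in a cell of the grid of scale `l - c`
shifted by `τ`. -/
def GoodShift (l : ℤ) (c : ℕ) (τ x : ℝ) : Prop :=
  ∀ x', |x - x'| ≤ (2 : ℝ) ^ (-l) → cell (l - c) (x + τ) = cell (l - c) (x' + τ)

lemma exists_int_near_of_floor_ne {X Y d : ℝ} (h : ⌊X⌋ ≠ ⌊Y⌋) (hd : |X - Y| ≤ d) :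
    ∃ N : ℤ, |X - N| ≤ d := by
  rw [abs_le] at hd
  rcases lt_or_gt_of_ne h with h | h
  · refine ⟨⌊X⌋ + 1, ?_⟩
    have h1 := Int.lt_floor_add_one X
    have h2 : ((⌊X⌋ : ℝ) + 1) ≤ ⌊Y⌋ := by exact_mod_cast h
    have h3 := Int.floor_le Y
    rw [abs_le]; push_cast; constructor <;> linarith
  · refine ⟨⌊X⌋, ?_⟩
    have h1 := Int.floor_le X
    have h2 : ((⌊Y⌋ : ℝ) + 1) ≤ ⌊X⌋ := by exact_mod_cast h
    have h3 := Int.lt_floor_add_one Y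
    rw [abs_le]; constructor <;> linarith

lemma exists_int_near_of_not_goodShift {l : ℤ} {c : ℕ} {τ x : ℝ} (h : ¬ GoodShift l c τ x) :
    ∃ N : ℤ, |(2 : ℝ) ^ (l - c) * (x + τ) - N| ≤ (2 : ℝ) ^ (-(c : ℤ)) := by
  unfold GoodShift at h
  push Not at h
  obtain ⟨x', hx', hne⟩ := h
  refine exists_int_near_of_floor_ne hne ?_
  have e : (2 : ℝ) ^ (l - c) * (x + τ) - 2 ^ (l - c) * (x' + τ) = 2 ^ (l - c) * (x - x') := by ring
  have e2 : (2 : ℝ) ^ (-(c : ℤ)) = 2 ^ (l - c) * 2 ^ (-l) := by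
    rw [← zpow_add₀ (by norm_num)]; congr 1; ring
  rw [e, abs_mul, abs_of_pos (by positivity : (0 : ℝ) < 2 ^ (l - c)), e2]
  gcongr

lemma goodShift_or {p : ℕ} (hp : p.Prime) (hp2 : p ≠ 2) {c : ℕ} (hc : 2 * p < 2 ^ c) {l : ℤ}
    {K : ℕ} (hK : 0 ≤ K + l - c) {t t' : Fin p} (hne : t ≠ t') (x : ℝ) :
    GoodShift l c (t * 2 ^ K / p) x ∨ GoodShift l c (t' * 2 ^ K / p) x := by
  by_contra hcon
  push Not at hcon
  obtain ⟨N, hN⟩ := exists_int_near_of_not_goodShift hcon.1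
  obtain ⟨N', hN'⟩ := exists_int_near_of_not_goodShift hcon.2
  obtain ⟨M, hM⟩ := Int.eq_ofNat_of_zero_le hK
  have hp0 : (0 : ℝ) < p := by exact_mod_cast hp.pos
  have e : (2 : ℝ) ^ (l - c) * 2 ^ K = 2 ^ M := by
    rw [← zpow_natCast, ← zpow_natCast, ← zpow_add₀ (by norm_num), ← hM]; congr 1; ring
  have h1 : |((2 : ℝ) ^ (l - c) * (x + t * 2 ^ K / p) - N) -
      ((2 : ℝ) ^ (l - c) * (x + t' * 2 ^ K / p) - N')| ≤ 2 * (2 : ℝ) ^ (-(c : ℤ)) :=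
    (abs_sub _ _).trans (by linarith)
  have e2 : ((2 : ℝ) ^ (l - c) * (x + t * 2 ^ K / p) - N) -
      ((2 : ℝ) ^ (l - c) * (x + t' * 2 ^ K / p) - N') =
      (((2 : ℤ) ^ M * ((t : ℤ) - (t' : ℤ)) - p * (N - N') : ℤ) : ℝ) / p := by
    push_cast
    rw [← e]
    field_simp
    ring
  rw [e2, abs_div, abs_of_pos hp0, div_le_iff₀ hp0] at h1
  have h2 : 2 * (2 : ℝ) ^ (-(c : ℤ)) * p < 1 := by
    rw [zpow_neg, zpow_natCast]
    have : (2 : ℝ) * p < 2 ^ c := by exact_mod_cast hc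
    rw [mul_right_comm, ← div_eq_mul_inv, div_lt_one (by positivity)]
    exact this
  have h3 : |(2 : ℤ) ^ M * ((t : ℤ) - (t' : ℤ)) - p * (N - N')| < 1 := by
    have := lt_of_le_of_lt h1 h2
    rw [← Int.cast_abs] at this
    exact_mod_cast this
  rw [Int.abs_lt_one_iff] at h3
  have h4 : (p : ℤ) ∣ 2 ^ M * ((t : ℤ) - (t' : ℤ)) := ⟨N - N', by linarith⟩
  have hpi : Prime (p : ℤ) := Nat.prime_iff_prime_int.1 hp
  rcases hpi.dvd_or_dvd h4 with h5 | h5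
  · have := hpi.dvd_of_dvd_pow h5
    have h6 : p ∣ 2 := by exact_mod_cast this
    exact hp2 ((Nat.prime_dvd_prime_iff_eq hp Nat.prime_two).1 h6)
  · have h7 : (t : ℤ) - t' = 0 := by
      apply Int.eq_zero_of_abs_lt_dvd h5
      have := t.2; have := t'.2
      rw [abs_lt]; constructor <;> omega
    apply hne; ext; omega

lemma cnv_box_le {l : ℤ} {c : ℕ} {τ x : ℝ} (h : GoodShift l c τ x) (u : ℝ → ℝ≥0∞) :
    cnv (box l) u x ≤ t2 c * dE (l - c) (fun x' => u (x' - τ)) (x + τ) := by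
  have e : dE (l - c) (fun x' => u (x' - τ)) (x + τ) =
      ∫⁻ x', dker (l - c) (x + τ) (x' + τ) * u x' := by
    unfold dE
    rw [← lintegral_add_right_eq_self _ τ]
    simp
  rw [e, ← lintegral_const_mul' _ _ (t2_ne_top _)]
  refine lintegral_mono fun x' => ?_
  beta_reduce
  rw [← mul_assoc]
  refine mul_le_mul_left ?_ _
  unfold box dker
  split_ifs with h1 h2
  · rw [← t2_add]; apply t2_mono; push_cast; linarith
  · exact absurd (h x' h1) h2
  · exact zero_le
  · exact zero_le

lemma mixMin_mul_le {ι : Type*} [Fintype ι] {ε : ℝ} {θp θm : ι → ℝ}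
    (hp : ∀ i, 0 < θp i) (hm : ∀ i, 0 < θm i) (k : ℤ) (c e : ι → ℝ≥0∞) {C : ℝ≥0∞}
    (h1 : ∏ i, c i ^ θp i ≤ C) (h2 : ∏ i, c i ^ θm i ≤ C) :
    mixMin ε θp θm k (fun i => c i * e i) ≤ C * mixMin ε θp θm k e := by
  unfold mixMin
  simp only [ENNReal.mul_rpow_of_nonneg _ _ (hp _).le, ENNReal.mul_rpow_of_nonneg _ _ (hm _).le,
    Finset.prod_mul_distrib]
  rw [mul_min]
  refine min_le_min ?_ ?_
  · rw [mul_left_comm]; gcongr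
  · rw [mul_left_comm]; gcongr

lemma carlC_add_le {ι : Type*} [Fintype ι] {ε : ℝ} {θ a b : ι → ℝ} (hθ : ∀ i, 0 ≤ θ i)
    (hb : ∀ i, 0 ≤ b i) (j j' : ι → ℕ) : carlC ε θ a b (fun i => j i + j' i) ≤
      carlC ε θ a b j' * ∏ i, (1 + j i : ℝ≥0∞) ^ θ i := by
  unfold carlC
  rw [mul_assoc (2 * geomC ε), ← Finset.prod_mul_distrib]
  refine mul_le_mul_right (Finset.prod_le_prod' fun i _ => ?_) _
  rw [mul_right_comm, ← ENNReal.mul_rpow_of_nonneg _ _ (hθ i)]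
  refine mul_le_mul_left (ENNReal.rpow_le_rpow ?_ (hθ i)) _
  have hD : (1 : ℝ≥0∞) ≤ 2 * dmaxC (b i) := by
    have : (1 : ℝ≥0∞) ≤ dmaxC (b i) := by
      unfold dmaxC
      split_ifs
      · exact le_rfl
      · rw [← one_mul (1 : ℝ≥0∞), ← t2_zero]
        refine mul_le_mul' (t2_mono (by have := hb i; positivity)) ?_
        rw [t2_zero]
        exact geomC_ge_one _
    calc (1 : ℝ≥0∞) ≤ 2 * 1 := by norm_num
      _ ≤ _ := by gcongr
  push_cast
  calc 2 * ((j i : ℝ≥0∞) + j' i + 2 * dmaxC (b i))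
      = 2 * (j' i + 2 * dmaxC (b i)) + 2 * (j i * 1) := by ring
    _ ≤ 2 * (j' i + 2 * dmaxC (b i)) + 2 * (j i * (j' i + 2 * dmaxC (b i))) := by
        gcongr
        exact hD.trans le_add_self
    _ = _ := by ring

end ShiftedGrids

section BoxCarleson

lemma carlC_ne_top {ι : Type*} [Fintype ι] {ε : ℝ} {θ a b : ι → ℝ} (hε : 0 < ε)
    (hθ : ∀ i, 0 < θ i) (ha : ∀ i, 0 ≤ a i) (ha1 : ∀ i, a i < 1) (hb : ∀ i, 0 ≤ b i)
    (hb1 : ∀ i, b i < 1) (j : ι → ℕ) : carlC ε θ a b j ≠ ∞ := by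
  unfold carlC
  refine ENNReal.mul_ne_top (ENNReal.mul_ne_top (by simp) (geomC_ne_top hε))
    (ENNReal.prod_ne_top fun i _ => ENNReal.mul_ne_top ?_ (ENNReal.mul_ne_top
      (geomC_ne_top (hθ i)) ?_))
  · refine ENNReal.rpow_ne_top_of_nonneg (hθ i).le (ENNReal.mul_ne_top (by simp)
      (ENNReal.add_ne_top.2 ⟨by simp, ENNReal.mul_ne_top (by simp) (dmaxC_ne_top (hb i) (hb1 i))⟩))
  · exact ENNReal.rpow_ne_top_of_nonneg (hθ i).le (dmaxC_ne_top (ha i) (ha1 i))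

lemma exists_forall_goodShift {ι : Type*} [Fintype ι] {p : ℕ} (hp : p.Prime) (hp2 : p ≠ 2)
    (hι : Fintype.card ι < p) {c : ℕ} (hc : 2 * p < 2 ^ c) {l : ι → ℤ} {K : ℕ}
    (hK : ∀ i, 0 ≤ K + l i - c) (x : ℝ) :
    ∃ t : Fin p, ∀ i, GoodShift (l i) c (t * 2 ^ K / p) x := by
  by_contra hcon
  push Not at hcon
  choose i hi using hcon
  obtain ⟨t, t', hne, he⟩ := Fintype.exists_ne_map_eq_of_card_lt i (by simpa using hι)
  rcases goodShift_or hp hp2 hc (hK (i t)) hne x with h | h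
  · exact hi t h
  · rw [he] at h; exact hi t' h

lemma box_carleson {ι : Type*} [Fintype ι] {a b θ θp θm : ι → ℝ} {ε : ℝ} (hε : 0 < ε)
    (ha : ∀ i, 0 ≤ a i) (ha1 : ∀ i, a i < 1)
    (hb : ∀ i, 0 ≤ b i) (hb1 : ∀ i, b i < 1) (hp : ∀ i, 0 < θp i) (hm : ∀ i, 0 < θm i)
    (hθ : ∀ i, θp i + θm i = 2 * θ i) (hsa : ∑ i, θ i * a i = 1) (hsb : ∑ i, θ i * b i = 1) :
    ∃ C : ℝ≥0∞, C ≠ ∞ ∧ ∀ F : ι → ℝ × ℝ → ℝ≥0∞, (∀ i, Measurable (F i)) → ∀ (j : ι → ℕ) (K : ℤ),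
    ∫⁻ z : ℝ × ℝ, ∑ k ∈ Finset.Icc (-K) K,
        mixMin ε θp θm k (fun i => cnv (box (k - j i)) (fun x' => F i (x', z.2)) z.1) ≤
      C * (∏ i, (1 + j i : ℝ≥0∞) ^ θ i) * ∏ i, nrm2 volume volume (a i) (b i) (F i) ^ θ i := by
  have hθ0 : ∀ i, 0 < θ i := fun i => by linarith [hp i, hm i, hθ i]
  obtain ⟨p, hp3, hpp⟩ := Nat.exists_infinite_primes (Fintype.card ι + 3)
  obtain ⟨c, hc⟩ : ∃ c : ℕ, 2 * p < 2 ^ c := ⟨2 * p, Nat.lt_two_pow_self⟩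
  set C0 : ℝ≥0∞ := max (∏ i : ι, (t2 c) ^ θp i) (∏ i : ι, (t2 c) ^ θm i) with hC0
  have hC0t : C0 ≠ ∞ := by
    rw [hC0]
    refine (max_lt ?_ ?_).ne <;> refine (ENNReal.prod_ne_top fun i _ => ?_).lt_top
    · exact ENNReal.rpow_ne_top_of_nonneg (hp i).le (t2_ne_top _)
    · exact ENNReal.rpow_ne_top_of_nonneg (hm i).le (t2_ne_top _)
  refine ⟨C0 * (p * carlC ε θ a b fun _ => c), ENNReal.mul_ne_top hC0t (ENNReal.mul_ne_top (by simp)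
    (carlC_ne_top hε hθ0 ha ha1 hb hb1 _)), fun F hF j K => ?_⟩
  set K' : ℕ := K.toNat + ∑ i, j i + c with hK'
  set τ : Fin p → ℝ := fun t => t * 2 ^ K' / p with hτ
  set G : Fin p → ι → ℝ × ℝ → ℝ≥0∞ := fun t i z => F i (z.1 + -τ t, z.2) with hG
  have mG : ∀ t i, Measurable (G t i) := fun t i => (hF i).comp (by fun_prop)
  set H : Fin p → ℤ → ℝ × ℝ → ℝ≥0∞ := fun t k z => mixMin ε θp θm k
    (fun i => dE (k - (j i + c : ℕ)) (fun x' => G t i (x', z.2)) z.1) with hH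
  have mH : ∀ t k, Measurable (H t k) := fun t k =>
    measurable_mixMin k fun i => measurable_dE_prod _ (mG t i)
  have key : ∀ z : ℝ × ℝ, ∀ k ∈ Finset.Icc (-K) K,
      mixMin ε θp θm k (fun i => cnv (box (k - j i)) (fun x' => F i (x', z.2)) z.1) ≤
        C0 * ∑ t, H t k (z.1 + τ t, z.2) := by
    intro z k hk
    rw [Finset.mem_Icc] at hk
    obtain ⟨t, ht⟩ := exists_forall_goodShift hpp (by omega) (by omega) hc
      (l := fun i => k - j i) (K := K') (fun i => by
        have h1 : j i ≤ ∑ i, j i := Finset.single_le_sum (fun _ _ => Nat.zero_le _) (Finset.mem_univ i)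
        have h2 := Int.self_le_toNat K
        rw [hK']; push_cast
        have h3 : (j i : ℤ) ≤ ∑ i, (j i : ℤ) := by exact_mod_cast h1
        linarith) z.1
    calc _ ≤ mixMin ε θp θm k (fun i => t2 c * dE (k - (j i + c : ℕ))
          (fun x' => G t i (x', z.2)) (z.1 + τ t)) := by
          refine mixMin_mono hp hm _ fun i => ?_
          have := cnv_box_le (ht i) (fun x' => F i (x', z.2))
          rw [show k - ((j i + c : ℕ) : ℤ) = k - j i - c by push_cast; ring]
          exact this
      _ ≤ C0 * H t k (z.1 + τ t, z.2) :=
          mixMin_mul_le hp hm k _ _ (le_max_left _ _) (le_max_right _ _)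
      _ ≤ _ := by
          refine mul_le_mul_right ?_ _
          exact Finset.single_le_sum (f := fun t => H t k (z.1 + τ t, z.2))
            (fun _ _ => zero_le) (Finset.mem_univ t)
  have mS : ∀ t, Measurable fun z => ∑ k ∈ Finset.Icc (-K) K, H t k z := fun t =>
    Finset.measurable_sum _ fun k _ => mH t k
  have mS' : ∀ t, Measurable fun z : ℝ × ℝ => ∑ k ∈ Finset.Icc (-K) K, H t k (z.1 + τ t, z.2) :=
    fun t => (mS t).comp (g := fun z => ∑ k ∈ Finset.Icc (-K) K, H t k z)
      (f := fun z : ℝ × ℝ => (z.1 + τ t, z.2)) (by fun_prop)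
  set N : ℝ≥0∞ := ∏ i, nrm2 volume volume (a i) (b i) (F i) ^ θ i with hN
  have hd : ∀ t, ∫⁻ z : ℝ × ℝ, ∑ k ∈ Finset.Icc (-K) K, H t k z ≤
      carlC ε θ a b (fun _ => c) * (∏ i, (1 + j i : ℝ≥0∞) ^ θ i) * N := by
    intro t
    have h1 := dyadic_carleson (ν := (volume : Measure ℝ)) (mG t) (fun i => j i + c) hε ha ha1 hb hb1
      hp hm hθ hsa hsb K
    have h2 : ∀ i, nrm2 volume volume (a i) (b i) (G t i) = nrm2 volume volume (a i) (b i) (F i) :=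
      fun i => nrm2_comp_add_right (F i) (-τ t)
    simp only [h2] at h1
    refine h1.trans (mul_le_mul_left ?_ _)
    exact carlC_add_le (fun i => (hθ0 i).le) hb j (fun _ => c)
  calc _ ≤ ∫⁻ z : ℝ × ℝ, C0 * ∑ t, ∑ k ∈ Finset.Icc (-K) K, H t k (z.1 + τ t, z.2) := by
        refine lintegral_mono fun z => ?_
        beta_reduce
        rw [Finset.sum_comm, Finset.mul_sum]
        exact Finset.sum_le_sum fun k hk => key z k hk
    _ = C0 * ∑ t, ∫⁻ z : ℝ × ℝ, ∑ k ∈ Finset.Icc (-K) K, H t k (z.1 + τ t, z.2) := by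
        rw [lintegral_const_mul' _ _ hC0t, lintegral_finsetSum]
        exact fun t _ => mS' t
    _ = C0 * ∑ t, ∫⁻ z : ℝ × ℝ, ∑ k ∈ Finset.Icc (-K) K, H t k z := by
        congr 1
        refine Finset.sum_congr rfl fun t _ => ?_
        exact lintegral_prod_comp_add_right (ν := (volume : Measure ℝ)) (mS t) (τ t)
    _ ≤ C0 * ∑ t : Fin p, carlC ε θ a b (fun _ => c) * (∏ i, (1 + j i : ℝ≥0∞) ^ θ i) * N :=
        mul_le_mul_right (Finset.sum_le_sum fun t _ => hd t) _
    _ = _ := by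
        rw [Finset.sum_const, Finset.card_univ, Fintype.card_fin, nsmul_eq_mul]
        ring

lemma box_carleson_tsum {ι : Type*} [Fintype ι] {a b θ θp θm : ι → ℝ} {ε : ℝ} (hε : 0 < ε)
    (ha : ∀ i, 0 ≤ a i) (ha1 : ∀ i, a i < 1)
    (hb : ∀ i, 0 ≤ b i) (hb1 : ∀ i, b i < 1) (hp : ∀ i, 0 < θp i) (hm : ∀ i, 0 < θm i)
    (hθ : ∀ i, θp i + θm i = 2 * θ i) (hsa : ∑ i, θ i * a i = 1) (hsb : ∑ i, θ i * b i = 1) :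
    ∃ C : ℝ≥0∞, C ≠ ∞ ∧ ∀ F : ι → ℝ × ℝ → ℝ≥0∞, (∀ i, Measurable (F i)) → ∀ j : ι → ℕ,
    ∫⁻ z : ℝ × ℝ, ∑' k : ℤ,
        mixMin ε θp θm k (fun i => cnv (box (k - j i)) (fun x' => F i (x', z.2)) z.1) ≤
      C * (∏ i, (1 + j i : ℝ≥0∞) ^ θ i) * ∏ i, nrm2 volume volume (a i) (b i) (F i) ^ θ i := by
  obtain ⟨C, hC, h⟩ := box_carleson hε ha ha1 hb hb1 hp hm hθ hsa hsb
  refine ⟨C, hC, fun F hF j => ?_⟩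
  have m : ∀ k : ℤ, Measurable fun z : ℝ × ℝ =>
      mixMin ε θp θm k (fun i => cnv (box (k - j i)) (fun x' => F i (x', z.2)) z.1) := fun k =>
    measurable_mixMin k fun i => measurable_cnv_prod (measurable_box _) (hF i)
  rw [lintegral_tsum fun k => (m k).aemeasurable, ENNReal.tsum_eq_iSup_sum]
  refine iSup_le fun s => ?_
  obtain ⟨K, hK⟩ : ∃ K : ℤ, s ⊆ Finset.Icc (-K) K := by
    refine ⟨∑ k ∈ s, |k|, fun k hk => ?_⟩
    have := Finset.single_le_sum (f := fun k : ℤ => |k|) (fun _ _ => abs_nonneg _) hk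
    rw [Finset.mem_Icc, ← abs_le]
    exact this
  refine (Finset.sum_le_sum_of_subset hK).trans ?_
  rw [← lintegral_finsetSum _ fun k _ => m k]
  exact h F hF j K

end BoxCarleson

section Omega

/-- The kernel `2 ^ (l - 2) (1 + 2 ^ l |z|)⁻²`, of integral at most one. -/
noncomputable def omg (l : ℤ) (z : ℝ) : ℝ≥0∞ :=
  ENNReal.ofReal ((2 : ℝ) ^ (l - 2) * (1 + 2 ^ l * |z|)⁻¹ ^ 2)

lemma measurable_omg (l : ℤ) : Measurable (omg l) := by unfold omg; fun_prop

lemma t2_intCast_eq_ofReal (l : ℤ) : t2 l = ENNReal.ofReal ((2 : ℝ) ^ l) := by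
  rw [t2_eq_ofReal, Real.rpow_intCast]

lemma lintegral_omg_le (l : ℤ) : ∫⁻ z, omg l z ≤ 1 := by
  have h1 : ∫⁻ z : ℝ, ENNReal.ofReal ((1 + z ^ 2)⁻¹) ≤ 4 := by
    rw [← ofReal_integral_eq_lintegral_ofReal integrable_inv_one_add_sq
      (Filter.Eventually.of_forall fun z => by positivity), integral_univ_inv_one_add_sq]
    calc ENNReal.ofReal Real.pi ≤ ENNReal.ofReal 4 := ENNReal.ofReal_le_ofReal Real.pi_le_four
      _ = 4 := by norm_num
  have h2 : ∀ z, omg l z ≤ ENNReal.ofReal (2 ^ (l - 2)) *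
      ENNReal.ofReal ((1 + ((2 : ℝ) ^ l * z) ^ 2)⁻¹) := by
    intro z
    rw [← ENNReal.ofReal_mul (by positivity)]
    unfold omg
    refine ENNReal.ofReal_le_ofReal (mul_le_mul_of_nonneg_left ?_ (by positivity))
    rw [inv_pow]
    refine inv_anti₀ (by positivity) ?_
    have e : ((2 : ℝ) ^ l * z) ^ 2 = (2 ^ l * |z|) ^ 2 := by rw [mul_pow, mul_pow, sq_abs]
    have : 0 ≤ (2 : ℝ) ^ l * |z| := by positivity
    rw [e]; nlinarith
  have h3 : ∫⁻ z : ℝ, ENNReal.ofReal ((1 + ((2 : ℝ) ^ l * z) ^ 2)⁻¹) =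
      ENNReal.ofReal (2 ^ (-l)) * ∫⁻ z : ℝ, ENNReal.ofReal ((1 + z ^ 2)⁻¹) := by
    have h0 : (2 : ℝ) ^ l ≠ 0 := by positivity
    have h4 := Real.map_volume_mul_left h0
    have h5 := lintegral_map (μ := volume) (f := fun z : ℝ => ENNReal.ofReal ((1 + z ^ 2)⁻¹))
      (g := fun z => (2 : ℝ) ^ l * z) (by fun_prop) (by fun_prop)
    rw [h4, lintegral_smul_measure] at h5
    rw [← h5, abs_of_pos (by positivity), zpow_neg, smul_eq_mul]
  calc _ ≤ ∫⁻ z, ENNReal.ofReal (2 ^ (l - 2)) * ENNReal.ofReal ((1 + ((2 : ℝ) ^ l * z) ^ 2)⁻¹) :=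
        lintegral_mono h2
    _ = ENNReal.ofReal (2 ^ (l - 2)) * (ENNReal.ofReal (2 ^ (-l)) *
        ∫⁻ z : ℝ, ENNReal.ofReal ((1 + z ^ 2)⁻¹)) := by
        rw [lintegral_const_mul' _ _ ENNReal.ofReal_ne_top, h3]
    _ ≤ ENNReal.ofReal (2 ^ (l - 2)) * (ENNReal.ofReal (2 ^ (-l)) * 4) := by gcongr
    _ = 1 := by
        rw [← mul_assoc, ← ENNReal.ofReal_mul (by positivity), ← zpow_add₀ (by norm_num)]
        have : l - 2 + -l = -2 := by ring
        rw [this, show (4 : ℝ≥0∞) = ENNReal.ofReal 4 by norm_num,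
          ← ENNReal.ofReal_mul (by positivity)]
        norm_num

lemma omg_le_tsum_box (l : ℤ) (z : ℝ) : omg l z ≤ ∑' n : ℕ, t2 (-n) * box (l - n) z := by
  have hex : ∃ n : ℕ, (2 : ℝ) ^ l * |z| ≤ 2 ^ n := by
    obtain ⟨n, hn⟩ := pow_unbounded_of_one_lt ((2 : ℝ) ^ l * |z|) (by norm_num : (1 : ℝ) < 2)
    exact ⟨n, hn.le⟩
  classical
  set n := Nat.find hex with hn
  have h1 : (2 : ℝ) ^ l * |z| ≤ 2 ^ n := Nat.find_spec hex
  refine le_trans ?_ (ENNReal.le_tsum n)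
  have h2 : |z| ≤ (2 : ℝ) ^ (-(l - (n : ℤ))) := by
    rw [neg_sub, zpow_sub₀ (by norm_num), zpow_natCast, le_div_iff₀ (by positivity), mul_comm]
    exact h1
  unfold box
  rw [if_pos h2, ← t2_add, t2_eq_ofReal]
  unfold omg
  refine ENNReal.ofReal_le_ofReal ?_
  have e : (2 : ℝ) ^ (-(n : ℝ) + ((l - n : ℤ) : ℝ)) = 2 ^ l / (2 ^ n) ^ 2 := by
    rw [show -(n : ℝ) + ((l - n : ℤ) : ℝ) = ((l - 2 * n : ℤ) : ℝ) by push_cast; ring,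
      Real.rpow_intCast, zpow_sub₀ (by norm_num)]
    congr 1
    rw [← pow_mul, mul_comm n 2]; norm_cast
  have e2 : (2 : ℝ) ^ (l - 2) = 2 ^ l / 4 := by rw [zpow_sub₀ (by norm_num)]; norm_num
  rw [e, e2, inv_pow, ← div_eq_mul_inv, div_div]
  refine div_le_div_of_nonneg_left (by positivity) (by positivity) ?_
  have hz : 0 ≤ (2 : ℝ) ^ l * |z| := by positivity
  rcases Nat.eq_zero_or_pos n with h0 | h0
  · rw [h0]; nlinarith
  · obtain ⟨m, hm⟩ := Nat.exists_eq_succ_of_ne_zero h0.ne'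
    have h3 : (2 : ℝ) ^ m < 2 ^ l * |z| := by
      have := Nat.find_min hex (m := m) (by omega)
      exact not_le.1 this
    rw [hm, Nat.succ_eq_add_one, pow_succ (2 : ℝ) m]
    have : (0 : ℝ) < 2 ^ m := by positivity
    nlinarith

lemma cnv_omg_le {l : ℤ} {u : ℝ → ℝ≥0∞} (hu : Measurable u) (x : ℝ) :
    cnv (omg l) u x ≤ ∑' n : ℕ, t2 (-n) * cnv (box (l - n)) u x := by
  have m : ∀ n : ℕ, Measurable fun x' => box (l - n) (x - x') * u x' := fun n =>
    ((measurable_box _).comp (by fun_prop)).mul hu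
  have : ∀ n : ℕ, t2 (-n) * cnv (box (l - n)) u x =
      ∫⁻ x', t2 (-n) * (box (l - n) (x - x') * u x') := fun n => by
    rw [lintegral_const_mul' _ _ (t2_ne_top _)]; rfl
  simp only [this]
  rw [← lintegral_tsum fun n => ((m n).const_mul _).aemeasurable]
  refine lintegral_mono fun x' => ?_
  beta_reduce
  simp only [← mul_assoc]
  rw [ENNReal.tsum_mul_right]
  exact mul_le_mul_left (omg_le_tsum_box l _) _

lemma cnv_const_le {κ u : ℝ → ℝ≥0∞} {M A : ℝ≥0∞} (hκm : Measurable κ)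
    (hκ : ∫⁻ z, κ z ≤ A) (hu : ∀ x, u x ≤ M) (x : ℝ) : cnv κ u x ≤ A * M := by
  calc cnv κ u x ≤ ∫⁻ x', κ (x - x') * M := lintegral_mono fun x' => mul_le_mul_right (hu x') _
    _ = (∫⁻ x', κ (x - x')) * M := lintegral_mul_const _ (hκm.comp (by fun_prop))
    _ = (∫⁻ x', κ x') * M := by rw [lintegral_sub_left_eq_self κ x]
    _ ≤ A * M := mul_le_mul_left hκ _

lemma lintegral_box_le (l : ℤ) : ∫⁻ z, box l z ≤ 2 := by
  have : box l = (Metric.closedBall (0 : ℝ) (2 ^ (-l))).indicator fun _ => t2 l := by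
    ext z
    unfold box
    split_ifs with h
    · rw [Set.indicator_of_mem (by simpa using h)]
    · rw [Set.indicator_of_notMem (by simpa using h)]
  rw [this, lintegral_indicator Metric.isClosed_closedBall.measurableSet, lintegral_const,
    Measure.restrict_apply_univ, Real.volume_closedBall, t2_intCast_eq_ofReal,
    ← ENNReal.ofReal_mul (by positivity), mul_left_comm, ← zpow_add₀ (by norm_num)]
  simp

lemma exists_tsum_le_of_bdd {B : ℕ → ℝ≥0∞} {M : ℝ≥0∞} (hM : M ≠ ∞) (hB : ∀ n, B n ≤ M) :
    ∃ n : ℕ, ∑' n : ℕ, t2 (-n) * B n ≤ 2 * geomC (1 / 2) * (t2 (-(1 / 2) * n) * B n) := by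
  set v : ℕ → ℝ≥0∞ := fun n => t2 (-(1 / 2) * n) * B n with hv
  have h1 : ∑' n : ℕ, t2 (-n) * B n ≤ geomC (1 / 2) * ⨆ n, v n := by
    unfold geomC
    rw [← ENNReal.tsum_mul_right]
    refine ENNReal.tsum_le_tsum fun n => ?_
    have e : t2 (-n) = t2 (-(1 / 2) * n) * t2 (-(1 / 2) * n) := by
      rw [← t2_add]; congr 1; ring
    rw [e, mul_assoc]
    exact mul_le_mul_right (le_iSup v n) _
  have hfin : ⨆ n, v n ≠ ∞ := by
    refine ne_top_of_le_ne_top hM (iSup_le fun n => ?_)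
    calc v n ≤ 1 * M := by
          refine mul_le_mul' ?_ (hB n)
          rw [← t2_zero]
          exact t2_mono (by have : (0:ℝ) ≤ n := by positivity
                            linarith)
      _ = M := one_mul _
  by_cases h0 : ⨆ n, v n = 0
  · refine ⟨0, h1.trans ?_⟩
    rw [h0]; simp
  · obtain ⟨n, hn⟩ := lt_iSup_iff.1 (ENNReal.half_lt_self h0 hfin)
    refine ⟨n, h1.trans ?_⟩
    calc geomC (1 / 2) * ⨆ n, v n = 2 * geomC (1 / 2) * ((⨆ n, v n) / 2) := by
          rw [mul_comm 2, mul_assoc, ENNReal.mul_div_cancel (by simp) (by simp)]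
      _ ≤ _ := mul_le_mul_right hn.le _

lemma exists_one_add_rpow_le {δ θ : ℝ} (hδ : 0 < δ) (hθ : 0 < θ) :
    ∃ C : ℝ≥0∞, C ≠ ∞ ∧ ∀ n : ℕ, (1 + n : ℝ≥0∞) ^ θ ≤ C * t2 (δ * n) := by
  set d := δ / θ * Real.log 2 with hd
  have hd0 : 0 < d := mul_pos (div_pos hδ hθ) (Real.log_pos (by norm_num))
  refine ⟨ENNReal.ofReal (1 + 1 / d) ^ θ, ENNReal.rpow_ne_top_of_nonneg hθ.le
    ENNReal.ofReal_ne_top, fun n => ?_⟩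
  have e : t2 (δ * n) = t2 (δ / θ * n) ^ θ := by rw [t2_rpow]; congr 1; field_simp
  rw [e, ← ENNReal.mul_rpow_of_nonneg _ _ hθ.le]
  refine ENNReal.rpow_le_rpow ?_ hθ.le
  rw [t2_eq_ofReal, ← ENNReal.ofReal_mul (by positivity)]
  have e2 : (1 + n : ℝ≥0∞) = ENNReal.ofReal (1 + n) := by
    rw [ENNReal.ofReal_add (by norm_num) (by positivity)]; simp
  rw [e2]
  refine ENNReal.ofReal_le_ofReal ?_
  have h1 : d * n + 1 ≤ (2 : ℝ) ^ (δ / θ * n) := by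
    rw [Real.rpow_def_of_pos (by norm_num)]
    have := Real.add_one_le_exp (d * n)
    convert this using 2
    rw [hd]; ring
  calc (1 + n : ℝ) ≤ (1 + 1 / d) * (d * n + 1) := by
        have e3 : (1 + 1 / d) * (d * n + 1) = 1 + n + (d * n + 1 / d) := by field_simp; ring
        rw [e3]
        have : 0 ≤ d * n + 1 / d := by positivity
        linarith
    _ ≤ _ := by gcongr

/-- The Carleson type estimate for convolution averages. -/
lemma omg_carleson {ι : Type*} [Fintype ι] {a b θ θp θm : ι → ℝ} {ε : ℝ} (hε : 0 < ε)
    (ha : ∀ i, 0 ≤ a i) (ha1 : ∀ i, a i < 1)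
    (hb : ∀ i, 0 ≤ b i) (hb1 : ∀ i, b i < 1) (hp : ∀ i, 0 < θp i) (hm : ∀ i, 0 < θm i)
    (hθ : ∀ i, θp i + θm i = 2 * θ i) (hsa : ∑ i, θ i * a i = 1) (hsb : ∑ i, θ i * b i = 1) :
    ∃ C : ℝ≥0∞, C ≠ ∞ ∧ ∀ F : ι → ℝ × ℝ → ℝ≥0∞, (∀ i, Measurable (F i)) →
      (∀ i, ∃ M : ℝ≥0, ∀ z, F i z ≤ M) → ∀ j : ι → ℕ,
    ∫⁻ z : ℝ × ℝ, ∑' k : ℤ,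
        mixMin ε θp θm k (fun i => cnv (omg (k - j i)) (fun x' => F i (x', z.2)) z.1) ≤
      C * (∏ i, (1 + j i : ℝ≥0∞) ^ θ i) * ∏ i, nrm2 volume volume (a i) (b i) (F i) ^ θ i := by
  have hθ0 : ∀ i, 0 < θ i := fun i => by linarith [hp i, hm i, hθ i]
  obtain ⟨C, hC, h⟩ := box_carleson_tsum hε ha ha1 hb hb1 hp hm hθ hsa hsb
  set δ : ι → ℝ := fun i => min (θp i) (θm i) / 2 with hδ
  have hδ0 : ∀ i, 0 < δ i := fun i => half_pos (lt_min (hp i) (hm i))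
  set c0 : ℝ≥0∞ := 2 * geomC (1 / 2) with hc0
  have hc0t : c0 ≠ ∞ := ENNReal.mul_ne_top (by simp) (geomC_ne_top (by norm_num))
  set C0 : ℝ≥0∞ := max (∏ i : ι, c0 ^ θp i) (∏ i : ι, c0 ^ θm i) with hC0
  have hC0t : C0 ≠ ∞ := by
    rw [hC0]
    refine (max_lt ?_ ?_).ne <;> refine (ENNReal.prod_ne_top fun i _ => ?_).lt_top
    · exact ENNReal.rpow_ne_top_of_nonneg (hp i).le hc0t
    · exact ENNReal.rpow_ne_top_of_nonneg (hm i).le hc0t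
  choose D hD hDn using fun i => exists_one_add_rpow_le (half_pos (hδ0 i)) (hθ0 i)
  refine ⟨C0 * (C * ∏ i, (D i * geomC (δ i / 2))), ENNReal.mul_ne_top hC0t (ENNReal.mul_ne_top hC
    (ENNReal.prod_ne_top fun i _ => ENNReal.mul_ne_top (hD i) (geomC_ne_top (half_pos (hδ0 i))))),
    fun F hF hbd j => ?_⟩
  choose M hM using hbd
  set N : ℝ≥0∞ := ∏ i, nrm2 volume volume (a i) (b i) (F i) ^ θ i with hN
  set H : (ι → ℕ) → ℤ → ℝ × ℝ → ℝ≥0∞ := fun n k z => mixMin ε θp θm k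
    (fun i => cnv (box (k - (j i + n i : ℕ))) (fun x' => F i (x', z.2)) z.1) with hH
  have mH : ∀ n k, Measurable (H n k) := fun n k =>
    measurable_mixMin k fun i => measurable_cnv_prod (measurable_box _) (hF i)
  set w : (ι → ℕ) → ℝ≥0∞ := fun n => ∏ i, t2 (-δ i * n i) with hw
  have hwt : ∀ n, w n ≠ ∞ := fun n => ENNReal.prod_ne_top fun i _ => t2_ne_top _
  have key : ∀ z k, mixMin ε θp θm k
      (fun i => cnv (omg (k - j i)) (fun x' => F i (x', z.2)) z.1) ≤
      C0 * ∑' n, w n * H n k z := by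
    intro z k
    have hex : ∀ i, ∃ n : ℕ, cnv (omg (k - j i)) (fun x' => F i (x', z.2)) z.1 ≤
        (c0 * t2 (-(1 / 2) * n)) * cnv (box (k - (j i + n : ℕ))) (fun x' => F i (x', z.2)) z.1 := by
      intro i
      obtain ⟨n, hn⟩ := exists_tsum_le_of_bdd (M := 2 * M i)
        (B := fun n => cnv (box (k - j i - n)) (fun x' => F i (x', z.2)) z.1)
        (ENNReal.mul_ne_top (by simp) (by simp))
        (fun n => cnv_const_le (measurable_box _) (lintegral_box_le _) (fun x' => hM i _) _)
      refine ⟨n, (cnv_omg_le ((hF i).comp (by fun_prop)) _).trans (hn.trans (le_of_eq ?_))⟩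
      rw [show k - ((j i + n : ℕ) : ℤ) = k - j i - n by push_cast; ring, ← mul_assoc]
    choose n hn using hex
    have hpw : ∀ (η : ι → ℝ), (∀ i, 0 < η i) → (∀ i, δ i ≤ η i / 2) →
        ∏ i, (c0 * t2 (-(1 / 2) * n i)) ^ η i ≤ (∏ i, c0 ^ η i) * w n := by
      intro η h0 h1
      rw [hw, ← Finset.prod_mul_distrib]
      refine Finset.prod_le_prod' fun i _ => ?_
      rw [ENNReal.mul_rpow_of_nonneg _ _ (h0 i).le, t2_rpow]
      refine mul_le_mul_right (t2_mono ?_) _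
      have : (0 : ℝ) ≤ n i := by positivity
      nlinarith [h1 i]
    calc _ ≤ mixMin ε θp θm k (fun i => (c0 * t2 (-(1 / 2) * n i)) *
          cnv (box (k - (j i + n i : ℕ))) (fun x' => F i (x', z.2)) z.1) :=
          mixMin_mono hp hm _ hn
      _ ≤ (C0 * w n) * H n k z := by
          refine mixMin_mul_le hp hm k _ _ ?_ ?_
          · refine (hpw θp hp fun i => ?_).trans (mul_le_mul_left (le_max_left _ _) _)
            exact div_le_div_of_nonneg_right (min_le_left _ _) (by norm_num)
          · refine (hpw θm hm fun i => ?_).trans (mul_le_mul_left (le_max_right _ _) _)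
            exact div_le_div_of_nonneg_right (min_le_right _ _) (by norm_num)
      _ ≤ _ := by
          rw [mul_assoc]
          exact mul_le_mul_right (ENNReal.le_tsum (f := fun n => w n * H n k z) n) _
  have hj : ∀ n : ι → ℕ, ∏ i, (1 + (j i + n i : ℕ) : ℝ≥0∞) ^ θ i ≤
      (∏ i, (1 + j i : ℝ≥0∞) ^ θ i) * ∏ i, (1 + n i : ℝ≥0∞) ^ θ i := by
    intro n
    rw [← Finset.prod_mul_distrib]
    refine Finset.prod_le_prod' fun i _ => ?_
    rw [← ENNReal.mul_rpow_of_nonneg _ _ (hθ0 i).le]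
    refine ENNReal.rpow_le_rpow ?_ (hθ0 i).le
    push_cast
    calc (1 : ℝ≥0∞) + (j i + n i) ≤ 1 + (j i + n i) + j i * n i := le_self_add
      _ = _ := by ring
  have hsum : ∑' n, w n * ∏ i, (1 + n i : ℝ≥0∞) ^ θ i ≤ ∏ i, (D i * geomC (δ i / 2)) := by
    simp only [hw, ← Finset.prod_mul_distrib]
    refine (tsum_pi_prod_le fun i (n : ℕ) => t2 (-δ i * n) * (1 + n : ℝ≥0∞) ^ θ i).trans ?_
    refine Finset.prod_le_prod' fun i _ => ?_
    unfold geomC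
    rw [← ENNReal.tsum_mul_left]
    refine ENNReal.tsum_le_tsum fun n => ?_
    calc t2 (-δ i * n) * (1 + n : ℝ≥0∞) ^ θ i ≤ t2 (-δ i * n) * (D i * t2 (δ i / 2 * n)) :=
          mul_le_mul_right (hDn i n) _
      _ = D i * t2 (-(δ i / 2) * n) := by
          rw [mul_left_comm, ← t2_add]; congr 2; ring
  have mT : ∀ n, Measurable fun z => w n * ∑' k, H n k z := fun n =>
    (Measurable.tsum fun k => mH n k).const_mul _
  calc _ ≤ ∫⁻ z : ℝ × ℝ, C0 * ∑' n, w n * ∑' k, H n k z := by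
        refine lintegral_mono fun z => ?_
        beta_reduce
        simp only [← ENNReal.tsum_mul_left]
        rw [ENNReal.tsum_comm]
        refine ENNReal.tsum_le_tsum fun k => ?_
        rw [ENNReal.tsum_mul_left]
        exact key z k
    _ = C0 * ∑' n, w n * ∫⁻ z : ℝ × ℝ, ∑' k, H n k z := by
        rw [lintegral_const_mul' _ _ hC0t, lintegral_tsum fun n => (mT n).aemeasurable]
        congr 1
        exact tsum_congr fun n => lintegral_const_mul' _ _ (hwt n)
    _ ≤ C0 * ∑' n, (C * (∏ i, (1 + j i : ℝ≥0∞) ^ θ i) * N) * (w n * ∏ i, (1 + n i : ℝ≥0∞) ^ θ i) := by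
        refine mul_le_mul_right (ENNReal.tsum_le_tsum fun n => ?_) _
        calc w n * ∫⁻ z : ℝ × ℝ, ∑' k, H n k z
            ≤ w n * (C * ((∏ i, (1 + j i : ℝ≥0∞) ^ θ i) * ∏ i, (1 + n i : ℝ≥0∞) ^ θ i) * N) := by
              refine mul_le_mul_right ((h F hF fun i => j i + n i).trans ?_) _
              exact mul_le_mul_left (mul_le_mul_right (hj n) _) _
          _ = _ := by ring
    _ = C0 * ((C * (∏ i, (1 + j i : ℝ≥0∞) ^ θ i) * N) * ∑' n, (w n * ∏ i, (1 + n i : ℝ≥0∞) ^ θ i)) := by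
        rw [ENNReal.tsum_mul_left]
    _ ≤ C0 * ((C * (∏ i, (1 + j i : ℝ≥0∞) ^ θ i) * N) * ∏ i, (D i * geomC (δ i / 2))) := by
        gcongr
    _ = _ := by ring

end Omega

section Maximal

lemma lintegral_prod_rpow_le_nrm_of_le {X : Type*} [MeasurableSpace X] {μ : Measure X}
    (hμ : μ Set.univ ≤ 1) {ι : Type*} [Fintype ι] {φ : ι → X → ℝ≥0∞} {θ a : ι → ℝ}
    (hφ : ∀ i, AEMeasurable (φ i) μ) (hθ : ∀ i, 0 ≤ θ i) (ha : ∀ i, 0 ≤ a i)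
    (hs : ∑ i, θ i * a i ≤ 1) :
    ∫⁻ x, ∏ i, φ i x ^ θ i ∂μ ≤ ∏ i, nrm μ (a i) (φ i) ^ θ i := by
  set d : ℝ := 1 - ∑ i, θ i * a i with hd
  have hd0 : 0 ≤ d := by rw [hd]; linarith
  have h1 : nrm μ d (fun _ => 1) ≤ 1 := by
    unfold nrm
    split_ifs with h
    · exact essSup_le_of_ae_le _ (Filter.Eventually.of_forall fun _ => le_rfl)
    · simp only [ENNReal.one_rpow, lintegral_const, one_mul]
      calc (μ Set.univ) ^ d ≤ 1 ^ d := ENNReal.rpow_le_rpow hμ hd0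
        _ = 1 := ENNReal.one_rpow _
  have := lintegral_prod_rpow_le_nrm (μ := μ) (ι := Option ι)
    (φ := fun o => o.elim (fun _ => 1) φ) (θ := fun o => o.elim 1 θ) (a := fun o => o.elim d a)
    (by rintro (_ | i)
        · exact aemeasurable_const
        · exact hφ i)
    (by rintro (_ | i)
        · exact zero_le_one
        · exact hθ i)
    (by rintro (_ | i)
        · exact hd0
        · exact ha i)
    (by rw [Fintype.sum_option]; simp [hd])
  simp only [Fintype.prod_option, Option.elim_none, Option.elim_some, ENNReal.one_rpow, one_mul,
    ENNReal.rpow_one] at this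
  refine this.trans ?_
  calc _ ≤ 1 * ∏ i, nrm μ (a i) (φ i) ^ θ i := mul_le_mul_left h1 _
    _ = _ := one_mul _

/-- The measure with density `omg l (x - ·)`. -/
noncomputable def omgM (l : ℤ) (x : ℝ) : Measure ℝ := volume.withDensity fun x' => omg l (x - x')

lemma omgM_univ_le (l : ℤ) (x : ℝ) : omgM l x Set.univ ≤ 1 := by
  unfold omgM
  rw [withDensity_apply _ MeasurableSet.univ, Measure.restrict_univ,
    lintegral_sub_left_eq_self (omg l) x]
  exact lintegral_omg_le l

instance (l : ℤ) (x : ℝ) : IsFiniteMeasure (omgM l x) :=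
  ⟨lt_of_le_of_lt (omgM_univ_le l x) one_lt_top⟩

lemma lintegral_omgM (l : ℤ) (x : ℝ) {f : ℝ → ℝ≥0∞} (hf : Measurable f) :
    ∫⁻ x', f x' ∂(omgM l x) = cnv (omg l) f x := by
  unfold omgM cnv
  have m : Measurable fun x' => omg l (x - x') := (measurable_omg l).comp (by fun_prop)
  rw [lintegral_withDensity_eq_lintegral_mul _ m hf]
  rfl

/-- The maximal function of order `1 / τ`. -/
noncomputable def Mx (τ : ℝ) (u : ℝ → ℝ≥0∞) (y : ℝ) : ℝ≥0∞ :=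
  ⨆ l : ℤ, cnv (omg l) (fun y' => u y' ^ (1 / τ)) y ^ τ

lemma nrm_omgM {τ : ℝ} (hτ : 0 < τ) (l : ℤ) (x : ℝ) {f : ℝ → ℝ≥0∞} (hf : Measurable f) :
    nrm (omgM l x) τ f = cnv (omg l) (fun y' => f y' ^ (1 / τ)) x ^ τ := by
  rw [nrm_pos hτ.ne', lintegral_omgM _ _ (hf.pow_const _)]

lemma measurable_Mx_prod {X : Type*} [MeasurableSpace X] (τ : ℝ) {F : X × ℝ → ℝ≥0∞}
    (hF : Measurable F) : Measurable fun z : X × ℝ => Mx τ (fun y' => F (z.1, y')) z.2 := by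
  have hF' : Measurable fun z : ℝ × X => F (z.2, z.1) ^ (1 / τ) :=
    (hF.comp measurable_swap).pow_const _
  have h1 : ∀ l : ℤ, Measurable fun z : ℝ × X =>
      cnv (omg l) (fun y' => F (z.2, y') ^ (1 / τ)) z.1 := fun l =>
    measurable_cnv_prod (Y := X) (measurable_omg l) hF'
  have h2 : ∀ l : ℤ, Measurable fun z : X × ℝ =>
      cnv (omg l) (fun y' => F (z.1, y') ^ (1 / τ)) z.2 := fun l =>
    (h1 l).comp (f := fun z : X × ℝ => (z.2, z.1)) (by fun_prop)
  have h3 : ∀ l : ℤ, Measurable fun z : X × ℝ =>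
      cnv (omg l) (fun y' => F (z.1, y') ^ (1 / τ)) z.2 ^ τ := fun l => (h2 l).pow_const τ
  have h4 := Measurable.iSup h3
  unfold Mx
  exact h4

lemma measurable_Mx (τ : ℝ) {u : ℝ → ℝ≥0∞} (hu : Measurable u) : Measurable (Mx τ u) := by
  have := measurable_Mx_prod (X := Unit) τ (F := fun z => u z.2) (hu.comp measurable_snd)
  exact this.comp (f := fun x : ℝ => ((), x)) (by fun_prop)

lemma cnv_mono (κ : ℝ → ℝ≥0∞) {u v : ℝ → ℝ≥0∞} (h : ∀ x, u x ≤ v x) (x : ℝ) :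
    cnv κ u x ≤ cnv κ v x := lintegral_mono fun x' => mul_le_mul_right (h x') _

lemma Mx_mono {τ : ℝ} (hτ : 0 < τ) {u v : ℝ → ℝ≥0∞} (h : ∀ x, u x ≤ v x) (x : ℝ) :
    Mx τ u x ≤ Mx τ v x :=
  iSup_mono fun l => ENNReal.rpow_le_rpow
    (cnv_mono _ (fun y => ENNReal.rpow_le_rpow (h y) (by positivity)) _) hτ.le

lemma cnv_omg_le_of_le {l : ℤ} {u : ℝ → ℝ≥0∞} {M : ℝ≥0∞} (hu : ∀ x, u x ≤ M) (x : ℝ) :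
    cnv (omg l) u x ≤ M :=
  (cnv_const_le (measurable_omg l) (lintegral_omg_le l) hu x).trans (one_mul M).le

lemma Mx_le_of_le {τ : ℝ} (hτ : 0 < τ) {u : ℝ → ℝ≥0∞} {M : ℝ≥0∞} (hu : ∀ x, u x ≤ M) (x : ℝ) :
    Mx τ u x ≤ M := by
  refine iSup_le fun l => ?_
  calc _ ≤ (M ^ (1 / τ)) ^ τ := ENNReal.rpow_le_rpow
        (cnv_omg_le_of_le (fun y => ENNReal.rpow_le_rpow (hu y) (by positivity)) x) hτ.le
    _ = M := by rw [← ENNReal.rpow_mul, one_div_mul_cancel hτ.ne', ENNReal.rpow_one]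

lemma cnv_omg_le_Mx {τ : ℝ} (hτ : 0 < τ) (hτ1 : τ ≤ 1) (l : ℤ) {u : ℝ → ℝ≥0∞} (hu : Measurable u)
    (x : ℝ) : cnv (omg l) u x ≤ Mx τ u x := by
  refine le_trans ?_ (le_iSup _ l)
  refine lintegral_mul_le_jensen hτ hτ1 ((measurable_omg l).comp (by fun_prop)) hu ?_
  rw [lintegral_sub_left_eq_self (omg l) x]
  exact lintegral_omg_le l

lemma Mx_lintegral_le {T : Type*} [MeasurableSpace T] {m : Measure T} [SFinite m] {τ : ℝ}
    (hτ : 0 < τ) (hτ1 : τ ≤ 1) {F : ℝ × T → ℝ≥0∞} (hF : Measurable F) (y : ℝ) :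
    Mx τ (fun y' => ∫⁻ t, F (y', t) ∂m) y ≤ ∫⁻ t, Mx τ (fun y' => F (y', t)) y ∂m := by
  refine iSup_le fun l => ?_
  rw [← nrm_omgM hτ l y hF.lintegral_prod_right']
  refine (nrm_lintegral_le hτ.le hτ1 hF).trans (lintegral_mono fun t => ?_)
  beta_reduce
  have m : Measurable fun y' => F (y', t) := hF.comp (by fun_prop)
  rw [nrm_omgM hτ l y m]
  exact le_iSup (fun l => cnv (omg l) (fun y' => F (y', t) ^ (1 / τ)) y ^ τ) l

lemma nrm_sup_cnv_omg_le {a : ℝ} (ha : 0 ≤ a) (ha1 : a < 1) (S : Finset ℤ) {u : ℝ → ℝ≥0∞}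
    (hu : Measurable u) : nrm volume a (fun x => S.sup fun l => cnv (omg l) u x) ≤
      geomC 1 * (24 * dmaxC a) * nrm volume a u := by
  obtain ⟨K, hK⟩ : ∃ K : ℕ → ℕ, ∀ n : ℕ, ∀ l ∈ S, 0 ≤ K n + (l - n : ℤ) - (3 : ℕ) := by
    refine ⟨fun n => n + 3 + (∑ l ∈ S, |l|).toNat, fun n l hl => ?_⟩
    have h1 := Finset.single_le_sum (f := fun k : ℤ => |k|) (fun _ _ => abs_nonneg _) hl
    have h2 := Int.self_le_toNat (∑ l ∈ S, |l|)
    have h3 := neg_abs_le l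
    push_cast
    beta_reduce at h1
    linarith
  set τ : ℕ → Fin 3 → ℝ := fun n t => t * 2 ^ K n / (3 : ℕ) with hτ
  set L : ℕ → Finset ℤ := fun n => S.image fun l => l - n - (3 : ℕ) with hL
  set G : ℕ × Fin 3 → ℝ → ℝ≥0∞ := fun q x =>
    (t2 (-q.1) * 8) * dmax (L q.1) (fun x' => u (x' + -τ q.1 q.2)) (x + τ q.1 q.2) with hG
  have md : ∀ q : ℕ × Fin 3, Measurable
      (dmax (L q.1) (fun x' => u (x' + -τ q.1 q.2))) := fun q =>
    measurable_dmax _ (hu.comp (by fun_prop))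
  have md' : ∀ q : ℕ × Fin 3, Measurable fun x =>
      (dmax (L q.1) (fun x' => u (x' + -τ q.1 q.2)) (x + τ q.1 q.2)) := fun q =>
    (md q).comp (by fun_prop)
  have mG : ∀ q, Measurable (G q) := fun q => (md' q).const_mul _
  have key : ∀ x, (S.sup fun l => cnv (omg l) u x) ≤ ∑' q, G q x := by
    intro x
    refine Finset.sup_le fun l hl => (cnv_omg_le hu x).trans ?_
    rw [ENNReal.tsum_prod']
    refine ENNReal.tsum_le_tsum fun n => ?_
    obtain ⟨t, ht⟩ := exists_forall_goodShift (ι := Unit) Nat.prime_three (by norm_num) (by simp)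
      (c := 3) (by norm_num) (l := fun _ => l - n) (K := K n) (fun _ => hK n l hl) x
    refine le_trans ?_ (ENNReal.le_tsum t)
    rw [hG]
    beta_reduce
    rw [mul_assoc]
    refine mul_le_mul_right ((cnv_box_le (ht ()) u).trans ?_) _
    have e8 : t2 ((3 : ℕ) : ℝ) = 8 := by
      unfold t2; rw [ENNReal.rpow_natCast]; norm_num
    rw [e8]
    exact mul_le_mul_right (dE_le_dmax (Finset.mem_image_of_mem _ hl) _ _) _
  calc _ ≤ nrm volume a (fun x => ∑' q, G q x) := nrm_mono ha key
    _ ≤ ∑' q, nrm volume a (G q) := nrm_tsum_le ha ha1.le mG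
    _ ≤ ∑' q : ℕ × Fin 3, (t2 (-q.1) * 8) * (dmaxC a * nrm volume a u) := by
        refine ENNReal.tsum_le_tsum fun q => ?_
        rw [hG]
        beta_reduce
        rw [nrm_const_mul ha _ (md' q).aemeasurable, nrm_comp_add_right]
        have m : Measurable fun x' => u (x' + -τ q.1 q.2) := hu.comp (by fun_prop)
        refine mul_le_mul_right ((nrm_dmax_le ha ha1 _ m).trans ?_) _
        rw [nrm_comp_add_right]
    _ = _ := by
        rw [ENNReal.tsum_prod']
        simp only [tsum_fintype, Finset.sum_const, Finset.card_univ, Fintype.card_fin]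
        unfold geomC
        simp only [mul_assoc, nsmul_eq_mul]
        rw [← ENNReal.tsum_mul_right]
        refine tsum_congr fun n => ?_
        rw [neg_one_mul]
        push_cast
        ring

lemma nrm_iSup_cnv_omg_le {a : ℝ} (ha : 0 ≤ a) (ha1 : a < 1) {u : ℝ → ℝ≥0∞}
    (hu : Measurable u) : nrm volume a (fun x => ⨆ l : ℤ, cnv (omg l) u x) ≤
      geomC 1 * (24 * dmaxC a) * nrm volume a u := by
  rcases eq_or_lt_of_le ha with h0 | h0
  · subst h0
    have h1 : (1 : ℝ≥0∞) ≤ geomC 1 * (24 * dmaxC 0) := by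
      have : dmaxC 0 = 1 := by simp [dmaxC]
      rw [this, ← one_mul (1 : ℝ≥0∞)]
      exact mul_le_mul' (geomC_ge_one 1) (by norm_num)
    calc _ ≤ 1 * nrm volume 0 u := by
          rw [one_mul, nrm_zero, nrm_zero]
          refine essSup_le_of_ae_le _ (Filter.Eventually.of_forall fun x => iSup_le fun l => ?_)
          calc cnv (omg l) u x ≤ ∫⁻ x', omg l (x - x') * essSup u volume := by
                refine lintegral_mono_ae ?_
                filter_upwards [ENNReal.ae_le_essSup u] with x' hx'
                exact mul_le_mul_right hx' _
            _ = (∫⁻ x', omg l (x - x')) * essSup u volume :=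
                lintegral_mul_const _ ((measurable_omg l).comp (by fun_prop))
            _ ≤ 1 * essSup u volume := by
                rw [lintegral_sub_left_eq_self (omg l) x]
                exact mul_le_mul_left (lintegral_omg_le l) _
            _ = _ := one_mul _
      _ ≤ _ := mul_le_mul_left h1 _
  · have e : ∀ x, (⨆ l : ℤ, cnv (omg l) u x) =
        ⨆ n : ℕ, (Finset.Icc (-(n : ℤ)) n).sup fun l => cnv (omg l) u x := by
      intro x
      refine le_antisymm (iSup_le fun l => ?_) (iSup_le fun n => Finset.sup_le fun l _ =>
        le_iSup (fun l => cnv (omg l) u x) l)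
      refine le_trans ?_ (le_iSup _ l.natAbs)
      exact Finset.le_sup (f := fun l => cnv (omg l) u x) (by rw [Finset.mem_Icc]; omega)
    simp only [e]
    rw [nrm_iSup_nat h0]
    · exact iSup_le fun n => nrm_sup_cnv_omg_le ha ha1 _ hu
    · intro n
      have : (fun x => (Finset.Icc (-(n : ℤ)) n).sup fun l => cnv (omg l) u x) =
          fun x => ⨆ l ∈ Finset.Icc (-(n : ℤ)) n, cnv (omg l) u x := by
        ext x; rw [Finset.sup_eq_iSup]
      rw [this]
      exact Measurable.iSup fun l => Measurable.iSup fun _ => measurable_cnv (measurable_omg l) hu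
    · intro x n m hnm
      exact Finset.sup_mono (Finset.Icc_subset_Icc (by simpa using hnm) (by simpa using hnm))

lemma exists_nrm_Mx_le {b τ : ℝ} (hb : 0 ≤ b) (hbτ : b < τ) : ∃ C : ℝ≥0∞, C ≠ ∞ ∧
    ∀ u : ℝ → ℝ≥0∞, Measurable u → nrm volume b (Mx τ u) ≤ C * nrm volume b u := by
  have hτ : 0 < τ := lt_of_le_of_lt hb hbτ
  have h1 : b / τ < 1 := (div_lt_one hτ).2 hbτ
  refine ⟨(geomC 1 * (24 * dmaxC (b / τ))) ^ τ, ENNReal.rpow_ne_top_of_nonneg hτ.le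
    (ENNReal.mul_ne_top (geomC_ne_top one_pos) (ENNReal.mul_ne_top (by simp)
      (dmaxC_ne_top (by positivity) h1))), fun u hu => ?_⟩
  have e : Mx τ u = fun y => (⨆ l : ℤ, cnv (omg l) (fun y' => u y' ^ (1 / τ)) y) ^ τ := by
    ext y
    exact ((ENNReal.orderIsoRpow τ hτ).map_iSup
      fun l : ℤ => cnv (omg l) (fun y' => u y' ^ (1 / τ)) y).symm
  have e2 : nrm volume (b / τ) (fun y' => u y' ^ (1 / τ)) = nrm volume b u ^ (1 / τ) := by
    rw [nrm_rpow (by positivity)]; congr 2; field_simp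
  rw [e, nrm_rpow hτ]
  calc _ ≤ (geomC 1 * (24 * dmaxC (b / τ)) * nrm volume b u ^ (1 / τ)) ^ τ := by
        refine ENNReal.rpow_le_rpow ?_ hτ.le
        rw [← e2]
        exact nrm_iSup_cnv_omg_le (by positivity) h1 (hu.pow_const _)
    _ = _ := by
        rw [ENNReal.mul_rpow_of_nonneg _ _ hτ.le, ← ENNReal.rpow_mul (nrm volume b u),
          one_div_mul_cancel hτ.ne', ENNReal.rpow_one]

end Maximal

section PowerTrick

/-- The rapidly decaying kernel `2 ^ l (1 + 2 ^ l |z|)⁻⁴`. -/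
noncomputable def krn (l : ℤ) (z : ℝ) : ℝ≥0∞ :=
  ENNReal.ofReal ((2 : ℝ) ^ l * (1 + 2 ^ l * |z|)⁻¹ ^ 4)

lemma measurable_krn (l : ℤ) : Measurable (krn l) := by unfold krn; fun_prop

lemma one_add_abs_le {l q : ℤ} (hlq : l ≤ q) {z w : ℝ} (h : |z - w| ≤ (2 : ℝ) ^ (-q)) :
    1 + (2 : ℝ) ^ l * |z| ≤ 2 * (1 + 2 ^ l * |w|) := by
  have h1 : |z| ≤ |w| + 2 ^ (-q) := by
    have := abs_sub_abs_le_abs_sub z w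
    linarith
  have h2 : (2 : ℝ) ^ l * 2 ^ (-q) ≤ 1 := by
    rw [← zpow_add₀ (by norm_num)]
    exact zpow_le_one_of_nonpos₀ (by norm_num) (by linarith)
  have h3 : (0 : ℝ) < 2 ^ l := by positivity
  have h4 : (2 : ℝ) ^ l * |z| ≤ 2 ^ l * (|w| + 2 ^ (-q)) := by gcongr
  have h5 : 0 ≤ (2 : ℝ) ^ l * |w| := by positivity
  rw [mul_add] at h4
  linarith

lemma omg_le_of_near {l q : ℤ} (hlq : l ≤ q) {z w : ℝ} (h : |z - w| ≤ (2 : ℝ) ^ (-q)) :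
    omg l z ≤ 4 * omg l w := by
  unfold omg
  rw [show (4 : ℝ≥0∞) = ENNReal.ofReal 4 by norm_num, ← ENNReal.ofReal_mul (by norm_num)]
  refine ENNReal.ofReal_le_ofReal ?_
  have h1 := one_add_abs_le hlq (z := w) (w := z) (by rw [abs_sub_comm]; exact h)
  have hz : 0 < 1 + (2 : ℝ) ^ l * |z| := by positivity
  have hw : 0 < 1 + (2 : ℝ) ^ l * |w| := by positivity
  have h2 : (1 + (2 : ℝ) ^ l * |z|)⁻¹ ≤ 2 * (1 + (2 : ℝ) ^ l * |w|)⁻¹ := by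
    rw [← div_eq_mul_inv, inv_eq_one_div, div_le_div_iff₀ hz hw]; linarith
  have h3 : (0 : ℝ) < 2 ^ (l - 2) := by positivity
  calc (2 : ℝ) ^ (l - 2) * (1 + (2 : ℝ) ^ l * |z|)⁻¹ ^ 2
      ≤ 2 ^ (l - 2) * (2 * (1 + (2 : ℝ) ^ l * |w|)⁻¹) ^ 2 := by gcongr
    _ = _ := by ring

lemma cnv_omg_le_of_near {l q : ℤ} (hlq : l ≤ q) {z w : ℝ} (h : |z - w| ≤ (2 : ℝ) ^ (-q))
    (u : ℝ → ℝ≥0∞) : cnv (omg l) u z ≤ 4 * cnv (omg l) u w := by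
  unfold cnv
  rw [← lintegral_const_mul' _ _ (by simp)]
  refine lintegral_mono fun x' => ?_
  beta_reduce
  rw [← mul_assoc]
  refine mul_le_mul_left (omg_le_of_near hlq ?_) _
  rwa [sub_sub_sub_cancel_right]

/-- A subaveraging estimate for locally essentially constant functions. -/
lemma cnv_krn_le {σ : ℝ} (hσ : 1 / 2 ≤ σ) (hσ1 : σ ≤ 1) {q : ℤ} {n : ℕ} {h : ℝ → ℝ≥0∞}
    (hm : Measurable h) {D : ℝ≥0∞}
    (hD : ∀ z w, |z - w| ≤ (2 : ℝ) ^ (-q) → h z ≤ D * h w) (x : ℝ) :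
    cnv (krn (q - n)) h x ≤ 4 * (8 * D ^ σ) ^ (1 / σ - 1) * t2 (n * (1 / σ - 1)) *
      cnv (omg (q - n)) (fun z => h z ^ σ) x ^ (1 / σ) := by
  have hσ0 : 0 < σ := by linarith
  have hκ : 0 ≤ 1 / σ - 1 := by
    rw [sub_nonneg, le_div_iff₀ hσ0]; linarith
  have hκ1 : 1 / σ - 1 ≤ 1 := by
    rw [sub_le_iff_le_add, div_le_iff₀ hσ0]; linarith
  set p : ℤ := q - n with hp
  have hpq : p ≤ q := by omega
  set A := cnv (omg p) (fun z => h z ^ σ) x with hA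
  set P : ℝ → ℝ≥0∞ := fun z => ENNReal.ofReal (1 + (2 : ℝ) ^ p * |x - z|) with hP
  have hP1 : ∀ z, 1 ≤ P z := fun z => by
    rw [hP, ENNReal.one_le_ofReal]
    have : 0 ≤ (2 : ℝ) ^ p * |x - z| := by positivity
    linarith
  set E : ℝ≥0∞ := 8 * D ^ σ * t2 n * A with hE
  have step2 : ∀ z, h z ^ σ ≤ E * P z ^ 2 := by
    intro z
    have h1 : ∀ w ∈ Metric.closedBall z (2 ^ (-q)),
        h z ^ σ ≤ (D ^ σ * (t2 (4 - p) * P z ^ 2)) * (omg p (x - w) * h w ^ σ) := by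
      intro w hw
      rw [Metric.mem_closedBall, dist_comm, Real.dist_eq] at hw
      have h2 : 1 ≤ omg p (x - w) * (t2 (4 - p) * P z ^ 2) := by
        unfold omg
        rw [hP, t2_eq_ofReal, ← ENNReal.ofReal_pow (by positivity),
          ← ENNReal.ofReal_mul (by positivity), ← ENNReal.ofReal_mul (by positivity),
          ENNReal.one_le_ofReal]
        have h3 := one_add_abs_le hpq (z := x - w) (w := x - z)
          (by have e0 : x - w - (x - z) = z - w := by ring
              rw [e0]; exact hw)
        have h4 : 0 < 1 + (2 : ℝ) ^ p * |x - w| := by positivity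
        have e : (2 : ℝ) ^ (p - 2) * (2 : ℝ) ^ (4 - (p : ℝ)) = 4 := by
          rw [show 4 - (p : ℝ) = ((4 - p : ℤ) : ℝ) by push_cast; ring, Real.rpow_intCast,
            ← zpow_add₀ (by norm_num), show p - 2 + (4 - p) = 2 by ring]
          norm_num
        calc (1 : ℝ) ≤ ((1 + 2 ^ p * |x - w|)⁻¹ * (2 * (1 + 2 ^ p * |x - z|))) ^ 2 := by
              refine one_le_pow₀ ?_
              rw [inv_mul_eq_div, le_div_iff₀ h4]; linarith
          _ = (1 + 2 ^ p * |x - w|)⁻¹ ^ 2 * (1 + 2 ^ p * |x - z|) ^ 2 * 4 := by ring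
          _ = _ := by
              linear_combination (-((1 + 2 ^ p * |x - w|)⁻¹ ^ 2 * (1 + 2 ^ p * |x - z|) ^ 2)) * e
      calc h z ^ σ ≤ (D * h w) ^ σ := ENNReal.rpow_le_rpow (hD z w hw) hσ0.le
        _ = D ^ σ * h w ^ σ * 1 := by rw [ENNReal.mul_rpow_of_nonneg _ _ hσ0.le, mul_one]
        _ ≤ D ^ σ * h w ^ σ * (omg p (x - w) * (t2 (4 - p) * P z ^ 2)) := mul_le_mul_right h2 _
        _ = _ := by ring
    have h2 : h z ^ σ * t2 (1 - q) ≤ (D ^ σ * (t2 (4 - p) * P z ^ 2)) * A := by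
      have ev : volume (Metric.closedBall z ((2 : ℝ) ^ (-q))) = t2 (1 - q) := by
        rw [Real.volume_closedBall, t2_eq_ofReal]
        congr 1
        rw [show 1 - (q : ℝ) = ((1 + -q : ℤ) : ℝ) by push_cast; ring, Real.rpow_intCast,
          zpow_add₀ (by norm_num)]
        simp
      calc h z ^ σ * t2 (1 - q) = ∫⁻ w in Metric.closedBall z ((2 : ℝ) ^ (-q)), h z ^ σ := by
            rw [lintegral_const, Measure.restrict_apply_univ, ev]
        _ ≤ ∫⁻ w in Metric.closedBall z ((2 : ℝ) ^ (-q)),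
            (D ^ σ * (t2 (4 - p) * P z ^ 2)) * (omg p (x - w) * h w ^ σ) :=
            setLIntegral_mono' Metric.isClosed_closedBall.measurableSet h1
        _ ≤ ∫⁻ w, (D ^ σ * (t2 (4 - p) * P z ^ 2)) * (omg p (x - w) * h w ^ σ) :=
            setLIntegral_le_lintegral _ _
        _ = _ := by
            have m : Measurable fun w => omg p (x - w) * h w ^ σ :=
              ((measurable_omg p).comp (by fun_prop)).mul (hm.pow_const _)
            rw [lintegral_const_mul _ m, hA]
            rfl
    have e1 : h z ^ σ = h z ^ σ * t2 (1 - q) * t2 (q - 1) := by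
      rw [mul_assoc, ← t2_add, sub_add_sub_cancel', sub_self, t2_zero, mul_one]
    rw [e1]
    calc _ ≤ (D ^ σ * (t2 (4 - p) * P z ^ 2)) * A * t2 (q - 1) := mul_le_mul_left h2 _
      _ = (t2 (4 - p) * t2 (q - 1)) * (D ^ σ * P z ^ 2 * A) := by ring
      _ = (8 * t2 n) * (D ^ σ * P z ^ 2 * A) := by
          have e8 : (8 : ℝ≥0∞) = t2 3 := by
            unfold t2
            rw [show (3 : ℝ) = ((3 : ℕ) : ℝ) by norm_num, ENNReal.rpow_natCast]; norm_num
          rw [e8, ← t2_add, ← t2_add]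
          congr 2
          rw [hp]; push_cast; ring
      _ = _ := by rw [hE]; ring
  have step4 : ∀ z, krn p (x - z) * h z ≤ (4 * E ^ (1 / σ - 1)) * (omg p (x - z) * h z ^ σ) := by
    intro z
    have h1 : h z ^ (1 - σ) ≤ E ^ (1 / σ - 1) * P z ^ 2 := by
      calc h z ^ (1 - σ) = (h z ^ σ) ^ (1 / σ - 1) := by
            rw [← ENNReal.rpow_mul]; congr 1; field_simp
        _ ≤ (E * P z ^ 2) ^ (1 / σ - 1) := ENNReal.rpow_le_rpow (step2 z) hκ
        _ = E ^ (1 / σ - 1) * (P z ^ 2) ^ (1 / σ - 1) := ENNReal.mul_rpow_of_nonneg _ _ hκ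
        _ ≤ E ^ (1 / σ - 1) * (P z ^ 2) ^ (1 : ℝ) := by
            refine mul_le_mul_right (ENNReal.rpow_le_rpow_of_exponent_le ?_ hκ1) _
            exact one_le_pow₀ (hP1 z)
        _ = _ := by rw [ENNReal.rpow_one]
    have h2 : krn p (x - z) * P z ^ 2 = 4 * omg p (x - z) := by
      unfold krn omg
      rw [hP, show (4 : ℝ≥0∞) = ENNReal.ofReal 4 by norm_num, ← ENNReal.ofReal_pow (by positivity),
          ← ENNReal.ofReal_mul (by positivity), ← ENNReal.ofReal_mul (by positivity)]
      congr 1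
      have e2 : (2 : ℝ) ^ (p - 2) = 2 ^ p / 4 := by rw [zpow_sub₀ (by norm_num)]; norm_num
      rw [e2]
      have h4 : (1 + (2 : ℝ) ^ p * |x - z|) ≠ 0 := by positivity
      field_simp
    calc krn p (x - z) * h z = krn p (x - z) * (h z ^ σ * h z ^ (1 - σ)) := by
          rw [← ENNReal.rpow_add_of_nonneg _ _ hσ0.le (by linarith)]; simp
      _ ≤ krn p (x - z) * (h z ^ σ * (E ^ (1 / σ - 1) * P z ^ 2)) := by gcongr
      _ = (krn p (x - z) * P z ^ 2) * (h z ^ σ * E ^ (1 / σ - 1)) := by ring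
      _ = _ := by rw [h2]; ring
  have m : Measurable fun w => omg p (x - w) * h w ^ σ :=
    ((measurable_omg p).comp (by fun_prop)).mul (hm.pow_const _)
  calc cnv (krn p) h x ≤ ∫⁻ z, (4 * E ^ (1 / σ - 1)) * (omg p (x - z) * h z ^ σ) :=
        lintegral_mono step4
    _ = (4 * E ^ (1 / σ - 1)) * A := lintegral_const_mul _ m
    _ = 4 * (8 * D ^ σ) ^ (1 / σ - 1) * t2 (n * (1 / σ - 1)) * (A ^ (1 / σ - 1) * A ^ (1 : ℝ)) := by
        rw [hE, ENNReal.mul_rpow_of_nonneg _ _ hκ, ENNReal.mul_rpow_of_nonneg _ _ hκ, t2_rpow,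
          ENNReal.rpow_one]
        ring
    _ = _ := by
        rw [← ENNReal.rpow_add_of_nonneg _ _ hκ zero_le_one, sub_add_cancel]

lemma mixMin_omg_le_of_near {ι : Type*} [Fintype ι] {ε : ℝ} {θp θm : ι → ℝ}
    (hp : ∀ i, 0 < θp i) (hm : ∀ i, 0 < θm i) (q : ℤ) (j : ι → ℕ) (u : ι → ℝ → ℝ≥0∞) {z w : ℝ}
    (h : |z - w| ≤ (2 : ℝ) ^ (-q)) :
    mixMin ε θp θm q (fun i => cnv (omg (q - j i)) (u i) z) ≤
      max (∏ i, (4 : ℝ≥0∞) ^ θp i) (∏ i, (4 : ℝ≥0∞) ^ θm i) *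
        mixMin ε θp θm q (fun i => cnv (omg (q - j i)) (u i) w) :=
  (mixMin_mono hp hm q fun i => cnv_omg_le_of_near (by omega) h (u i)).trans
    (mixMin_mul_le hp hm q _ _ (le_max_left _ _) (le_max_right _ _))

/-- The constant in the subaveraging estimate for the functions `mixMin`. -/
noncomputable def subC {ι : Type*} [Fintype ι] (θp θm : ι → ℝ) (σ : ℝ) : ℝ≥0∞ :=
  4 * (8 * (max (∏ i, (4 : ℝ≥0∞) ^ θp i) (∏ i, (4 : ℝ≥0∞) ^ θm i)) ^ σ) ^ (1 / σ - 1)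

lemma subC_ne_top {ι : Type*} [Fintype ι] {θp θm : ι → ℝ} {σ : ℝ} (hp : ∀ i, 0 < θp i)
    (hm : ∀ i, 0 < θm i) (hσ : 0 < σ) (hσ1 : σ ≤ 1) : subC θp θm σ ≠ ∞ := by
  have hκ : 0 ≤ 1 / σ - 1 := by
    rw [sub_nonneg, le_div_iff₀ hσ]; linarith
  unfold subC
  refine ENNReal.mul_ne_top (by simp) (ENNReal.rpow_ne_top_of_nonneg hκ (ENNReal.mul_ne_top (by simp)
    (ENNReal.rpow_ne_top_of_nonneg hσ.le ?_)))
  refine (max_lt ?_ ?_).ne <;> refine (ENNReal.prod_ne_top fun i _ => ?_).lt_top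
  · exact ENNReal.rpow_ne_top_of_nonneg (hp i).le (by simp)
  · exact ENNReal.rpow_ne_top_of_nonneg (hm i).le (by simp)

lemma cnv_krn_mixMin_le {ι : Type*} [Fintype ι] {ε : ℝ} {θp θm : ι → ℝ} {σ : ℝ}
    (hp : ∀ i, 0 < θp i) (hm : ∀ i, 0 < θm i) (hσ : 1 / 2 ≤ σ) (hσ1 : σ ≤ 1)
    (q : ℤ) (n : ℕ) (j : ι → ℕ) {u : ι → ℝ → ℝ≥0∞} (hu : ∀ i, Measurable (u i)) (x : ℝ) :
    cnv (krn (q - n)) (fun z => mixMin ε θp θm q (fun i => cnv (omg (q - j i)) (u i) z)) x ≤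
      subC θp θm σ * t2 (n * (1 / σ - 1)) * cnv (omg (q - n))
        (fun z => mixMin ε θp θm q (fun i => cnv (omg (q - j i)) (u i) z) ^ σ) x ^ (1 / σ) :=
  cnv_krn_le hσ hσ1 (measurable_mixMin q fun i => measurable_cnv (measurable_omg _) (hu i))
    (fun _ _ h => mixMin_omg_le_of_near hp hm q j u h) x

lemma cnv_omg_prod_le {ι : Type*} [Fintype ι] {σ : ℝ} (hσ : 0 < σ) {η τ : ι → ℝ}
    (hη : ∀ i, 0 ≤ η i) (hτ : ∀ i, 0 < τ i) (hs : ∑ i, η i * τ i ≤ 1 / σ) (l : ℤ) {c : ℝ≥0∞}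
    (hc : c ≠ ∞) {v : ι → ℝ → ℝ≥0∞} (hv : ∀ i, Measurable (v i)) (y : ℝ) :
    cnv (omg l) (fun y' => (c * ∏ i, v i y' ^ η i) ^ σ) y ^ (1 / σ) ≤
      c * ∏ i, Mx (τ i) (v i) y ^ η i := by
  have e : ∀ y', (c * ∏ i, v i y' ^ η i) ^ σ = c ^ σ * ∏ i, v i y' ^ (σ * η i) := by
    intro y'
    rw [ENNReal.mul_rpow_of_nonneg _ _ hσ.le, ← ENNReal.prod_rpow_of_nonneg hσ.le]
    congr 1
    refine Finset.prod_congr rfl fun i _ => ?_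
    rw [← ENNReal.rpow_mul, mul_comm]
  have m : Measurable fun y' => ∏ i, v i y' ^ (σ * η i) :=
    Finset.measurable_fun_prod _ fun i _ => (hv i).pow_const _
  simp only [e]
  rw [← lintegral_omgM l y (m.const_mul _), lintegral_const_mul _ m]
  have h1 := lintegral_prod_rpow_le_nrm_of_le (omgM_univ_le l y) (φ := v) (θ := fun i => σ * η i)
    (a := τ) (fun i => (hv i).aemeasurable) (fun i => mul_nonneg hσ.le (hη i)) (fun i => (hτ i).le)
    (by rw [le_div_iff₀ hσ, Finset.sum_mul] at hs
        refine le_trans (le_of_eq (Finset.sum_congr rfl fun i _ => ?_)) hs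
        ring)
  calc _ ≤ (c ^ σ * ∏ i, (Mx (τ i) (v i) y) ^ (σ * η i)) ^ (1 / σ) := by
        refine ENNReal.rpow_le_rpow (mul_le_mul_right (h1.trans ?_) _) (by positivity)
        refine Finset.prod_le_prod' fun i _ => ENNReal.rpow_le_rpow ?_ (mul_nonneg hσ.le (hη i))
        rw [nrm_omgM (hτ i) l y (hv i)]
        exact le_iSup (fun l => cnv (omg l) (fun y' => v i y' ^ (1 / τ i)) y ^ τ i) l
    _ = _ := by
        rw [ENNReal.mul_rpow_of_nonneg _ _ (by positivity), ← ENNReal.rpow_mul,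
          mul_one_div_cancel hσ.ne', ENNReal.rpow_one, ← ENNReal.prod_rpow_of_nonneg (by positivity)]
        congr 1
        refine Finset.prod_congr rfl fun i _ => ?_
        rw [← ENNReal.rpow_mul]; congr 1; field_simp

/-- The pointwise bound for sums of averaged products by maximal functions. -/
lemma tsum_cnv_krn_mixMin_le {ι : Type*} [Fintype ι] {ε : ℝ} {θ θp θm τ : ι → ℝ} {σ : ℝ}
    (hε : 0 < ε) (hp : ∀ i, 0 < θp i) (hm : ∀ i, 0 < θm i) (hθ : ∀ i, θp i + θm i = 2 * θ i)
    (hσ : 1 / 2 ≤ σ) (hσ1 : σ ≤ 1) (hτ : ∀ i, 0 < τ i) (hτ1 : ∀ i, τ i ≤ 1)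
    (hsp : ∑ i, θp i * τ i ≤ 1 / σ) (hsm : ∑ i, θm i * τ i ≤ 1 / σ)
    {u : ι → ℝ → ℝ≥0∞} (hu : ∀ i, Measurable (u i)) (j : ι → ℕ) (n : ℕ) (y : ℝ) :
    ∑' q : ℤ, cnv (krn (q - n))
        (fun z => mixMin ε θp θm q (fun i => cnv (omg (q - j i)) (u i) z)) y ≤
      subC θp θm σ * (2 * geomC ε) * t2 (n * (1 / σ - 1)) *
        ∏ i, Mx (τ i) (Mx (τ i) (u i)) y ^ θ i := by
  have hσ0 : 0 < σ := by linarith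
  have key : ∀ q : ℤ, cnv (krn (q - n))
        (fun z => mixMin ε θp θm q (fun i => cnv (omg (q - j i)) (u i) z)) y ≤
      subC θp θm σ * t2 (n * (1 / σ - 1)) *
        mixMin ε θp θm q (fun i => Mx (τ i) (Mx (τ i) (u i)) y) := by
    intro q
    refine (cnv_krn_mixMin_le hp hm hσ hσ1 q n j hu y).trans (mul_le_mul_right ?_ _)
    refine le_min ?_ ?_
    · refine le_trans (ENNReal.rpow_le_rpow (cnv_mono _ (fun z => ENNReal.rpow_le_rpow ?_ hσ0.le) y)
        (by positivity)) (cnv_omg_prod_le hσ0 (fun i => (hp i).le) hτ hsp (q - n) (t2_ne_top (ε * q))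
        (fun i => measurable_Mx (τ i) (hu i)) y)
      refine (min_le_left _ _).trans (mul_le_mul_right (Finset.prod_le_prod' fun i _ => ?_) _)
      exact ENNReal.rpow_le_rpow (cnv_omg_le_Mx (hτ i) (hτ1 i) _ (hu i) z) (hp i).le
    · refine le_trans (ENNReal.rpow_le_rpow (cnv_mono _ (fun z => ENNReal.rpow_le_rpow ?_ hσ0.le) y)
        (by positivity)) (cnv_omg_prod_le hσ0 (fun i => (hm i).le) hτ hsm (q - n) (t2_ne_top (-ε * q))
        (fun i => measurable_Mx (τ i) (hu i)) y)
      refine (min_le_right _ _).trans (mul_le_mul_right (Finset.prod_le_prod' fun i _ => ?_) _)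
      exact ENNReal.rpow_le_rpow (cnv_omg_le_Mx (hτ i) (hτ1 i) _ (hu i) z) (hm i).le
  calc _ ≤ ∑' q : ℤ, subC θp θm σ * t2 (n * (1 / σ - 1)) *
        mixMin ε θp θm q (fun i => Mx (τ i) (Mx (τ i) (u i)) y) := ENNReal.tsum_le_tsum key
    _ ≤ subC θp θm σ * t2 (n * (1 / σ - 1)) *
        (2 * geomC ε * ∏ i, Mx (τ i) (Mx (τ i) (u i)) y ^ θ i) := by
        rw [ENNReal.tsum_mul_left]
        exact mul_le_mul_right (tsum_mixMin_le hε hθ hp hm _) _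
    _ = _ := by ring

end PowerTrick

section Sweep

lemma omg_neg (l : ℤ) (z : ℝ) : omg l (-z) = omg l z := by unfold omg; rw [abs_neg]

lemma lintegral_cnv_mul {κ h u : ℝ → ℝ≥0∞} (hκ : Measurable κ) (hs : ∀ z, κ (-z) = κ z)
    (hh : Measurable h) (hu : Measurable u) :
    ∫⁻ x, cnv κ h x * u x = ∫⁻ x, h x * cnv κ u x := by
  have m1 : Measurable fun w : ℝ × ℝ => κ (w.1 - w.2) * h w.2 * u w.1 :=
    ((hκ.comp (by fun_prop)).mul (hh.comp measurable_snd)).mul (hu.comp measurable_fst)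
  calc ∫⁻ x, cnv κ h x * u x = ∫⁻ x, ∫⁻ x', κ (x - x') * h x' * u x := by
        refine lintegral_congr fun x => ?_
        have m : Measurable fun x' => κ (x - x') * h x' :=
          (hκ.comp (by fun_prop : Measurable fun x' : ℝ => x - x')).mul hh
        rw [lintegral_mul_const _ m]
        rfl
    _ = ∫⁻ x', ∫⁻ x, κ (x - x') * h x' * u x := lintegral_lintegral_swap m1.aemeasurable
    _ = _ := by
        refine lintegral_congr fun x' => ?_
        unfold cnv
        have m : Measurable fun x => κ (x' - x) * u x :=
          (hκ.comp (by fun_prop : Measurable fun x : ℝ => x' - x)).mul hu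
        rw [← lintegral_const_mul _ m]
        refine lintegral_congr fun x => ?_
        rw [← hs (x - x'), neg_sub]
        ring

lemma mixMin_rpow {ι : Type*} [Fintype ι] {ε σ : ℝ} {θp θm : ι → ℝ} (hσ : 0 < σ) (k : ℤ)
    (e : ι → ℝ≥0∞) :
    mixMin ε θp θm k e ^ σ = mixMin (σ * ε) (fun i => σ * θp i) (fun i => σ * θm i) k e := by
  unfold mixMin
  rw [(ENNReal.monotone_rpow_of_nonneg hσ.le).map_min, ENNReal.mul_rpow_of_nonneg _ _ hσ.le,
    ENNReal.mul_rpow_of_nonneg _ _ hσ.le, t2_rpow, t2_rpow, ← ENNReal.prod_rpow_of_nonneg hσ.le,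
    ← ENNReal.prod_rpow_of_nonneg hσ.le]
  congr 2
  · congr 1; ring
  · refine Finset.prod_congr rfl fun i _ => ?_
    rw [← ENNReal.rpow_mul, mul_comm]
  · congr 1; ring
  · refine Finset.prod_congr rfl fun i _ => ?_
    rw [← ENNReal.rpow_mul, mul_comm]

lemma mixMin_option {ι : Type*} [Fintype ι] {ε : ℝ} {θp θm : ι → ℝ} (k : ℤ)
    (e : ι → ℝ≥0∞) (v : ℝ≥0∞) :
    mixMin ε (fun o : Option ι => o.elim 1 θp) (fun o : Option ι => o.elim 1 θm) k
      (fun o => o.elim v e) = mixMin ε θp θm k e * v := by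
  unfold mixMin
  simp only [Fintype.prod_option, Option.elim_none, Option.elim_some, ENNReal.rpow_one]
  rw [mul_comm _ v, mul_min]
  congr 1 <;> ring

/-- The mixed-norm estimate for sums of averaged products. -/
lemma exists_nrm2_tsum_cnv_krn_mixMin_le {ι : Type*} [Fintype ι] {ε : ℝ} {θ θp θm a b : ι → ℝ}
    {σ A B : ℝ} (hε : 0 < ε) (hp : ∀ i, 0 < θp i) (hm : ∀ i, 0 < θm i)
    (hθ : ∀ i, θp i + θm i = 2 * θ i) (hσ : 1 / 2 ≤ σ) (hσ1 : σ ≤ 1)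
    (ha : ∀ i, 0 ≤ a i) (ha1 : ∀ i, a i < 1) (hb : ∀ i, 0 ≤ b i) (hb1 : ∀ i, b i < 1)
    (hsa : ∑ i, θ i * a i = A) (hsb : ∑ i, θ i * b i = B)
    (hA : 0 < A) (hB : 0 < B) (hσA : σ * A ≤ 1) (hσB : σ * B ≤ 1) :
    ∃ C : ℝ≥0∞, C ≠ ∞ ∧ ∀ F : ι → ℝ × ℝ → ℝ≥0∞, (∀ i, Measurable (F i)) →
      (∀ i, ∃ M : ℝ≥0, ∀ z, F i z ≤ M) → ∀ (j : ι → ℕ) (n : ℕ),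
    nrm2 volume volume A B (fun z => ∑' q : ℤ, cnv (krn (q - n)) (fun x' => mixMin ε θp θm q
        (fun i => cnv (omg (q - j i)) (fun x'' => F i (x'', z.2)) x')) z.1) ≤
      C * t2 (n * (1 / σ - 1)) * (1 + n : ℝ≥0∞) ^ (1 / σ) * (∏ i, (1 + j i : ℝ≥0∞) ^ θ i) *
        ∏ i, nrm2 volume volume (a i) (b i) (F i) ^ θ i := by
  have hσ0 : 0 < σ := by linarith
  obtain ⟨C, hC, hcar⟩ := omg_carleson (ι := Option ι) (ε := σ * ε)
    (a := fun o => o.elim (1 - σ * A) a) (b := fun o => o.elim (1 - σ * B) b)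
    (θ := fun o => o.elim 1 (fun i => σ * θ i)) (θp := fun o => o.elim 1 (fun i => σ * θp i))
    (θm := fun o => o.elim 1 (fun i => σ * θm i)) (by positivity)
    (by rintro (_ | i); exacts [by simpa using hσA, ha i])
    (by rintro (_ | i); exacts [by simpa using mul_pos hσ0 hA, ha1 i])
    (by rintro (_ | i); exacts [by simpa using hσB, hb i])
    (by rintro (_ | i); exacts [by simpa using mul_pos hσ0 hB, hb1 i])
    (by rintro (_ | i); exacts [one_pos, mul_pos hσ0 (hp i)])
    (by rintro (_ | i); exacts [one_pos, mul_pos hσ0 (hm i)])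
    (by rintro (_ | i)
        · norm_num
        · simp only [Option.elim_some]; rw [← mul_add, hθ]; ring)
    (by simp only [Fintype.sum_option, Option.elim_none, Option.elim_some]
        simp only [mul_assoc, ← Finset.mul_sum, hsa]; ring)
    (by simp only [Fintype.sum_option, Option.elim_none, Option.elim_some]
        simp only [mul_assoc, ← Finset.mul_sum, hsb]; ring)
  refine ⟨subC θp θm σ * C ^ (1 / σ), ENNReal.mul_ne_top (subC_ne_top hp hm hσ0 hσ1)
    (ENNReal.rpow_ne_top_of_nonneg (by positivity) hC), fun F hF hFb j n => ?_⟩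
  set h : ℤ → ℝ × ℝ → ℝ≥0∞ := fun q z => mixMin ε θp θm q
    (fun i => cnv (omg (q - j i)) (fun x'' => F i (x'', z.2)) z.1) with hh
  have hmeas : ∀ q, Measurable (h q) := fun q =>
    measurable_mixMin q fun i => measurable_cnv_prod (measurable_omg _) (hF i)
  set Z : ℝ × ℝ → ℝ≥0∞ := fun z => ∑' q : ℤ, cnv (omg (q - n)) (fun x' => h q (x', z.2) ^ σ) z.1
    with hZ
  have hZt : ∀ q : ℤ, Measurable fun z : ℝ × ℝ =>
      cnv (omg (q - n)) (fun x' => h q (x', z.2) ^ σ) z.1 := fun q =>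
    measurable_cnv_prod (measurable_omg _) ((hmeas q).pow_const σ)
  have hZm : Measurable Z := Measurable.ennreal_tsum hZt
  set c := subC θp θm σ * t2 (n * (1 / σ - 1)) with hc
  set R := (1 + n : ℝ≥0∞) * (∏ i, (1 + j i : ℝ≥0∞) ^ (σ * θ i)) *
    ∏ i, nrm2 volume volume (a i) (b i) (F i) ^ (σ * θ i) with hR
  have point : ∀ z : ℝ × ℝ, (∑' q : ℤ, cnv (krn (q - n)) (fun x' => mixMin ε θp θm q
        (fun i => cnv (omg (q - j i)) (fun x'' => F i (x'', z.2)) x')) z.1) ^ σ ≤ c ^ σ * Z z := by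
    intro z
    refine (tsum_rpow_le _ hσ0 hσ1).trans ?_
    rw [hZ]
    beta_reduce
    rw [← ENNReal.tsum_mul_left]
    refine ENNReal.tsum_le_tsum fun q => ?_
    have h1 := cnv_krn_mixMin_le (ε := ε) hp hm hσ hσ1 q n j (u := fun i x'' => F i (x'', z.2))
      (fun i => (hF i).comp (by fun_prop)) z.1
    refine (ENNReal.rpow_le_rpow h1 hσ0.le).trans (le_of_eq ?_)
    rw [ENNReal.mul_rpow_of_nonneg _ _ hσ0.le, ← ENNReal.rpow_mul, one_div_mul_cancel hσ0.ne',
      ENNReal.rpow_one]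
  have dual : nrm2 volume volume (σ * A) (σ * B) Z ≤ C * R := by
    refine nrm2_le_of_forall_test (by positivity) hσA (by positivity) hσB hZm fun u hu hub => ?_
    have hcar' := hcar (fun o => o.elim u F) (by rintro (_ | i); exacts [hu, hF i])
      (by rintro (_ | i); exacts [hub, hFb i]) (fun o => o.elim n j)
    rw [lintegral_lintegral_swap (hZm.mul hu).aemeasurable]
    have e1 : ∀ y, ∫⁻ x, Z (x, y) * u (x, y) =
        ∫⁻ x, ∑' q : ℤ, h q (x, y) ^ σ * cnv (omg (q - n)) (fun x' => u (x', y)) x := by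
      intro y
      have mu : Measurable fun x => u (x, y) := hu.comp (by fun_prop)
      have mh : ∀ q, Measurable fun x => h q (x, y) ^ σ := fun q =>
        ((hmeas q).comp (by fun_prop : Measurable fun x : ℝ => (x, y))).pow_const σ
      have mc : ∀ q : ℤ, Measurable (cnv (omg (q - n)) (fun x' => u (x', y))) := fun q =>
        measurable_cnv (measurable_omg _) mu
      have mm : ∀ q : ℤ, Measurable fun x => h q (x, y) ^ σ *
          cnv (omg (q - n)) (fun x' => u (x', y)) x := fun q => (mh q).mul (mc q)
      rw [lintegral_tsum fun q => (mm q).aemeasurable]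
      simp only [hZ]
      simp_rw [← ENNReal.tsum_mul_right]
      have mz : ∀ q : ℤ, Measurable fun x => cnv (omg (q - n)) (fun x' => h q (x', y) ^ σ) x *
          u (x, y) := fun q => (measurable_cnv (measurable_omg _) (mh q)).mul mu
      rw [lintegral_tsum fun q => (mz q).aemeasurable]
      refine tsum_congr fun q => ?_
      exact lintegral_cnv_mul (measurable_omg _) (omg_neg _) (mh q) mu
    simp_rw [e1]
    have mt : Measurable fun z : ℝ × ℝ => ∑' q : ℤ, h q z ^ σ *
        cnv (omg (q - n)) (fun x' => u (x', z.2)) z.1 :=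
      Measurable.ennreal_tsum fun q => ((hmeas q).pow_const σ).mul
        (measurable_cnv_prod (measurable_omg _) hu)
    rw [← lintegral_prod_symm' (μ := (volume : Measure ℝ)) (ν := (volume : Measure ℝ))
      (fun z : ℝ × ℝ => ∑' q : ℤ, h q z ^ σ * cnv (omg (q - n)) (fun x' => u (x', z.2)) z.1) mt]
    refine le_trans (le_of_eq (lintegral_congr fun z => tsum_congr fun q => ?_))
      (hcar'.trans (le_of_eq ?_))
    · rw [hh]
      beta_reduce
      rw [mixMin_rpow hσ0, ← mixMin_option]
      congr 1
      funext o
      rcases o with _ | i <;> rfl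
    · simp only [Fintype.prod_option, Option.elim_none, Option.elim_some, ENNReal.rpow_one]
      rw [hR]; ring
  calc _ = (nrm2 volume volume (σ * A) (σ * B) (fun z => (∑' q : ℤ, cnv (krn (q - n))
          (fun x' => mixMin ε θp θm q (fun i => cnv (omg (q - j i))
            (fun x'' => F i (x'', z.2)) x')) z.1) ^ σ)) ^ (1 / σ) := by
        rw [nrm2_rpow hσ0, ← ENNReal.rpow_mul, mul_one_div_cancel hσ0.ne', ENNReal.rpow_one,
          mul_div_cancel_left₀ _ hσ0.ne', mul_div_cancel_left₀ _ hσ0.ne']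
    _ ≤ (nrm2 volume volume (σ * A) (σ * B) (fun z => c ^ σ * Z z)) ^ (1 / σ) :=
        ENNReal.rpow_le_rpow (nrm2_mono (by positivity) (by positivity) point) (by positivity)
    _ ≤ (c ^ σ * (C * R)) ^ (1 / σ) := by
        rw [nrm2_const_mul (by positivity) (by positivity) _ hZm]
        exact ENNReal.rpow_le_rpow (mul_le_mul_right dual _) (by positivity)
    _ = _ := by
        have h0 : 0 ≤ 1 / σ := by positivity
        have e2 : ∀ t, t * σ * (1 / σ) = t := fun t => by field_simp
        have e3 : (c ^ σ) ^ (1 / σ) = c := by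
          rw [← ENNReal.rpow_mul, mul_one_div_cancel hσ0.ne', ENNReal.rpow_one]
        rw [ENNReal.mul_rpow_of_nonneg _ _ h0, e3, hR, hc]
        simp only [ENNReal.mul_rpow_of_nonneg _ _ h0, ← ENNReal.prod_rpow_of_nonneg h0,
          ← ENNReal.rpow_mul, mul_comm σ, e2]
        ring

end Sweep

section Maximal

lemma measurable_slice_left {X Y Z : Type*} [MeasurableSpace X] [MeasurableSpace Y]
    [MeasurableSpace Z] {G : X × Y → Z} (hG : Measurable G) (y : Y) :
    Measurable fun x => G (x, y) :=
  hG.comp (by fun_prop)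

lemma measurable_slice_right {X Y Z : Type*} [MeasurableSpace X] [MeasurableSpace Y]
    [MeasurableSpace Z] {G : X × Y → Z} (hG : Measurable G) (x : X) :
    Measurable fun y => G (x, y) :=
  hG.comp (by fun_prop)

/-- The twice iterated maximal function in the second variable. -/
noncomputable def MM (τ : ℝ) (F : ℝ × ℝ → ℝ≥0∞) (z : ℝ × ℝ) : ℝ≥0∞ :=
  Mx τ (Mx τ (fun y => F (z.1, y))) z.2

lemma measurable_MM (τ : ℝ) {F : ℝ × ℝ → ℝ≥0∞} (hF : Measurable F) : Measurable (MM τ F) := by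
  have h1 : Measurable fun z : ℝ × ℝ => Mx τ (fun y => F (z.1, y)) z.2 := measurable_Mx_prod τ hF
  have h2 := measurable_Mx_prod τ h1
  unfold MM
  exact h2

lemma MM_le_of_le {τ : ℝ} (hτ : 0 < τ) {F : ℝ × ℝ → ℝ≥0∞} {M : ℝ≥0∞} (hF : ∀ z, F z ≤ M)
    (z : ℝ × ℝ) : MM τ F z ≤ M :=
  Mx_le_of_le hτ (fun _ => Mx_le_of_le hτ (fun _ => hF _) _) _

lemma exists_nrm2_MM_le {a b τ : ℝ} (ha : 0 ≤ a) (hb : 0 ≤ b) (hbτ : b < τ) :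
    ∃ C : ℝ≥0∞, C ≠ ∞ ∧ ∀ F : ℝ × ℝ → ℝ≥0∞, Measurable F →
      nrm2 volume volume a b (MM τ F) ≤ C * nrm2 volume volume a b F := by
  obtain ⟨C, hC, h⟩ := exists_nrm_Mx_le hb hbτ
  refine ⟨C * C, ENNReal.mul_ne_top hC hC, fun F hF => ?_⟩
  have m : ∀ x, Measurable fun y => F (x, y) := fun x => hF.comp (by fun_prop)
  calc nrm2 volume volume a b (MM τ F)
      ≤ nrm volume a (fun x => C * C * nrm volume b (fun y => F (x, y))) :=
        nrm_mono ha fun x => (h _ (measurable_Mx τ (m x))).trans (by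
          rw [mul_assoc]; exact mul_le_mul_right (h _ (m x)) _)
    _ = _ := nrm_const_mul ha _ (measurable_nrm hF).aemeasurable

/-- Averaging in both variables. -/
noncomputable def cnv2 (l l' : ℤ) (F : ℝ × ℝ → ℝ≥0∞) (z : ℝ × ℝ) : ℝ≥0∞ :=
  cnv (omg l') (fun y => cnv (omg l) (fun x => F (x, y)) z.1) z.2

lemma measurable_cnv_prod_right {Y : Type*} [MeasurableSpace Y] {κ : ℝ → ℝ≥0∞} (hκ : Measurable κ)
    {F : Y × ℝ → ℝ≥0∞} (hF : Measurable F) :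
    Measurable fun z : Y × ℝ => cnv κ (fun y => F (z.1, y)) z.2 :=
  (measurable_cnv_prod hκ (F := fun w : ℝ × Y => F (w.2, w.1)) (hF.comp measurable_swap)).comp
    measurable_swap

lemma measurable_cnv2 (l l' : ℤ) {F : ℝ × ℝ → ℝ≥0∞} (hF : Measurable F) :
    Measurable (cnv2 l l' F) :=
  measurable_cnv_prod_right (measurable_omg l') (measurable_cnv_prod (measurable_omg l) hF)

lemma Mx_Mx_cnv_le {τ : ℝ} (hτ : 0 < τ) (hτ1 : τ ≤ 1) (l : ℤ) {F : ℝ × ℝ → ℝ≥0∞}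
    (hF : Measurable F) (x y : ℝ) :
    Mx τ (Mx τ (fun y' => cnv (omg l) (fun x' => F (x', y')) x)) y ≤
      cnv (omg l) (fun x' => MM τ F (x', y)) x := by
  have key : ∀ G : ℝ × ℝ → ℝ≥0∞, Measurable G → ∀ y,
      Mx τ (fun y' => cnv (omg l) (fun x' => G (x', y')) x) y ≤
      cnv (omg l) (fun x' => Mx τ (fun y' => G (x', y')) y) x := by
    intro G hG y
    have e : ∀ y', cnv (omg l) (fun x' => G (x', y')) x = ∫⁻ x', G (x', y') ∂(omgM l x) :=
      fun y' => (lintegral_omgM l x (hG.comp (by fun_prop))).symm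
    simp only [e]
    have mG : Measurable fun w : ℝ × ℝ => G (w.2, w.1) := hG.comp measurable_swap
    refine (Mx_lintegral_le hτ hτ1 mG y).trans (le_of_eq ?_)
    have m0 : Measurable fun z : ℝ × ℝ => Mx τ (fun y' => G (z.1, y')) z.2 := measurable_Mx_prod τ hG
    have m := measurable_slice_left m0 y
    exact lintegral_omgM l x m
  refine (Mx_mono hτ (key F hF) y).trans ?_
  have m1 : Measurable fun z : ℝ × ℝ => Mx τ (fun y' => F (z.1, y')) z.2 := measurable_Mx_prod τ hF
  have h2 := key _ m1 y
  unfold MM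
  exact h2

/-- The mixed-norm estimate for sums of products averaged in both variables. -/
lemma exists_nrm2_tsum_tsum_le {ι : Type*} [Fintype ι] {ε ε' : ℝ}
    {θ θp θm θpp θpm θmp θmm a b τ : ι → ℝ}
    {σ σ' A B : ℝ} (hε : 0 < ε) (hε' : 0 < ε') (hpp : ∀ i, 0 < θpp i) (hpm : ∀ i, 0 < θpm i)
    (hmp : ∀ i, 0 < θmp i) (hmm : ∀ i, 0 < θmm i)
    (hθp : ∀ i, θpp i + θpm i = 2 * θp i) (hθm : ∀ i, θmp i + θmm i = 2 * θm i)
    (hθ : ∀ i, θp i + θm i = 2 * θ i) (hσ : 1 / 2 ≤ σ) (hσ1 : σ ≤ 1)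
    (hσ' : 1 / 2 ≤ σ') (hσ1' : σ' ≤ 1)
    (ha : ∀ i, 0 ≤ a i) (ha1 : ∀ i, a i < 1) (hb : ∀ i, 0 ≤ b i)
    (hbτ : ∀ i, b i < τ i) (hτ1 : ∀ i, τ i ≤ 1)
    (hsa : ∑ i, θ i * a i = A) (hsb : ∑ i, θ i * b i = B)
    (hA : 0 < A) (hB : 0 < B) (hσA : σ * A ≤ 1) (hσB : σ * B ≤ 1)
    (hτpp : ∑ i, θpp i * τ i ≤ 1 / σ') (hτpm : ∑ i, θpm i * τ i ≤ 1 / σ')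
    (hτmp : ∑ i, θmp i * τ i ≤ 1 / σ') (hτmm : ∑ i, θmm i * τ i ≤ 1 / σ') :
    ∃ C : ℝ≥0∞, C ≠ ∞ ∧ ∀ F : ι → ℝ × ℝ → ℝ≥0∞, (∀ i, Measurable (F i)) →
      (∀ i, ∃ M : ℝ≥0, ∀ z, F i z ≤ M) → ∀ (j j' : ι → ℕ) (n n' : ℕ),
    nrm2 volume volume A B (fun z => ∑' q : ℤ, cnv (krn (q - n)) (fun x =>
        ∑' q' : ℤ, cnv (krn (q' - n')) (fun y =>
          min (t2 (ε * q) * mixMin ε' θpp θpm q' (fun i => cnv2 (q - j i) (q' - j' i) (F i) (x, y)))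
            (t2 (-ε * q) * mixMin ε' θmp θmm q'
              (fun i => cnv2 (q - j i) (q' - j' i) (F i) (x, y)))) z.2) z.1) ≤
      C * t2 (n * (1 / σ - 1)) * (1 + n : ℝ≥0∞) ^ (1 / σ) * t2 (n' * (1 / σ' - 1)) *
        (∏ i, (1 + j i : ℝ≥0∞) ^ θ i) * ∏ i, nrm2 volume volume (a i) (b i) (F i) ^ θ i := by
  have hτ : ∀ i, 0 < τ i := fun i => (hb i).trans_lt (hbτ i)
  have hp : ∀ i, 0 < θp i := fun i => by linarith [hpp i, hpm i, hθp i]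
  have hm : ∀ i, 0 < θm i := fun i => by linarith [hmp i, hmm i, hθm i]
  have hθ0 : ∀ i, 0 ≤ θ i := fun i => by linarith [hp i, hm i, hθ i]
  obtain ⟨C, hC, hX⟩ := exists_nrm2_tsum_cnv_krn_mixMin_le hε hp hm hθ hσ hσ1 ha ha1 hb
    (fun i => (hbτ i).trans_le (hτ1 i)) hsa hsb hA hB hσA hσB
  choose D hD hMM using fun i => exists_nrm2_MM_le (ha i) (hb i) (hbτ i)
  set c := max (subC θpp θpm σ') (subC θmp θmm σ') * (2 * geomC ε') with hc
  have hctop : c ≠ ∞ := ENNReal.mul_ne_top (max_lt (subC_ne_top hpp hpm (by linarith) hσ1').lt_top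
      (subC_ne_top hmp hmm (by linarith) hσ1').lt_top).ne
      (ENNReal.mul_ne_top (by simp) (geomC_ne_top hε'))
  refine ⟨c * C * ∏ i, D i ^ θ i, ENNReal.mul_ne_top (ENNReal.mul_ne_top hctop hC)
    (ENNReal.prod_ne_top fun i _ => ENNReal.rpow_ne_top_of_nonneg (hθ0 i) (hD i)),
    fun F hF hFb j j' n n' => ?_⟩
  have hu : ∀ (q : ℤ) (x : ℝ) (i : ι), Measurable fun y =>
      cnv (omg (q - j i)) (fun x' => F i (x', y)) x := fun q x i => by
    have m := measurable_slice_right (measurable_cnv_prod (measurable_omg (q - j i)) (hF i)) x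
    exact m
  have inner : ∀ (q : ℤ) (x y : ℝ), ∑' q' : ℤ, cnv (krn (q' - n')) (fun y =>
          min (t2 (ε * q) * mixMin ε' θpp θpm q' (fun i => cnv2 (q - j i) (q' - j' i) (F i) (x, y)))
            (t2 (-ε * q) * mixMin ε' θmp θmm q'
              (fun i => cnv2 (q - j i) (q' - j' i) (F i) (x, y)))) y ≤
      (c * t2 (n' * (1 / σ' - 1))) * mixMin ε θp θm q
        (fun i => cnv (omg (q - j i)) (fun x' => MM (τ i) (F i) (x', y)) x) := by
    intro q x y
    have side : ∀ (s : ℝ) (η η1 η2 : ι → ℝ), (∀ i, 0 < η1 i) → (∀ i, 0 < η2 i) →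
        (∀ i, η1 i + η2 i = 2 * η i) → subC η1 η2 σ' * (2 * geomC ε') ≤ c →
        ∑ i, η1 i * τ i ≤ 1 / σ' → ∑ i, η2 i * τ i ≤ 1 / σ' →
        ∑' q' : ℤ, cnv (krn (q' - n')) (fun y => t2 s * mixMin ε' η1 η2 q'
          (fun i => cnv2 (q - j i) (q' - j' i) (F i) (x, y))) y ≤
        (c * t2 (n' * (1 / σ' - 1))) * (t2 s * ∏ i,
          cnv (omg (q - j i)) (fun x' => MM (τ i) (F i) (x', y)) x ^ η i) := by
      intro s η η1 η2 h1 h2 h3 h4 h5 h6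
      have hy := tsum_cnv_krn_mixMin_le hε' h1 h2 h3 hσ' hσ1' hτ hτ1 h5 h6 (hu q x) j' n' y
      have e : ∀ q' : ℤ, cnv (krn (q' - n')) (fun y => t2 s * mixMin ε' η1 η2 q'
          (fun i => cnv2 (q - j i) (q' - j' i) (F i) (x, y))) y =
          t2 s * cnv (krn (q' - n')) (fun y => mixMin ε' η1 η2 q'
          (fun i => cnv2 (q - j i) (q' - j' i) (F i) (x, y))) y := by
        intro q'
        unfold cnv
        rw [← lintegral_const_mul' _ _ (t2_ne_top s)]
        exact lintegral_congr fun _ => mul_left_comm _ _ _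
      simp only [e]
      rw [ENNReal.tsum_mul_left]
      calc _ ≤ t2 s * (subC η1 η2 σ' * (2 * geomC ε') * t2 (n' * (1 / σ' - 1)) *
            ∏ i, Mx (τ i) (Mx (τ i) (fun y =>
              cnv (omg (q - j i)) (fun x' => F i (x', y)) x)) y ^ η i) := mul_le_mul_right hy _
        _ ≤ t2 s * (c * t2 (n' * (1 / σ' - 1)) *
            ∏ i, cnv (omg (q - j i)) (fun x' => MM (τ i) (F i) (x', y)) x ^ η i) := by
            refine mul_le_mul_right (mul_le_mul' (mul_le_mul_left h4 _)
              (Finset.prod_le_prod' fun i _ => ENNReal.rpow_le_rpow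
                (Mx_Mx_cnv_le (hτ i) (hτ1 i) _ (hF i) x y) ?_)) _
            linarith [h1 i, h2 i, h3 i]
        _ = _ := mul_left_comm _ _ _
    unfold mixMin
    rw [mul_min]
    refine le_min ?_ ?_
    · refine le_trans (ENNReal.tsum_le_tsum fun q' => cnv_mono _ (fun y => min_le_left _ _) y)
        (side (ε * q) θp θpp θpm hpp hpm hθp ?_ hτpp hτpm)
      exact mul_le_mul_left (le_max_left _ _) _
    · refine le_trans (ENNReal.tsum_le_tsum fun q' => cnv_mono _ (fun y => min_le_right _ _) y)
        (side (-ε * q) θm θmp θmm hmp hmm hθm ?_ hτmp hτmm)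
      exact mul_le_mul_left (le_max_right _ _) _
  have hcn : c * t2 (n' * (1 / σ' - 1)) ≠ ∞ := ENNReal.mul_ne_top hctop (t2_ne_top _)
  have hMMm : ∀ i, Measurable (MM (τ i) (F i)) := fun i => measurable_MM (τ i) (hF i)
  have hmeas : Measurable fun z : ℝ × ℝ => ∑' q : ℤ, cnv (krn (q - n)) (fun x =>
      mixMin ε θp θm q (fun i => cnv (omg (q - j i)) (fun x' => MM (τ i) (F i) (x', z.2)) x)) z.1 :=
    Measurable.ennreal_tsum fun q => measurable_cnv_prod (measurable_krn _)
      (F := fun z => mixMin ε θp θm q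
        (fun i => cnv (omg (q - j i)) (fun x' => MM (τ i) (F i) (x', z.2)) z.1))
      (measurable_mixMin q fun i => measurable_cnv_prod (measurable_omg _) (hMMm i))
  calc _ ≤ nrm2 volume volume A B (fun z => (c * t2 (n' * (1 / σ' - 1))) *
          ∑' q : ℤ, cnv (krn (q - n)) (fun x => mixMin ε θp θm q
            (fun i => cnv (omg (q - j i)) (fun x' => MM (τ i) (F i) (x', z.2)) x)) z.1) := by
        refine nrm2_mono hA.le hB.le fun z => ?_
        rw [← ENNReal.tsum_mul_left]
        refine ENNReal.tsum_le_tsum fun q => ?_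
        refine (cnv_mono _ (fun x => inner q x z.2) z.1).trans (le_of_eq ?_)
        unfold cnv
        rw [← lintegral_const_mul' _ _ hcn]
        exact lintegral_congr fun _ => mul_left_comm _ _ _
    _ = (c * t2 (n' * (1 / σ' - 1))) * _ := nrm2_const_mul hA.le hB.le _ hmeas
    _ ≤ (c * t2 (n' * (1 / σ' - 1))) * (C * t2 (n * (1 / σ - 1)) * (1 + n : ℝ≥0∞) ^ (1 / σ) *
          (∏ i, (1 + j i : ℝ≥0∞) ^ θ i) *
          ∏ i, nrm2 volume volume (a i) (b i) (MM (τ i) (F i)) ^ θ i) :=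
        mul_le_mul_right (hX (fun i => MM (τ i) (F i)) hMMm (fun i => by
          obtain ⟨M, hM⟩ := hFb i
          exact ⟨M, MM_le_of_le (hτ i) hM⟩) j n) _
    _ ≤ (c * t2 (n' * (1 / σ' - 1))) * (C * t2 (n * (1 / σ - 1)) * (1 + n : ℝ≥0∞) ^ (1 / σ) *
          (∏ i, (1 + j i : ℝ≥0∞) ^ θ i) *
          ∏ i, (D i * nrm2 volume volume (a i) (b i) (F i)) ^ θ i) := by
        refine mul_le_mul_right (mul_le_mul_right (Finset.prod_le_prod' fun i _ =>
          ENNReal.rpow_le_rpow (hMM i (F i) (hF i)) (hθ0 i)) _) _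
    _ = _ := by
        have e : ∀ i, (D i * nrm2 volume volume (a i) (b i) (F i)) ^ θ i =
            D i ^ θ i * nrm2 volume volume (a i) (b i) (F i) ^ θ i := fun i =>
          ENNReal.mul_rpow_of_nonneg _ _ (hθ0 i)
        simp only [e, Finset.prod_mul_distrib]
        ring

/-- The mixed-norm estimate for sums of products averaged in the second variable. -/
lemma exists_nrm2_tsum_right_le {ι : Type*} [Fintype ι] {ε : ℝ}
    {θ θp θm a b τ : ι → ℝ} {σ A B : ℝ} (hε : 0 < ε) (hp : ∀ i, 0 < θp i) (hm : ∀ i, 0 < θm i)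
    (hθ : ∀ i, θp i + θm i = 2 * θ i) (hσ : 1 / 2 ≤ σ) (hσ1 : σ ≤ 1)
    (ha : ∀ i, 0 ≤ a i) (hb : ∀ i, 0 ≤ b i)
    (hbτ : ∀ i, b i < τ i) (hτ1 : ∀ i, τ i ≤ 1)
    (hsa : ∑ i, θ i * a i = A) (hsb : ∑ i, θ i * b i = B)
    (hA : 0 < A) (hB : 0 < B)
    (hτp : ∑ i, θp i * τ i ≤ 1 / σ) (hτm : ∑ i, θm i * τ i ≤ 1 / σ) :
    ∃ C : ℝ≥0∞, C ≠ ∞ ∧ ∀ F : ι → ℝ × ℝ → ℝ≥0∞, (∀ i, Measurable (F i)) →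
      ∀ (j : ι → ℕ) (n : ℕ),
    nrm2 volume volume A B (fun z => ∑' q : ℤ, cnv (krn (q - n)) (fun y =>
          mixMin ε θp θm q (fun i => cnv (omg (q - j i)) (fun y' => F i (z.1, y')) y)) z.2) ≤
      C * t2 (n * (1 / σ - 1)) * ∏ i, nrm2 volume volume (a i) (b i) (F i) ^ θ i := by
  have hτ : ∀ i, 0 < τ i := fun i => (hb i).trans_lt (hbτ i)
  have hθ0 : ∀ i, 0 ≤ θ i := fun i => by linarith [hp i, hm i, hθ i]
  choose D hD hMM using fun i => exists_nrm2_MM_le (ha i) (hb i) (hbτ i)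
  refine ⟨subC θp θm σ * (2 * geomC ε) * ∏ i, D i ^ θ i, ENNReal.mul_ne_top
    (ENNReal.mul_ne_top (subC_ne_top hp hm (by linarith) hσ1)
      (ENNReal.mul_ne_top (by simp) (geomC_ne_top hε)))
    (ENNReal.prod_ne_top fun i _ => ENNReal.rpow_ne_top_of_nonneg (hθ0 i) (hD i)),
    fun F hF j n => ?_⟩
  have hMMm : ∀ i, Measurable (MM (τ i) (F i)) := fun i => measurable_MM (τ i) (hF i)
  calc _ ≤ nrm2 volume volume A B (fun z => (subC θp θm σ * (2 * geomC ε) *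
          t2 (n * (1 / σ - 1))) * ∏ i, MM (τ i) (F i) z ^ θ i) := by
        refine nrm2_mono hA.le hB.le fun z => ?_
        exact tsum_cnv_krn_mixMin_le hε hp hm hθ hσ hσ1 hτ hτ1 hτp hτm
          (u := fun i y' => F i (z.1, y')) (fun i => (hF i).comp (by fun_prop)) j n z.2
    _ = (subC θp θm σ * (2 * geomC ε) * t2 (n * (1 / σ - 1))) * _ :=
        nrm2_const_mul hA.le hB.le _ (Finset.measurable_fun_prod _ fun i _ =>
          (hMMm i).pow_const _)
    _ ≤ (subC θp θm σ * (2 * geomC ε) * t2 (n * (1 / σ - 1))) *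
          ∏ i, (D i * nrm2 volume volume (a i) (b i) (F i)) ^ θ i := by
        refine mul_le_mul_right ((nrm2_prod_rpow_le hA hB hMMm hθ0 ha hb hsa hsb).trans
          (Finset.prod_le_prod' fun i _ => ENNReal.rpow_le_rpow (hMM i (F i) (hF i)) (hθ0 i))) _
    _ = _ := by
        have e : ∀ i, (D i * nrm2 volume volume (a i) (b i) (F i)) ^ θ i =
            D i ^ θ i * nrm2 volume volume (a i) (b i) (F i) ^ θ i := fun i =>
          ENNReal.mul_rpow_of_nonneg _ _ (hθ0 i)
        simp only [e, Finset.prod_mul_distrib]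
        ring

end Maximal

section FourierPlane

open FourierTransform

/-- The character `ξ ↦ e^{2πi z·ξ}` of the plane. -/
noncomputable def ex2 (z ξ : ℝ × ℝ) : ℂ :=
  Complex.exp ((2 * Real.pi * (z.1 * ξ.1 + z.2 * ξ.2) : ℝ) * Complex.I)

lemma continuous_ex2 : Continuous fun p : (ℝ × ℝ) × (ℝ × ℝ) => ex2 p.1 p.2 := by
  unfold ex2; fun_prop

lemma norm_ex2 (z ξ : ℝ × ℝ) : ‖ex2 z ξ‖ = 1 := Complex.norm_exp_ofReal_mul_I _

lemma ex2_add (z ξ η : ℝ × ℝ) : ex2 z (ξ + η) = ex2 z ξ * ex2 z η := by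
  unfold ex2
  rw [← Complex.exp_add]
  congr 1
  push_cast [Prod.fst_add, Prod.snd_add]
  ring

/-- The inverse Fourier integral in the plane. -/
noncomputable def IF2 (W : ℝ × ℝ → ℂ) (z : ℝ × ℝ) : ℂ := ∫ ξ, W ξ * ex2 z ξ

lemma fracD_eq_IF2 (a b : ℝ) (h : ℝ × ℝ → ℂ) (z : ℝ × ℝ) :
    fracD a b h z = IF2 (fun ξ => ((|ξ.1| ^ a * |ξ.2| ^ b : ℝ) : ℂ) * ft2 h ξ) z := rfl

lemma integrable_mul_ex2 {W : ℝ × ℝ → ℂ} (hW : Integrable W) (z : ℝ × ℝ) :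
    Integrable fun ξ => W ξ * ex2 z ξ := by
  refine hW.mul_bdd (c := 1) ?_ ?_
  · exact (continuous_ex2.comp (by fun_prop : Continuous fun ξ => (z, ξ))).aestronglyMeasurable
  · exact Filter.Eventually.of_forall fun ξ => (norm_ex2 z ξ).le

lemma continuous_IF2 {W : ℝ × ℝ → ℂ} (hW : Integrable W) : Continuous (IF2 W) := by
  refine continuous_of_dominated (bound := fun ξ => ‖W ξ‖) ?_ ?_ hW.norm ?_
  · exact fun z => (integrable_mul_ex2 hW z).1
  · exact fun z => Filter.Eventually.of_forall fun ξ => by rw [norm_mul, norm_ex2, mul_one]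
  · refine Filter.Eventually.of_forall fun ξ => ?_
    exact continuous_const.mul (continuous_ex2.comp (by fun_prop : Continuous fun z => (z, ξ)))

lemma norm_IF2_le (W : ℝ × ℝ → ℂ) (z : ℝ × ℝ) : ‖IF2 W z‖ ≤ ∫ ξ, ‖W ξ‖ := by
  refine (norm_integral_le_integral_norm _).trans_eq ?_
  simp_rw [norm_mul, norm_ex2, mul_one]

lemma exists_schwartz_ft2 (f : SchwartzMap (ℝ × ℝ) ℂ) :
    ∃ G : SchwartzMap (ℝ × ℝ) ℂ, ft2 f = G ∧ ∀ z, f z = IF2 G z := by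
  have mp := WithLp.volume_preserving_symm_measurableEquiv_toLp_prod ℝ ℝ
  let h : SchwartzMap (WithLp 2 (ℝ × ℝ)) ℂ :=
    SchwartzMap.compCLMOfContinuousLinearEquiv ℂ (WithLp.prodContinuousLinearEquiv 2 ℝ ℝ ℝ) f
  let G : SchwartzMap (ℝ × ℝ) ℂ :=
    SchwartzMap.compCLMOfContinuousLinearEquiv ℂ (WithLp.prodContinuousLinearEquiv 2 ℝ ℝ ℝ).symm
      (𝓕 h)
  have hG : ∀ ξ, G ξ = (𝓕 h) (WithLp.toLp 2 ξ) := fun ξ => rfl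
  have hh : ∀ v : WithLp 2 (ℝ × ℝ), h v = f v.ofLp := fun v => rfl
  refine ⟨G, ?_, ?_⟩
  · funext ξ
    rw [hG, SchwartzMap.fourier_coe, Real.fourier_eq', ft2,
      ← mp.integral_comp (MeasurableEquiv.measurableEmbedding _)]
    refine integral_congr_ae (Filter.Eventually.of_forall fun v => ?_)
    simp only [hh, WithLp.prod_inner_apply, smul_eq_mul]
    rw [mul_comm]
    congr 3
    simp [mul_comm]
  · intro z
    have h1 : f z = h (WithLp.toLp 2 z) := rfl
    have h2 : h = 𝓕⁻ (𝓕 h) := (FourierTransform.fourierInv_fourier_eq h).symm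
    rw [h1, h2, SchwartzMap.fourierInv_coe, Real.fourierInv_eq', IF2,
      ← mp.integral_comp (MeasurableEquiv.measurableEmbedding _)]
    refine integral_congr_ae (Filter.Eventually.of_forall fun v => ?_)
    simp only [WithLp.prod_inner_apply, smul_eq_mul, ex2]
    rw [mul_comm]
    refine congrArg₂ (· * ·) rfl (congrArg (fun t : ℝ => Complex.exp (t * Complex.I)) ?_)
    simp [mul_comm]

lemma one_add_norm_rpow_ge {α : ℝ} (hα : 0 ≤ α) {t r : ℝ} (ht : |t| ≤ r) :
    1 + |t| ^ α ≤ 2 * (1 + r) ^ α := by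
  have h0 := abs_nonneg t
  have h1 : (1 : ℝ) ≤ (1 + r) ^ α := Real.one_le_rpow (by linarith) hα
  have h2 : |t| ^ α ≤ (1 + r) ^ α := Real.rpow_le_rpow h0 (by linarith) hα
  linarith

lemma SchwartzMap.integrable_weight_mul (G : SchwartzMap (ℝ × ℝ) ℂ) {α β : ℝ} (hα : 0 ≤ α)
    (hβ : 0 ≤ β) :
    Integrable fun ξ : ℝ × ℝ => (((1 + |ξ.1| ^ α) * (1 + |ξ.2| ^ β) : ℝ) : ℂ) * G ξ := by
  obtain ⟨N, hN⟩ := exists_nat_gt (α + β + 2)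
  have hdec := SchwartzMap.one_add_le_sup_seminorm_apply (𝕜 := ℂ) (m := (N, 0)) (k := N) (n := 0)
    le_rfl le_rfl G
  set S := 2 ^ N * ((Finset.Iic (N, 0)).sup fun m => SchwartzMap.seminorm ℂ m.1 m.2) G with hS
  have hInt : Integrable fun ξ : ℝ × ℝ => 4 * S * (1 + ‖ξ‖) ^ (-(N - α - β)) := by
    refine (integrable_one_add_norm (μ := (volume : Measure (ℝ × ℝ))) (r := N - α - β)
      ?_).const_mul _
    simp only [Module.finrank_prod, Module.finrank_self]
    push_cast
    linarith
  refine hInt.mono' ?_ ?_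
  · refine (Continuous.mul ?_ G.continuous).aestronglyMeasurable
    refine Complex.continuous_ofReal.comp ?_
    have c1 : Continuous fun ξ : ℝ × ℝ => |ξ.1| ^ α :=
      (by fun_prop : Continuous fun ξ : ℝ × ℝ => |ξ.1|).rpow_const fun _ => Or.inr hα
    have c2 : Continuous fun ξ : ℝ × ℝ => |ξ.2| ^ β :=
      (by fun_prop : Continuous fun ξ : ℝ × ℝ => |ξ.2|).rpow_const fun _ => Or.inr hβ
    fun_prop
  · refine Filter.Eventually.of_forall fun ξ => ?_
    have hpos : 0 < 1 + ‖ξ‖ := by positivity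
    have h1 := one_add_norm_rpow_ge hα (norm_fst_le ξ)
    have h2 := one_add_norm_rpow_ge hβ (norm_snd_le ξ)
    have h3 := hdec ξ
    rw [norm_iteratedFDeriv_zero] at h3
    have h4 : ‖G ξ‖ ≤ S * (1 + ‖ξ‖) ^ (-(N : ℝ)) := by
      rw [Real.rpow_neg hpos.le, Real.rpow_natCast, ← div_eq_mul_inv, le_div_iff₀ (by positivity),
        mul_comm]
      exact h3
    rw [norm_mul, Complex.norm_real, Real.norm_of_nonneg (by positivity)]
    calc (1 + |ξ.1| ^ α) * (1 + |ξ.2| ^ β) * ‖G ξ‖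
        ≤ (2 * (1 + ‖ξ‖) ^ α) * (2 * (1 + ‖ξ‖) ^ β) * (S * (1 + ‖ξ‖) ^ (-(N : ℝ))) := by
          gcongr
      _ = 4 * S * ((1 + ‖ξ‖) ^ α * (1 + ‖ξ‖) ^ β * (1 + ‖ξ‖) ^ (-(N : ℝ))) := by ring
      _ = 4 * S * (1 + ‖ξ‖) ^ (-(N - α - β)) := by
          rw [← Real.rpow_add hpos, ← Real.rpow_add hpos]; congr 2; ring

lemma integrable_weight_mul_ft2 (f : SchwartzMap (ℝ × ℝ) ℂ) {α β : ℝ} (hα : 0 ≤ α)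
    (hβ : 0 ≤ β) :
    Integrable fun ξ : ℝ × ℝ => (((1 + |ξ.1| ^ α) * (1 + |ξ.2| ^ β) : ℝ) : ℂ) * ft2 f ξ := by
  obtain ⟨G, h, -⟩ := exists_schwartz_ft2 f
  rw [h]
  exact G.integrable_weight_mul hα hβ

lemma continuous_ft2 (f : SchwartzMap (ℝ × ℝ) ℂ) : Continuous (ft2 f) := by
  obtain ⟨G, h, -⟩ := exists_schwartz_ft2 f
  rw [h]
  exact G.continuous

/-- A weight dominated by `(1 + |ξ₁|^α) (1 + |ξ₂|^β)` is integrable against the Fourier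
transform of a Schwartz function. -/
lemma integrable_mul_ft2_of_le (f : SchwartzMap (ℝ × ℝ) ℂ) {α β C : ℝ} (hα : 0 ≤ α)
    (hβ : 0 ≤ β) {m : ℝ × ℝ → ℂ} (hm : Measurable m)
    (h : ∀ ξ, ‖m ξ‖ ≤ C * ((1 + |ξ.1| ^ α) * (1 + |ξ.2| ^ β))) :
    Integrable fun ξ : ℝ × ℝ => m ξ * ft2 f ξ := by
  refine ((integrable_weight_mul_ft2 f hα hβ).const_mul (C : ℂ)).mono
    (hm.aestronglyMeasurable.mul (continuous_ft2 f).aestronglyMeasurable) ?_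
  refine Filter.Eventually.of_forall fun ξ => ?_
  have h0 : 0 ≤ (1 + |ξ.1| ^ α) * (1 + |ξ.2| ^ β) := by positivity
  rw [norm_mul, norm_mul, norm_mul, Complex.norm_real, Complex.norm_real, ← mul_assoc,
    Real.norm_of_nonneg h0]
  refine mul_le_mul_of_nonneg_right ((h ξ).trans ?_) (norm_nonneg _)
  exact mul_le_mul_of_nonneg_right (le_abs_self _) h0

lemma rpow_abs_le_one_add {a α : ℝ} (ha : 0 ≤ a) (haα : a ≤ α) (t : ℝ) :
    |t| ^ a ≤ 1 + |t| ^ α := by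
  rcases le_total |t| 1 with h | h
  · have := Real.rpow_le_one (abs_nonneg t) h ha
    have := Real.rpow_nonneg (abs_nonneg t) α
    linarith
  · have := Real.rpow_le_rpow_of_exponent_le h haα
    linarith

lemma measurable_weight (a b : ℝ) :
    Measurable fun ξ : ℝ × ℝ => ((|ξ.1| ^ a * |ξ.2| ^ b : ℝ) : ℂ) := by
  fun_prop

lemma integrable_fracD_weight (f : SchwartzMap (ℝ × ℝ) ℂ) {a b : ℝ} (ha : 0 ≤ a) (hb : 0 ≤ b) :
    Integrable fun ξ : ℝ × ℝ => ((|ξ.1| ^ a * |ξ.2| ^ b : ℝ) : ℂ) * ft2 f ξ := by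
  refine integrable_mul_ft2_of_le f (C := 1) ha hb (measurable_weight a b) fun ξ => ?_
  rw [Complex.norm_real, Real.norm_of_nonneg (by positivity), one_mul]
  have h1 := rpow_abs_le_one_add ha le_rfl ξ.1
  have h2 := rpow_abs_le_one_add hb le_rfl ξ.2
  gcongr

lemma fracD_zero (f : SchwartzMap (ℝ × ℝ) ℂ) : fracD 0 0 f = f := by
  obtain ⟨G, h, h'⟩ := exists_schwartz_ft2 f
  funext z
  rw [fracD_eq_IF2, h', h]
  simp

lemma continuous_fracD (f : SchwartzMap (ℝ × ℝ) ℂ) {a b : ℝ} (ha : 0 ≤ a) (hb : 0 ≤ b) :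
    Continuous (fracD a b f) :=
  continuous_IF2 (integrable_fracD_weight f ha hb)

lemma exists_norm_fracD_le (f : SchwartzMap (ℝ × ℝ) ℂ) (a b : ℝ) :
    ∃ M : ℝ≥0, ∀ z, ‖fracD a b f z‖ₑ ≤ M := by
  refine ⟨Real.toNNReal (∫ ξ : ℝ × ℝ, ‖((|ξ.1| ^ a * |ξ.2| ^ b : ℝ) : ℂ) * ft2 f ξ‖),
    fun z => ?_⟩
  rw [← ofReal_norm]
  exact ENNReal.ofReal_le_ofReal (norm_IF2_le _ z)

/-- The Fourier transform of a product. -/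
lemma ft2_mul (f g : SchwartzMap (ℝ × ℝ) ℂ) (ζ : ℝ × ℝ) :
    ft2 (fun z => f z * g z) ζ = ∫ η, ft2 f (ζ - η) * ft2 g η := by
  obtain ⟨G, h, h'⟩ := exists_schwartz_ft2 g
  have hexp : ∀ z ξ : ℝ × ℝ, Complex.exp (((-2) * Real.pi * (z.1 * ξ.1 + z.2 * ξ.2) : ℝ) *
      Complex.I) = ex2 z (-ξ) := fun z ξ => by
    unfold ex2; congr 2; simp only [Prod.fst_neg, Prod.snd_neg]; push_cast; ring
  have hInt : Integrable (Function.uncurry fun (z η : ℝ × ℝ) =>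
      f z * G η * (ex2 z η * ex2 z (-ζ))) := by
    refine (f.integrable.mul_prod G.integrable).mul_bdd (c := 1) ?_ ?_
    · refine Continuous.aestronglyMeasurable ?_
      exact continuous_ex2.mul (continuous_ex2.comp
        (by fun_prop : Continuous fun p : (ℝ × ℝ) × (ℝ × ℝ) => (p.1, -ζ)))
    · exact Filter.Eventually.of_forall fun p => by
        rw [norm_mul, norm_ex2, norm_ex2, mul_one]
  calc ft2 (fun z => f z * g z) ζ
      = ∫ z, ∫ η, f z * G η * (ex2 z η * ex2 z (-ζ)) := by
        refine integral_congr_ae (Filter.Eventually.of_forall fun z => ?_)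
        beta_reduce
        rw [hexp, h', IF2, ← integral_const_mul, ← integral_mul_const]
        refine integral_congr_ae (Filter.Eventually.of_forall fun η => ?_)
        beta_reduce
        ring
    _ = ∫ η, ∫ z, f z * G η * (ex2 z η * ex2 z (-ζ)) := integral_integral_swap hInt
    _ = ∫ η, ft2 f (ζ - η) * ft2 g η := by
        refine integral_congr_ae (Filter.Eventually.of_forall fun η => ?_)
        beta_reduce
        rw [h, ft2, ← integral_mul_const]
        refine integral_congr_ae (Filter.Eventually.of_forall fun z => ?_)
        beta_reduce
        rw [hexp, ← ex2_add, neg_sub, sub_eq_add_neg]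
        ring

end FourierPlane

section Bilinear

lemma ae_coord_ne_zero : ∀ᵐ p : (ℝ × ℝ) × (ℝ × ℝ),
    (p.1.1 ≠ 0 ∧ p.1.2 ≠ 0) ∧ (p.2.1 ≠ 0 ∧ p.2.2 ≠ 0) := by
  have h0 : ∀ᵐ x : ℝ, x ≠ 0 := by simp [ae_iff]
  have h1 : ∀ᵐ p : ℝ × ℝ, p.1 ≠ 0 := Measure.quasiMeasurePreserving_fst.ae h0
  have h2 : ∀ᵐ p : ℝ × ℝ, p.2 ≠ 0 := Measure.quasiMeasurePreserving_snd.ae h0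
  have h3 : ∀ᵐ p : ℝ × ℝ, p.1 ≠ 0 ∧ p.2 ≠ 0 := h1.and h2
  exact (Measure.quasiMeasurePreserving_fst.ae h3).and (Measure.quasiMeasurePreserving_snd.ae h3)

lemma abs_add_rpow_le {α : ℝ} (hα : 0 ≤ α) (x y : ℝ) :
    |x + y| ^ α ≤ 2 ^ α * ((1 + |x| ^ α) * (1 + |y| ^ α)) := by
  have hx := Real.rpow_nonneg (abs_nonneg x) α
  have hy := Real.rpow_nonneg (abs_nonneg y) α
  have key : ∀ u v : ℝ, |u| ≤ |v| → |u + v| ^ α ≤ 2 ^ α * |v| ^ α := fun u v h => by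
    rw [← Real.mul_rpow zero_le_two (abs_nonneg v)]
    refine Real.rpow_le_rpow (abs_nonneg _) ((abs_add_le u v).trans (by linarith)) hα
  have h2 : (0 : ℝ) ≤ 2 ^ α := by positivity
  rcases le_total |x| |y| with h | h
  · refine (key x y h).trans (mul_le_mul_of_nonneg_left ?_ h2)
    nlinarith [mul_nonneg hx hy]
  · rw [add_comm x y]
    refine (key y x h).trans (mul_le_mul_of_nonneg_left ?_ h2)
    nlinarith [mul_nonneg hx hy]

lemma fracD_mul_eq (f g : SchwartzMap (ℝ × ℝ) ℂ) {α β : ℝ} (hα : 0 ≤ α) (hβ : 0 ≤ β)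
    (z : ℝ × ℝ) :
    fracD α β (fun z => f z * g z) z = ∫ p : (ℝ × ℝ) × (ℝ × ℝ),
      ((|p.1.1 + p.2.1| ^ α * |p.1.2 + p.2.2| ^ β : ℝ) : ℂ) *
        ((ft2 f p.1 * ex2 z p.1) * (ft2 g p.2 * ex2 z p.2)) := by
  have hInt : Integrable fun p : (ℝ × ℝ) × (ℝ × ℝ) =>
      ((|p.1.1 + p.2.1| ^ α * |p.1.2 + p.2.2| ^ β : ℝ) : ℂ) *
        ((ft2 f p.1 * ex2 z p.1) * (ft2 g p.2 * ex2 z p.2)) := by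
    have hF := (integrable_weight_mul_ft2 f hα hβ).mul_prod (integrable_weight_mul_ft2 g hα hβ)
    refine (hF.const_mul ((2 ^ α * 2 ^ β : ℝ) : ℂ)).mono ?_ ?_
    · refine Measurable.aestronglyMeasurable ?_
      have m1 := (continuous_ft2 f).measurable
      have m2 := (continuous_ft2 g).measurable
      have m3 : Measurable (ex2 z) :=
        (continuous_ex2.comp (by fun_prop : Continuous fun ξ => (z, ξ))).measurable
      fun_prop
    · refine Filter.Eventually.of_forall fun p => ?_
      simp only [norm_mul, norm_ex2, Complex.norm_real, mul_one]
      rw [Real.norm_of_nonneg (by positivity), Real.norm_of_nonneg (by positivity),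
        Real.norm_of_nonneg (by positivity), Real.norm_of_nonneg (by positivity),
        Real.norm_of_nonneg (by positivity), Real.norm_of_nonneg (by positivity),
        Real.norm_of_nonneg (by positivity), Real.norm_of_nonneg (by positivity)]
      have h1 := abs_add_rpow_le hα p.1.1 p.2.1
      have h2 := abs_add_rpow_le hβ p.1.2 p.2.2
      calc |p.1.1 + p.2.1| ^ α * |p.1.2 + p.2.2| ^ β * (‖ft2 f p.1‖ * ‖ft2 g p.2‖)
          ≤ (2 ^ α * ((1 + |p.1.1| ^ α) * (1 + |p.2.1| ^ α))) *
            (2 ^ β * ((1 + |p.1.2| ^ β) * (1 + |p.2.2| ^ β))) *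
              (‖ft2 f p.1‖ * ‖ft2 g p.2‖) := by gcongr
        _ = _ := by ring
  have mp : MeasurePreserving (fun p : (ℝ × ℝ) × (ℝ × ℝ) => (p.1 + p.2, p.2)) :=
    measurePreserving_add_prod volume volume
  have me : MeasurableEmbedding (fun p : (ℝ × ℝ) × (ℝ × ℝ) => (p.1 + p.2, p.2)) :=
    (MeasurableEquiv.mk
      { toFun := fun p : (ℝ × ℝ) × (ℝ × ℝ) => (p.1 + p.2, p.2)
        invFun := fun p => (p.1 - p.2, p.2)
        left_inv := fun p => by simp
        right_inv := fun p => by simp } (by simp only [Equiv.coe_fn_mk]; fun_prop)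
          (by simp only [Equiv.coe_fn_symm_mk]; fun_prop)).measurableEmbedding
  set Φ : (ℝ × ℝ) × (ℝ × ℝ) → ℂ := fun q => ((|q.1.1| ^ α * |q.1.2| ^ β : ℝ) : ℂ) *
    (ft2 f (q.1 - q.2) * ft2 g q.2) * ex2 z q.1 with hΦ
  have heq : ∀ p : (ℝ × ℝ) × (ℝ × ℝ),
      ((|p.1.1 + p.2.1| ^ α * |p.1.2 + p.2.2| ^ β : ℝ) : ℂ) *
        ((ft2 f p.1 * ex2 z p.1) * (ft2 g p.2 * ex2 z p.2)) = Φ (p.1 + p.2, p.2) := fun p => by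
    simp only [hΦ, add_sub_cancel_right, ex2_add, Prod.fst_add, Prod.snd_add]
    ring
  simp_rw [heq] at hInt ⊢
  have hΦi : Integrable Φ := (mp.integrable_comp_emb me).1 hInt
  rw [mp.integral_comp me, Measure.volume_eq_prod, integral_prod _ hΦi, fracD_eq_IF2, IF2]
  refine integral_congr_ae (Filter.Eventually.of_forall fun ζ => ?_)
  simp only [hΦ]
  rw [integral_mul_const, integral_const_mul, ft2_mul]

/-- Superposition of tensor products inside the bilinear Fourier integral. -/
lemma enorm_integral_superposition_le {T T' : Type*} [MeasurableSpace T] [MeasurableSpace T']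
    (τ : Measure T) (τ' : Measure T') [SFinite τ] [SFinite τ']
    {mu la : T → ℝ → ℂ} {mu' la' : T' → ℝ → ℂ}
    (hmu : Measurable (Function.uncurry mu)) (hla : Measurable (Function.uncurry la))
    (hmu' : Measurable (Function.uncurry mu')) (hla' : Measurable (Function.uncurry la'))
    {α β : ℝ} (hα : 0 ≤ α) (hβ : 0 ≤ β) {C C' : ℝ≥0∞} (hC : C ≠ ∞) (hC' : C' ≠ ∞)
    (hb : ∀ ξ η : ℝ, ξ ≠ 0 → η ≠ 0 → ∫⁻ t, ‖mu t ξ‖ₑ * ‖la t η‖ₑ ∂τ ≤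
      C * ENNReal.ofReal ((1 + |ξ| ^ α) * (1 + |η| ^ α)))
    (hb' : ∀ ξ η : ℝ, ξ ≠ 0 → η ≠ 0 → ∫⁻ t, ‖mu' t ξ‖ₑ * ‖la' t η‖ₑ ∂τ' ≤
      C' * ENNReal.ofReal ((1 + |ξ| ^ β) * (1 + |η| ^ β)))
    (f g : SchwartzMap (ℝ × ℝ) ℂ) (z : ℝ × ℝ) :
    (Integrable fun p : (ℝ × ℝ) × (ℝ × ℝ) =>
      ((∫ t, mu t p.1.1 * la t p.2.1 ∂τ) * (∫ t, mu' t p.1.2 * la' t p.2.2 ∂τ')) *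
        ((ft2 f p.1 * ex2 z p.1) * (ft2 g p.2 * ex2 z p.2))) ∧
    ‖∫ p : (ℝ × ℝ) × (ℝ × ℝ),
      ((∫ t, mu t p.1.1 * la t p.2.1 ∂τ) * (∫ t, mu' t p.1.2 * la' t p.2.2 ∂τ')) *
        ((ft2 f p.1 * ex2 z p.1) * (ft2 g p.2 * ex2 z p.2))‖ₑ ≤
      ∫⁻ t, ∫⁻ t', ‖IF2 (fun ξ => mu t ξ.1 * (mu' t' ξ.2 * ft2 f ξ)) z‖ₑ *
        ‖IF2 (fun ξ => la t ξ.1 * (la' t' ξ.2 * ft2 g ξ)) z‖ₑ ∂τ' ∂τ := by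
  set Φ : ((ℝ × ℝ) × (ℝ × ℝ)) × (T × T') → ℂ := fun q =>
    ((mu q.2.1 q.1.1.1 * la q.2.1 q.1.2.1) * (mu' q.2.2 q.1.1.2 * la' q.2.2 q.1.2.2)) *
      ((ft2 f q.1.1 * ex2 z q.1.1) * (ft2 g q.1.2 * ex2 z q.1.2)) with hΦ
  have mf := (continuous_ft2 f).measurable
  have mg := (continuous_ft2 g).measurable
  have mz : Measurable (ex2 z) :=
    (continuous_ex2.comp (by fun_prop : Continuous fun ξ => (z, ξ))).measurable
  have m1 : Measurable fun q : ((ℝ × ℝ) × (ℝ × ℝ)) × (T × T') => mu q.2.1 q.1.1.1 :=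
    hmu.comp (by fun_prop : Measurable fun q : ((ℝ × ℝ) × (ℝ × ℝ)) × (T × T') =>
      (q.2.1, q.1.1.1))
  have m2 : Measurable fun q : ((ℝ × ℝ) × (ℝ × ℝ)) × (T × T') => la q.2.1 q.1.2.1 :=
    hla.comp (by fun_prop : Measurable fun q : ((ℝ × ℝ) × (ℝ × ℝ)) × (T × T') =>
      (q.2.1, q.1.2.1))
  have m3 : Measurable fun q : ((ℝ × ℝ) × (ℝ × ℝ)) × (T × T') => mu' q.2.2 q.1.1.2 :=
    hmu'.comp (by fun_prop : Measurable fun q : ((ℝ × ℝ) × (ℝ × ℝ)) × (T × T') =>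
      (q.2.2, q.1.1.2))
  have m4 : Measurable fun q : ((ℝ × ℝ) × (ℝ × ℝ)) × (T × T') => la' q.2.2 q.1.2.2 :=
    hla'.comp (by fun_prop : Measurable fun q : ((ℝ × ℝ) × (ℝ × ℝ)) × (T × T') =>
      (q.2.2, q.1.2.2))
  have mΦ : Measurable Φ := by
    simp only [hΦ]
    fun_prop
  have n1 : ∀ ξ η : ℝ, Measurable fun t => ‖mu t ξ‖ₑ * ‖la t η‖ₑ := fun ξ η =>
    ((hmu.comp (by fun_prop : Measurable fun t : T => (t, ξ))).enorm).mul
      ((hla.comp (by fun_prop : Measurable fun t : T => (t, η))).enorm)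
  have n2 : ∀ ξ η : ℝ, Measurable fun t => ‖mu' t ξ‖ₑ * ‖la' t η‖ₑ := fun ξ η =>
    ((hmu'.comp (by fun_prop : Measurable fun t : T' => (t, ξ))).enorm).mul
      ((hla'.comp (by fun_prop : Measurable fun t : T' => (t, η))).enorm)
  have hi : Integrable Φ (volume.prod (τ.prod τ')) := by
    refine ⟨mΦ.aestronglyMeasurable, ?_⟩
    rw [HasFiniteIntegral, lintegral_prod _ mΦ.enorm.aemeasurable]
    have hF := (integrable_weight_mul_ft2 f hα hβ).mul_prod (integrable_weight_mul_ft2 g hα hβ)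
    refine lt_of_le_of_lt (b := ∫⁻ p : (ℝ × ℝ) × (ℝ × ℝ), (C * C') *
      ‖((((1 + |p.1.1| ^ α) * (1 + |p.1.2| ^ β) : ℝ) : ℂ) * ft2 f p.1) *
        ((((1 + |p.2.1| ^ α) * (1 + |p.2.2| ^ β) : ℝ) : ℂ) * ft2 g p.2)‖ₑ) ?_ ?_
    · refine lintegral_mono_ae ?_
      filter_upwards [ae_coord_ne_zero] with p hp
      calc ∫⁻ t, ‖Φ (p, t)‖ₑ ∂(τ.prod τ')
          = ∫⁻ t : T × T', ((‖mu t.1 p.1.1‖ₑ * ‖la t.1 p.2.1‖ₑ) *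
              (‖mu' t.2 p.1.2‖ₑ * ‖la' t.2 p.2.2‖ₑ)) * (‖ft2 f p.1‖ₑ * ‖ft2 g p.2‖ₑ)
                ∂(τ.prod τ') := by
            refine lintegral_congr fun t => ?_
            have e1 : ∀ ξ, ‖ex2 z ξ‖ₑ = 1 := fun ξ => by
              rw [← ofReal_norm, norm_ex2, ENNReal.ofReal_one]
            simp only [hΦ, enorm_mul, e1, mul_one]
        _ = ((∫⁻ t, ‖mu t p.1.1‖ₑ * ‖la t p.2.1‖ₑ ∂τ) *
              ∫⁻ t, ‖mu' t p.1.2‖ₑ * ‖la' t p.2.2‖ₑ ∂τ') * (‖ft2 f p.1‖ₑ * ‖ft2 g p.2‖ₑ) := by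
            rw [lintegral_mul_const' _ _ (ENNReal.mul_ne_top enorm_ne_top enorm_ne_top),
              lintegral_prod_mul (n1 _ _).aemeasurable (n2 _ _).aemeasurable]
        _ ≤ ((C * ENNReal.ofReal ((1 + |p.1.1| ^ α) * (1 + |p.2.1| ^ α))) *
              (C' * ENNReal.ofReal ((1 + |p.1.2| ^ β) * (1 + |p.2.2| ^ β)))) *
              (‖ft2 f p.1‖ₑ * ‖ft2 g p.2‖ₑ) := by
            gcongr
            · exact hb _ _ hp.1.1 hp.2.1
            · exact hb' _ _ hp.1.2 hp.2.2
        _ = _ := by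
            have e2 : ∀ r : ℝ, 0 ≤ r → ‖(r : ℂ)‖ₑ = ENNReal.ofReal r := fun r hr => by
              rw [← ofReal_norm, Complex.norm_real, Real.norm_of_nonneg hr]
            rw [enorm_mul, enorm_mul, enorm_mul, e2 _ (by positivity), e2 _ (by positivity),
              ENNReal.ofReal_mul (by positivity), ENNReal.ofReal_mul (by positivity),
              ENNReal.ofReal_mul (by positivity), ENNReal.ofReal_mul (by positivity)]
            ring
    · rw [lintegral_const_mul' _ _ (ENNReal.mul_ne_top hC hC')]
      exact ENNReal.mul_lt_top (ENNReal.mul_lt_top hC.lt_top hC'.lt_top) hF.2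
  have e3 : ∀ p : (ℝ × ℝ) × (ℝ × ℝ), ∫ t, Φ (p, t) ∂(τ.prod τ') =
      ((∫ t, mu t p.1.1 * la t p.2.1 ∂τ) * (∫ t, mu' t p.1.2 * la' t p.2.2 ∂τ')) *
        ((ft2 f p.1 * ex2 z p.1) * (ft2 g p.2 * ex2 z p.2)) := fun p => by
    simp only [hΦ]
    rw [integral_mul_const, integral_prod_mul (fun t => mu t p.1.1 * la t p.2.1)
      (fun t => mu' t p.1.2 * la' t p.2.2)]
  have e4 : ∀ t : T × T', ∫ p, Φ (p, t) =
      IF2 (fun ξ => mu t.1 ξ.1 * (mu' t.2 ξ.2 * ft2 f ξ)) z *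
        IF2 (fun ξ => la t.1 ξ.1 * (la' t.2 ξ.2 * ft2 g ξ)) z := fun t => by
    simp only [hΦ, IF2]
    rw [← integral_prod_mul, ← Measure.volume_eq_prod]
    refine integral_congr_ae (Filter.Eventually.of_forall fun p => ?_)
    beta_reduce
    ring
  refine ⟨by simp_rw [← e3]; exact hi.integral_prod_left, ?_⟩
  simp_rw [← e3]
  rw [integral_integral_swap (f := fun p t => Φ (p, t)) hi]
  refine (enorm_integral_le_lintegral_enorm _).trans ?_
  refine (lintegral_prod_le _).trans_eq ?_
  simp_rw [e4, enorm_mul]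

lemma enorm_fracD_mul_le {I I' T T' : Type*} [Fintype I] [Fintype I'] [MeasurableSpace T]
    [MeasurableSpace T'] (τ : I → Measure T) (τ' : I' → Measure T') [∀ i, SFinite (τ i)]
    [∀ i, SFinite (τ' i)]
    {mu la : I → T → ℝ → ℂ} {mu' la' : I' → T' → ℝ → ℂ}
    (hmu : ∀ i, Measurable (Function.uncurry (mu i)))
    (hla : ∀ i, Measurable (Function.uncurry (la i)))
    (hmu' : ∀ i, Measurable (Function.uncurry (mu' i)))
    (hla' : ∀ i, Measurable (Function.uncurry (la' i)))
    {α β : ℝ} (hα : 0 ≤ α) (hβ : 0 ≤ β) {C C' : ℝ≥0∞} (hC : C ≠ ∞) (hC' : C' ≠ ∞)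
    (hb : ∀ i, ∀ ξ η : ℝ, ξ ≠ 0 → η ≠ 0 → ∫⁻ t, ‖mu i t ξ‖ₑ * ‖la i t η‖ₑ ∂τ i ≤
      C * ENNReal.ofReal ((1 + |ξ| ^ α) * (1 + |η| ^ α)))
    (hb' : ∀ i, ∀ ξ η : ℝ, ξ ≠ 0 → η ≠ 0 → ∫⁻ t, ‖mu' i t ξ‖ₑ * ‖la' i t η‖ₑ ∂τ' i ≤
      C' * ENNReal.ofReal ((1 + |ξ| ^ β) * (1 + |η| ^ β)))
    (hs : ∀ ξ η : ℝ, ξ ≠ 0 → η ≠ 0 →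
      ((|ξ + η| ^ α : ℝ) : ℂ) = ∑ i, ∫ t, mu i t ξ * la i t η ∂τ i)
    (hs' : ∀ ξ η : ℝ, ξ ≠ 0 → η ≠ 0 →
      ((|ξ + η| ^ β : ℝ) : ℂ) = ∑ i, ∫ t, mu' i t ξ * la' i t η ∂τ' i)
    (f g : SchwartzMap (ℝ × ℝ) ℂ) (z : ℝ × ℝ) :
    ‖fracD α β (fun z => f z * g z) z‖ₑ ≤ ∑ i, ∑ i',
      ∫⁻ t, ∫⁻ t', ‖IF2 (fun ξ => mu i t ξ.1 * (mu' i' t' ξ.2 * ft2 f ξ)) z‖ₑ *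
        ‖IF2 (fun ξ => la i t ξ.1 * (la' i' t' ξ.2 * ft2 g ξ)) z‖ₑ ∂τ' i' ∂τ i := by
  have key := fun i i' => enorm_integral_superposition_le (τ i) (τ' i') (hmu i) (hla i) (hmu' i')
    (hla' i') hα hβ hC hC' (hb i) (hb' i') f g z
  have : fracD α β (fun z => f z * g z) z = ∑ i, ∑ i', ∫ p : (ℝ × ℝ) × (ℝ × ℝ),
      ((∫ t, mu i t p.1.1 * la i t p.2.1 ∂τ i) *
        (∫ t, mu' i' t p.1.2 * la' i' t p.2.2 ∂τ' i')) *
        ((ft2 f p.1 * ex2 z p.1) * (ft2 g p.2 * ex2 z p.2)) := by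
    rw [fracD_mul_eq f g hα hβ]
    simp_rw [← integral_finset_sum _ fun i' _ => (key _ i').1]
    rw [← integral_finset_sum _ fun i _ => integrable_finset_sum _ fun i' _ => (key i i').1]
    refine integral_congr_ae ?_
    filter_upwards [ae_coord_ne_zero] with p hp
    rw [Complex.ofReal_mul, hs _ _ hp.1.1 hp.2.1, hs' _ _ hp.1.2 hp.2.2, Finset.sum_mul_sum,
      Finset.sum_mul]
    simp_rw [Finset.sum_mul]
  rw [this]
  refine (enorm_sum_le _ _).trans (Finset.sum_le_sum fun i _ => ?_)
  exact (enorm_sum_le _ _).trans (Finset.sum_le_sum fun i' _ => (key i i').2)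

end Bilinear

section Kernels

open FourierTransform

/-- A Fourier multiplier in one of the variables acts as a superposition of translations. -/
lemma enorm_IF2_fourier_mul_le {κ : ℝ → ℂ} (hκ : Integrable κ) {W : ℝ × ℝ → ℂ}
    (hW : Integrable W) (d z : ℝ × ℝ) :
    ‖IF2 (fun ξ => 𝓕 κ (d.1 * ξ.1 + d.2 * ξ.2) * W ξ) z‖ₑ ≤
      ∫⁻ v, ‖κ v‖ₑ * ‖IF2 W (z.1 - v * d.1, z.2 - v * d.2)‖ₑ := by
  have hexp : ∀ (v : ℝ) (ξ : ℝ × ℝ),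
      Complex.exp (((-2 * Real.pi * v * (d.1 * ξ.1 + d.2 * ξ.2) : ℝ) : ℂ) * Complex.I) * ex2 z ξ =
        ex2 (z.1 - v * d.1, z.2 - v * d.2) ξ := fun v ξ => by
    unfold ex2
    rw [← Complex.exp_add]
    congr 1
    push_cast
    ring
  have hInt : Integrable (Function.uncurry fun (ξ : ℝ × ℝ) (v : ℝ) =>
      W ξ * κ v * ex2 (z.1 - v * d.1, z.2 - v * d.2) ξ) (volume.prod volume) := by
    refine (hW.mul_prod hκ).mul_bdd (c := 1) ?_ ?_
    · exact (continuous_ex2.comp (by fun_prop : Continuous fun p : (ℝ × ℝ) × ℝ =>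
        ((z.1 - p.2 * d.1, z.2 - p.2 * d.2), p.1))).aestronglyMeasurable
    · exact Filter.Eventually.of_forall fun p => (norm_ex2 _ _).le
  have : IF2 (fun ξ => 𝓕 κ (d.1 * ξ.1 + d.2 * ξ.2) * W ξ) z =
      ∫ v, κ v * IF2 W (z.1 - v * d.1, z.2 - v * d.2) := by
    calc IF2 (fun ξ => 𝓕 κ (d.1 * ξ.1 + d.2 * ξ.2) * W ξ) z
        = ∫ ξ, ∫ v, W ξ * κ v * ex2 (z.1 - v * d.1, z.2 - v * d.2) ξ := by
          refine integral_congr_ae (Filter.Eventually.of_forall fun ξ => ?_)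
          beta_reduce
          rw [Real.fourier_real_eq_integral_exp_smul, mul_assoc, ← integral_mul_const]
          refine integral_congr_ae (Filter.Eventually.of_forall fun v => ?_)
          beta_reduce
          rw [← hexp, smul_eq_mul]
          ring
      _ = ∫ v, ∫ ξ, W ξ * κ v * ex2 (z.1 - v * d.1, z.2 - v * d.2) ξ :=
          integral_integral_swap hInt
      _ = _ := by
          refine integral_congr_ae (Filter.Eventually.of_forall fun v => ?_)
          beta_reduce
          rw [IF2, ← integral_const_mul]
          refine integral_congr_ae (Filter.Eventually.of_forall fun ξ => ?_)
          beta_reduce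
          ring
  rw [this]
  refine (enorm_integral_le_lintegral_enorm _).trans_eq ?_
  simp_rw [enorm_mul]

/-- The symbol `m` is `|ξ|^γ` times the Fourier transform of a kernel of size
`A 2^{-γ l}`, localized at scale `2^{-l}` around `w`. -/
def KB (γ : ℝ) (m : ℝ → ℂ) (l : ℤ) (w : ℝ) (A : ℝ≥0∞) : Prop :=
  ∃ κ : ℝ → ℂ, Integrable κ ∧ (∀ ξ, m ξ = ((|ξ| ^ γ : ℝ) : ℂ) * 𝓕 κ ξ) ∧
    ∀ v, ‖κ v‖ₑ ≤ A * t2 (-γ * l) * omg l (v - w)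

lemma KB.mono {γ : ℝ} {m : ℝ → ℂ} {l : ℤ} {w : ℝ} {A A' : ℝ≥0∞} (h : KB γ m l w A)
    (hA : A ≤ A') : KB γ m l w A' := by
  obtain ⟨κ, h1, h2, h3⟩ := h
  exact ⟨κ, h1, h2, fun v => (h3 v).trans (by gcongr)⟩

lemma KB.add {γ : ℝ} {m m' : ℝ → ℂ} {l : ℤ} {w : ℝ} {A A' : ℝ≥0∞} (h : KB γ m l w A)
    (h' : KB γ m' l w A') : KB γ (fun ξ => m ξ + m' ξ) l w (A + A') := by
  obtain ⟨κ, h1, h2, h3⟩ := h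
  obtain ⟨κ', h1', h2', h3'⟩ := h'
  refine ⟨κ + κ', h1.add h1', fun ξ => ?_, fun v => ?_⟩
  · beta_reduce
    rw [h2, h2', ← mul_add]
    congr 1
    simp only [Real.fourier_real_eq_integral_exp_smul, Pi.add_apply, smul_add]
    refine (integral_add ?_ ?_).symm
    · exact h1.bdd_mul (c := 1) (by fun_prop)
        (Filter.Eventually.of_forall fun v => (Complex.norm_exp_ofReal_mul_I _).le)
    · exact h1'.bdd_mul (c := 1) (by fun_prop)
        (Filter.Eventually.of_forall fun v => (Complex.norm_exp_ofReal_mul_I _).le)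
  · rw [Pi.add_apply, add_mul, add_mul]
    exact (enorm_add_le _ _).trans (add_le_add (h3 v) (h3' v))

lemma KB.const_mul {γ : ℝ} {m : ℝ → ℂ} {l : ℤ} {w : ℝ} {A : ℝ≥0∞} (h : KB γ m l w A) (c : ℂ) :
    KB γ (fun ξ => c * m ξ) l w (‖c‖ₑ * A) := by
  obtain ⟨κ, h1, h2, h3⟩ := h
  refine ⟨fun v => c * κ v, h1.const_mul c, fun ξ => ?_, fun v => ?_⟩
  · beta_reduce
    rw [h2, mul_left_comm]
    congr 1
    simp only [Real.fourier_real_eq_integral_exp_smul, smul_eq_mul]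
    rw [← integral_const_mul]
    refine integral_congr_ae (Filter.Eventually.of_forall fun v => ?_)
    beta_reduce
    ring
  · rw [enorm_mul, mul_assoc, mul_assoc, ← mul_assoc A]
    exact mul_le_mul_right (h3 v) _

lemma KB.enorm_le {γ : ℝ} {m : ℝ → ℂ} {l : ℤ} {w : ℝ} {A : ℝ≥0∞} (h : KB γ m l w A) (ξ : ℝ) :
    ‖m ξ‖ₑ ≤ ENNReal.ofReal (|ξ| ^ γ) * (A * t2 (-γ * l) * ∫⁻ v, omg l (v - w)) := by
  obtain ⟨κ, h1, h2, h3⟩ := h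
  have mo : Measurable fun v => omg l (v - w) := by
    have m := measurable_omg l
    fun_prop
  rw [h2, enorm_mul, ← lintegral_const_mul _ mo]
  gcongr
  · rw [← ofReal_norm, Complex.norm_real, Real.norm_of_nonneg (by positivity)]
  · rw [Real.fourier_real_eq_integral_exp_smul]
    refine (enorm_integral_le_lintegral_enorm _).trans (lintegral_mono fun v => ?_)
    beta_reduce
    have : ‖Complex.exp (((-2 * Real.pi * v * ξ : ℝ) : ℂ) * Complex.I)‖ₑ = 1 := by
      rw [← ofReal_norm, Complex.norm_exp_ofReal_mul_I, ENNReal.ofReal_one]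
    rw [enorm_smul, this, one_mul]
    exact h3 v

lemma lintegral_omg_sub_mul (l : ℤ) (w x : ℝ) (u : ℝ → ℝ≥0∞) :
    ∫⁻ v, omg l (v - w) * u (x - v) = cnv (omg l) u (x - w) := by
  unfold cnv
  rw [← lintegral_sub_left_eq_self _ x]
  refine lintegral_congr fun v => ?_
  rw [show x - (x - v) = v by ring, sub_right_comm]

lemma KB.enorm_IF2_fst_le {γ : ℝ} {m : ℝ → ℂ} {l : ℤ} {w : ℝ} {A : ℝ≥0∞} (h : KB γ m l w A)
    {W : ℝ × ℝ → ℂ} (hW : Integrable fun ξ : ℝ × ℝ => ((|ξ.1| ^ γ : ℝ) : ℂ) * W ξ) (x y : ℝ) :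
    ‖IF2 (fun ξ => m ξ.1 * W ξ) (x, y)‖ₑ ≤ A * t2 (-γ * l) * cnv (omg l)
      (fun x' => ‖IF2 (fun ξ : ℝ × ℝ => ((|ξ.1| ^ γ : ℝ) : ℂ) * W ξ) (x', y)‖ₑ) (x - w) := by
  obtain ⟨κ, h1, h2, h3⟩ := h
  have := enorm_IF2_fourier_mul_le h1 hW (1, 0) (x, y)
  simp only [one_mul, zero_mul, add_zero, mul_one, mul_zero, sub_zero] at this
  have e : (fun ξ : ℝ × ℝ => m ξ.1 * W ξ) =
      fun ξ => 𝓕 κ ξ.1 * (((|ξ.1| ^ γ : ℝ) : ℂ) * W ξ) := by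
    funext ξ; rw [h2]; ring
  rw [e]
  refine this.trans ?_
  have mo : Measurable fun v => omg l (v - w) := by
    have m := measurable_omg l
    fun_prop
  have mc := (continuous_IF2 hW).enorm.measurable
  have mc' : Measurable fun v =>
      ‖IF2 (fun ξ : ℝ × ℝ => ((|ξ.1| ^ γ : ℝ) : ℂ) * W ξ) (x - v, y)‖ₑ :=
    mc.comp (by fun_prop : Measurable fun v => (x - v, y))
  have mm : Measurable fun v => omg l (v - w) *
      ‖IF2 (fun ξ : ℝ × ℝ => ((|ξ.1| ^ γ : ℝ) : ℂ) * W ξ) (x - v, y)‖ₑ := mo.mul mc'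
  rw [← lintegral_omg_sub_mul, ← lintegral_const_mul _ mm]
  refine lintegral_mono fun v => ?_
  beta_reduce
  rw [← mul_assoc]
  exact mul_le_mul_left (h3 v) _

lemma KB.enorm_IF2_snd_le {γ : ℝ} {m : ℝ → ℂ} {l : ℤ} {w : ℝ} {A : ℝ≥0∞} (h : KB γ m l w A)
    {W : ℝ × ℝ → ℂ} (hW : Integrable fun ξ : ℝ × ℝ => ((|ξ.2| ^ γ : ℝ) : ℂ) * W ξ) (x y : ℝ) :
    ‖IF2 (fun ξ => m ξ.2 * W ξ) (x, y)‖ₑ ≤ A * t2 (-γ * l) * cnv (omg l)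
      (fun y' => ‖IF2 (fun ξ : ℝ × ℝ => ((|ξ.2| ^ γ : ℝ) : ℂ) * W ξ) (x, y')‖ₑ) (y - w) := by
  obtain ⟨κ, h1, h2, h3⟩ := h
  have := enorm_IF2_fourier_mul_le h1 hW (0, 1) (x, y)
  simp only [one_mul, zero_mul, zero_add, mul_one, mul_zero, sub_zero] at this
  have e : (fun ξ : ℝ × ℝ => m ξ.2 * W ξ) =
      fun ξ => 𝓕 κ ξ.2 * (((|ξ.2| ^ γ : ℝ) : ℂ) * W ξ) := by
    funext ξ; rw [h2]; ring
  rw [e]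
  refine this.trans ?_
  have mo : Measurable fun v => omg l (v - w) := by
    have m := measurable_omg l
    fun_prop
  have mc := (continuous_IF2 hW).enorm.measurable
  have mc' : Measurable fun v =>
      ‖IF2 (fun ξ : ℝ × ℝ => ((|ξ.2| ^ γ : ℝ) : ℂ) * W ξ) (x, y - v)‖ₑ :=
    mc.comp (by fun_prop : Measurable fun v => (x, y - v))
  have mm : Measurable fun v => omg l (v - w) *
      ‖IF2 (fun ξ : ℝ × ℝ => ((|ξ.2| ^ γ : ℝ) : ℂ) * W ξ) (x, y - v)‖ₑ := mo.mul mc'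
  rw [← lintegral_omg_sub_mul, ← lintegral_const_mul _ mm]
  refine lintegral_mono fun v => ?_
  beta_reduce
  rw [← mul_assoc]
  exact mul_le_mul_left (h3 v) _

/-- A localized multiplier in the first variable, against `|ξ₂|^γ'` in the second one. -/
lemma KB.enorm_left_le {γ γ' : ℝ} (hγ : 0 ≤ γ) (hγ' : 0 ≤ γ') {m : ℝ → ℂ} {l : ℤ} {w : ℝ}
    {A : ℝ≥0∞} (h : KB γ m l w A) (f : SchwartzMap (ℝ × ℝ) ℂ) (x y : ℝ) :
    ‖IF2 (fun ξ => m ξ.1 * (((|ξ.2| ^ γ' : ℝ) : ℂ) * ft2 f ξ)) (x, y)‖ₑ ≤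
      A * t2 (-γ * l) * cnv (omg l) (fun x' => ‖fracD γ γ' f (x', y)‖ₑ) (x - w) := by
  have e : (fun ξ : ℝ × ℝ => ((|ξ.1| ^ γ : ℝ) : ℂ) * (((|ξ.2| ^ γ' : ℝ) : ℂ) * ft2 f ξ)) =
      fun ξ : ℝ × ℝ => ((|ξ.1| ^ γ * |ξ.2| ^ γ' : ℝ) : ℂ) * ft2 f ξ := by
    funext ξ; push_cast; ring
  have := h.enorm_IF2_fst_le (W := fun ξ => ((|ξ.2| ^ γ' : ℝ) : ℂ) * ft2 f ξ)
    (by rw [e]; exact integrable_fracD_weight f hγ hγ') x y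
  rw [e] at this
  exact this

lemma KB.enorm_right_le {γ γ' : ℝ} (hγ : 0 ≤ γ) (hγ' : 0 ≤ γ') {m : ℝ → ℂ} {l : ℤ} {w : ℝ}
    {A : ℝ≥0∞} (h : KB γ' m l w A) (f : SchwartzMap (ℝ × ℝ) ℂ) (x y : ℝ) :
    ‖IF2 (fun ξ => ((|ξ.1| ^ γ : ℝ) : ℂ) * (m ξ.2 * ft2 f ξ)) (x, y)‖ₑ ≤
      A * t2 (-γ' * l) * cnv (omg l) (fun y' => ‖fracD γ γ' f (x, y')‖ₑ) (y - w) := by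
  have e : (fun ξ : ℝ × ℝ => ((|ξ.2| ^ γ' : ℝ) : ℂ) * (((|ξ.1| ^ γ : ℝ) : ℂ) * ft2 f ξ)) =
      fun ξ : ℝ × ℝ => ((|ξ.1| ^ γ * |ξ.2| ^ γ' : ℝ) : ℂ) * ft2 f ξ := by
    funext ξ; push_cast; ring
  have := h.enorm_IF2_snd_le (W := fun ξ => ((|ξ.1| ^ γ : ℝ) : ℂ) * ft2 f ξ)
    (by rw [e]; exact integrable_fracD_weight f hγ hγ') x y
  rw [e] at this
  simp_rw [mul_left_comm (m _)] at this
  exact this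

lemma KB.exists_norm_le {γ : ℝ} {m : ℝ → ℂ} {l : ℤ} {w : ℝ} {A : ℝ≥0∞} (h : KB γ m l w A) :
    ∃ C : ℝ, ∀ ξ, ‖m ξ‖ ≤ C * |ξ| ^ γ := by
  obtain ⟨κ, h1, h2, h3⟩ := h
  refine ⟨∫ v, ‖κ v‖, fun ξ => ?_⟩
  rw [h2, norm_mul, Complex.norm_real, Real.norm_of_nonneg (by positivity), mul_comm]
  refine mul_le_mul_of_nonneg_right ?_ (by positivity)
  rw [Real.fourier_real_eq_integral_exp_smul]
  refine (norm_integral_le_integral_norm _).trans_eq ?_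
  refine integral_congr_ae (Filter.Eventually.of_forall fun v => ?_)
  beta_reduce
  rw [norm_smul, Complex.norm_exp_ofReal_mul_I, one_mul]

/-- Localized multipliers in both variables. -/
lemma KB.enorm_both_le {γ γ' : ℝ} (hγ : 0 ≤ γ) (hγ' : 0 ≤ γ') {m m' : ℝ → ℂ} {l l' : ℤ}
    {w w' : ℝ} {A A' : ℝ≥0∞} (h : KB γ m l w A) (h' : KB γ' m' l' w' A')
    (hm : Measurable m) (hA : A ≠ ∞) (f : SchwartzMap (ℝ × ℝ) ℂ) (x y : ℝ) :
    ‖IF2 (fun ξ => m ξ.1 * (m' ξ.2 * ft2 f ξ)) (x, y)‖ₑ ≤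
      A * A' * (t2 (-γ * l) * t2 (-γ' * l')) *
        cnv2 l l' (fun z => ‖fracD γ γ' f z‖ₑ) (x - w, y - w') := by
  obtain ⟨C, hC⟩ := h.exists_norm_le
  have hC0 : 0 ≤ C := by simpa using (norm_nonneg _).trans (hC 1)
  have hInt : Integrable fun ξ : ℝ × ℝ => ((|ξ.2| ^ γ' : ℝ) : ℂ) * (m ξ.1 * ft2 f ξ) := by
    have hi := integrable_mul_ft2_of_le f (C := C) (m := fun ξ => ((|ξ.2| ^ γ' : ℝ) : ℂ) * m ξ.1)
      hγ hγ' (by fun_prop) fun ξ => ?_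
    · simpa only [mul_assoc] using hi
    · rw [norm_mul, Complex.norm_real, Real.norm_of_nonneg (by positivity)]
      have h1 := rpow_abs_le_one_add hγ le_rfl ξ.1
      have h2 := rpow_abs_le_one_add hγ' le_rfl ξ.2
      calc |ξ.2| ^ γ' * ‖m ξ.1‖ ≤ (1 + |ξ.2| ^ γ') * (C * (1 + |ξ.1| ^ γ)) := by
            refine mul_le_mul h2 ((hC _).trans ?_) (norm_nonneg _) (by positivity)
            exact mul_le_mul_of_nonneg_left h1 hC0
        _ = _ := by ring
  have k := h'.enorm_IF2_snd_le hInt x y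
  have k' := fun y' => h.enorm_left_le hγ hγ' f x y'
  have e1 : (fun ξ : ℝ × ℝ => m ξ.1 * (m' ξ.2 * ft2 f ξ)) =
      fun ξ => m' ξ.2 * (m ξ.1 * ft2 f ξ) := by funext ξ; ring
  have e2 : (fun ξ : ℝ × ℝ => ((|ξ.2| ^ γ' : ℝ) : ℂ) * (m ξ.1 * ft2 f ξ)) =
      fun ξ => m ξ.1 * (((|ξ.2| ^ γ' : ℝ) : ℂ) * ft2 f ξ) := by funext ξ; ring
  rw [e2] at k
  rw [e1]
  refine (k.trans (mul_le_mul_right (cnv_mono _ k' _) _)).trans_eq ?_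
  have hc : A * t2 (-γ * l) ≠ ∞ := ENNReal.mul_ne_top hA (t2_ne_top _)
  simp only [cnv2, cnv]
  simp_rw [mul_left_comm _ (A * t2 (-γ * l))]
  rw [lintegral_const_mul' _ _ hc]
  ring

end Kernels

section BumpFunctions

open FourierTransform ContDiff

/-- A smooth even cutoff, equal to `1` for `ξ² ≤ 1` and to `0` for `ξ² ≥ 2`. -/
noncomputable def phC (ξ : ℝ) : ℂ := (Real.smoothTransition (2 - ξ ^ 2) : ℝ)

/-- The Littlewood–Paley function `φ(ξ) - φ(2ξ)`. -/
noncomputable def psC (ξ : ℝ) : ℂ := phC ξ - phC (2 * ξ)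

lemma phC_of_le {ξ : ℝ} (h : |ξ| ≤ 1) : phC ξ = 1 := by
  have : ξ ^ 2 ≤ 1 := by rw [← sq_abs]; exact pow_le_one₀ (abs_nonneg _) h
  rw [phC, Real.smoothTransition.one_of_one_le (by linarith), Complex.ofReal_one]

lemma phC_of_ge {ξ : ℝ} (h : 3 / 2 ≤ |ξ|) : phC ξ = 0 := by
  have : (3 / 2) ^ 2 ≤ ξ ^ 2 := by rw [← sq_abs ξ]; gcongr
  rw [phC, Real.smoothTransition.zero_of_nonpos (by linarith), Complex.ofReal_zero]

lemma contDiff_phC : ContDiff ℝ ∞ phC := by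
  unfold phC
  exact Complex.ofRealCLM.contDiff.comp
    (Real.smoothTransition.contDiff.comp (contDiff_const.sub (contDiff_id.pow 2)))

lemma contDiff_psC : ContDiff ℝ ∞ psC := by
  unfold psC
  exact contDiff_phC.sub (contDiff_phC.comp (contDiff_const.mul contDiff_id))

lemma hasCompactSupport_of_abs_ge {χ : ℝ → ℂ} {R : ℝ} (h : ∀ ξ, R ≤ |ξ| → χ ξ = 0) :
    HasCompactSupport χ := by
  refine HasCompactSupport.of_support_subset_isCompact (isCompact_closedBall (0 : ℝ) R)
    fun ξ hξ => ?_
  rw [mem_closedBall_zero_iff, Real.norm_eq_abs]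
  by_contra hc
  exact hξ (h ξ (not_le.1 hc).le)

lemma psC_of_ge {ξ : ℝ} (h : 3 / 2 ≤ |ξ|) : psC ξ = 0 := by
  rw [psC, phC_of_ge h, phC_of_ge (by rw [abs_mul, abs_two]; linarith), sub_zero]

lemma psC_of_le {ξ : ℝ} (h : |ξ| ≤ 1 / 2) : psC ξ = 0 := by
  rw [psC, phC_of_le (by linarith), phC_of_le (by rw [abs_mul, abs_two]; linarith), sub_self]

/-- A compactly supported smooth function is the Fourier transform of a Schwartz function. -/
lemma exists_fourier_eq {χ : ℝ → ℂ} (h : ContDiff ℝ ∞ χ) (hc : HasCompactSupport χ) :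
    ∃ g : SchwartzMap ℝ ℂ, ∀ ξ, 𝓕 (g : ℝ → ℂ) ξ = χ ξ := by
  refine ⟨𝓕⁻ (hc.toSchwartzMap h), fun ξ => ?_⟩
  rw [← SchwartzMap.fourier_coe, FourierTransform.fourier_fourierInv_eq]
  rfl

lemma contDiff_abs_rpow_mul {χ : ℝ → ℂ} (h : ContDiff ℝ ∞ χ) {r : ℝ} (hr : 0 < r)
    (h0 : ∀ ξ, |ξ| < r → χ ξ = 0) (p : ℝ) :
    ContDiff ℝ ∞ fun ξ => ((|ξ| ^ p : ℝ) : ℂ) * χ ξ := by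
  rw [contDiff_iff_contDiffAt]
  intro ξ
  rcases eq_or_ne ξ 0 with rfl | hξ
  · refine (contDiffAt_const (c := (0 : ℂ))).congr_of_eventuallyEq ?_
    filter_upwards [Metric.ball_mem_nhds (0 : ℝ) hr] with ξ hξ
    rw [h0 ξ (by simpa using hξ), mul_zero]
  · exact (Complex.ofRealCLM.contDiff.contDiffAt.comp ξ
      ((contDiffAt_abs hξ).rpow_const_of_ne (abs_pos.2 hξ).ne')).mul h.contDiffAt

lemma SchwartzMap.exists_decay (g : SchwartzMap ℝ ℂ) (N : ℕ) :
    ∃ C : ℝ, 0 ≤ C ∧ ∀ v, ‖g v‖ ≤ C * (1 + |v|)⁻¹ ^ N := by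
  obtain ⟨C, hC⟩ : ∃ C : ℝ, ∀ v, (1 + ‖v‖) ^ N * ‖g v‖ ≤ C := by
    refine ⟨2 ^ N * (Finset.Iic (N, 0)).sup
      (fun m => SchwartzMap.seminorm ℝ m.1 m.2) g, fun v => ?_⟩
    have := SchwartzMap.one_add_le_sup_seminorm_apply (𝕜 := ℝ) (m := (N, 0)) (k := N) (n := 0)
      le_rfl le_rfl g v
    rwa [norm_iteratedFDeriv_zero] at this
  refine ⟨C, ?_, fun v => ?_⟩
  · exact (by positivity : (0 : ℝ) ≤ (1 + ‖(0 : ℝ)‖) ^ N * ‖g 0‖).trans (hC 0)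
  · have := hC v
    rw [Real.norm_eq_abs] at this
    rw [inv_pow, ← div_eq_mul_inv, le_div_iff₀ (by positivity), mul_comm]
    exact this

/-- The character `e^{2πit}`. -/
noncomputable def eC (t : ℝ) : ℂ := Complex.exp (((2 * Real.pi * t : ℝ) : ℂ) * Complex.I)

lemma continuous_eC : Continuous eC := by unfold eC; fun_prop

lemma norm_eC (t : ℝ) : ‖eC t‖ = 1 := Complex.norm_exp_ofReal_mul_I _

lemma eC_add (s t : ℝ) : eC (s + t) = eC s * eC t := by
  unfold eC
  rw [← Complex.exp_add]
  congr 1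
  push_cast
  ring

lemma eC_zero : eC 0 = 1 := by simp [eC]

lemma fourier_eq_integral_eC (g : ℝ → ℂ) (ξ : ℝ) : 𝓕 g ξ = ∫ v, g v * eC (-(v * ξ)) := by
  rw [Real.fourier_real_eq_integral_exp_smul]
  refine integral_congr_ae (Filter.Eventually.of_forall fun v => ?_)
  beta_reduce
  rw [smul_eq_mul, mul_comm, eC]
  congr 3
  push_cast
  ring

lemma integral_dilate_mul_eC (g : ℝ → ℂ) (l : ℤ) (ζ : ℝ) :
    (((2 : ℝ) ^ l : ℝ) : ℂ) * ∫ v, g (2 ^ l * v) * eC (-(v * ζ)) = 𝓕 g (2 ^ (-l) * ζ) := by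
  have h2 : (0 : ℝ) < 2 ^ l := by positivity
  have := Measure.integral_comp_mul_left (fun v => g v * eC (-(v * (2 ^ (-l) * ζ)))) ((2 : ℝ) ^ l)
  rw [fourier_eq_integral_eC]
  have e : ∀ v : ℝ, (2 : ℝ) ^ l * v * (2 ^ (-l) * ζ) = v * ζ := fun v => by
    rw [zpow_neg]; field_simp
  simp_rw [e] at this
  rw [this, abs_of_pos (by positivity), ← Complex.real_smul, smul_smul,
    mul_inv_cancel₀ h2.ne', one_smul]

lemma fourier_dilate_translate (g : ℝ → ℂ) (l : ℤ) (w ξ : ℝ) :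
    𝓕 (fun v => (((2 : ℝ) ^ l : ℝ) : ℂ) * g (2 ^ l * (v - w))) ξ =
      eC (-(w * ξ)) * 𝓕 g (2 ^ (-l) * ξ) := by
  rw [← integral_dilate_mul_eC, fourier_eq_integral_eC]
  simp_rw [mul_assoc]
  rw [integral_const_mul, mul_left_comm]
  congr 1
  symm
  rw [← integral_const_mul, ← integral_sub_right_eq_self _ w]
  refine integral_congr_ae (Filter.Eventually.of_forall fun v => ?_)
  beta_reduce
  rw [mul_left_comm, ← eC_add]
  congr 2
  ring

lemma SchwartzMap.integrable_dilate (g : SchwartzMap ℝ ℂ) (l : ℤ) (w : ℝ) :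
    Integrable fun v => g (2 ^ l * (v - w)) :=
  (g.integrable.comp_mul_left' (by positivity : (2 : ℝ) ^ l ≠ 0)).comp_sub_right w

end BumpFunctions

section LocalizedMultipliers

open FourierTransform ContDiff

lemma ofReal_dilate_eq_omg (l : ℤ) (c z : ℝ) (hc : 0 ≤ c) :
    ENNReal.ofReal (c * (2 ^ l * (1 + 2 ^ l * |z|)⁻¹ ^ 2)) =
      ENNReal.ofReal (4 * c) * omg l z := by
  rw [omg, ← ENNReal.ofReal_mul (by positivity), zpow_sub₀ two_ne_zero]
  congr 1
  norm_num
  ring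

lemma abs_rpow_mul_dilate {χ : ℝ → ℂ} (h0 : χ 0 = 0) (γ : ℝ) (l : ℤ) (η : ℝ) :
    ((|η| ^ γ : ℝ) : ℂ) * ((((2 : ℝ) ^ (-γ * l) : ℝ) : ℂ) *
      (((|2 ^ (-l) * η| ^ (-γ) : ℝ) : ℂ) * χ (2 ^ (-l) * η))) = χ (2 ^ (-l) * η) := by
  rcases eq_or_ne η 0 with rfl | hη
  · rw [mul_zero, h0]; simp
  · have hη' : 0 < |η| := abs_pos.2 hη
    rw [← mul_assoc, ← mul_assoc, ← Complex.ofReal_mul, ← Complex.ofReal_mul]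
    have : |η| ^ γ * 2 ^ (-γ * (l : ℝ)) * |2 ^ (-l) * η| ^ (-γ) = 1 := by
      rw [abs_mul, abs_of_pos (by positivity : (0 : ℝ) < 2 ^ (-l)),
        Real.mul_rpow (by positivity) (by positivity), ← Real.rpow_intCast,
        ← Real.rpow_mul two_pos.le, Real.rpow_neg hη'.le]
      have e : (2 : ℝ) ^ (-γ * (l : ℝ)) * 2 ^ (((-l : ℤ) : ℝ) * -γ) = 1 := by
        rw [← Real.rpow_add two_pos]
        push_cast
        rw [show -γ * (l : ℝ) + -(l : ℝ) * -γ = 0 by ring, Real.rpow_zero]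
      have e2 : |η| ^ γ * (|η| ^ γ)⁻¹ = 1 := mul_inv_cancel₀ (by positivity)
      calc _ = (2 : ℝ) ^ (-γ * (l : ℝ)) * 2 ^ (((-l : ℤ) : ℝ) * -γ) *
            (|η| ^ γ * (|η| ^ γ)⁻¹) := by ring
        _ = 1 := by rw [e, e2, one_mul]
    rw [this, Complex.ofReal_one, one_mul]

lemma KB.of_kernel {γ : ℝ} {m κ : ℝ → ℂ} {l : ℤ} {w C : ℝ} (hC : 0 ≤ C) (hκ : Integrable κ)
    (hm : ∀ ξ, m ξ = ((|ξ| ^ γ : ℝ) : ℂ) * ((((2 : ℝ) ^ (-γ * l) : ℝ) : ℂ) * 𝓕 κ ξ))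
    (h : ∀ v, ‖κ v‖ ≤ C * (2 ^ l * (1 + 2 ^ l * |v - w|)⁻¹ ^ 2)) :
    KB γ m l w (ENNReal.ofReal (4 * C)) := by
  refine ⟨fun v => (((2 : ℝ) ^ (-γ * l) : ℝ) : ℂ) * κ v, hκ.const_mul _, fun ξ => ?_, fun v => ?_⟩
  · rw [hm, fourier_eq_integral_eC, fourier_eq_integral_eC, ← integral_const_mul]
    simp_rw [mul_assoc]
  · rw [enorm_mul, t2_eq_ofReal, mul_comm (ENNReal.ofReal (4 * C)), mul_assoc,
      ← ofReal_dilate_eq_omg l C _ hC, ← ofReal_norm, ← ofReal_norm, Complex.norm_real,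
      Real.norm_of_nonneg (by positivity)]
    exact mul_le_mul_right (ENNReal.ofReal_le_ofReal (h v)) _

/-- A modulated dyadic bump is a localized multiplier of every order. -/
lemma exists_KB_modulated {χ : ℝ → ℂ} (h : ContDiff ℝ ∞ χ) {r R : ℝ} (hr : 0 < r)
    (h0 : ∀ ξ, |ξ| < r → χ ξ = 0) (hR : ∀ ξ, R ≤ |ξ| → χ ξ = 0) (γ : ℝ) :
    ∃ C : ℝ, 0 ≤ C ∧ ∀ (l : ℤ) (w : ℝ),
      KB γ (fun η => eC (-(w * η)) * χ (2 ^ (-l) * η)) l w (ENNReal.ofReal C) := by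
  obtain ⟨Ψ, hΨ⟩ := exists_fourier_eq (contDiff_abs_rpow_mul h hr h0 (-γ))
    (hasCompactSupport_of_abs_ge (R := R) fun ξ hξ => by rw [hR ξ hξ, mul_zero])
  obtain ⟨C, hC0, hC⟩ := Ψ.exists_decay 2
  refine ⟨4 * C, by positivity, fun l w => ?_⟩
  have h2 : (0 : ℝ) < 2 ^ l := by positivity
  refine KB.of_kernel (κ := fun v => (((2 : ℝ) ^ l : ℝ) : ℂ) * Ψ (2 ^ l * (v - w))) hC0
    ((Ψ.integrable_dilate l w).const_mul _) (fun η => ?_) fun v => ?_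
  · rw [fourier_dilate_translate, hΨ, mul_left_comm _ (eC _), mul_left_comm _ (eC _),
      abs_rpow_mul_dilate (h0 0 (by simpa using hr))]
  · rw [norm_mul, Complex.norm_real, Real.norm_of_nonneg h2.le, mul_left_comm]
    have := hC (2 ^ l * (v - w))
    rw [abs_mul, abs_of_pos h2] at this
    exact mul_le_mul_of_nonneg_left this h2.le

lemma SchwartzMap.exists_norm_sub_le (g : SchwartzMap ℝ ℂ) :
    ∃ C : ℝ, 0 ≤ C ∧ ∀ a h : ℝ,
      ‖g (a - h) - g a‖ ≤ C * (|h| * (1 + |h|) ^ 2) * (1 + |a - h|)⁻¹ ^ 2 := by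
  obtain ⟨C, hC0, hC⟩ := (SchwartzMap.derivCLM ℝ ℂ g).exists_decay 2
  refine ⟨C, hC0, fun a h => ?_⟩
  have key : ∀ t ∈ segment ℝ a (a - h),
      ‖deriv g t‖ ≤ C * ((1 + |h|) ^ 2 * (1 + |a - h|)⁻¹ ^ 2) := fun t ht => by
    refine (hC t).trans (mul_le_mul_of_nonneg_left ?_ hC0)
    have h1 : |t - (a - h)| ≤ |h| := by
      rw [segment_eq_uIcc] at ht
      have := Set.abs_sub_right_of_mem_uIcc ht
      rw [abs_sub_comm]
      simpa [abs_sub_comm] using this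
    have h2 : 1 + |a - h| ≤ (1 + |h|) * (1 + |t|) := by
      have h3 : |a - h| ≤ |t| + |t - (a - h)| := by
        have := abs_sub_abs_le_abs_sub (a - h) t
        rw [abs_sub_comm (a - h) t] at this
        linarith
      nlinarith [abs_nonneg h, abs_nonneg t]
    rw [← mul_pow]
    refine pow_le_pow_left₀ (by positivity) ?_ 2
    rw [← div_eq_mul_inv, le_div_iff₀ (by positivity), ← div_eq_inv_mul,
      div_le_iff₀ (by positivity)]
    exact h2
  have := Convex.norm_image_sub_le_of_norm_deriv_le (𝕜 := ℝ) (f := g)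
    (fun t _ => g.differentiableAt) key (convex_segment _ _) (left_mem_segment ℝ a (a - h))
    (right_mem_segment ℝ a (a - h))
  refine this.trans_eq ?_
  rw [show a - h - a = -h by ring, norm_neg, Real.norm_eq_abs]
  ring

/-- The difference of a modulated dyadic bump and the unmodulated one. -/
lemma exists_KB_modulated_sub {χ : ℝ → ℂ} (h : ContDiff ℝ ∞ χ) {r R : ℝ} (hr : 0 < r)
    (h0 : ∀ ξ, |ξ| < r → χ ξ = 0) (hR : ∀ ξ, R ≤ |ξ| → χ ξ = 0) (γ : ℝ) :
    ∃ C : ℝ, 0 ≤ C ∧ ∀ (l : ℤ) (w : ℝ),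
      KB γ (fun η => (eC (-(w * η)) - 1) * χ (2 ^ (-l) * η)) l w
        (ENNReal.ofReal (C * (2 ^ l * |w| * (1 + 2 ^ l * |w|) ^ 2))) := by
  obtain ⟨Ψ, hΨ⟩ := exists_fourier_eq (contDiff_abs_rpow_mul h hr h0 (-γ))
    (hasCompactSupport_of_abs_ge (R := R) fun ξ hξ => by rw [hR ξ hξ, mul_zero])
  obtain ⟨C, hC0, hC⟩ := Ψ.exists_norm_sub_le
  refine ⟨4 * C, by positivity, fun l w => ?_⟩
  have h2 : (0 : ℝ) < 2 ^ l := by positivity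
  have i1 := (Ψ.integrable_dilate l w).const_mul (((2 : ℝ) ^ l : ℝ) : ℂ)
  have i2 := (Ψ.integrable_dilate l 0).const_mul (((2 : ℝ) ^ l : ℝ) : ℂ)
  rw [mul_assoc]
  refine KB.of_kernel (κ := fun v => (((2 : ℝ) ^ l : ℝ) : ℂ) * Ψ (2 ^ l * (v - w)) -
    (((2 : ℝ) ^ l : ℝ) : ℂ) * Ψ (2 ^ l * (v - 0))) (by positivity)
    (i1.sub i2) (fun η => ?_) fun v => ?_
  · have e : 𝓕 (fun v => (((2 : ℝ) ^ l : ℝ) : ℂ) * Ψ (2 ^ l * (v - w)) -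
        (((2 : ℝ) ^ l : ℝ) : ℂ) * Ψ (2 ^ l * (v - 0))) η =
        (eC (-(w * η)) - 1) * 𝓕 (Ψ : ℝ → ℂ) (2 ^ (-l) * η) := by
      have e1 := fourier_dilate_translate Ψ l w η
      have e2 := fourier_dilate_translate Ψ l 0 η
      rw [zero_mul, neg_zero, eC_zero] at e2
      rw [sub_mul, ← e1, ← e2]
      simp only [Real.fourier_real_eq_integral_exp_smul, smul_sub]
      refine integral_sub ?_ ?_
      · exact i1.bdd_mul (c := 1) (by fun_prop)
          (Filter.Eventually.of_forall fun v => (Complex.norm_exp_ofReal_mul_I _).le)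
      · exact i2.bdd_mul (c := 1) (by fun_prop)
          (Filter.Eventually.of_forall fun v => (Complex.norm_exp_ofReal_mul_I _).le)
    rw [e, hΨ, mul_left_comm _ (eC _ - 1), mul_left_comm _ (eC _ - 1),
      abs_rpow_mul_dilate (h0 0 (by simpa using hr))]
  · rw [← mul_sub, norm_mul, Complex.norm_real, Real.norm_of_nonneg h2.le, mul_left_comm]
    have := hC (2 ^ l * v) (2 ^ l * w)
    rw [← mul_sub, abs_mul, abs_mul, abs_of_pos h2] at this
    rw [sub_zero]
    exact mul_le_mul_of_nonneg_left this h2.le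

end LocalizedMultipliers

section CommutatorFamily

open FourierTransform ContDiff

/-- The high-frequency member of the commutator family. -/
noncomputable def muF (q : ℤ) (w ξ : ℝ) : ℂ := eC (-(w * ξ)) * psC (2 ^ (-(q - 3)) * ξ)

/-- The coefficient of the difference part of the low-frequency member. -/
noncomputable def cfD (α : ℝ) (q : ℤ) (j n : ℕ) : ℝ :=
  if n = 0 ∧ 7 ≤ j then 2 ^ ((q - 3) * α) * 2 ^ (q - 3) else 0

/-- The coefficient of the diagonal part of the low-frequency member. -/
noncomputable def cfE (α : ℝ) (q : ℤ) (j n : ℕ) : ℝ :=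
  if n = 0 then -(2 ^ ((q - j) * α) * 2 ^ (q - 3)) else 0

/-- The coefficient of the resonant part of the low-frequency member. -/
noncomputable def cfR (α : ℝ) (q : ℤ) (j n : ℕ) : ℝ :=
  if j ≤ 6 then 1 / 2 * (2 ^ ((q + 3 - n) * α) * 2 ^ (q + 3 - n)) else 0

/-- The low-frequency member of the commutator family. -/
noncomputable def laF (α : ℝ) (L Θ Q : ℝ → ℂ) (q : ℤ) (j n : ℕ) (w η : ℝ) : ℂ :=
  cfD α q j n * L (2 ^ (q - 3) * w) * ((eC (-(w * η)) - 1) * psC (2 ^ (-(q - j)) * η)) +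
  cfE α q j n * Θ (2 ^ (q - 3) * w) * (eC (-(w * η)) *
    (((|2 ^ (-(q - j)) * η| ^ α : ℝ) : ℂ) * psC (2 ^ (-(q - j)) * η))) +
  cfR α q j n * Q (2 ^ (q + 3 - n) * w) * (eC (-(w * η)) * psC (2 ^ (-(q - j)) * η))

/-- The size of the low-frequency member. -/
noncomputable def szR (α δ : ℝ) (q : ℤ) (j n : ℕ) (w : ℝ) : ℝ :=
  2 ^ (q * α) * 2 ^ (-δ * j) * 2 ^ (-α * n) *
    (2 ^ (q - (n + 3 : ℕ) : ℤ) * (1 + 2 ^ (q - (n + 3 : ℕ) : ℤ) * |w|)⁻¹ ^ 4)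

lemma szR_nonneg (α δ : ℝ) (q : ℤ) (j n : ℕ) (w : ℝ) : 0 ≤ szR α δ q j n w := by
  unfold szR; positivity

lemma ofReal_szR (α δ : ℝ) (q : ℤ) (j n : ℕ) (w : ℝ) :
    ENNReal.ofReal (szR α δ q j n w) =
      t2 (q * α) * t2 (-δ * j) * t2 (-α * n) * krn (q - (n + 3 : ℕ)) w := by
  rw [szR, krn, t2_eq_ofReal, t2_eq_ofReal, t2_eq_ofReal, ← ENNReal.ofReal_mul (by positivity),
    ← ENNReal.ofReal_mul (by positivity), ← ENNReal.ofReal_mul (by positivity)]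

lemma cfD_mul_le {α δ : ℝ} (hα : 0 < α) (hδ1 : δ ≤ 1) {C : ℝ} (hC : 0 ≤ C)
    {L : ℝ → ℂ} (hL : ∀ v, ‖L v‖ ≤ C * (1 + |v|)⁻¹ ^ 7) (q : ℤ) (j n : ℕ) (w : ℝ) :
    ‖(cfD α q j n : ℂ) * L (2 ^ (q - 3) * w)‖ *
        (2 ^ (q - j) * |w| * (1 + 2 ^ (q - j) * |w|) ^ 2) ≤ 8 * C * szR α δ q j n w := by
  by_cases h : n = 0 ∧ 7 ≤ j
  · rw [cfD, if_pos h]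
    obtain ⟨rfl, hj⟩ := h
    have h2 : (0 : ℝ) < 2 ^ (q - 3) := by positivity
    set u : ℝ := 2 ^ (q - 3) * |w| with hu
    have hu0 : 0 ≤ u := by positivity
    have e1 : (2 : ℝ) ^ (q - j) * |w| = 8 * 2 ^ (-(j : ℝ)) * u := by
      rw [hu, Real.rpow_neg two_pos.le, Real.rpow_natCast, zpow_sub₀ two_ne_zero,
        zpow_sub₀ two_ne_zero, zpow_natCast]
      norm_num
      ring
    have e2 : (8 : ℝ) * 2 ^ (-(j : ℝ)) ≤ 1 := by
      rw [Real.rpow_neg two_pos.le, Real.rpow_natCast, ← div_eq_mul_inv, div_le_one (by positivity)]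
      calc (8 : ℝ) = 2 ^ 3 := by norm_num
        _ ≤ 2 ^ j := pow_le_pow_right₀ (by norm_num) (by omega)
    have hLv := hL (2 ^ (q - 3) * w)
    rw [abs_mul, abs_of_pos h2, ← hu] at hLv
    have e3 : (2 : ℝ) ^ ((q - 3) * α) ≤ 2 ^ (q * α) :=
      Real.rpow_le_rpow_of_exponent_le (by norm_num) (by nlinarith)
    have e4 : (2 : ℝ) ^ (-(j : ℝ)) ≤ 2 ^ (-δ * j) :=
      Real.rpow_le_rpow_of_exponent_le (by norm_num) (by nlinarith [(j.cast_nonneg : (0 : ℝ) ≤ j)])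
    rw [norm_mul, Complex.norm_real, Real.norm_of_nonneg (by positivity), e1, szR]
    have e5 : (1 + u)⁻¹ ^ 7 * (1 + u) ^ 3 = (1 + u)⁻¹ ^ 4 := by
      have : (1 + u) ≠ 0 := by positivity
      field_simp
    simp only [CharP.cast_eq_zero, mul_zero, Real.rpow_zero, mul_one, zero_add, Nat.cast_ofNat]
    rw [← hu]
    calc 2 ^ ((q - 3) * α) * 2 ^ (q - 3) * ‖L (2 ^ (q - 3) * w)‖ *
          (8 * 2 ^ (-(j : ℝ)) * u * (1 + 8 * 2 ^ (-(j : ℝ)) * u) ^ 2)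
        ≤ 2 ^ (q * α) * 2 ^ (q - 3) * (C * (1 + u)⁻¹ ^ 7) *
          (8 * 2 ^ (-δ * j) * (1 + u) * (1 + 1 * u) ^ 2) := by
          gcongr
          linarith
      _ = 8 * C * (2 ^ (q * α) * 2 ^ (-δ * j) * (2 ^ (q - 3) * ((1 + u)⁻¹ ^ 7 * (1 + u) ^ 3))) := by
          ring
      _ = _ := by rw [e5]
  · rw [cfD, if_neg h, Complex.ofReal_zero, zero_mul, norm_zero, zero_mul]
    have := szR_nonneg α δ q j n w
    positivity

lemma cfE_mul_le {α δ : ℝ} (hα : 0 < α) (hδα : δ ≤ α) {C : ℝ} (hC : 0 ≤ C)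
    {L : ℝ → ℂ} (hL : ∀ v, ‖L v‖ ≤ C * (1 + |v|)⁻¹ ^ 4) (q : ℤ) (j n : ℕ) (w : ℝ) :
    ‖(cfE α q j n : ℂ) * L (2 ^ (q - 3) * w)‖ ≤ C * szR α δ q j n w := by
  by_cases h : n = 0
  · rw [cfE, if_pos h]
    subst h
    have h2 : (0 : ℝ) < 2 ^ (q - 3) := by positivity
    have hLv := hL (2 ^ (q - 3) * w)
    rw [abs_mul, abs_of_pos h2] at hLv
    have e4 : (2 : ℝ) ^ ((q - j) * α) ≤ 2 ^ (q * α) * 2 ^ (-δ * j) := by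
      rw [← Real.rpow_add two_pos]
      exact Real.rpow_le_rpow_of_exponent_le (by norm_num)
        (by nlinarith [(j.cast_nonneg : (0 : ℝ) ≤ j)])
    rw [norm_mul, Complex.norm_real, norm_neg, Real.norm_of_nonneg (by positivity), szR]
    simp only [CharP.cast_eq_zero, mul_zero, Real.rpow_zero, mul_one, zero_add, Nat.cast_ofNat]
    calc _ ≤ 2 ^ (q * α) * 2 ^ (-δ * j) * 2 ^ (q - 3) * (C * (1 + 2 ^ (q - 3) * |w|)⁻¹ ^ 4) := by
          gcongr
      _ = _ := by ring
  · rw [cfE, if_neg h, Complex.ofReal_zero, zero_mul, norm_zero]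
    have := szR_nonneg α δ q j n w
    positivity

lemma cfR_mul_le {α δ : ℝ} (hα : 0 < α) (hδ0 : 0 ≤ δ) (hδ1 : δ ≤ 1) {C : ℝ} (hC : 0 ≤ C)
    {L : ℝ → ℂ} (hL : ∀ v, ‖L v‖ ≤ C * (1 + |v|)⁻¹ ^ 4) (q : ℤ) (j n : ℕ) (w : ℝ) :
    ‖(cfR α q j n : ℂ) * L (2 ^ (q + 3 - n) * w)‖ ≤
      4096 * 2 ^ (3 * α) * C * szR α δ q j n w := by
  by_cases h : j ≤ 6
  · rw [cfR, if_pos h]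
    have h2 : (0 : ℝ) < 2 ^ (q + 3 - n) := by positivity
    have hLv := hL (2 ^ (q + 3 - n) * w)
    rw [abs_mul, abs_of_pos h2] at hLv
    have e1 : (2 : ℝ) ^ (q + 3 - n) = 64 * 2 ^ (q - (n + 3 : ℕ) : ℤ) := by
      rw [show q + 3 - (n : ℤ) = 6 + (q - (n + 3 : ℕ) : ℤ) by push_cast; ring,
        zpow_add₀ two_ne_zero]
      norm_num
    have e4 : (1 : ℝ) ≤ 64 * 2 ^ (-δ * j) := by
      have : (64 : ℝ) = 2 ^ (6 : ℝ) := by norm_num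
      rw [this, ← Real.rpow_add two_pos]
      refine Real.one_le_rpow (by norm_num) ?_
      have : (j : ℝ) ≤ 6 := by exact_mod_cast h
      nlinarith [(j.cast_nonneg : (0 : ℝ) ≤ j)]
    have e3 : (2 : ℝ) ^ ((q + 3 - n) * α) = 2 ^ (3 * α) * 2 ^ (q * α) * 2 ^ (-α * n) := by
      rw [← Real.rpow_add two_pos, ← Real.rpow_add two_pos]
      congr 1
      ring
    rw [norm_mul, Complex.norm_real, Real.norm_of_nonneg (by positivity), szR]
    set K : ℝ := 2 ^ (q - (n + 3 : ℕ) : ℤ) with hK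
    have hK0 : 0 < K := by positivity
    have e5 : (1 + 2 ^ (q + 3 - n) * |w|)⁻¹ ≤ (1 + K * |w|)⁻¹ := by
      rw [e1]
      gcongr
      nlinarith [abs_nonneg w]
    calc 1 / 2 * (2 ^ ((q + 3 - n) * α) * 2 ^ (q + 3 - n)) * ‖L (2 ^ (q + 3 - n) * w)‖
        ≤ 1 * (2 ^ ((q + 3 - n) * α) * 2 ^ (q + 3 - n)) * (C * (1 + K * |w|)⁻¹ ^ 4) := by
          refine mul_le_mul ?_ (hLv.trans ?_) (norm_nonneg _) (by positivity)
          · gcongr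
            norm_num
          · gcongr
      _ = 1 * (2 ^ (3 * α) * 2 ^ (q * α) * 2 ^ (-α * n) * (64 * K)) *
            (C * (1 + K * |w|)⁻¹ ^ 4) := by rw [e3, e1]
      _ ≤ (64 * 2 ^ (-δ * j)) * (2 ^ (3 * α) * 2 ^ (q * α) * 2 ^ (-α * n) * (64 * K)) *
            (C * (1 + K * |w|)⁻¹ ^ 4) := by gcongr
      _ = _ := by ring
  · rw [cfR, if_neg h, Complex.ofReal_zero, zero_mul, norm_zero]
    have := szR_nonneg α δ q j n w
    positivity

lemma exists_KB_muF (γ : ℝ) : ∃ C : ℝ, 0 ≤ C ∧ ∀ q w, KB γ (muF q w) (q - 3) w (ENNReal.ofReal C) := by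
  obtain ⟨C, hC0, hC⟩ := exists_KB_modulated contDiff_psC (r := 1 / 2) (R := 3 / 2) (by norm_num)
    (fun ξ h => psC_of_le h.le) (fun ξ h => psC_of_ge h) γ
  exact ⟨C, hC0, fun q w => hC (q - 3) w⟩

lemma exists_KB_laF {α δ : ℝ} (hα : 0 < α) (hδ0 : 0 ≤ δ) (hδ1 : δ ≤ 1) (hδα : δ ≤ α)
    (L Θ Q : SchwartzMap ℝ ℂ) (γ : ℝ) :
    ∃ C : ℝ, 0 ≤ C ∧ ∀ q (j n : ℕ) w, KB γ (laF α L Θ Q q j n w) (q - j) w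
      (ENNReal.ofReal (C * szR α δ q j n w)) := by
  have p0 : ∀ ξ, |ξ| < 1 / 2 → psC ξ = 0 := fun ξ h => psC_of_le h.le
  have p1 : ∀ ξ, 3 / 2 ≤ |ξ| → psC ξ = 0 := fun ξ h => psC_of_ge h
  obtain ⟨C₁, h10, h1⟩ := exists_KB_modulated_sub contDiff_psC (by norm_num) p0 p1 γ
  obtain ⟨C₂, h20, h2⟩ := exists_KB_modulated
    (contDiff_abs_rpow_mul contDiff_psC (by norm_num) p0 α) (r := 1 / 2) (R := 3 / 2) (by norm_num)
    (fun ξ h => by rw [p0 ξ h, mul_zero]) (fun ξ h => by rw [p1 ξ h, mul_zero]) γ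
  obtain ⟨C₃, h30, h3⟩ := exists_KB_modulated contDiff_psC (by norm_num) p0 p1 γ
  obtain ⟨A, hA0, hA⟩ := L.exists_decay 7
  obtain ⟨B, hB0, hB⟩ := Θ.exists_decay 4
  obtain ⟨D, hD0, hD⟩ := Q.exists_decay 4
  refine ⟨C₁ * (8 * A) + C₂ * B + C₃ * (4096 * 2 ^ (3 * α) * D), by positivity,
    fun q j n w => ?_⟩
  have k := (((h1 (q - j) w).const_mul (cfD α q j n * L (2 ^ (q - 3) * w))).add
    ((h2 (q - j) w).const_mul (cfE α q j n * Θ (2 ^ (q - 3) * w)))).add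
    ((h3 (q - j) w).const_mul (cfR α q j n * Q (2 ^ (q + 3 - n) * w)))
  refine KB.mono k ?_
  have b1 := cfD_mul_le hα hδ1 hA0 hA q j n w
  have b2 := cfE_mul_le hα hδα hB0 hB q j n w
  have b3 := cfR_mul_le hα hδ0 hδ1 hD0 hD q j n w
  have s0 := szR_nonneg α δ q j n w
  rw [← ofReal_norm, ← ofReal_norm, ← ofReal_norm, ← ENNReal.ofReal_mul (norm_nonneg _),
    ← ENNReal.ofReal_mul (norm_nonneg _), ← ENNReal.ofReal_mul (norm_nonneg _),
    ← ENNReal.ofReal_add (by positivity) (by positivity),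
    ← ENNReal.ofReal_add (by positivity) (by positivity)]
  refine ENNReal.ofReal_le_ofReal ?_
  rw [add_mul, add_mul]
  refine add_le_add (add_le_add ?_ ?_) ?_
  · calc _ = C₁ * (‖(cfD α q j n : ℂ) * L (2 ^ (q - 3) * w)‖ *
        (2 ^ (q - j) * |w| * (1 + 2 ^ (q - j) * |w|) ^ 2)) := by ring
      _ ≤ C₁ * (8 * A * szR α δ q j n w) := by gcongr
      _ = _ := by ring
  · calc _ ≤ (B * szR α δ q j n w) * C₂ := by gcongr
      _ = _ := by ring
  · calc _ ≤ (4096 * 2 ^ (3 * α) * D * szR α δ q j n w) * C₃ := by gcongr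
      _ = _ := by ring

end CommutatorFamily

section CommutatorIdentity

open FourierTransform ContDiff

lemma two_rpow_mul_abs_dilate_rpow (α : ℝ) (c : ℤ) (ζ : ℝ) :
    (2 : ℝ) ^ ((c : ℝ) * α) * |2 ^ (-c) * ζ| ^ α = |ζ| ^ α := by
  have h2 : (0 : ℝ) < 2 ^ (-c) := by positivity
  rw [abs_mul, abs_of_pos h2, Real.mul_rpow h2.le (abs_nonneg _), ← Real.rpow_intCast,
    ← Real.rpow_mul two_pos.le, ← mul_assoc, ← Real.rpow_add two_pos]
  push_cast
  rw [show (c : ℝ) * α + -c * α = 0 by ring, Real.rpow_zero, one_mul]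

lemma psC_dilate (m : ℤ) (ξ : ℝ) :
    psC (2 ^ (-m) * ξ) = phC (2 ^ (-m) * ξ) - phC (2 ^ (1 - m) * ξ) := by
  rw [psC, sub_eq_add_neg 1 m, zpow_add₀ two_ne_zero, zpow_one, mul_assoc]

lemma abs_dilate (m : ℤ) (ξ : ℝ) : |(2 : ℝ) ^ m * ξ| = 2 ^ m * |ξ| := by
  rw [abs_mul, abs_of_pos (by positivity)]

lemma exists_finset_psC {ξ : ℝ} (hξ : ξ ≠ 0) :
    ∃ K : Finset ℤ, (∀ k ∉ K, psC (2 ^ (-k) * ξ) = 0) ∧ ∑ k ∈ K, psC (2 ^ (-k) * ξ) = 1 := by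
  obtain ⟨m, h1, h2⟩ := exists_mem_Ico_zpow (abs_pos.2 hξ) (one_lt_two (α := ℝ))
  have hm : (0 : ℝ) < 2 ^ m := by positivity
  refine ⟨{m, m + 1, m + 2}, fun k hk => ?_, ?_⟩
  · simp only [Finset.mem_insert, Finset.mem_singleton, not_or] at hk
    rcases lt_or_ge k m with h | h
    · apply psC_of_ge
      rw [abs_dilate]
      calc (3 / 2 : ℝ) ≤ 2 ^ (1 : ℤ) := by norm_num
        _ ≤ 2 ^ (-k + m) := zpow_le_zpow_right₀ one_le_two (by omega)
        _ = 2 ^ (-k) * 2 ^ m := zpow_add₀ two_ne_zero _ _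
        _ ≤ _ := by gcongr
    · apply psC_of_le
      rw [abs_dilate]
      calc 2 ^ (-k) * |ξ| ≤ 2 ^ (-k) * 2 ^ (m + 1) := by gcongr
        _ = (2 : ℝ) ^ (-k + (m + 1)) := (zpow_add₀ two_ne_zero _ _).symm
        _ ≤ 2 ^ (-1 : ℤ) := zpow_le_zpow_right₀ one_le_two (by omega)
        _ = 1 / 2 := by norm_num
  · rw [Finset.sum_insert (by simp), Finset.sum_insert (by simp), Finset.sum_singleton,
      psC_dilate, psC_dilate, psC_dilate, show 1 - (m + 1) = -m by ring,
      show 1 - (m + 2) = -(m + 1) by ring]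
    have e1 : phC (2 ^ (1 - m) * ξ) = 0 := by
      apply phC_of_ge
      rw [abs_dilate]
      calc (3 / 2 : ℝ) ≤ 2 ^ (1 : ℤ) := by norm_num
        _ ≤ 2 ^ (1 - m + m) := zpow_le_zpow_right₀ one_le_two (by omega)
        _ = 2 ^ (1 - m) * 2 ^ m := zpow_add₀ two_ne_zero _ _
        _ ≤ _ := by gcongr
    have e2 : phC (2 ^ (-(m + 2)) * ξ) = 1 := by
      apply phC_of_le
      rw [abs_dilate]
      calc 2 ^ (-(m + 2)) * |ξ| ≤ 2 ^ (-(m + 2)) * 2 ^ (m + 1) := by gcongr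
        _ = (2 : ℝ) ^ (-(m + 2) + (m + 1)) := (zpow_add₀ two_ne_zero _ _).symm
        _ ≤ 2 ^ (0 : ℤ) := zpow_le_zpow_right₀ one_le_two (by omega)
        _ = 1 := by norm_num
    rw [e1, e2]
    ring

lemma hasSum_psC {ζ : ℝ} (hζ : ζ ≠ 0) {m : ℤ} (h : |ζ| ≤ 2 ^ m) :
    HasSum (fun n : ℕ => psC (2 ^ (-(m - n)) * ζ)) 1 := by
  obtain ⟨N, hN⟩ := pow_unbounded_of_one_lt (2 * (2 ^ m * |ζ|⁻¹)) (one_lt_two (α := ℝ))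
  have hz : 0 < |ζ| := abs_pos.2 hζ
  have big : ∀ n : ℕ, N ≤ n → 2 ≤ |(2 : ℝ) ^ (n - m : ℤ) * ζ| := fun n hn => by
    rw [abs_dilate, zpow_sub₀ two_ne_zero, zpow_natCast]
    have : (2 : ℝ) ^ N ≤ 2 ^ n := pow_le_pow_right₀ one_le_two hn
    have h3 := hN.le.trans this
    rw [← mul_assoc, ← div_eq_mul_inv, div_le_iff₀ hz] at h3
    rw [div_mul_eq_mul_div, le_div_iff₀ (by positivity)]
    exact h3
  have hs : HasSum (fun n : ℕ => psC (2 ^ (-(m - n)) * ζ))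
      (∑ n ∈ Finset.range N, psC (2 ^ (-(m - n)) * ζ)) := by
    refine hasSum_sum_of_ne_finset_zero fun n hn => ?_
    rw [Finset.mem_range, not_lt] at hn
    apply psC_of_ge
    rw [neg_sub]
    linarith [big n hn]
  have e : ∀ n : ℕ, psC (2 ^ (-(m - n)) * ζ) =
      phC (2 ^ ((n : ℤ) - m) * ζ) - phC (2 ^ (((n + 1 : ℕ) : ℤ) - m) * ζ) := fun n => by
    rw [psC_dilate, neg_sub]
    congr 4
    push_cast
    ring
  convert hs using 1
  simp_rw [e]
  rw [Finset.sum_range_sub' (fun n : ℕ => phC (2 ^ ((n : ℤ) - m) * ζ)),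
    phC_of_ge (ξ := 2 ^ ((N : ℤ) - m) * ζ) (by linarith [big N le_rfl]), phC_of_le, sub_zero]
  rw [abs_dilate, Nat.cast_zero, zero_sub, zpow_neg, ← div_eq_inv_mul, div_le_one (by positivity)]
  exact h

/-- The total coefficient of a pair of frequency scales. -/
noncomputable def pairC (i : ℤ) (Z X Y : ℂ) : ℂ :=
  if i < 0 then 0 else (if 7 ≤ i then Z - X else 0) - Y + if i ≤ 6 then 1 / 2 * Z else 0

lemma pairC_add_pairC (i : ℤ) (Z X Y : ℂ) : pairC i Z X Y + pairC (6 - i) Z Y X = Z - X - Y := by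
  unfold pairC
  split_ifs <;> first | omega | ring

end CommutatorIdentity

section CommutatorIntegral

open FourierTransform ContDiff

lemma SchwartzMap.integrable_dilate_mul_eC (g : SchwartzMap ℝ ℂ) (l : ℤ) (ζ : ℝ) :
    Integrable fun w => g (2 ^ l * w) * eC (-(w * ζ)) := by
  have h := g.integrable_dilate l 0
  simp_rw [sub_zero] at h
  refine h.mul_bdd (c := 1) ?_ (Filter.Eventually.of_forall fun w => (norm_eC _).le)
  exact (continuous_eC.comp (by fun_prop)).aestronglyMeasurable

lemma integral_lin_comb {a b c d : ℝ → ℂ} (ha : Integrable a) (hb : Integrable b)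
    (hc : Integrable c) (hd : Integrable d) (x y z : ℂ) :
    ∫ w, x * (a w - b w) + y * c w + z * d w =
      x * ((∫ w, a w) - ∫ w, b w) + y * (∫ w, c w) + z * ∫ w, d w := by
  have h1 : Integrable fun w => x * (a w - b w) := (ha.sub hb).const_mul x
  have h2 : Integrable fun w => y * c w := hc.const_mul y
  have h3 : Integrable fun w => z * d w := hd.const_mul z
  have h4 : Integrable fun w => x * (a w - b w) + y * c w := h1.add h2
  rw [integral_add h4 h3, integral_add h1 h2, integral_const_mul, integral_const_mul,
    integral_const_mul, integral_sub ha hb]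

lemma integral_muF_mul_laF_eq (α : ℝ) (L Θ Q : SchwartzMap ℝ ℂ) (q : ℤ) (j n : ℕ) (ξ η : ℝ) :
    ∫ w, muF q w ξ * laF α L Θ Q q j n w η =
      psC (2 ^ (-(q - 3)) * ξ) *
        (cfD α q j n * psC (2 ^ (-(q - j)) * η) *
          ((∫ w, L (2 ^ (q - 3) * w) * eC (-(w * (ξ + η)))) -
            ∫ w, L (2 ^ (q - 3) * w) * eC (-(w * ξ))) +
        cfE α q j n * (((|2 ^ (-(q - j)) * η| ^ α : ℝ) : ℂ) * psC (2 ^ (-(q - j)) * η)) *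
          (∫ w, Θ (2 ^ (q - 3) * w) * eC (-(w * (ξ + η)))) +
        cfR α q j n * psC (2 ^ (-(q - j)) * η) *
          ∫ w, Q (2 ^ (q + 3 - n) * w) * eC (-(w * (ξ + η)))) := by
  have i1 := L.integrable_dilate_mul_eC (q - 3) (ξ + η)
  have i2 := L.integrable_dilate_mul_eC (q - 3) ξ
  have i3 := Θ.integrable_dilate_mul_eC (q - 3) (ξ + η)
  have i4 := Q.integrable_dilate_mul_eC (q + 3 - n) (ξ + η)
  rw [← integral_lin_comb i1 i2 i3 i4, ← integral_const_mul]
  refine integral_congr_ae (Filter.Eventually.of_forall fun w => ?_)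
  beta_reduce
  have e : eC (-(w * (ξ + η))) = eC (-(w * ξ)) * eC (-(w * η)) := by
    rw [← eC_add]; congr 1; ring
  simp only [e, muF, laF]
  ring

variable {α : ℝ} {L Θ Q : SchwartzMap ℝ ℂ}

lemma integral_muF_mul_laF
    (hL : ∀ ξ, 𝓕 (L : ℝ → ℂ) ξ = ((|ξ| ^ α : ℝ) : ℂ) * (phC (ξ / 4) - phC (8 * ξ)))
    (hΘ : ∀ ξ, 𝓕 (Θ : ℝ → ℂ) ξ = phC (ξ / 32))
    (hQ : ∀ ξ, 𝓕 (Q : ℝ → ℂ) ξ = ((|ξ| ^ α : ℝ) : ℂ) * psC ξ)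
    (q : ℤ) (j n : ℕ) (ξ η : ℝ) :
    ∫ w, muF q w ξ * laF α L Θ Q q j n w η =
      psC (2 ^ (-(q - 3)) * ξ) * psC (2 ^ (-(q - j)) * η) *
        ((if n = 0 then (if 7 ≤ j then ((|ξ + η| ^ α : ℝ) : ℂ) - ((|ξ| ^ α : ℝ) : ℂ) else 0) -
            ((|η| ^ α : ℝ) : ℂ) else 0) +
          if j ≤ 6 then 1 / 2 * (((|ξ + η| ^ α : ℝ) : ℂ) * psC (2 ^ (-(q + 3 - n)) * (ξ + η)))
            else 0) := by
  rcases eq_or_ne (psC (2 ^ (-(q - 3)) * ξ)) 0 with h1 | h1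
  · rw [integral_muF_mul_laF_eq, h1]; ring
  rcases eq_or_ne (psC (2 ^ (-(q - j)) * η)) 0 with h2 | h2
  · rw [integral_muF_mul_laF_eq, h2]; ring
  have a1 : 1 / 2 < |2 ^ (-(q - 3)) * ξ| := not_le.1 fun h => h1 (psC_of_le h)
  have a2 : |2 ^ (-(q - 3)) * ξ| < 3 / 2 := not_le.1 fun h => h1 (psC_of_ge h)
  have b2 : |2 ^ (-(q - j)) * η| < 3 / 2 := not_le.1 fun h => h2 (psC_of_ge h)
  have b3 : |2 ^ (-(q - 3)) * η| = 8 * 2 ^ (-(j : ℤ)) * |2 ^ (-(q - j)) * η| := by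
    rw [abs_dilate, abs_dilate, ← mul_assoc]
    congr 1
    rw [show -(q - 3) = 3 + (-(j : ℤ) + -(q - j)) by ring, zpow_add₀ two_ne_zero,
      zpow_add₀ two_ne_zero]
    norm_num
    ring
  have j1 : (2 : ℝ) ^ (-(j : ℤ)) ≤ 1 := zpow_le_one_of_nonpos₀ one_le_two (by omega)
  have j0 : (0 : ℝ) < 2 ^ (-(j : ℤ)) := by positivity
  have b4 : |2 ^ (-(q - 3)) * η| ≤ 12 := by rw [b3]; nlinarith [abs_nonneg (2 ^ (-(q - j)) * η)]
  have ez : (2 : ℝ) ^ (-(q - 3)) * (ξ + η) = 2 ^ (-(q - 3)) * ξ + 2 ^ (-(q - 3)) * η := by ring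
  have cast3 : ((q : ℝ) - 3) * α = ((q - 3 : ℤ) : ℝ) * α := by push_cast; ring
  have castj : ((q : ℝ) - j) * α = ((q - j : ℤ) : ℝ) * α := by push_cast; ring
  have castn : ((q : ℝ) + 3 - n) * α = ((q + 3 - n : ℤ) : ℝ) * α := by push_cast; ring
  have f1 : ∀ ζ : ℝ, ((2 ^ (q - 3) : ℝ) : ℂ) * (∫ w, L (2 ^ (q - 3) * w) * eC (-(w * ζ))) =
      ((|2 ^ (-(q - 3)) * ζ| ^ α : ℝ) : ℂ) *
        (phC (2 ^ (-(q - 3)) * ζ / 4) - phC (8 * (2 ^ (-(q - 3)) * ζ))) := fun ζ => by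
    rw [integral_dilate_mul_eC, hL]
  have f2 : ((2 ^ (q - 3) : ℝ) : ℂ) * (∫ w, Θ (2 ^ (q - 3) * w) * eC (-(w * (ξ + η)))) = 1 := by
    rw [integral_dilate_mul_eC, hΘ, phC_of_le]
    rw [ez, abs_div, abs_of_pos (by norm_num : (0 : ℝ) < 32), div_le_one (by norm_num)]
    linarith [abs_add_le (2 ^ (-(q - 3)) * ξ) (2 ^ (-(q - 3)) * η)]
  have f3 : ((2 ^ (q + 3 - n) : ℝ) : ℂ) *
      (∫ w, Q (2 ^ (q + 3 - n) * w) * eC (-(w * (ξ + η)))) =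
      ((|2 ^ (-(q + 3 - n)) * (ξ + η)| ^ α : ℝ) : ℂ) * psC (2 ^ (-(q + 3 - n)) * (ξ + η)) := by
    rw [integral_dilate_mul_eC, hQ]
  have f4 : ∀ (c : ℤ) (ζ : ℝ), (((2 : ℝ) ^ ((c : ℝ) * α) : ℝ) : ℂ) *
      ((|2 ^ (-c) * ζ| ^ α : ℝ) : ℂ) = ((|ζ| ^ α : ℝ) : ℂ) := fun c ζ => by
    rw [← Complex.ofReal_mul, two_rpow_mul_abs_dilate_rpow]
  have f5 : ∀ u : ℝ, 1 / 5 ≤ |u| → |u| ≤ 4 → phC (u / 4) - phC (8 * u) = 1 := fun u h h' => by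
    rw [phC_of_le, phC_of_ge, sub_zero]
    · rw [abs_mul, abs_of_pos (by norm_num : (0 : ℝ) < 8)]; linarith
    · rw [abs_div, abs_of_pos (by norm_num : (0 : ℝ) < 4), div_le_one (by norm_num)]; exact h'
  rw [integral_muF_mul_laF_eq,
    mul_assoc (psC (2 ^ (-(q - 3)) * ξ)) (psC (2 ^ (-(q - j)) * η))]
  congr 1
  rw [mul_add]
  congr 1
  · by_cases hn : n = 0
    · rw [if_pos hn, cfE, if_pos hn, castj]
      have eE : ((-(2 ^ (((q - j : ℤ) : ℝ) * α) * 2 ^ (q - 3)) : ℝ) : ℂ) *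
          (((|2 ^ (-(q - j)) * η| ^ α : ℝ) : ℂ) * psC (2 ^ (-(q - j)) * η)) *
          (∫ w, Θ (2 ^ (q - 3) * w) * eC (-(w * (ξ + η)))) =
          -(psC (2 ^ (-(q - j)) * η) * ((|η| ^ α : ℝ) : ℂ)) := by
        rw [← f4 (q - j) η, ← mul_one (psC (2 ^ (-(q - j)) * η) * _), ← f2]
        push_cast
        ring
      rw [eE]
      by_cases hj : 7 ≤ j
      · rw [if_pos hj, cfD, if_pos ⟨hn, hj⟩, cast3]
        have j7 : (2 : ℝ) ^ (-(j : ℤ)) ≤ 1 / 128 := by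
          calc (2 : ℝ) ^ (-(j : ℤ)) ≤ 2 ^ (-7 : ℤ) := zpow_le_zpow_right₀ one_le_two (by omega)
            _ = 1 / 128 := by norm_num
        have b5 : |2 ^ (-(q - 3)) * η| ≤ 3 / 32 := by
          rw [b3]; nlinarith [abs_nonneg (2 ^ (-(q - j)) * η)]
        have l1 := abs_add_le (2 ^ (-(q - 3)) * ξ) (2 ^ (-(q - 3)) * η)
        have l2 := abs_sub_abs_le_abs_add (2 ^ (-(q - 3)) * ξ) (2 ^ (-(q - 3)) * η)
        have g1 := f1 (ξ + η)
        have g2 := f1 ξ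
        rw [f5 _ (by rw [ez]; linarith) (by rw [ez]; linarith), mul_one] at g1
        rw [f5 _ (by linarith) (by linarith), mul_one] at g2
        rw [← f4 (q - 3) (ξ + η), ← f4 (q - 3) ξ, ← g1, ← g2]
        push_cast
        ring
      · rw [if_neg hj, cfD, if_neg fun h => hj h.2]
        push_cast
        ring
    · rw [if_neg hn, cfE, if_neg hn, cfD, if_neg fun h => hn h.1]
      push_cast
      ring
  · rw [cfR]
    by_cases hj : j ≤ 6
    · rw [if_pos hj, if_pos hj, castn, ← f4 (q + 3 - n) (ξ + η),
        mul_assoc (((2 : ℝ) ^ (((q + 3 - n : ℤ) : ℝ) * α) : ℝ) : ℂ), ← f3]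
      push_cast
      ring
    · rw [if_neg hj, if_neg hj]
      push_cast
      ring

end CommutatorIntegral

section CommutatorSeries

open FourierTransform

lemma continuous_muF (q : ℤ) : Continuous (Function.uncurry (muF q)) := by
  unfold muF Function.uncurry
  exact (continuous_eC.comp (by fun_prop)).mul (contDiff_psC.continuous.comp (by fun_prop))

lemma continuous_laF {α : ℝ} (hα : 0 < α) (L Θ Q : SchwartzMap ℝ ℂ) (q : ℤ) (j n : ℕ) :
    Continuous (Function.uncurry (laF α L Θ Q q j n)) := by
  have h1 : Continuous fun z : ℝ × ℝ => eC (-(z.1 * z.2)) := continuous_eC.comp (by fun_prop)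
  have h2 : Continuous fun z : ℝ × ℝ => psC (2 ^ (-(q - j)) * z.2) :=
    contDiff_psC.continuous.comp (by fun_prop)
  have h3 : Continuous fun z : ℝ × ℝ => ((|2 ^ (-(q - j)) * z.2| ^ α : ℝ) : ℂ) :=
    Complex.continuous_ofReal.comp (Continuous.rpow_const (by fun_prop) fun _ => Or.inr hα.le)
  have h4 (g : SchwartzMap ℝ ℂ) (l : ℤ) : Continuous fun z : ℝ × ℝ => g (2 ^ l * z.1) :=
    g.continuous.comp (by fun_prop)
  unfold laF Function.uncurry
  have a1 := h4 L (q - 3)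
  have a2 := h4 Θ (q - 3)
  have a3 := h4 Q (q + 3 - n)
  exact (((continuous_const.mul a1).mul ((h1.sub continuous_const).mul h2)).add
    ((continuous_const.mul a2).mul (h1.mul (h3.mul h2)))).add
    ((continuous_const.mul a3).mul (h1.mul h2))

/-- The parameter space of the commutator families. -/
abbrev CPar := (ℤ × ℕ × ℕ) × ℝ

/-- The two members of the commutator family. -/
noncomputable def famC (α : ℝ) (L Θ Q : ℝ → ℂ) (d : Bool) (t : CPar) (ξ : ℝ) : ℂ :=
  if d then laF α L Θ Q t.1.1 t.1.2.1 t.1.2.2 t.2 ξ else muF t.1.1 t.2 ξ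

lemma measurable_famC {α : ℝ} (hα : 0 < α) (L Θ Q : SchwartzMap ℝ ℂ) (d : Bool) :
    Measurable (Function.uncurry (famC α L Θ Q d)) := by
  have : Measurable fun u : (ℤ × ℕ × ℕ) × ℝ × ℝ => famC α L Θ Q d (u.1, u.2.1) u.2.2 := by
    refine measurable_from_prod_countable_right fun k => ?_
    cases d
    · exact (continuous_muF k.1).measurable
    · exact (continuous_laF hα L Θ Q k.1 k.2.1 k.2.2).measurable
  have e : Function.uncurry (famC α L Θ Q d) =
      (fun u : (ℤ × ℕ × ℕ) × ℝ × ℝ => famC α L Θ Q d (u.1, u.2.1) u.2.2) ∘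
        MeasurableEquiv.prodAssoc := by
    funext ⟨⟨k, w⟩, ξ⟩; rfl
  rw [e]
  exact this.comp MeasurableEquiv.prodAssoc.measurable

lemma lintegral_krn_le (l : ℤ) : ∫⁻ w, krn l w ≤ 4 := by
  have h (w : ℝ) : krn l w ≤ 4 * omg l w := by
    rw [krn, omg, show (4 : ℝ≥0∞) = ENNReal.ofReal 4 by norm_num,
      ← ENNReal.ofReal_mul (by norm_num)]
    apply ENNReal.ofReal_le_ofReal
    have h1 : (1 + 2 ^ l * |w|)⁻¹ ≤ 1 := inv_le_one_of_one_le₀ (by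
      have : 0 ≤ (2 : ℝ) ^ l * |w| := by positivity
      linarith)
    have h0 : 0 ≤ (1 + 2 ^ l * |w|)⁻¹ := by positivity
    have h2 : (1 + 2 ^ l * |w|)⁻¹ ^ 4 ≤ (1 + 2 ^ l * |w|)⁻¹ ^ 2 :=
      pow_le_pow_of_le_one h0 h1 (by norm_num)
    have h3 : (2 : ℝ) ^ l = 4 * 2 ^ (l - 2) := by
      rw [zpow_sub₀ two_ne_zero]; norm_num; ring
    calc (2 : ℝ) ^ l * (1 + 2 ^ l * |w|)⁻¹ ^ 4 ≤ 2 ^ l * (1 + 2 ^ l * |w|)⁻¹ ^ 2 := by gcongr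
      _ = 4 * (2 ^ (l - 2) * (1 + 2 ^ l * |w|)⁻¹ ^ 2) := by nth_rw 1 [h3]; ring
  calc ∫⁻ w, krn l w ≤ ∫⁻ w, 4 * omg l w := lintegral_mono h
    _ = 4 * ∫⁻ w, omg l w := lintegral_const_mul' _ _ (by norm_num)
    _ ≤ 4 * 1 := by gcongr; exact lintegral_omg_le l
    _ = 4 := mul_one _

lemma exists_enorm_muF_le : ∃ M : ℝ≥0∞, M ≠ ∞ ∧ ∀ q w ξ,
    ‖muF q w ξ‖ₑ ≤ if t2 q ≤ ENNReal.ofReal (16 * |ξ|) then M else 0 := by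
  obtain ⟨M, hM⟩ := contDiff_psC.continuous.bounded_above_of_compact_support
    (hasCompactSupport_of_abs_ge fun ξ => psC_of_ge)
  refine ⟨ENNReal.ofReal M, ENNReal.ofReal_ne_top, fun q w ξ => ?_⟩
  split_ifs with h
  · rw [← ofReal_norm_eq_enorm, muF, norm_mul, norm_eC, one_mul]
    exact ENNReal.ofReal_le_ofReal (hM _)
  · rw [muF, psC_of_le, mul_zero, enorm_zero]
    rw [t2_intCast_eq_ofReal] at h
    have h' : 16 * |ξ| < 2 ^ q := by
      by_contra! hc
      exact h (ENNReal.ofReal_le_ofReal hc)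
    rw [abs_dilate, show -(q - 3) = 3 + -q by ring, zpow_add₀ two_ne_zero]
    have e : (2 : ℝ) ^ q * 2 ^ (-q) = 1 := by rw [← zpow_add₀ two_ne_zero]; simp
    have e0 : (0 : ℝ) < 2 ^ (-q) := by positivity
    have e1 := mul_lt_mul_of_pos_right h' e0
    rw [e] at e1
    norm_num at e1 ⊢
    linarith

lemma exists_lintegral_famC_le {α : ℝ} (hα : 0 < α) (L Θ Q : SchwartzMap ℝ ℂ) :
    ∃ C : ℝ≥0∞, C ≠ ∞ ∧ ∀ ξ η : ℝ, ∫⁻ t, ‖famC α L Θ Q false t ξ‖ₑ * ‖famC α L Θ Q true t η‖ₑ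
      ∂((Measure.count : Measure (ℤ × ℕ × ℕ)).prod volume) ≤ C * ENNReal.ofReal (|ξ| ^ α) := by
  obtain ⟨M, hM, hmu⟩ := exists_enorm_muF_le
  have hδ : 0 < min 1 α := lt_min one_pos hα
  set δ := min 1 α
  obtain ⟨B, hB, hla⟩ := exists_KB_laF hα hδ.le (min_le_left _ _) (min_le_right _ _) L Θ Q 0
  refine ⟨M * (ENNReal.ofReal B * 4) * geomC δ * geomC α * geomC α * ENNReal.ofReal (16 ^ α),
    ?_, fun ξ η => ?_⟩
  · have := geomC_ne_top hδ
    have := geomC_ne_top hα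
    finiteness
  have hla' (q : ℤ) (j n : ℕ) (w : ℝ) : ‖laF α L Θ Q q j n w η‖ₑ ≤
      ENNReal.ofReal B * (t2 (q * α) * t2 (-δ * j) * t2 (-α * n) * krn (q - (n + 3 : ℕ)) w) := by
    refine ((hla q j n w).enorm_le η).trans ?_
    rw [Real.rpow_zero, ENNReal.ofReal_one, one_mul, neg_zero, zero_mul, t2_zero, mul_one,
      ENNReal.ofReal_mul hB, ofReal_szR]
    refine mul_le_of_le_one_right' ?_
    rw [lintegral_sub_right_eq_self (fun v => omg (q - j) v) w]
    exact lintegral_omg_le _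
  have hm : Measurable fun t : CPar => ‖famC α L Θ Q false t ξ‖ₑ * ‖famC α L Θ Q true t η‖ₑ := by
    have h1 := (measurable_famC hα L Θ Q false).comp (measurable_prodMk_right (y := ξ))
    have h2 := (measurable_famC hα L Θ Q true).comp (measurable_prodMk_right (y := η))
    exact h1.enorm.mul h2.enorm
  rw [lintegral_prod _ hm.aemeasurable, lintegral_count, ENNReal.tsum_prod']
  set v := ENNReal.ofReal (16 * |ξ|) with hv
  have hv' : v ^ α = ENNReal.ofReal (16 ^ α) * ENNReal.ofReal (|ξ| ^ α) := by
    rw [hv, ENNReal.ofReal_rpow_of_nonneg (by positivity) hα.le, Real.mul_rpow (by norm_num)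
      (abs_nonneg _), ENNReal.ofReal_mul (by positivity)]
  have key (q : ℤ) (k : ℕ × ℕ) : ∫⁻ w, ‖famC α L Θ Q false ((q, k), w) ξ‖ₑ *
      ‖famC α L Θ Q true ((q, k), w) η‖ₑ ≤ (M * (ENNReal.ofReal B * 4)) *
        ((if t2 q ≤ v then t2 (q * α) else 0) * (t2 (-δ * k.1) * t2 (-α * k.2))) := by
    set c := M * (ENNReal.ofReal B) *
        ((if t2 q ≤ v then t2 (q * α) else 0) * (t2 (-δ * k.1) * t2 (-α * k.2))) with hc
    have hct : c ≠ ∞ := by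
      have := t2_ne_top (q * α)
      have := t2_ne_top (-δ * k.1)
      have := t2_ne_top (-α * k.2)
      rw [hc]
      split_ifs <;> finiteness
    calc _ ≤ ∫⁻ w, c * krn (q - (k.2 + 3 : ℕ)) w := by
          refine lintegral_mono fun w => ?_
          beta_reduce
          simp only [famC, if_true, if_neg Bool.false_ne_true]
          refine (mul_le_mul' (hmu q w ξ) (hla' q k.1 k.2 w)).trans (le_of_eq ?_)
          rw [hc]
          split_ifs <;> ring
      _ = c * ∫⁻ w, krn (q - (k.2 + 3 : ℕ)) w := lintegral_const_mul' _ _ hct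
      _ ≤ c * 4 := by gcongr; exact lintegral_krn_le _
      _ = _ := by rw [hc]; ring
  calc _ ≤ ∑' (q : ℤ) (k : ℕ × ℕ), (M * (ENNReal.ofReal B * 4)) *
        ((if t2 q ≤ v then t2 (q * α) else 0) * (t2 (-δ * k.1) * t2 (-α * k.2))) :=
        ENNReal.tsum_le_tsum fun q => ENNReal.tsum_le_tsum fun k => key q k
    _ = (M * (ENNReal.ofReal B * 4)) * ((∑' q : ℤ, if t2 q ≤ v then t2 (q * α) else 0) *
        (geomC δ * geomC α)) := by
        simp_rw [ENNReal.tsum_mul_left, ENNReal.tsum_mul_right]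
        rw [ENNReal.tsum_prod']
        simp_rw [ENNReal.tsum_mul_left, ENNReal.tsum_mul_right]
        rfl
    _ ≤ (M * (ENNReal.ofReal B * 4)) * (geomC α * v ^ α * (geomC δ * geomC α)) := by
        gcongr
        exact tsum_dyadic_le hα v
    _ = _ := by rw [hv']; ring

end CommutatorSeries

section CommutatorSum

open FourierTransform

open scoped ContDiff

variable {α : ℝ} {L Θ Q : SchwartzMap ℝ ℂ}

lemma tsum_integral_muF_mul_laF (hα : 0 < α)
    (hL : ∀ ξ, 𝓕 (L : ℝ → ℂ) ξ = ((|ξ| ^ α : ℝ) : ℂ) * (phC (ξ / 4) - phC (8 * ξ)))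
    (hΘ : ∀ ξ, 𝓕 (Θ : ℝ → ℂ) ξ = phC (ξ / 32))
    (hQ : ∀ ξ, 𝓕 (Q : ℝ → ℂ) ξ = ((|ξ| ^ α : ℝ) : ℂ) * psC ξ)
    (q : ℤ) (j : ℕ) (ξ η : ℝ) :
    ∑' n : ℕ, ∫ w, muF q w ξ * laF α L Θ Q q j n w η =
      psC (2 ^ (-(q - 3)) * ξ) * psC (2 ^ (-(q - j)) * η) *
        pairC j ((|ξ + η| ^ α : ℝ) : ℂ) ((|ξ| ^ α : ℝ) : ℂ) ((|η| ^ α : ℝ) : ℂ) := by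
  simp_rw [integral_muF_mul_laF hL hΘ hQ]
  rcases eq_or_ne (psC (2 ^ (-(q - 3)) * ξ)) 0 with h1 | h1
  · simp only [h1, zero_mul, tsum_zero]
  rcases eq_or_ne (psC (2 ^ (-(q - j)) * η)) 0 with h2 | h2
  · simp only [h2, mul_zero, zero_mul, tsum_zero]
  refine HasSum.tsum_eq (HasSum.mul_left _ ?_)
  have a2 : |2 ^ (-(q - 3)) * ξ| < 3 / 2 := not_le.1 fun h => h1 (psC_of_ge h)
  have b2 : |2 ^ (-(q - j)) * η| < 3 / 2 := not_le.1 fun h => h2 (psC_of_ge h)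
  have a3 : |ξ| ≤ 3 / 16 * 2 ^ q := by
    have e : (2 : ℝ) ^ (q - 3) * 2 ^ (-(q - 3)) = 1 := by rw [← zpow_add₀ two_ne_zero]; simp
    have e1 := mul_lt_mul_of_pos_left a2 (by positivity : (0 : ℝ) < 2 ^ (q - 3))
    rw [abs_dilate, ← mul_assoc, e, zpow_sub₀ two_ne_zero] at e1
    norm_num at e1
    linarith
  have b3 : |η| ≤ 3 / 2 * 2 ^ q := by
    have e : (2 : ℝ) ^ (q - j) * 2 ^ (-(q - j)) = 1 := by rw [← zpow_add₀ two_ne_zero]; simp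
    have e1 := mul_lt_mul_of_pos_left b2 (by positivity : (0 : ℝ) < 2 ^ (q - j))
    rw [abs_dilate, ← mul_assoc, e] at e1
    have e2 : (2 : ℝ) ^ (q - j) ≤ 2 ^ q := zpow_le_zpow_right₀ one_le_two (by omega)
    linarith
  have hle : |ξ + η| ≤ 2 ^ (q + 3) := by
    rw [zpow_add₀ two_ne_zero]
    have := abs_add_le ξ η
    have : (0 : ℝ) < 2 ^ q := by positivity
    norm_num
    linarith
  have hs : HasSum (fun n : ℕ => ((|ξ + η| ^ α : ℝ) : ℂ) * psC (2 ^ (-(q + 3 - n)) * (ξ + η)))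
      ((|ξ + η| ^ α : ℝ) : ℂ) := by
    rcases eq_or_ne (ξ + η) 0 with h | h
    · simp only [h, abs_zero, Real.zero_rpow hα.ne', Complex.ofReal_zero, zero_mul]
      exact hasSum_zero
    · simpa using (hasSum_psC h hle).mul_left ((|ξ + η| ^ α : ℝ) : ℂ)
  have h0 := hasSum_ite_eq (0 : ℕ)
    ((if 7 ≤ j then ((|ξ + η| ^ α : ℝ) : ℂ) - ((|ξ| ^ α : ℝ) : ℂ) else 0) - ((|η| ^ α : ℝ) : ℂ))
  have h6 : HasSum (fun n : ℕ => if j ≤ 6 then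
      1 / 2 * (((|ξ + η| ^ α : ℝ) : ℂ) * psC (2 ^ (-(q + 3 - n)) * (ξ + η))) else 0)
      (if j ≤ 6 then 1 / 2 * ((|ξ + η| ^ α : ℝ) : ℂ) else 0) := by
    split_ifs
    · exact hs.mul_left _
    · exact hasSum_zero
  have e0 : ¬ (j : ℤ) < 0 := by omega
  have e7 : (7 : ℤ) ≤ j ↔ 7 ≤ j := by omega
  have e6 : (j : ℤ) ≤ 6 ↔ j ≤ 6 := by omega
  simp only [pairC, if_neg e0, e7, e6]
  exact h0.add h6

lemma tsum_tsum_pairC {K Λ : Finset ℤ} {ξ η : ℝ} (hK : ∀ k ∉ K, psC (2 ^ (-k) * ξ) = 0)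
    (hΛ : ∀ k ∉ Λ, psC (2 ^ (-k) * η) = 0) (Z X Y : ℂ) :
    ∑' (q : ℤ) (j : ℕ), psC (2 ^ (-(q - 3)) * ξ) * psC (2 ^ (-(q - j)) * η) * pairC j Z X Y =
      ∑ k ∈ K, ∑ l ∈ Λ, psC (2 ^ (-k) * ξ) * psC (2 ^ (-l) * η) *
        pairC (k + 3 - l) Z X Y := by
  have h1 (q : ℤ) : ∑' j : ℕ, psC (2 ^ (-(q - 3)) * ξ) * psC (2 ^ (-(q - j)) * η) *
      pairC j Z X Y = ∑ l ∈ Λ, psC (2 ^ (-(q - 3)) * ξ) * psC (2 ^ (-l) * η) *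
        pairC (q - 3 + 3 - l) Z X Y := by
    have hs : ∑' l : ℤ, psC (2 ^ (-(q - 3)) * ξ) * psC (2 ^ (-l) * η) *
        pairC (q - 3 + 3 - l) Z X Y = ∑ l ∈ Λ, psC (2 ^ (-(q - 3)) * ξ) *
        psC (2 ^ (-l) * η) * pairC (q - 3 + 3 - l) Z X Y :=
      tsum_eq_sum fun l hl => by rw [hΛ l hl]; ring
    rw [← hs]
    have hi : Function.Injective fun j : ℕ => q - j := fun a b h => by
      simp only at h; omega
    rw [← hi.tsum_eq]
    · refine tsum_congr fun j => ?_
      rw [show q - 3 + 3 - (q - j) = (j : ℤ) by ring]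
    · intro l hl
      by_contra hr
      apply hl
      have : q - 3 + 3 - l < 0 := by
        by_contra! hc
        exact hr ⟨(q - l).toNat, by simp only; omega⟩
      simp only [pairC, if_pos this, mul_zero]
  simp_rw [h1]
  refine ((Equiv.subRight (3 : ℤ)).tsum_eq fun k => ∑ l ∈ Λ, psC (2 ^ (-k) * ξ) *
    psC (2 ^ (-l) * η) * pairC (k + 3 - l) Z X Y).trans ?_
  refine tsum_eq_sum fun k hk => Finset.sum_eq_zero fun l _ => ?_
  rw [hK k hk]; ring

lemma integrable_famC (hα : 0 < α) (ξ η : ℝ) :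
    Integrable (fun t => famC α L Θ Q false t ξ * famC α L Θ Q true t η)
      ((Measure.count : Measure (ℤ × ℕ × ℕ)).prod volume) := by
  obtain ⟨C, hC, hle⟩ := exists_lintegral_famC_le hα L Θ Q
  have h1 := (measurable_famC hα L Θ Q false).comp (measurable_prodMk_right (y := ξ))
  have h2 := (measurable_famC hα L Θ Q true).comp (measurable_prodMk_right (y := η))
  refine ⟨(h1.mul h2).aestronglyMeasurable, ?_⟩
  rw [HasFiniteIntegral]
  simp_rw [enorm_mul]
  exact (hle ξ η).trans_lt (by finiteness)

lemma integral_famC_eq (hα : 0 < α)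
    (hL : ∀ ξ, 𝓕 (L : ℝ → ℂ) ξ = ((|ξ| ^ α : ℝ) : ℂ) * (phC (ξ / 4) - phC (8 * ξ)))
    (hΘ : ∀ ξ, 𝓕 (Θ : ℝ → ℂ) ξ = phC (ξ / 32))
    (hQ : ∀ ξ, 𝓕 (Q : ℝ → ℂ) ξ = ((|ξ| ^ α : ℝ) : ℂ) * psC ξ)
    {K Λ : Finset ℤ} {ξ η : ℝ} (hK : ∀ k ∉ K, psC (2 ^ (-k) * ξ) = 0)
    (hΛ : ∀ k ∉ Λ, psC (2 ^ (-k) * η) = 0) :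
    ∫ t, famC α L Θ Q false t ξ * famC α L Θ Q true t η
      ∂((Measure.count : Measure (ℤ × ℕ × ℕ)).prod volume) =
      ∑ k ∈ K, ∑ l ∈ Λ, psC (2 ^ (-k) * ξ) * psC (2 ^ (-l) * η) *
        pairC (k + 3 - l) ((|ξ + η| ^ α : ℝ) : ℂ) ((|ξ| ^ α : ℝ) : ℂ) ((|η| ^ α : ℝ) : ℂ) := by
  have hi := integrable_famC (L := L) (Θ := Θ) (Q := Q) hα ξ η
  have hic := hi.integral_prod_left
  replace hic := (integrable_count_iff.1 hic).of_norm
  rw [integral_prod _ hi, integral_countable hi.integral_prod_left]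
  simp only [measureReal_def, Measure.count_singleton, ENNReal.toReal_one, one_smul]
  rw [hic.tsum_prod, ← tsum_tsum_pairC hK hΛ]
  refine tsum_congr fun q => ?_
  rw [(hic.prod_factor q).tsum_prod]
  refine tsum_congr fun j => ?_
  rw [← tsum_integral_muF_mul_laF hα hL hΘ hQ]
  rfl

lemma exists_schwartz_bumps (α : ℝ) : ∃ L Θ Q : SchwartzMap ℝ ℂ,
    (∀ ξ, 𝓕 (L : ℝ → ℂ) ξ = ((|ξ| ^ α : ℝ) : ℂ) * (phC (ξ / 4) - phC (8 * ξ))) ∧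
    (∀ ξ, 𝓕 (Θ : ℝ → ℂ) ξ = phC (ξ / 32)) ∧
    (∀ ξ, 𝓕 (Q : ℝ → ℂ) ξ = ((|ξ| ^ α : ℝ) : ℂ) * psC ξ) := by
  have c4 : ContDiff ℝ ∞ fun ξ : ℝ => phC (ξ / 4) := contDiff_phC.comp (by fun_prop)
  have c8 : ContDiff ℝ ∞ fun ξ : ℝ => phC (8 * ξ) := contDiff_phC.comp (by fun_prop)
  have c32 : ContDiff ℝ ∞ fun ξ : ℝ => phC (ξ / 32) := contDiff_phC.comp (by fun_prop)
  have a4 (ξ : ℝ) : |ξ / 4| = |ξ| / 4 := by rw [abs_div]; norm_num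
  have a8 (ξ : ℝ) : |8 * ξ| = 8 * |ξ| := by rw [abs_mul]; norm_num
  have a32 (ξ : ℝ) : |ξ / 32| = |ξ| / 32 := by rw [abs_div]; norm_num
  obtain ⟨L, hL⟩ := exists_fourier_eq (contDiff_abs_rpow_mul (c4.sub c8)
    (r := 1 / 8) (by norm_num) (fun ξ h => by
      rw [phC_of_le (by rw [a4]; linarith), phC_of_le (by rw [a8]; linarith), sub_self]) α)
    (hasCompactSupport_of_abs_ge (R := 6) fun ξ h => by
      rw [phC_of_ge (by rw [a4]; linarith), phC_of_ge (by rw [a8]; linarith), sub_self,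
        mul_zero])
  obtain ⟨Θ, hΘ⟩ := exists_fourier_eq c32
    (hasCompactSupport_of_abs_ge (R := 48) fun ξ h => phC_of_ge (by rw [a32]; linarith))
  obtain ⟨Q, hQ⟩ := exists_fourier_eq (contDiff_abs_rpow_mul contDiff_psC
    (r := 1 / 2) (by norm_num) (fun ξ h => psC_of_le h.le) α)
    (hasCompactSupport_of_abs_ge (R := 3 / 2) fun ξ h => by rw [psC_of_ge h, mul_zero])
  exact ⟨L, Θ, Q, hL, hΘ, hQ⟩

/-- The commutator `|ξ + η|^α - |ξ|^α - |η|^α` is a superposition of products of multipliers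
which are localised in frequency. -/
lemma exists_commutator_family {α δ : ℝ} (hα : 0 < α) (hδ0 : 0 ≤ δ) (hδ1 : δ ≤ 1) (hδα : δ ≤ α) :
    ∃ (fam : Bool → CPar → ℝ → ℂ) (C : ℝ≥0), (∀ d, Measurable (Function.uncurry (fam d))) ∧
      (∀ γ, γ = 0 ∨ γ = α → ∀ t : CPar, KB γ (fam false t) (t.1.1 - 3) t.2 C) ∧
      (∀ γ, γ = 0 ∨ γ = α → ∀ t : CPar, KB γ (fam true t) (t.1.1 - t.1.2.1) t.2
        (C * (t2 (t.1.1 * α) * t2 (-δ * t.1.2.1) * t2 (-α * t.1.2.2) *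
          krn (t.1.1 - (t.1.2.2 + 3 : ℕ)) t.2))) ∧
      (∀ ξ η : ℝ, ∫⁻ t, ‖fam false t ξ‖ₑ * ‖fam true t η‖ₑ
        ∂((Measure.count : Measure (ℤ × ℕ × ℕ)).prod volume) ≤ C * ENNReal.ofReal (|ξ| ^ α)) ∧
      ∀ ξ η : ℝ, ξ ≠ 0 → η ≠ 0 → ((|ξ + η| ^ α : ℝ) : ℂ) =
        ((|ξ| ^ α : ℝ) : ℂ) + ((|η| ^ α : ℝ) : ℂ) +
        (∫ t, fam false t ξ * fam true t η
          ∂((Measure.count : Measure (ℤ × ℕ × ℕ)).prod volume)) +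
        ∫ t, fam true t ξ * fam false t η
          ∂((Measure.count : Measure (ℤ × ℕ × ℕ)).prod volume) := by
  obtain ⟨L, Θ, Q, hL, hΘ, hQ⟩ := exists_schwartz_bumps α
  obtain ⟨c0, h0, h0'⟩ := exists_KB_muF 0
  obtain ⟨c1, h1, h1'⟩ := exists_KB_muF α
  obtain ⟨d0, i0, i0'⟩ := exists_KB_laF hα hδ0 hδ1 hδα L Θ Q 0
  obtain ⟨d1, i1, i1'⟩ := exists_KB_laF hα hδ0 hδ1 hδα L Θ Q α
  obtain ⟨E, hE, hE'⟩ := exists_lintegral_famC_le hα L Θ Q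
  lift E to ℝ≥0 using hE
  refine ⟨famC α L Θ Q, c0.toNNReal + c1.toNNReal + d0.toNNReal + d1.toNNReal + E,
    measurable_famC hα L Θ Q, ?_, ?_, ?_, ?_⟩
  · rintro γ (rfl | rfl) t
    · refine (h0' t.1.1 t.2).mono (ENNReal.coe_le_coe.2 ?_)
      simp only [add_assoc]
      exact le_self_add
    · refine (h1' t.1.1 t.2).mono (ENNReal.coe_le_coe.2 ?_)
      rw [add_comm c0.toNNReal]
      simp only [add_assoc]
      exact le_self_add
  · rintro γ (rfl | rfl) t
    · refine (i0' t.1.1 t.1.2.1 t.1.2.2 t.2).mono ?_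
      rw [ENNReal.ofReal_mul i0, ofReal_szR]
      gcongr
      refine ENNReal.coe_le_coe.2 ?_
      rw [add_comm _ d0.toNNReal]
      simp only [add_assoc]
      exact le_self_add
    · refine (i1' t.1.1 t.1.2.1 t.1.2.2 t.2).mono ?_
      rw [ENNReal.ofReal_mul i1, ofReal_szR]
      gcongr
      refine ENNReal.coe_le_coe.2 ?_
      rw [add_comm _ d1.toNNReal]
      simp only [add_assoc]
      exact le_self_add
  · intro ξ η
    refine (hE' ξ η).trans ?_
    gcongr
    exact le_add_self
  · intro ξ η hξ hη
    obtain ⟨K, hK, hK1⟩ := exists_finset_psC hξ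
    obtain ⟨Λ, hΛ, hΛ1⟩ := exists_finset_psC hη
    have e : ∀ t, famC α L Θ Q true t ξ * famC α L Θ Q false t η =
        famC α L Θ Q false t η * famC α L Θ Q true t ξ := fun t => mul_comm _ _
    simp_rw [e]
    rw [integral_famC_eq hα hL hΘ hQ hK hΛ, integral_famC_eq hα hL hΘ hQ hΛ hK,
      Finset.sum_comm (s := Λ), add_assoc, ← Finset.sum_add_distrib, add_comm η ξ]
    simp_rw [← Finset.sum_add_distrib]
    set Z := ((|ξ + η| ^ α : ℝ) : ℂ)
    set X := ((|ξ| ^ α : ℝ) : ℂ)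
    set Y := ((|η| ^ α : ℝ) : ℂ)
    have hkl (k l : ℤ) : psC (2 ^ (-k) * ξ) * psC (2 ^ (-l) * η) * pairC (k + 3 - l) Z X Y +
        psC (2 ^ (-l) * η) * psC (2 ^ (-k) * ξ) * pairC (l + 3 - k) Z Y X =
        psC (2 ^ (-k) * ξ) * (psC (2 ^ (-l) * η) * (Z - X - Y)) := by
      rw [← pairC_add_pairC (k + 3 - l) Z X Y, show 6 - (k + 3 - l) = l + 3 - k by ring]
      ring
    simp_rw [hkl, ← Finset.mul_sum, ← Finset.sum_mul]
    rw [hK1, hΛ1]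
    ring

end CommutatorSum

section Weights

/-- Interpolation weights: the `c`-side carries the derivative with weight close to `0` if
`c = true` and close to `1` if `c = false`; `u` is the perturbation. -/
noncomputable def bwt (η u : ℝ) (c a : Bool) : ℝ :=
  if a then (if c then η else 1 - η) + u * (η / 2) else 1 - ((if c then η else 1 - η) + u * (η / 2))

lemma sum_bwt (η u : ℝ) (c : Bool) : ∑ a, bwt η u c a = 1 := by
  simp [bwt]

lemma bwt_pos {η u : ℝ} (hη : 0 < η) (hη1 : η ≤ 1 / 2) (hu : |u| ≤ 1) (c a : Bool) :
    0 < bwt η u c a := by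
  obtain ⟨h1, h2⟩ := abs_le.1 hu
  cases a <;> cases c <;> simp only [bwt, if_true, if_neg Bool.false_ne_true] <;> nlinarith

lemma bwt_le_one {η u : ℝ} (hη : 0 < η) (hη1 : η ≤ 1 / 2) (hu : |u| ≤ 1) (c a : Bool) :
    bwt η u c a ≤ 1 := by
  have h := sum_bwt η u c
  have h0 := bwt_pos hη hη1 hu c true
  have h1 := bwt_pos hη hη1 hu c false
  rw [Fintype.sum_bool] at h
  cases a <;> linarith

lemma bwt_not_not (η : ℝ) (c a : Bool) : bwt η 0 (!c) (!a) = bwt η 0 c a := by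
  cases a <;> cases c <;> simp [bwt]

lemma bwt_add (η : ℝ) (c a : Bool) : bwt η (-1) c a + bwt η 1 c a = 2 * bwt η 0 c a := by
  cases a <;> cases c <;> simp [bwt] <;> ring

lemma bwt_le_add {η u : ℝ} (hη : 0 < η) (hu : |u| ≤ 1) (c a : Bool) :
    bwt η u c a ≤ bwt η 0 c a + η / 2 := by
  obtain ⟨h1, h2⟩ := abs_le.1 hu
  cases a <;> cases c <;> simp only [bwt, if_true, if_neg Bool.false_ne_true] <;> nlinarith

/-- The scale shift on the `c`-side. -/
def shf (c : Bool) (j : ℕ) : ℕ := if c then j else 3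

/-- `x` if the derivative is present and `0` otherwise. -/
def selD (a : Bool) (x : ℝ) : ℝ := if a then x else 0

lemma weight_exponent_le {α δ η : ℝ} (hα : 0 < α) (hη : 0 < η) (hη1 : η ≤ 1 / 2)
    (hηδ : 3 * η * α ≤ δ) {u : ℝ} (hu : u = 1 ∨ u = -1) (q : ℤ) (d : Bool) (j : ℕ) :
    q * α + -δ * j + ∑ s : Bool, ∑ a : Bool,
        (-selD a α * ((q - (shf (xor s d) j : ℕ) : ℤ) : ℝ)) * bwt η u (xor s d) a ≤
      3 * α + -(δ / 2) * j + -u * (α * η) * q := by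
  have hj : (0 : ℝ) ≤ j := Nat.cast_nonneg j
  have h1 : 0 ≤ (δ - 3 * η * α) * j := mul_nonneg (by linarith) hj
  have h2 : 0 ≤ α * η := by positivity
  have h3 : 0 ≤ α * η * j := by positivity
  rcases hu with rfl | rfl <;> cases d <;> simp [selD, bwt, shf] <;> nlinarith

lemma rpow_sum_eq_prod {κ : Type*} [Fintype κ] {θ : κ → ℝ} (hθ : ∀ k, 0 ≤ θ k) (X : ℝ≥0∞) :
    X ^ ∑ k, θ k = ∏ k, X ^ θ k := by
  classical
  refine Finset.induction_on (Finset.univ : Finset κ) (by simp) fun k S hk ih => ?_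
  rw [Finset.sum_insert hk, Finset.prod_insert hk,
    ENNReal.rpow_add_of_nonneg _ _ (hθ k) (Finset.sum_nonneg fun i _ => hθ i), ih]

lemma le_prod_rpow {κ : Type*} [Fintype κ] {X : ℝ≥0∞} {Y : κ → ℝ≥0∞} {θ : κ → ℝ}
    (hθ : ∀ k, 0 ≤ θ k) (hs : ∑ k, θ k = 1) (h : ∀ k, X ≤ Y k) : X ≤ ∏ k, Y k ^ θ k := by
  calc X = X ^ ∑ k, θ k := by rw [hs, ENNReal.rpow_one]
    _ = ∏ k, X ^ θ k := rpow_sum_eq_prod hθ X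
    _ ≤ _ := Finset.prod_le_prod' fun k _ => ENNReal.rpow_le_rpow (h k) (hθ k)

lemma prod_rpow_le {κ : Type*} [Fintype κ] {X : ℝ≥0∞} {Y : κ → ℝ≥0∞} {θ : κ → ℝ}
    (hθ : ∀ k, 0 ≤ θ k) (hs : ∑ k, θ k = 1) (h : ∀ k, Y k ≤ X) : ∏ k, Y k ^ θ k ≤ X := by
  calc ∏ k, Y k ^ θ k ≤ ∏ k, X ^ θ k :=
        Finset.prod_le_prod' fun k _ => ENNReal.rpow_le_rpow (h k) (hθ k)
    _ = X ^ ∑ k, θ k := (rpow_sum_eq_prod hθ X).symm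
    _ = X := by rw [hs, ENNReal.rpow_one]

lemma t2_sum {κ : Type*} (S : Finset κ) (x : κ → ℝ) : t2 (∑ k ∈ S, x k) = ∏ k ∈ S, t2 (x k) := by
  classical
  induction S using Finset.induction_on with
  | empty => simp [t2_zero]
  | insert k S hk ih => rw [Finset.sum_insert hk, Finset.prod_insert hk, t2_add, ih]

lemma prod_le_t2_mul_prod {κ : Type*} [Fintype κ] {X : Bool → ℝ≥0∞} {c θ : Bool → κ → ℝ}
    {e : Bool × κ → ℝ≥0∞} (hθ : ∀ s k, 0 ≤ θ s k) (hs : ∀ s, ∑ k, θ s k = 1)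
    (hX : ∀ s k, X s ≤ t2 (c s k) * e (s, k)) :
    X false * X true ≤ t2 (∑ s, ∑ k, c s k * θ s k) * ∏ i : Bool × κ, e i ^ θ i.1 i.2 := by
  have h (s : Bool) : X s ≤ t2 (∑ k, c s k * θ s k) * ∏ k, e (s, k) ^ θ s k := by
    refine (le_prod_rpow (hθ s) (hs s) (hX s)).trans (le_of_eq ?_)
    rw [t2_sum, ← Finset.prod_mul_distrib]
    refine Finset.prod_congr rfl fun k _ => ?_
    rw [ENNReal.mul_rpow_of_nonneg _ _ (hθ s k), t2_rpow]
  refine (mul_le_mul' (h false) (h true)).trans (le_of_eq ?_)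
  rw [Fintype.sum_bool, Fintype.prod_prod_type, Fintype.prod_bool, t2_add]
  ring

lemma prod_fst_rpow {κ : Type*} [Fintype κ] {θ : Bool → κ → ℝ} (hθ : ∀ s k, 0 ≤ θ s k)
    (hs : ∀ s, ∑ k, θ s k = 1) (c : Bool → ℝ≥0∞) :
    ∏ i : Bool × κ, c i.1 ^ θ i.1 i.2 = c false * c true := by
  rw [Fintype.prod_prod_type, Fintype.prod_bool]
  simp_rw [← rpow_sum_eq_prod (hθ _), hs, ENNReal.rpow_one]
  ring

lemma sum_pair_eq {κ : Type*} [Fintype κ] {θ x : Bool → κ → ℝ} (flip : κ ≃ κ)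
    (hs : ∑ k, θ false k = 1) (hf : ∀ k, θ true (flip k) = θ false k) {A : ℝ}
    (hx : ∀ k, x false k + x true (flip k) = A) : ∑ i : Bool × κ, θ i.1 i.2 * x i.1 i.2 = A := by
  rw [Fintype.sum_prod_type, Fintype.sum_bool, ← flip.sum_comp fun k => θ true k * x true k,
    ← Finset.sum_add_distrib]
  simp_rw [hf, ← mul_add]
  simp_rw [add_comm (x true _), hx, ← Finset.sum_mul, hs, one_mul]

lemma prod_pair_le {κ : Type*} [Fintype κ] {θ : Bool → κ → ℝ} {N : Bool → κ → ℝ≥0∞}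
    (flip : κ ≃ κ) (hθ : ∀ s k, 0 ≤ θ s k)
    (hs : ∑ k, θ false k = 1) (hf : ∀ k, θ true (flip k) = θ false k) {R : ℝ≥0∞}
    (hR : ∀ k, N false k * N true (flip k) ≤ R) : ∏ i : Bool × κ, N i.1 i.2 ^ θ i.1 i.2 ≤ R := by
  rw [Fintype.prod_prod_type, Fintype.prod_bool, ← flip.prod_comp fun k => N true k ^ θ true k,
    ← Finset.prod_mul_distrib]
  simp_rw [hf]
  refine le_trans (le_of_eq ?_) (prod_rpow_le (hθ false) hs hR)
  refine Finset.prod_congr rfl fun k _ => ?_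
  rw [ENNReal.mul_rpow_of_nonneg _ _ (hθ false k), mul_comm]

lemma nrm2_tsum_geom_le {A B κ κ' : ℝ} (hA : 0 ≤ A) (hA2 : A ≤ 2) (hB : 0 ≤ B) (hB2 : B ≤ 2)
    {Z : ℕ × ℕ → ℝ × ℝ → ℝ≥0∞} (hZ : ∀ k, Measurable (Z k)) {D : ℝ≥0∞}
    (h : ∀ k, nrm2 volume volume A B (Z k) ≤ D * (t2 (-κ * k.1) * t2 (-κ' * k.2))) :
    nrm2 volume volume A B (fun z => ∑' k, Z k z) ≤
      (geomC (κ / 2) * geomC (κ' / 2)) ^ (2 : ℝ) * D := by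
  have h1 := nrm2_tsum_rpow_half_le hA hA2 hB hB2 hZ (μ := volume) (ν := volume)
  have h2 : ∑' k, nrm2 volume volume A B (Z k) ^ (1 / 2 : ℝ) ≤
      (geomC (κ / 2) * geomC (κ' / 2)) * D ^ (1 / 2 : ℝ) := by
    calc _ ≤ ∑' k : ℕ × ℕ, D ^ (1 / 2 : ℝ) * (t2 (-(κ / 2) * k.1) * t2 (-(κ' / 2) * k.2)) := by
          refine ENNReal.tsum_le_tsum fun k => ?_
          refine (ENNReal.rpow_le_rpow (h k) (by norm_num)).trans (le_of_eq ?_)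
          rw [ENNReal.mul_rpow_of_nonneg _ _ (by norm_num),
            ENNReal.mul_rpow_of_nonneg _ _ (by norm_num), t2_rpow, t2_rpow]
          congr 3 <;> ring_nf
      _ = _ := by
          rw [ENNReal.tsum_mul_left, ENNReal.tsum_prod', mul_comm]
          simp_rw [ENNReal.tsum_mul_left, ENNReal.tsum_mul_right]
          rfl
  have h3 := ENNReal.rpow_le_rpow (h1.trans h2) (by norm_num : (0 : ℝ) ≤ 2)
  rw [← ENNReal.rpow_mul, ENNReal.mul_rpow_of_nonneg _ _ (by norm_num : (0 : ℝ) ≤ 2),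
    ← ENNReal.rpow_mul] at h3
  norm_num at h3 ⊢
  exact h3

end Weights

section Superposition

/-- Amplitude of the pieces of the commutator family. -/
noncomputable def amp (α δ : ℝ) (C : ℝ≥0∞) (t : CPar) (c : Bool) : ℝ≥0∞ :=
  if c then C * (t2 (t.1.1 * α) * t2 (-δ * t.1.2.1) * t2 (-α * t.1.2.2) *
    krn (t.1.1 - (t.1.2.2 + 3 : ℕ)) t.2) else C

lemma amp_mul_amp (α δ : ℝ) (C : ℝ≥0∞) (t : CPar) (d : Bool) :
    amp α δ C t (xor false d) * amp α δ C t (xor true d) =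
      C * C * (t2 (-α * t.1.2.2) * krn (t.1.1 - (t.1.2.2 + 3 : ℕ)) t.2) *
        t2 (t.1.1 * α + -δ * t.1.2.1) := by
  rw [t2_add]
  cases d <;> simp [amp] <;> ring

lemma prod_le_amp_mul_prod {κ : Type*} [Fintype κ] {X A : Bool → ℝ≥0∞} {c θ : Bool → κ → ℝ}
    {e : Bool × κ → ℝ≥0∞} (hθ : ∀ s k, 0 ≤ θ s k) (hs : ∀ s, ∑ k, θ s k = 1)
    (hX : ∀ s k, X s ≤ A s * t2 (c s k) * e (s, k)) :
    X false * X true ≤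
      A false * A true * t2 (∑ s, ∑ k, c s k * θ s k) * ∏ i : Bool × κ, e i ^ θ i.1 i.2 := by
  refine (prod_le_t2_mul_prod (X := X) (e := fun i => A i.1 * e i) hθ hs
    (fun s k => (hX s k).trans (le_of_eq (by ring)))).trans (le_of_eq ?_)
  have : ∏ i : Bool × κ, (A i.1 * e i) ^ θ i.1 i.2 =
      (∏ i : Bool × κ, A i.1 ^ θ i.1 i.2) * ∏ i : Bool × κ, e i ^ θ i.1 i.2 := by
    rw [← Finset.prod_mul_distrib]
    exact Finset.prod_congr rfl fun i _ => ENNReal.mul_rpow_of_nonneg _ _ (hθ _ _)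
  rw [this, prod_fst_rpow hθ hs]
  ring

/-- Decay profile of a commutator piece. -/
noncomputable def prf (α δ : ℝ) (C : ℝ≥0∞) (p : ℕ × ℕ) : ℝ≥0∞ :=
  C * C * t2 (3 * α) * (t2 (-(δ / 2) * p.1) * t2 (-α * p.2))

section Pointwise

variable {α δ η : ℝ} (hα : 0 < α) (hη : 0 < η) (hη1 : η ≤ 1 / 2) (hηδ : 3 * η * α ≤ δ)
include hα hη hη1 hηδ

lemma amp_mul_t2_le {u : ℝ} (hu : u = 1 ∨ u = -1) (C : ℝ≥0∞) (t : CPar) (d : Bool) :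
    amp α δ C t (xor false d) * amp α δ C t (xor true d) * t2 (∑ s : Bool, ∑ a : Bool,
        (-selD a α * ((t.1.1 - (shf (xor s d) t.1.2.1 : ℕ) : ℤ) : ℝ)) * bwt η u (xor s d) a) ≤
      prf α δ C t.1.2 * krn (t.1.1 - (t.1.2.2 + 3 : ℕ)) t.2 * t2 (-u * (α * η) * t.1.1) := by
  rw [amp_mul_amp, mul_assoc, ← t2_add]
  refine (mul_le_mul_right (t2_mono (weight_exponent_le hα hη hη1 hηδ hu t.1.1 d t.1.2.1))
    _).trans (le_of_eq ?_)
  rw [t2_add, t2_add, prf]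
  ring

lemma prod_le_mixMin (C : ℝ≥0∞) (t : CPar) (d : Bool) {X : Bool → ℝ≥0∞}
    {e : Bool × Bool → ℝ≥0∞}
    (hX : ∀ s a, X s ≤ amp α δ C t (xor s d) *
      t2 (-selD a α * ((t.1.1 - (shf (xor s d) t.1.2.1 : ℕ) : ℤ) : ℝ)) * e (s, a)) :
    X false * X true ≤ prf α δ C t.1.2 * (krn (t.1.1 - (t.1.2.2 + 3 : ℕ)) t.2 *
      mixMin (α * η) (fun i : Bool × Bool => bwt η (-1) (xor i.1 d) i.2)
        (fun i => bwt η 1 (xor i.1 d) i.2) t.1.1 e) := by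
  have h (u : ℝ) (hu : u = 1 ∨ u = -1) := (prod_le_amp_mul_prod
    (θ := fun s a => bwt η u (xor s d) a)
    (fun s a => (bwt_pos hη hη1 (by rcases hu with rfl | rfl <;> simp) _ _).le)
    (fun s => sum_bwt η u _) hX).trans
      (mul_le_mul_left (amp_mul_t2_le hα hη hη1 hηδ hu C t d) _)
  have h1 := h 1 (Or.inl rfl)
  have h2 := h (-1) (Or.inr rfl)
  unfold mixMin
  rw [← mul_assoc, mul_min]
  refine le_min (h2.trans (le_of_eq ?_)) (h1.trans (le_of_eq ?_)) <;> ring_nf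

lemma prod_le_min_mixMin {α' δ' : ℝ} (hα' : 0 < α') (hηδ' : 3 * η * α' ≤ δ') (C C' : ℝ≥0∞)
    (t t' : CPar) (d d' : Bool) {X : Bool → ℝ≥0∞} {e : Bool × Bool × Bool → ℝ≥0∞}
    (hX : ∀ s a b, X s ≤ amp α δ C t (xor s d) * amp α' δ' C' t' (xor s d') *
      (t2 (-selD a α * ((t.1.1 - (shf (xor s d) t.1.2.1 : ℕ) : ℤ) : ℝ)) *
        t2 (-selD b α' * ((t'.1.1 - (shf (xor s d') t'.1.2.1 : ℕ) : ℤ) : ℝ))) * e (s, a, b)) :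
    X false * X true ≤ prf α δ C t.1.2 * prf α' δ' C' t'.1.2 *
      (krn (t.1.1 - (t.1.2.2 + 3 : ℕ)) t.2 * (krn (t'.1.1 - (t'.1.2.2 + 3 : ℕ)) t'.2 *
        min (t2 (α * η * t.1.1) * mixMin (α' * η)
            (fun i : Bool × Bool × Bool =>
              bwt η (-1) (xor i.1 d) i.2.1 * bwt η (-1) (xor i.1 d') i.2.2)
            (fun i => bwt η (-1) (xor i.1 d) i.2.1 * bwt η 1 (xor i.1 d') i.2.2) t'.1.1 e)
          (t2 (-(α * η) * t.1.1) * mixMin (α' * η)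
            (fun i : Bool × Bool × Bool =>
              bwt η 1 (xor i.1 d) i.2.1 * bwt η (-1) (xor i.1 d') i.2.2)
            (fun i => bwt η 1 (xor i.1 d) i.2.1 * bwt η 1 (xor i.1 d') i.2.2) t'.1.1 e))) := by
  have h (u v : ℝ) (hu : u = 1 ∨ u = -1) (hv : v = 1 ∨ v = -1) : X false * X true ≤
      prf α δ C t.1.2 * prf α' δ' C' t'.1.2 * (krn (t.1.1 - (t.1.2.2 + 3 : ℕ)) t.2 *
        (krn (t'.1.1 - (t'.1.2.2 + 3 : ℕ)) t'.2 * (t2 (-u * (α * η) * t.1.1) *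
          (t2 (-v * (α' * η) * t'.1.1) * ∏ i : Bool × Bool × Bool,
            e i ^ (bwt η u (xor i.1 d) i.2.1 * bwt η v (xor i.1 d') i.2.2))))) := by
    have pu (s a) : 0 ≤ bwt η u (xor s d) a :=
      (bwt_pos hη hη1 (by rcases hu with rfl | rfl <;> simp) _ _).le
    have pv (s a) : 0 ≤ bwt η v (xor s d') a :=
      (bwt_pos hη hη1 (by rcases hv with rfl | rfl <;> simp) _ _).le
    have hsum (s : Bool) :
        ∑ k : Bool × Bool, bwt η u (xor s d) k.1 * bwt η v (xor s d') k.2 = 1 := by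
      rw [Fintype.sum_prod_type]
      simp_rw [← Finset.mul_sum, sum_bwt, mul_one]
      exact sum_bwt η u _
    have hle := prod_le_amp_mul_prod (X := X) (e := e)
      (A := fun s => amp α δ C t (xor s d) * amp α' δ' C' t' (xor s d'))
      (c := fun s (k : Bool × Bool) =>
        -selD k.1 α * ((t.1.1 - (shf (xor s d) t.1.2.1 : ℕ) : ℤ) : ℝ) +
        -selD k.2 α' * ((t'.1.1 - (shf (xor s d') t'.1.2.1 : ℕ) : ℤ) : ℝ))
      (θ := fun s (k : Bool × Bool) => bwt η u (xor s d) k.1 * bwt η v (xor s d') k.2)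
      (fun s k => mul_nonneg (pu _ _) (pv _ _)) hsum
      (fun s k => by rw [t2_add]; exact hX s k.1 k.2)
    refine hle.trans ?_
    have hE (s : Bool) : ∑ k : Bool × Bool,
        (-selD k.1 α * ((t.1.1 - (shf (xor s d) t.1.2.1 : ℕ) : ℤ) : ℝ) +
          -selD k.2 α' * ((t'.1.1 - (shf (xor s d') t'.1.2.1 : ℕ) : ℤ) : ℝ)) *
          (bwt η u (xor s d) k.1 * bwt η v (xor s d') k.2) =
        (∑ a : Bool, (-selD a α * ((t.1.1 - (shf (xor s d) t.1.2.1 : ℕ) : ℤ) : ℝ)) *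
          bwt η u (xor s d) a) +
        ∑ b : Bool, (-selD b α' * ((t'.1.1 - (shf (xor s d') t'.1.2.1 : ℕ) : ℤ) : ℝ)) *
          bwt η v (xor s d') b := by
      have e1 := sum_bwt η u (xor s d)
      have e2 := sum_bwt η v (xor s d')
      simp only [Fintype.sum_bool] at e1 e2
      rw [Fintype.sum_prod_type]
      simp only [Fintype.sum_bool]
      generalize bwt η u (xor s d) true = x1 at *
      generalize bwt η v (xor s d') true = x3 at *
      rw [eq_sub_of_add_eq' e1, eq_sub_of_add_eq' e2]
      ring
    simp_rw [hE]
    rw [Finset.sum_add_distrib, t2_add]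
    have i1 := amp_mul_t2_le hα hη hη1 hηδ hu C t d
    have i2 := amp_mul_t2_le hα' hη hη1 hηδ' hv C' t' d'
    generalize ∏ i : Bool × Bool × Bool,
      e i ^ (bwt η u (xor i.1 d) i.2.1 * bwt η v (xor i.1 d') i.2.2) = P
    refine le_trans (le_of_eq ?_) ((mul_le_mul_left (mul_le_mul' i1 i2) P).trans (le_of_eq ?_))
    · ring
    · ring
  unfold mixMin
  rw [← mul_assoc, ← mul_assoc, mul_min, mul_min, mul_min, mul_min, mul_min]
  refine le_min (le_min ?_ ?_) (le_min ?_ ?_)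
  · exact (h (-1) (-1) (Or.inr rfl) (Or.inr rfl)).trans (le_of_eq (by ring_nf))
  · exact (h (-1) 1 (Or.inr rfl) (Or.inl rfl)).trans (le_of_eq (by ring_nf))
  · exact (h 1 (-1) (Or.inl rfl) (Or.inr rfl)).trans (le_of_eq (by ring_nf))
  · exact (h 1 1 (Or.inl rfl) (Or.inl rfl)).trans (le_of_eq (by ring_nf))

end Pointwise

lemma lintegral_CPar_le {Y : CPar → ℝ≥0∞} {D : ℕ × ℕ → ℝ≥0∞} {G : ℤ → ℕ × ℕ → ℝ → ℝ≥0∞}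
    (hG : ∀ q p, Measurable (G q p)) (x : ℝ)
    (h : ∀ t : CPar, Y t ≤
      D t.1.2 * (krn (t.1.1 - (t.1.2.2 + 3 : ℕ)) t.2 * G t.1.1 t.1.2 (x - t.2))) :
    ∫⁻ t, Y t ∂((Measure.count : Measure (ℤ × ℕ × ℕ)).prod volume) ≤
      ∑' p : ℕ × ℕ, D p * ∑' q : ℤ, cnv (krn (q - (p.2 + 3 : ℕ))) (G q p) x := by
  have m (k : ℤ × ℕ × ℕ) : Measurable fun w => krn (k.1 - (k.2.2 + 3 : ℕ)) w * G k.1 k.2 (x - w) :=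
    (measurable_krn _).mul ((hG _ _).comp (by fun_prop))
  refine (lintegral_mono h).trans ((lintegral_prod_le _).trans (le_of_eq ?_))
  rw [lintegral_count, ENNReal.tsum_prod', ENNReal.tsum_comm]
  refine tsum_congr fun p => ?_
  rw [← ENNReal.tsum_mul_left]
  refine tsum_congr fun q => ?_
  refine (lintegral_const_mul (D p) (m (q, p))).trans ?_
  congr 1
  unfold cnv
  rw [← lintegral_sub_left_eq_self _ x]
  simp

lemma cnv_tsum_mul {κ : Type*} [Countable κ] {k : ℝ → ℝ≥0∞} (hk : Measurable k) (D : κ → ℝ≥0∞)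
    {u : κ → ℝ → ℝ≥0∞} (hu : ∀ i, Measurable (u i)) (x : ℝ) :
    cnv k (fun x => ∑' i, D i * u i x) x = ∑' i, D i * cnv k (u i) x := by
  have m (i : κ) : Measurable fun x' => k (x - x') * u i x' :=
    (hk.comp (by fun_prop)).mul (hu i)
  have m2 (i : κ) : Measurable fun x' => D i * (k (x - x') * u i x') := (m i).const_mul _
  unfold cnv
  calc _ = ∫⁻ x', ∑' i, D i * (k (x - x') * u i x') := by
        refine lintegral_congr fun x' => ?_
        rw [← ENNReal.tsum_mul_left]
        exact tsum_congr fun i => by ring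
    _ = ∑' i, ∫⁻ x', D i * (k (x - x') * u i x') := lintegral_tsum fun i => (m2 i).aemeasurable
    _ = _ := tsum_congr fun i => lintegral_const_mul _ (m i)

lemma lintegral_CPar_CPar_le {Y : CPar → CPar → ℝ≥0∞} {D D' : ℕ × ℕ → ℝ≥0∞}
    {H : ℤ → ℤ → ℕ × ℕ → ℕ × ℕ → ℝ × ℝ → ℝ≥0∞} (hH : ∀ q q' p p', Measurable (H q q' p p'))
    (x y : ℝ)
    (h : ∀ t t' : CPar, Y t t' ≤ D t.1.2 * D' t'.1.2 * (krn (t.1.1 - (t.1.2.2 + 3 : ℕ)) t.2 *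
      (krn (t'.1.1 - (t'.1.2.2 + 3 : ℕ)) t'.2 *
        H t.1.1 t'.1.1 t.1.2 t'.1.2 (x - t.2, y - t'.2)))) :
    ∫⁻ t, ∫⁻ t', Y t t' ∂((Measure.count : Measure (ℤ × ℕ × ℕ)).prod volume)
        ∂((Measure.count : Measure (ℤ × ℕ × ℕ)).prod volume) ≤
      ∑' p : ℕ × ℕ, ∑' p' : ℕ × ℕ, D p * D' p' * ∑' q : ℤ, cnv (krn (q - (p.2 + 3 : ℕ)))
        (fun x => ∑' q' : ℤ, cnv (krn (q' - (p'.2 + 3 : ℕ))) (fun y => H q q' p p' (x, y)) y) x := by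
  have mH (q q' p p') : Measurable fun x =>
      cnv (krn (q' - (p'.2 + 3 : ℕ))) (fun y => H q q' p p' (x, y)) y := by
    have m := measurable_slice_left
      (measurable_cnv_prod_right (measurable_krn (q' - (p'.2 + 3 : ℕ))) (hH q q' p p')) y
    exact m
  have mT (q p p') : Measurable fun x => ∑' q' : ℤ,
      cnv (krn (q' - (p'.2 + 3 : ℕ))) (fun y => H q q' p p' (x, y)) y :=
    Measurable.ennreal_tsum fun q' => mH q q' p p'
  have hin (t : CPar) : ∫⁻ t', Y t t' ∂((Measure.count : Measure (ℤ × ℕ × ℕ)).prod volume) ≤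
      D t.1.2 * (krn (t.1.1 - (t.1.2.2 + 3 : ℕ)) t.2 * ∑' p' : ℕ × ℕ, D' p' * ∑' q' : ℤ,
        cnv (krn (q' - (p'.2 + 3 : ℕ))) (fun y => H t.1.1 q' t.1.2 p' (x - t.2, y)) y) := by
    have := lintegral_CPar_le (Y := Y t)
      (D := fun p' => D t.1.2 * krn (t.1.1 - (t.1.2.2 + 3 : ℕ)) t.2 * D' p')
      (G := fun q' p' y => H t.1.1 q' t.1.2 p' (x - t.2, y))
      (fun q' p' => by
        have m := measurable_slice_right (hH t.1.1 q' t.1.2 p') (x - t.2)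
        exact m) y (fun t' => (h t t').trans (le_of_eq (by ring)))
    refine this.trans (le_of_eq ?_)
    rw [← mul_assoc, ← ENNReal.tsum_mul_left]
    exact tsum_congr fun p' => by rw [mul_assoc (D t.1.2 * _)]
  have := lintegral_CPar_le (D := D) (G := fun q p x => ∑' p' : ℕ × ℕ, D' p' * ∑' q' : ℤ,
    cnv (krn (q' - (p'.2 + 3 : ℕ))) (fun y => H q q' p p' (x, y)) y)
    (fun q p => Measurable.ennreal_tsum fun p' => (mT q p p').const_mul _) x hin
  refine this.trans (le_of_eq (tsum_congr fun p => ?_))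
  simp_rw [cnv_tsum_mul (measurable_krn _) D' fun p' => mT _ p p']
  rw [ENNReal.tsum_comm, ← ENNReal.tsum_mul_left]
  refine tsum_congr fun p' => ?_
  rw [ENNReal.tsum_mul_left, mul_assoc]

lemma exists_profile_le {α δ σ : ℝ} (hδ : 0 < δ) (hσ : 0 < σ) (hα : 1 / σ - 1 < α) {C : ℝ≥0∞}
    (hC : C ≠ ⊤) : ∃ K : ℝ≥0∞, K ≠ ⊤ ∧ ∀ p : ℕ × ℕ,
      prf α δ C p * (t2 ((p.2 + 3 : ℕ) * (1 / σ - 1)) * (1 + (p.2 + 3 : ℕ) : ℝ≥0∞) ^ (1 / σ) *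
        (4 * (1 + p.1))) ≤
      K * (t2 (-(δ / 4) * p.1) * t2 (-((α - (1 / σ - 1)) / 2) * p.2)) := by
  set κ := (α - (1 / σ - 1)) / 2 with hκ
  have hκ0 : 0 < κ := by rw [hκ]; linarith
  obtain ⟨C1, hC1, h1⟩ := exists_one_add_rpow_le hκ0 (by positivity : 0 < 1 / σ)
  obtain ⟨C2, hC2, h2⟩ := exists_one_add_rpow_le (by positivity : 0 < δ / 4) one_pos
  refine ⟨C * C * t2 (3 * α) * C1 * C2 * 4 * t2 (3 * (1 / σ - 1)) * t2 (κ * 3), ?_, fun p => ?_⟩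
  · refine ENNReal.mul_ne_top (ENNReal.mul_ne_top (ENNReal.mul_ne_top (ENNReal.mul_ne_top
      (ENNReal.mul_ne_top (ENNReal.mul_ne_top (ENNReal.mul_ne_top hC hC) ?_) hC1) hC2) ?_) ?_) ?_
    all_goals first | exact t2_ne_top _ | norm_num
  · have e1 := h1 (p.2 + 3)
    have e2 := h2 p.1
    rw [ENNReal.rpow_one] at e2
    calc _ ≤ prf α δ C p * (t2 ((p.2 + 3 : ℕ) * (1 / σ - 1)) * (C1 * t2 (κ * (p.2 + 3 : ℕ))) *
          (4 * (C2 * t2 (δ / 4 * p.1)))) := by gcongr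
      _ = _ := by
        have x1 : t2 (-(δ / 4) * p.1) = t2 (-(δ / 2) * p.1) * t2 (δ / 4 * p.1) := by
          rw [← t2_add]; ring_nf
        have x2 : t2 (-κ * p.2) = t2 (-α * p.2) * t2 (p.2 * (1 / σ - 1)) * t2 (κ * p.2) := by
          rw [← t2_add, ← t2_add, hκ]; ring_nf
        rw [x1, x2, prf]
        push_cast
        rw [add_mul, mul_add κ, t2_add, t2_add]
        ring

end Superposition

section Classes

/-- The multiplier families produced by the commutator decomposition of `|ξ + η| ^ α`. -/
structure CommFam (α δ : ℝ) (C : ℝ≥0) (fam : Bool → CPar → ℝ → ℂ) : Prop where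
  meas : ∀ d, Measurable (Function.uncurry (fam d))
  kb : ∀ a t d, KB (selD a α) (fam d t) (t.1.1 - (shf d t.1.2.1 : ℕ)) t.2 (amp α δ C t d)

lemma amp_ne_top (α δ : ℝ) (C : ℝ≥0) (t : CPar) (c : Bool) : amp α δ C t c ≠ ⊤ := by
  unfold amp krn
  split_ifs
  · exact ENNReal.mul_ne_top coe_ne_top (ENNReal.mul_ne_top (ENNReal.mul_ne_top (ENNReal.mul_ne_top
      (t2_ne_top _) (t2_ne_top _)) (t2_ne_top _)) ENNReal.ofReal_ne_top)
  · exact coe_ne_top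

/-- The modulus of a fractional derivative of one of the two factors. -/
noncomputable def fdn (α β : ℝ) (h : Bool → SchwartzMap (ℝ × ℝ) ℂ) (s a b : Bool) (z : ℝ × ℝ) :
    ℝ≥0∞ := ‖fracD (selD a α) (selD b β) (h s) z‖ₑ

lemma selD_nonneg {x : ℝ} (hx : 0 < x) (a : Bool) : 0 ≤ selD a x := by
  unfold selD; split_ifs <;> linarith

/-- Admissible families of exponents. -/
structure ExpPair (e : Bool → Bool → Bool → ℝ) (A : ℝ) : Prop where
  nonneg : ∀ s a b, 0 ≤ e s a b
  lt_one : ∀ s a b, e s a b < 1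
  add_eq : ∀ a b, e false a b + e true (!a) (!b) = A

/-- The mixed norms of the factors. -/
noncomputable def fnm (α β : ℝ) (ea eb : Bool → Bool → Bool → ℝ)
    (h : Bool → SchwartzMap (ℝ × ℝ) ℂ) (s a b : Bool) : ℝ≥0∞ :=
  nrm2 volume volume (ea s a b) (eb s a b) (fdn α β h s a b)

/-- The boundedness of a bilinear expression by the right-hand side of the Leibniz rule. -/
def LeibBd (α β A B : ℝ) (ea eb : Bool → Bool → Bool → ℝ)
    (T : (Bool → SchwartzMap (ℝ × ℝ) ℂ) → ℝ × ℝ → ℝ≥0∞) : Prop :=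
  ∃ K : ℝ≥0∞, K ≠ ⊤ ∧ ∀ h R, (∀ a b, fnm α β ea eb h false a b * fnm α β ea eb h true (!a) (!b) ≤ R) →
    nrm2 volume volume A B (T h) ≤ K * R

lemma exists_nrm2_tsum_prf_le {α δ σ A B : ℝ} (hδ : 0 < δ) (hσ : 0 < σ) (hα : 1 / σ - 1 < α)
    (hA : 0 ≤ A) (hA2 : A ≤ 2) (hB : 0 ≤ B) (hB2 : B ≤ 2) (C : ℝ≥0) :
    ∃ K : ℝ≥0∞, K ≠ ⊤ ∧ ∀ (R : ℝ≥0∞) (Z : ℕ × ℕ → ℝ × ℝ → ℝ≥0∞), (∀ p, Measurable (Z p)) →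
      (∀ p, nrm2 volume volume A B (Z p) ≤ R * (t2 ((p.2 + 3 : ℕ) * (1 / σ - 1)) *
        (1 + (p.2 + 3 : ℕ) : ℝ≥0∞) ^ (1 / σ) * (4 * (1 + p.1)))) →
      nrm2 volume volume A B (fun z => ∑' p, prf α δ C p * Z p z) ≤ K * R := by
  obtain ⟨K, hK, h⟩ := exists_profile_le hδ hσ hα (coe_ne_top : (C : ℝ≥0∞) ≠ ⊤)
  refine ⟨(geomC (δ / 4 / 2) * geomC ((α - (1 / σ - 1)) / 2 / 2)) ^ (2 : ℝ) * K,
    ENNReal.mul_ne_top (ENNReal.rpow_ne_top_of_nonneg (by norm_num) (ENNReal.mul_ne_top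
      (geomC_ne_top (by linarith)) (geomC_ne_top (by linarith)))) hK, fun R Z hZ hR => ?_⟩
  rw [mul_assoc]
  refine nrm2_tsum_geom_le hA hA2 hB hB2 (fun p => (hZ p).const_mul _) fun p => ?_
  rw [nrm2_const_mul hA hB _ (hZ p)]
  calc _ ≤ prf α δ C p * (R * (t2 ((p.2 + 3 : ℕ) * (1 / σ - 1)) *
        (1 + (p.2 + 3 : ℕ) : ℝ≥0∞) ^ (1 / σ) * (4 * (1 + p.1)))) := mul_le_mul_right (hR p) _
    _ = R * (prf α δ C p * (t2 ((p.2 + 3 : ℕ) * (1 / σ - 1)) *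
        (1 + (p.2 + 3 : ℕ) : ℝ≥0∞) ^ (1 / σ) * (4 * (1 + p.1)))) := by ring
    _ ≤ R * (K * (t2 (-(δ / 4) * p.1) * t2 (-((α - (1 / σ - 1)) / 2) * p.2))) :=
        mul_le_mul_right (h p) _
    _ = _ := by ring

lemma measurable_fdn {α β : ℝ} (hα : 0 < α) (hβ : 0 < β) (h : Bool → SchwartzMap (ℝ × ℝ) ℂ)
    (s a b : Bool) : Measurable (fdn α β h s a b) :=
  (continuous_fracD (h s) (selD_nonneg hα a) (selD_nonneg hβ b)).enorm.measurable

lemma exists_fdn_le (α β : ℝ) (h : Bool → SchwartzMap (ℝ × ℝ) ℂ) (s a b : Bool) :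
    ∃ M : ℝ≥0, ∀ z, fdn α β h s a b z ≤ M :=
  exists_norm_fracD_le (h s) _ _

lemma sum_bwt_mul_le {κ : Type*} [Fintype κ] {θ θ' x : Bool → κ → ℝ} (flip : κ ≃ κ)
    (hs : ∀ s, ∑ k, θ s k = 1) (hf : ∀ k, θ true (flip k) = θ false k) {B ν ζ : ℝ}
    (hx : ∀ k, x false k + x true (flip k) = B) (hθ : ∀ s k, θ' s k ≤ θ s k + ζ)
    (h0 : ∀ s k, 0 ≤ x s k + ν) (h1 : ∀ s k, x s k + ν ≤ 1) (hζ : 0 ≤ ζ) :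
    ∑ i : Bool × κ, θ' i.1 i.2 * (x i.1 i.2 + ν) ≤ B + 2 * ν + 2 * Fintype.card κ * ζ := by
  calc _ ≤ ∑ i : Bool × κ, (θ i.1 i.2 * x i.1 i.2 + ν * θ i.1 i.2 + ζ) := by
        refine Finset.sum_le_sum fun i _ => ?_
        nlinarith [mul_le_mul_of_nonneg_right (hθ i.1 i.2) (h0 i.1 i.2),
          mul_le_mul_of_nonneg_left (h1 i.1 i.2) hζ]
    _ = _ := by
        rw [Finset.sum_add_distrib, Finset.sum_add_distrib, sum_pair_eq flip (hs false) hf hx,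
          ← Finset.mul_sum, Fintype.sum_prod_type]
        simp only [hs]
        simp
        ring

variable {α β δ δ' η A B : ℝ} {C C' : ℝ≥0} {fam fam' : Bool → CPar → ℝ → ℂ}
  {ea eb : Bool → Bool → Bool → ℝ}

lemma leibBd_main_main (hα : 0 < α) (hβ : 0 < β) (hA : 0 < A) (hB : 0 < B) (hea : ExpPair ea A)
    (heb : ExpPair eb B) (d d' : Bool) :
    LeibBd α β A B ea eb fun h z => fdn α β h false (xor false d) (xor false d') z *
      fdn α β h true (xor true d) (xor true d') z := by
  refine ⟨1, by simp, fun h R hR => ?_⟩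
  have := nrm2_prod_rpow_le (μ := volume) (ν := volume) (ι := Bool) (c := A) (d := B)
    (F := fun s => fdn α β h s (xor s d) (xor s d')) (θ := fun _ => 1)
    (a := fun s => ea s (xor s d) (xor s d')) (b := fun s => eb s (xor s d) (xor s d'))
    hA hB (fun s => measurable_fdn hα hβ h _ _ _) (fun _ => zero_le_one)
    (fun s => hea.nonneg _ _ _) (fun s => heb.nonneg _ _ _)
    (by rw [← hea.add_eq d d']; simp [add_comm]) (by rw [← heb.add_eq d d']; simp [add_comm])
  simp only [ENNReal.rpow_one, Fintype.prod_bool] at this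
  rw [one_mul]
  refine le_trans (le_of_eq ?_) (this.trans (le_trans (le_of_eq ?_) (hR d d')))
  · simp only [mul_comm]
  · rw [mul_comm]; simp [fnm]

lemma prod_one_add_shf {κ : Type*} [Fintype κ] {θ : Bool → κ → ℝ} (hθ : ∀ s k, 0 ≤ θ s k)
    (hs : ∀ s, ∑ k, θ s k = 1) (d : Bool) (j : ℕ) :
    ∏ i : Bool × κ, (1 + (shf (xor i.1 d) j : ℕ) : ℝ≥0∞) ^ θ i.1 i.2 = 4 * (1 + j) := by
  rw [prod_fst_rpow hθ hs fun s => (1 + (shf (xor s d) j : ℕ) : ℝ≥0∞)]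
  have : (1 : ℝ≥0∞) + 3 = 4 := by norm_num
  cases d <;> simp [shf, this, mul_comm]

section Common

variable (hα : 0 < α) (hβ : 0 < β) (hη : 0 < η) (hη1 : η ≤ 1 / 2)
  (hA : 0 < A) (hA2 : A ≤ 2) (hB : 0 < B) (hB2 : B ≤ 2) (hea : ExpPair ea A) (heb : ExpPair eb B)
include hα hβ hη hη1 hA hA2 hB hB2 hea heb

lemma leibBd_comm_main (hδ : 0 < δ) (hηδ : 3 * η * α ≤ δ) (hfam : CommFam α δ C fam)
    {σ : ℝ} (hσ : 1 / 2 ≤ σ) (hσ1 : σ ≤ 1) (hσα : 1 / σ - 1 < α) (hσA : σ * A ≤ 1)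
    (hσB : σ * B ≤ 1) (d d' : Bool) :
    LeibBd α β A B ea eb fun h z => ∫⁻ t,
      ‖IF2 (fun ξ => fam (xor false d) t ξ.1 *
        (((|ξ.2| ^ selD (xor false d') β : ℝ) : ℂ) * ft2 (h false) ξ)) z‖ₑ *
      ‖IF2 (fun ξ => fam (xor true d) t ξ.1 *
        (((|ξ.2| ^ selD (xor true d') β : ℝ) : ℂ) * ft2 (h true) ξ)) z‖ₑ
      ∂((Measure.count : Measure (ℤ × ℕ × ℕ)).prod volume) := by
  have hb0 (s a) : 0 ≤ bwt η 0 (xor s d) a := (bwt_pos hη hη1 (by simp) _ _).le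
  have hfl (k : Bool) : bwt η 0 (xor true d) (Equiv.boolNot k) = bwt η 0 (xor false d) k := by
    simp [bwt_not_not]
  have pairx (k : Bool) : ea false k (xor false d') + ea true (Equiv.boolNot k) (xor true d') = A := by
    simpa using hea.add_eq k d'
  have pairy (k : Bool) : eb false k (xor false d') + eb true (Equiv.boolNot k) (xor true d') = B := by
    simpa using heb.add_eq k d'
  obtain ⟨Cx, hCx, hx⟩ := exists_nrm2_tsum_cnv_krn_mixMin_le (ι := Bool × Bool) (ε := α * η)
    (θ := fun i => bwt η 0 (xor i.1 d) i.2) (θp := fun i => bwt η (-1) (xor i.1 d) i.2)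
    (θm := fun i => bwt η 1 (xor i.1 d) i.2) (a := fun i => ea i.1 i.2 (xor i.1 d'))
    (b := fun i => eb i.1 i.2 (xor i.1 d')) (mul_pos hα hη)
    (fun i => bwt_pos hη hη1 (by simp) _ _) (fun i => bwt_pos hη hη1 (by simp) _ _)
    (fun i => bwt_add _ _ _) hσ hσ1 (fun i => hea.nonneg _ _ _) (fun i => hea.lt_one _ _ _)
    (fun i => heb.nonneg _ _ _) (fun i => heb.lt_one _ _ _)
    (sum_pair_eq (θ := fun s a => bwt η 0 (xor s d) a) (x := fun s a => ea s a (xor s d'))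
      Equiv.boolNot (sum_bwt _ _ _) hfl pairx)
    (sum_pair_eq (θ := fun s a => bwt η 0 (xor s d) a) (x := fun s a => eb s a (xor s d'))
      Equiv.boolNot (sum_bwt _ _ _) hfl pairy) hA hB hσA hσB
  obtain ⟨K, hK, hfin⟩ := exists_nrm2_tsum_prf_le hδ (by linarith : 0 < σ) hσα hA.le hA2 hB.le hB2 C
  refine ⟨K * Cx, ENNReal.mul_ne_top hK hCx, fun h R hR => ?_⟩
  have mF (i : Bool × Bool) := measurable_fdn hα hβ h i.1 i.2 (xor i.1 d')
  set G : ℤ → ℕ × ℕ → ℝ × ℝ → ℝ≥0∞ := fun q p z => mixMin (α * η)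
    (fun i : Bool × Bool => bwt η (-1) (xor i.1 d) i.2) (fun i => bwt η 1 (xor i.1 d) i.2) q
    (fun i => cnv (omg (q - (shf (xor i.1 d) p.1 : ℕ)))
      (fun x => fdn α β h i.1 i.2 (xor i.1 d') (x, z.2)) z.1) with hG
  have mG (q p) : Measurable (G q p) :=
    measurable_mixMin q fun i => measurable_cnv_prod (measurable_omg _) (mF i)
  have hpt (z : ℝ × ℝ) := lintegral_CPar_le (D := prf α δ C) (G := fun q p x => G q p (x, z.2))
    (fun q p => measurable_slice_left (mG q p) z.2) z.1 (fun t =>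
      prod_le_mixMin hα hη hη1 hηδ C t d (X := fun s =>
        ‖IF2 (fun ξ => fam (xor s d) t ξ.1 *
          (((|ξ.2| ^ selD (xor s d') β : ℝ) : ℂ) * ft2 (h s) ξ)) z‖ₑ)
        fun s a => (hfam.kb a t (xor s d)).enorm_left_le (selD_nonneg hα a)
          (selD_nonneg hβ _) (h s) z.1 z.2)
  rw [mul_assoc]
  refine (nrm2_mono hA.le hB.le hpt).trans (hfin (Cx * R) _ (fun p => ?_) fun p => ?_)
  · exact Measurable.ennreal_tsum fun q => measurable_cnv_prod (measurable_krn _) (mG q p)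
  · refine (hx (fun i => fdn α β h i.1 i.2 (xor i.1 d')) mF (fun i => exists_fdn_le α β h _ _ _)
      (fun i => shf (xor i.1 d) p.1) (p.2 + 3)).trans ?_
    rw [prod_one_add_shf (θ := fun s a => bwt η 0 (xor s d) a) hb0 (fun s => sum_bwt _ _ _)]
    have hN := prod_pair_le (θ := fun s a => bwt η 0 (xor s d) a)
      (N := fun s a => fnm α β ea eb h s a (xor s d')) Equiv.boolNot hb0 (sum_bwt _ _ _) hfl (R := R)
      (fun k => by simpa using hR k d')
    refine (mul_le_mul_right hN _).trans (le_of_eq (by ring))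

lemma leibBd_main_comm (hδ' : 0 < δ') (hηδ' : 3 * η * β ≤ δ') (hfam' : CommFam β δ' C' fam')
    {σ ν : ℝ} (hσ : 1 / 2 ≤ σ) (hσ1 : σ ≤ 1) (hσβ : 1 / σ - 1 < β) (hν : 0 < ν)
    (hν1 : ∀ s a b, eb s a b + ν ≤ 1) (hνB : B + 2 * ν + 16 * η ≤ 1 / σ) (d d' : Bool) :
    LeibBd α β A B ea eb fun h z => ∫⁻ t,
      ‖IF2 (fun ξ => ((|ξ.1| ^ selD (xor false d) α : ℝ) : ℂ) *
        (fam' (xor false d') t ξ.2 * ft2 (h false) ξ)) z‖ₑ *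
      ‖IF2 (fun ξ => ((|ξ.1| ^ selD (xor true d) α : ℝ) : ℂ) *
        (fam' (xor true d') t ξ.2 * ft2 (h true) ξ)) z‖ₑ
      ∂((Measure.count : Measure (ℤ × ℕ × ℕ)).prod volume) := by
  have hb0 (s a) : 0 ≤ bwt η 0 (xor s d') a := (bwt_pos hη hη1 (by simp) _ _).le
  have hfl (k : Bool) : bwt η 0 (xor true d') (Equiv.boolNot k) = bwt η 0 (xor false d') k := by
    simp [bwt_not_not]
  have pairx (k : Bool) : ea false (xor false d) k + ea true (xor true d) (Equiv.boolNot k) = A := by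
    simpa using hea.add_eq d k
  have pairy (k : Bool) : eb false (xor false d) k + eb true (xor true d) (Equiv.boolNot k) = B := by
    simpa using heb.add_eq d k
  have hτ (u : ℝ) (hu : |u| ≤ 1) : ∑ i : Bool × Bool,
      bwt η u (xor i.1 d') i.2 * (eb i.1 (xor i.1 d) i.2 + ν) ≤ 1 / σ := by
    refine (sum_bwt_mul_le (θ := fun s a => bwt η 0 (xor s d') a)
      (θ' := fun s a => bwt η u (xor s d') a) (x := fun s b => eb s (xor s d) b)
      Equiv.boolNot (fun s => sum_bwt _ _ _) hfl pairy (fun s k => bwt_le_add hη hu _ _)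
      (fun s k => add_nonneg (heb.nonneg _ _ _) hν.le) (fun s k => hν1 _ _ _)
      (by positivity)).trans ?_
    rw [Fintype.card_bool]
    push_cast
    linarith
  obtain ⟨Cx, hCx, hx⟩ := exists_nrm2_tsum_right_le (ι := Bool × Bool) (ε := β * η)
    (θ := fun i => bwt η 0 (xor i.1 d') i.2) (θp := fun i => bwt η (-1) (xor i.1 d') i.2)
    (θm := fun i => bwt η 1 (xor i.1 d') i.2) (a := fun i => ea i.1 (xor i.1 d) i.2)
    (b := fun i => eb i.1 (xor i.1 d) i.2) (τ := fun i => eb i.1 (xor i.1 d) i.2 + ν)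
    (mul_pos hβ hη)
    (fun i => bwt_pos hη hη1 (by simp) _ _) (fun i => bwt_pos hη hη1 (by simp) _ _)
    (fun i => bwt_add _ _ _) hσ hσ1 (fun i => hea.nonneg _ _ _)
    (fun i => heb.nonneg _ _ _) (fun i => by linarith) (fun i => hν1 _ _ _)
    (sum_pair_eq (θ := fun s a => bwt η 0 (xor s d') a) (x := fun s b => ea s (xor s d) b)
      Equiv.boolNot (sum_bwt _ _ _) hfl pairx)
    (sum_pair_eq (θ := fun s a => bwt η 0 (xor s d') a) (x := fun s b => eb s (xor s d) b)
      Equiv.boolNot (sum_bwt _ _ _) hfl pairy) hA hB (hτ _ (by simp)) (hτ _ (by simp))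
  obtain ⟨K, hK, hfin⟩ :=
    exists_nrm2_tsum_prf_le hδ' (by linarith : 0 < σ) hσβ hA.le hA2 hB.le hB2 C'
  refine ⟨K * Cx, ENNReal.mul_ne_top hK hCx, fun h R hR => ?_⟩
  have mF (i : Bool × Bool) := measurable_fdn hα hβ h i.1 (xor i.1 d) i.2
  set G : ℤ → ℕ × ℕ → ℝ × ℝ → ℝ≥0∞ := fun q p z => mixMin (β * η)
    (fun i : Bool × Bool => bwt η (-1) (xor i.1 d') i.2) (fun i => bwt η 1 (xor i.1 d') i.2) q
    (fun i => cnv (omg (q - (shf (xor i.1 d') p.1 : ℕ)))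
      (fun y => fdn α β h i.1 (xor i.1 d) i.2 (z.1, y)) z.2) with hG
  have mG (q p) : Measurable (G q p) :=
    measurable_mixMin q fun i => measurable_cnv_prod_right (measurable_omg _) (mF i)
  have hpt (z : ℝ × ℝ) := lintegral_CPar_le (D := prf β δ' C') (G := fun q p y => G q p (z.1, y))
    (fun q p => measurable_slice_right (mG q p) z.1) z.2 (fun t =>
      prod_le_mixMin hβ hη hη1 hηδ' C' t d' (X := fun s =>
        ‖IF2 (fun ξ => ((|ξ.1| ^ selD (xor s d) α : ℝ) : ℂ) *
          (fam' (xor s d') t ξ.2 * ft2 (h s) ξ)) z‖ₑ)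
        fun s a => (hfam'.kb a t (xor s d')).enorm_right_le (selD_nonneg hα _)
          (selD_nonneg hβ a) (h s) z.1 z.2)
  rw [mul_assoc]
  refine (nrm2_mono hA.le hB.le hpt).trans (hfin (Cx * R) _ (fun p => ?_) fun p => ?_)
  · exact Measurable.ennreal_tsum fun q => measurable_cnv_prod_right (measurable_krn _) (mG q p)
  · refine (hx (fun i => fdn α β h i.1 (xor i.1 d) i.2) mF
      (fun i => shf (xor i.1 d') p.1) (p.2 + 3)).trans ?_
    have hN := prod_pair_le (θ := fun s a => bwt η 0 (xor s d') a)
      (N := fun s b => fnm α β ea eb h s (xor s d) b) Equiv.boolNot hb0 (sum_bwt _ _ _) hfl (R := R)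
      (fun k => by simpa using hR d k)
    refine (mul_le_mul_right hN _).trans ?_
    have l1 : (1 : ℝ≥0∞) ≤ (1 + (p.2 + 3 : ℕ) : ℝ≥0∞) ^ (1 / σ) :=
      ENNReal.one_le_rpow le_self_add (by positivity)
    have l2 : (1 : ℝ≥0∞) ≤ 4 * (1 + p.1) := one_le_mul (by norm_num) le_self_add
    calc _ = Cx * R * (t2 ((p.2 + 3 : ℕ) * (1 / σ - 1)) * 1 * 1) := by ring
      _ ≤ _ := by gcongr

end Common

end Classes

section CommComm

/-- Product weights for a double commutator. -/
noncomputable def bw2 (η u v : ℝ) (d d' : Bool) (i : Bool × Bool × Bool) : ℝ :=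
  bwt η u (xor i.1 d) i.2.1 * bwt η v (xor i.1 d') i.2.2

variable {α β δ δ' η A B : ℝ} {C C' : ℝ≥0} {fam fam' : Bool → CPar → ℝ → ℂ}
  {ea eb : Bool → Bool → Bool → ℝ}

lemma sum_bw2 (η u v : ℝ) (d d' s : Bool) : ∑ k : Bool × Bool, bw2 η u v d d' (s, k) = 1 := by
  unfold bw2
  rw [Fintype.sum_prod_type]
  simp_rw [← Finset.mul_sum, sum_bwt, mul_one]
  exact sum_bwt η u _

lemma bw2_pos {u v : ℝ} (hη : 0 < η) (hη1 : η ≤ 1 / 2) (hu : |u| ≤ 1) (hv : |v| ≤ 1) (d d' : Bool)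
    (i : Bool × Bool × Bool) : 0 < bw2 η u v d d' i :=
  mul_pos (bwt_pos hη hη1 hu _ _) (bwt_pos hη hη1 hv _ _)

lemma bw2_add_right (η u : ℝ) (d d' : Bool) (i : Bool × Bool × Bool) :
    bw2 η u (-1) d d' i + bw2 η u 1 d d' i = 2 * bw2 η u 0 d d' i := by
  unfold bw2
  rw [← mul_add, bwt_add]
  ring

lemma bw2_add_left (η v : ℝ) (d d' : Bool) (i : Bool × Bool × Bool) :
    bw2 η (-1) v d d' i + bw2 η 1 v d d' i = 2 * bw2 η 0 v d d' i := by
  unfold bw2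
  rw [← add_mul, bwt_add]
  ring

lemma bw2_le_add {u v : ℝ} (hη : 0 < η) (hη1 : η ≤ 1 / 2) (hu : |u| ≤ 1) (hv : |v| ≤ 1)
    (d d' : Bool) (i : Bool × Bool × Bool) : bw2 η u v d d' i ≤ bw2 η 0 0 d d' i + 2 * η := by
  unfold bw2
  have a1 := bwt_le_add hη hu (xor i.1 d) i.2.1
  have a2 := bwt_le_add hη hv (xor i.1 d') i.2.2
  have b1 := (bwt_pos (u := 0) hη hη1 (by simp) (xor i.1 d) i.2.1).le
  have b3 := (bwt_pos hη hη1 hv (xor i.1 d') i.2.2).le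
  have c1 := bwt_le_one (u := 0) hη hη1 (by simp) (xor i.1 d) i.2.1
  have c2 := bwt_le_one hη hη1 hv (xor i.1 d') i.2.2
  have e1 := mul_le_mul_of_nonneg_right a1 b3
  have e2 := mul_le_mul_of_nonneg_left a2 b1
  nlinarith

lemma leibBd_comm_comm (hα : 0 < α) (hβ : 0 < β) (hη : 0 < η) (hη1 : η ≤ 1 / 2)
    (hA : 0 < A) (hA2 : A ≤ 2) (hB : 0 < B) (hB2 : B ≤ 2) (hea : ExpPair ea A) (heb : ExpPair eb B)
    (hδ : 0 < δ) (hηδ : 3 * η * α ≤ δ) (hfam : CommFam α δ C fam)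
    {σ : ℝ} (hσ : 1 / 2 ≤ σ) (hσ1 : σ ≤ 1) (hσα : 1 / σ - 1 < α) (hσA : σ * A ≤ 1)
    (hσB : σ * B ≤ 1) (hδ' : 0 < δ') (hηδ' : 3 * η * β ≤ δ') (hfam' : CommFam β δ' C' fam')
    {σ' ν : ℝ} (hσ' : 1 / 2 ≤ σ') (hσ1' : σ' ≤ 1) (hσβ : 1 / σ' - 1 < β) (hν : 0 < ν)
    (hν1 : ∀ s a b, eb s a b + ν ≤ 1) (hνB : B + 2 * ν + 16 * η ≤ 1 / σ') (d d' : Bool) :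
    LeibBd α β A B ea eb fun h z => ∫⁻ t, ∫⁻ t',
      ‖IF2 (fun ξ => fam (xor false d) t ξ.1 *
        (fam' (xor false d') t' ξ.2 * ft2 (h false) ξ)) z‖ₑ *
      ‖IF2 (fun ξ => fam (xor true d) t ξ.1 *
        (fam' (xor true d') t' ξ.2 * ft2 (h true) ξ)) z‖ₑ
      ∂((Measure.count : Measure (ℤ × ℕ × ℕ)).prod volume)
      ∂((Measure.count : Measure (ℤ × ℕ × ℕ)).prod volume) := by
  have p0 : |(0 : ℝ)| ≤ 1 := by simp
  have p1 : |(1 : ℝ)| ≤ 1 := by simp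
  have pm : |(-1 : ℝ)| ≤ 1 := by simp
  have hb0 (s : Bool) (k : Bool × Bool) : 0 ≤ bw2 η 0 0 d d' (s, k) :=
    (bw2_pos hη hη1 p0 p0 _ _ _).le
  set flip : Bool × Bool ≃ Bool × Bool := Equiv.prodCongr Equiv.boolNot Equiv.boolNot with hflip
  have hfl (k : Bool × Bool) : bw2 η 0 0 d d' (true, flip k) = bw2 η 0 0 d d' (false, k) := by
    simp [bw2, bwt_not_not, hflip]
  have pairx (k : Bool × Bool) : ea false k.1 k.2 + ea true (flip k).1 (flip k).2 = A := by
    simpa [hflip] using hea.add_eq k.1 k.2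
  have pairy (k : Bool × Bool) : eb false k.1 k.2 + eb true (flip k).1 (flip k).2 = B := by
    simpa [hflip] using heb.add_eq k.1 k.2
  have hτ (u v : ℝ) (hu : |u| ≤ 1) (hv : |v| ≤ 1) : ∑ i : Bool × Bool × Bool,
      bw2 η u v d d' i * (eb i.1 i.2.1 i.2.2 + ν) ≤ 1 / σ' := by
    refine (sum_bwt_mul_le (θ := fun s k => bw2 η 0 0 d d' (s, k))
      (θ' := fun s k => bw2 η u v d d' (s, k)) (x := fun s (k : Bool × Bool) => eb s k.1 k.2)
      flip (fun s => sum_bw2 _ _ _ _ _ _) hfl pairy (fun s k => bw2_le_add hη hη1 hu hv _ _ _)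
      (fun s k => add_nonneg (heb.nonneg _ _ _) hν.le) (fun s k => hν1 _ _ _)
      (by positivity)).trans ?_
    rw [Fintype.card_prod, Fintype.card_bool]
    push_cast
    linarith
  obtain ⟨Cx, hCx, hx⟩ := exists_nrm2_tsum_tsum_le (ι := Bool × Bool × Bool)
    (ε := α * η) (ε' := β * η)
    (θ := bw2 η 0 0 d d') (θp := bw2 η (-1) 0 d d') (θm := bw2 η 1 0 d d')
    (θpp := bw2 η (-1) (-1) d d') (θpm := bw2 η (-1) 1 d d')
    (θmp := bw2 η 1 (-1) d d') (θmm := bw2 η 1 1 d d') (a := fun i => ea i.1 i.2.1 i.2.2)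
    (b := fun i => eb i.1 i.2.1 i.2.2) (τ := fun i => eb i.1 i.2.1 i.2.2 + ν)
    (mul_pos hα hη) (mul_pos hβ hη)
    (bw2_pos hη hη1 pm pm _ _) (bw2_pos hη hη1 pm p1 _ _)
    (bw2_pos hη hη1 p1 pm _ _) (bw2_pos hη hη1 p1 p1 _ _)
    (bw2_add_right _ _ _ _) (bw2_add_right _ _ _ _) (bw2_add_left _ _ _ _) hσ hσ1 hσ' hσ1'
    (fun i => hea.nonneg _ _ _) (fun i => hea.lt_one _ _ _)
    (fun i => heb.nonneg _ _ _) (fun i => by linarith) (fun i => hν1 _ _ _)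
    (sum_pair_eq (θ := fun s k => bw2 η 0 0 d d' (s, k))
      (x := fun s (k : Bool × Bool) => ea s k.1 k.2) flip (sum_bw2 _ _ _ _ _ _) hfl pairx)
    (sum_pair_eq (θ := fun s k => bw2 η 0 0 d d' (s, k))
      (x := fun s (k : Bool × Bool) => eb s k.1 k.2) flip (sum_bw2 _ _ _ _ _ _) hfl pairy)
    hA hB hσA hσB (hτ _ _ pm pm) (hτ _ _ pm p1) (hτ _ _ p1 pm) (hτ _ _ p1 p1)
  obtain ⟨K, hK, hfin⟩ := exists_nrm2_tsum_prf_le hδ (by linarith : 0 < σ) hσα hA.le hA2 hB.le hB2 C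
  obtain ⟨K', hK', hfin'⟩ :=
    exists_nrm2_tsum_prf_le hδ' (by linarith : 0 < σ') hσβ hA.le hA2 hB.le hB2 C'
  refine ⟨K * (K' * Cx), ENNReal.mul_ne_top hK (ENNReal.mul_ne_top hK' hCx), fun h R hR => ?_⟩
  have mF (i : Bool × Bool × Bool) := measurable_fdn hα hβ h i.1 i.2.1 i.2.2
  set H : ℤ → ℤ → ℕ × ℕ → ℕ × ℕ → ℝ × ℝ → ℝ≥0∞ := fun q q' p p' z =>
    min (t2 (α * η * q) * mixMin (β * η) (bw2 η (-1) (-1) d d') (bw2 η (-1) 1 d d') q' fun i =>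
        cnv2 (q - (shf (xor i.1 d) p.1 : ℕ)) (q' - (shf (xor i.1 d') p'.1 : ℕ))
          (fdn α β h i.1 i.2.1 i.2.2) z)
      (t2 (-(α * η) * q) * mixMin (β * η) (bw2 η 1 (-1) d d') (bw2 η 1 1 d d') q' fun i =>
        cnv2 (q - (shf (xor i.1 d) p.1 : ℕ)) (q' - (shf (xor i.1 d') p'.1 : ℕ))
          (fdn α β h i.1 i.2.1 i.2.2) z) with hHdef
  have mH (q q' p p') : Measurable (H q q' p p') :=
    (measurable_const.mul (measurable_mixMin q' fun i => measurable_cnv2 _ _ (mF i))).min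
      (measurable_const.mul (measurable_mixMin q' fun i => measurable_cnv2 _ _ (mF i)))
  have hpt (z : ℝ × ℝ) := lintegral_CPar_CPar_le (D := prf α δ C) (D' := prf β δ' C') mH z.1 z.2
    (fun t t' => prod_le_min_mixMin hα hη hη1 hηδ hβ hηδ' C C' t t' d d' (X := fun s =>
        ‖IF2 (fun ξ => fam (xor s d) t ξ.1 * (fam' (xor s d') t' ξ.2 * ft2 (h s) ξ)) z‖ₑ)
        fun s a b => (hfam.kb a t (xor s d)).enorm_both_le (selD_nonneg hα a) (selD_nonneg hβ b)
          (hfam'.kb b t' (xor s d')) (measurable_slice_right (hfam.meas _) t)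
          (amp_ne_top _ _ _ _ _) (h s) z.1 z.2)
  have mI (q q' p p') : Measurable fun z : ℝ × ℝ =>
      cnv (krn (q' - (p'.2 + 3 : ℕ))) (fun y => H q q' p p' (z.1, y)) z.2 :=
    measurable_cnv_prod_right (measurable_krn _) (mH q q' p p')
  have mJ (p p') : Measurable fun z : ℝ × ℝ => ∑' q : ℤ, cnv (krn (q - (p.2 + 3 : ℕ)))
      (fun x => ∑' q' : ℤ, cnv (krn (q' - (p'.2 + 3 : ℕ))) (fun y => H q q' p p' (x, y)) z.2) z.1 :=
    Measurable.ennreal_tsum fun q => measurable_cnv_prod (measurable_krn _)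
      (F := fun z => ∑' q' : ℤ, cnv (krn (q' - (p'.2 + 3 : ℕ))) (fun y => H q q' p p' (z.1, y)) z.2)
      (Measurable.ennreal_tsum fun q' => mI q q' p p')
  refine (nrm2_mono hA.le hB.le hpt).trans ?_
  simp_rw [mul_assoc (prf α δ C _), ENNReal.tsum_mul_left]
  rw [mul_assoc]
  refine hfin (K' * Cx * R) _ (fun p => Measurable.ennreal_tsum fun p' =>
    (mJ p p').const_mul _) fun p => ?_
  rw [mul_assoc K', mul_assoc K']
  refine hfin' _ _ (mJ p) fun p' => ?_
  refine (hx (fun i => fdn α β h i.1 i.2.1 i.2.2) mF (fun i => exists_fdn_le α β h _ _ _)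
    (fun i => shf (xor i.1 d) p.1) (fun i => shf (xor i.1 d') p'.1) (p.2 + 3) (p'.2 + 3)).trans ?_
  rw [prod_one_add_shf (θ := fun s k => bw2 η 0 0 d d' (s, k)) hb0 (fun s => sum_bw2 _ _ _ _ _ _)]
  have hN := prod_pair_le (θ := fun s k => bw2 η 0 0 d d' (s, k))
    (N := fun s (k : Bool × Bool) => fnm α β ea eb h s k.1 k.2) flip hb0 (sum_bw2 _ _ _ _ _ _) hfl
    (R := R) (fun k => by simpa [hflip] using hR k.1 k.2)
  refine (mul_le_mul_right hN _).trans ?_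
  have l1 : (1 : ℝ≥0∞) ≤ (1 + (p'.2 + 3 : ℕ) : ℝ≥0∞) ^ (1 / σ') :=
    ENNReal.one_le_rpow le_self_add (by positivity)
  have l2 : (1 : ℝ≥0∞) ≤ 4 * (1 + p'.1) := one_le_mul (by norm_num) le_self_add
  calc _ = Cx * R * (t2 ((p.2 + 3 : ℕ) * (1 / σ - 1)) * (1 + (p.2 + 3 : ℕ) : ℝ≥0∞) ^ (1 / σ) *
        (4 * (1 + p.1))) * (t2 ((p'.2 + 3 : ℕ) * (1 / σ' - 1)) * 1 * 1) := by ring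
    _ ≤ Cx * R * (t2 ((p.2 + 3 : ℕ) * (1 / σ - 1)) * (1 + (p.2 + 3 : ℕ) : ℝ≥0∞) ^ (1 / σ) *
        (4 * (1 + p.1))) * (t2 ((p'.2 + 3 : ℕ) * (1 / σ' - 1)) *
        (1 + (p'.2 + 3 : ℕ) : ℝ≥0∞) ^ (1 / σ') * (4 * (1 + p'.1))) := by gcongr
    _ = _ := by ring

end CommComm

section Assembly

/-- The symbols of the superposition of `|ξ + η| ^ α`: main terms and commutator terms. -/
noncomputable def msym (α : ℝ) (fam : Bool → CPar → ℝ → ℂ) (s : Bool) (i : Bool × Bool)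
    (t : CPar) (ξ : ℝ) : ℂ :=
  if i.1 then fam (xor s i.2) t ξ else ((|ξ| ^ selD (xor s i.2) α : ℝ) : ℂ)

/-- The parameter measures of the superposition of `|ξ + η| ^ α`. -/
noncomputable def mms (m : Bool) : Measure CPar :=
  if m then (Measure.count : Measure (ℤ × ℕ × ℕ)).prod volume else Measure.dirac ((0, 0, 0), 0)

instance (m : Bool) : SFinite (mms m) := by
  unfold mms
  split_ifs <;> infer_instance

lemma measurable_msym {α : ℝ} {fam : Bool → CPar → ℝ → ℂ}
    (hf : ∀ d, Measurable (Function.uncurry (fam d))) (s : Bool) (i : Bool × Bool) :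
    Measurable (Function.uncurry (msym α fam s i)) := by
  obtain ⟨m, d⟩ := i
  cases m
  · simp only [Function.uncurry_def, msym, Bool.false_eq_true, if_false]
    fun_prop
  · exact hf _

/-- Commutator decomposition of `|ξ + η| ^ α` as a superposition of product symbols. -/
lemma exists_commFam {α : ℝ} (hα : 0 < α) :
    ∃ (fam : Bool → CPar → ℝ → ℂ) (C : ℝ≥0), CommFam α (min 1 α) C fam ∧
      (∃ K : ℝ≥0∞, K ≠ ⊤ ∧ ∀ i : Bool × Bool, ∀ ξ η : ℝ, ξ ≠ 0 → η ≠ 0 →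
        ∫⁻ t, ‖msym α fam false i t ξ‖ₑ * ‖msym α fam true i t η‖ₑ ∂(mms i.1) ≤
          K * ENNReal.ofReal ((1 + |ξ| ^ α) * (1 + |η| ^ α))) ∧
      ∀ ξ η : ℝ, ξ ≠ 0 → η ≠ 0 → ((|ξ + η| ^ α : ℝ) : ℂ) =
        ∑ i : Bool × Bool, ∫ t, msym α fam false i t ξ * msym α fam true i t η ∂(mms i.1) := by
  obtain ⟨fam, C, hm, h0, h1, hb, hs⟩ := exists_commutator_family hα
    (le_min zero_le_one hα.le) (min_le_left 1 α) (min_le_right 1 α)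
  have hsel : ∀ a, selD a α = 0 ∨ selD a α = α := fun a => by cases a <;> simp [selD]
  have hpow : ∀ x : ℝ, 0 ≤ |x| ^ α := fun x => Real.rpow_nonneg (abs_nonneg x) α
  refine ⟨fam, C, ⟨hm, fun a t d => ?_⟩, ⟨C + 1, by simp, fun i ξ η hξ hη => ?_⟩,
    fun ξ η hξ hη => ?_⟩
  · cases d
    · simpa [shf, amp] using h0 _ (hsel a) t
    · simpa [shf, amp] using h1 _ (hsel a) t
  · have hle : ENNReal.ofReal (|ξ| ^ α) ≤ ENNReal.ofReal ((1 + |ξ| ^ α) * (1 + |η| ^ α)) :=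
      ENNReal.ofReal_le_ofReal (by nlinarith [hpow ξ, hpow η, mul_nonneg (hpow ξ) (hpow η)])
    have hle' : ENNReal.ofReal (|η| ^ α) ≤ ENNReal.ofReal ((1 + |ξ| ^ α) * (1 + |η| ^ α)) :=
      ENNReal.ofReal_le_ofReal (by nlinarith [hpow ξ, hpow η, mul_nonneg (hpow ξ) (hpow η)])
    have e : ∀ x : ℝ, ‖((|x| ^ α : ℝ) : ℂ)‖ₑ = ENNReal.ofReal (|x| ^ α) := fun x => by
      rw [← ofReal_norm_eq_enorm, Complex.norm_real, Real.norm_of_nonneg (hpow x)]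
    obtain ⟨m, d⟩ := i
    cases m
    · simp only [mms, msym, Bool.false_eq_true, if_false, lintegral_dirac]
      rw [add_mul, one_mul]
      refine le_trans ?_ le_add_self
      cases d <;> simp only [Bool.false_xor, Bool.true_xor, Bool.not_false, Bool.not_true, selD,
        Bool.false_eq_true, if_false, if_true, Real.rpow_zero, e] <;> simpa
    · refine le_trans ?_ (mul_le_mul_left (le_self_add : (C : ℝ≥0∞) ≤ C + 1) _)
      simp only [mms, msym, if_true]
      cases d
      · exact (hb ξ η).trans (mul_le_mul_right hle _)
      · simp_rw [mul_comm ‖fam _ _ ξ‖ₑ]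
        exact (hb η ξ).trans (mul_le_mul_right hle' _)
  · rw [hs ξ η hξ hη]
    simp only [Fintype.sum_prod_type, Fintype.sum_bool, mms, msym, if_true, Bool.false_eq_true,
      if_false, integral_dirac, Bool.false_xor, Bool.true_xor, Bool.not_false, Bool.not_true, selD,
      Real.rpow_zero]
    push_cast
    ring

lemma measurable_enorm_IF2 {T : Type*} [MeasurableSpace T] {W : T → ℝ × ℝ → ℂ}
    (hW : Measurable (Function.uncurry W)) :
    Measurable fun p : T × (ℝ × ℝ) => ‖IF2 (W p.1) p.2‖ₑ := by
  have : Measurable (Function.uncurry fun (p : T × (ℝ × ℝ)) (ξ : ℝ × ℝ) =>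
      W p.1 ξ * ex2 p.2 ξ) :=
    (hW.comp (by fun_prop : Measurable fun q : (T × (ℝ × ℝ)) × (ℝ × ℝ) => (q.1.1, q.2))).mul
      (continuous_ex2.measurable.comp
        (by fun_prop : Measurable fun q : (T × (ℝ × ℝ)) × (ℝ × ℝ) => (q.1.2, q.2)))
  exact (this.stronglyMeasurable.integral_prod_right).measurable.enorm

variable {α β δ δ' η A B : ℝ} {C C' : ℝ≥0} {fam fam' : Bool → CPar → ℝ → ℂ}
  {ea eb : Bool → Bool → Bool → ℝ}

/-- A term of the superposition of the fractional derivative of a product. -/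
noncomputable def mterm (α β : ℝ) (fam fam' : Bool → CPar → ℝ → ℂ)
    (i : (Bool × Bool) × (Bool × Bool))
    (h : Bool → SchwartzMap (ℝ × ℝ) ℂ) (z : ℝ × ℝ) : ℝ≥0∞ :=
  ∫⁻ t, ∫⁻ t',
    ‖IF2 (fun ξ => msym α fam false i.1 t ξ.1 *
      (msym β fam' false i.2 t' ξ.2 * ft2 (h false) ξ)) z‖ₑ *
    ‖IF2 (fun ξ => msym α fam true i.1 t ξ.1 *
      (msym β fam' true i.2 t' ξ.2 * ft2 (h true) ξ)) z‖ₑ ∂(mms i.2.1) ∂(mms i.1.1)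

lemma measurable_mterm (hf : ∀ d, Measurable (Function.uncurry (fam d)))
    (hf' : ∀ d, Measurable (Function.uncurry (fam' d))) (i : (Bool × Bool) × (Bool × Bool))
    (h : Bool → SchwartzMap (ℝ × ℝ) ℂ) : Measurable (mterm α β fam fam' i h) := by
  have key : ∀ s, Measurable fun p : (CPar × CPar) × (ℝ × ℝ) =>
      ‖IF2 (fun ξ => msym α fam s i.1 p.1.1 ξ.1 *
        (msym β fam' s i.2 p.1.2 ξ.2 * ft2 (h s) ξ)) p.2‖ₑ := fun s =>
    measurable_enorm_IF2 (W := fun (t : CPar × CPar) ξ => msym α fam s i.1 t.1 ξ.1 *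
        (msym β fam' s i.2 t.2 ξ.2 * ft2 (h s) ξ))
      (((measurable_msym hf s i.1).comp (by fun_prop :
          Measurable fun q : (CPar × CPar) × (ℝ × ℝ) => (q.1.1, q.2.1))).mul
        (((measurable_msym hf' s i.2).comp (by fun_prop :
          Measurable fun q : (CPar × CPar) × (ℝ × ℝ) => (q.1.2, q.2.2))).mul
          ((continuous_ft2 (h s)).measurable.comp measurable_snd)))
  have hk := (key false).mul (key true)
  have h1 := Measurable.lintegral_prod_right' (ν := mms i.2.1) (hk.comp (by fun_prop :
    Measurable fun q : ((ℝ × ℝ) × CPar) × CPar => ((q.1.2, q.2), q.1.1)))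
  exact Measurable.lintegral_prod_right' (ν := mms i.1.1) h1

lemma leibBd_sum {ι : Type*} [Fintype ι] (hA : 0 < A) (hA2 : A ≤ 2) (hB : 0 < B) (hB2 : B ≤ 2)
    {T : ι → (Bool → SchwartzMap (ℝ × ℝ) ℂ) → ℝ × ℝ → ℝ≥0∞} (hT : ∀ i h, Measurable (T i h))
    (hbd : ∀ i, LeibBd α β A B ea eb (T i)) :
    LeibBd α β A B ea eb fun h z => ∑ i, T i h z := by
  choose K hK hb using hbd
  refine ⟨(∑ i, K i ^ (1 / 2 : ℝ)) ^ (2 : ℝ), ENNReal.rpow_ne_top_of_nonneg (by norm_num)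
    (ENNReal.sum_ne_top.2 fun i _ => ENNReal.rpow_ne_top_of_nonneg (by norm_num) (hK i)),
    fun h R hR => ?_⟩
  have h1 := nrm2_tsum_rpow_half_le (μ := volume) (ν := volume) hA.le hA2 hB.le hB2
    (fun i => hT i h)
  simp only [tsum_fintype] at h1
  have h2 : nrm2 volume volume A B (fun z => ∑ i, T i h z) ^ (1 / 2 : ℝ) ≤
      (∑ i, K i ^ (1 / 2 : ℝ)) * R ^ (1 / 2 : ℝ) := by
    refine h1.trans ?_
    rw [Finset.sum_mul]
    refine Finset.sum_le_sum fun i _ => ?_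
    rw [← ENNReal.mul_rpow_of_nonneg _ _ (by norm_num)]
    exact ENNReal.rpow_le_rpow (hb i h R hR) (by norm_num)
  have h3 := ENNReal.rpow_le_rpow h2 (by norm_num : (0 : ℝ) ≤ 2)
  rw [ENNReal.mul_rpow_of_nonneg _ _ (by norm_num), ← ENNReal.rpow_mul, ← ENNReal.rpow_mul] at h3
  norm_num at h3
  simpa using h3

lemma LeibBd.congr {T T' : (Bool → SchwartzMap (ℝ × ℝ) ℂ) → ℝ × ℝ → ℝ≥0∞}
    (hT : LeibBd α β A B ea eb T) (h : ∀ h z, T' h z = T h z) : LeibBd α β A B ea eb T' := by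
  obtain rfl : T' = T := by ext; exact h _ _
  exact hT

/-- The Leibniz rule for families of reciprocal exponents. -/
lemma leibBd_fracD (hα : 0 < α) (hβ : 0 < β) (hA : 0 < A) (hAα : A < 1 + α) (hB : 0 < B)
    (hBα : B < 1 + α) (hBβ : B < 1 + β) (hea : ExpPair ea A) (heb : ExpPair eb B) :
    LeibBd α β A B ea eb fun h z => ‖fracD α β (fun z => h false z * h true z) z‖ₑ := by
  have hA2 : A < 2 := by
    have := hea.add_eq true true; have := hea.lt_one false true true
    have := hea.lt_one true (!true) (!true); linarith
  have hB2 : B < 2 := by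
    have := heb.add_eq true true; have := heb.lt_one false true true
    have := heb.lt_one true (!true) (!true); linarith
  obtain ⟨fam, C, hfam, ⟨K, hK, hb⟩, hs⟩ := exists_commFam hα
  obtain ⟨fam', C', hfam', ⟨K', hK', hb'⟩, hs'⟩ := exists_commFam hβ
  have hδ : 0 < min 1 α := lt_min zero_lt_one hα
  have hδ' : 0 < min 1 β := lt_min zero_lt_one hβ
  set S := max 1 (max A B) with hS
  have hS1 : 1 ≤ S := le_max_left _ _
  have hSA : A ≤ S := (le_max_left _ _).trans (le_max_right _ _)
  have hSB : B ≤ S := (le_max_right _ _).trans (le_max_right _ _)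
  have hS2 : S ≤ 2 := max_le one_le_two (max_le hA2.le hB2.le)
  have hSα : S < 1 + α := max_lt (by linarith) (max_lt hAα hBα)
  obtain ⟨S', hS1', hS2'⟩ : ∃ S', max 1 B < S' ∧ S' < min 2 (1 + β) :=
    exists_between (max_lt (lt_min one_lt_two (by linarith)) (lt_min hB2 hBβ))
  obtain ⟨h1S, hBS⟩ := max_lt_iff.1 hS1'
  obtain ⟨hS2, hSβ⟩ := lt_min_iff.1 hS2'
  obtain ⟨ν, hν, hν1, hνB⟩ : ∃ ν : ℝ, 0 < ν ∧ (∀ s a b, eb s a b + ν ≤ 1) ∧ 4 * ν ≤ S' - B := by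
    have hev : ∀ᶠ ν in nhdsWithin (0 : ℝ) (Set.Ioi 0), 0 < ν ∧ (∀ s a b, eb s a b + ν ≤ 1) ∧
        4 * ν ≤ S' - B := by
      simp only [Filter.eventually_and, Filter.eventually_all]
      have hsm : ∀ c : ℝ, 0 < c → ∀ᶠ ν in nhdsWithin (0 : ℝ) (Set.Ioi 0), ν < c := fun c hc =>
        nhdsWithin_le_nhds (Iio_mem_nhds hc)
      refine ⟨self_mem_nhdsWithin, fun s a b => ?_, ?_⟩
      · filter_upwards [hsm _ (sub_pos.2 (heb.lt_one s a b))] with ν hν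
        linarith
      · filter_upwards [hsm ((S' - B) / 4) (by linarith)] with ν hν
        linarith
    exact hev.exists
  obtain ⟨η, hη, hηlt⟩ := exists_between (show (0 : ℝ) < min (1 / 2) (min (min 1 α / (3 * α))
      (min (min 1 β / (3 * β)) ((S' - B) / 32))) from
    lt_min (by norm_num) (lt_min (by positivity) (lt_min (by positivity) (by linarith))))
  simp only [lt_min_iff] at hηlt
  obtain ⟨hη1, hη2, hη3, hη4⟩ := hηlt
  have hηδ : 3 * η * α ≤ min 1 α := by
    linarith [(lt_div_iff₀ (by positivity)).1 hη2]
  have hηδ' : 3 * η * β ≤ min 1 β := by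
    linarith [(lt_div_iff₀ (by positivity)).1 hη3]
  have hσA : S⁻¹ * A ≤ 1 := by rw [inv_mul_le_iff₀ (by linarith)]; linarith
  have hσB : S⁻¹ * B ≤ 1 := by rw [inv_mul_le_iff₀ (by linarith)]; linarith
  have hinv : ∀ x : ℝ, 1 ≤ x → x ≤ 2 → 1 / 2 ≤ x⁻¹ ∧ x⁻¹ ≤ 1 := fun x h1 h2 =>
    ⟨by rw [one_div]; exact inv_anti₀ (by linarith) h2, inv_le_one_of_one_le₀ h1⟩
  obtain ⟨hσ, hσ1⟩ := hinv S hS1 (by assumption)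
  obtain ⟨hσ', hσ1'⟩ := hinv S' h1S.le hS2.le
  have hσα : 1 / S⁻¹ - 1 < α := by rw [one_div, inv_inv]; linarith
  have hσβ : 1 / S'⁻¹ - 1 < β := by rw [one_div, inv_inv]; linarith
  have hνB' : B + 2 * ν + 16 * η ≤ 1 / S'⁻¹ := by rw [one_div, inv_inv]; linarith
  have hterm : ∀ i, LeibBd α β A B ea eb (mterm α β fam fam' i) := by
    rintro ⟨⟨m, d⟩, m', d'⟩
    cases m <;> cases m'
    · refine (leibBd_main_main hα hβ hA hB hea heb d d').congr fun h z => ?_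
      simp only [mterm, msym, mms, Bool.false_eq_true, if_false, lintegral_dirac, fdn,
        fracD_eq_IF2, Complex.ofReal_mul, mul_assoc]
    · refine (leibBd_main_comm hα hβ hη hη1.le hA hA2.le hB hB2.le hea heb hδ' hηδ' hfam'
        hσ' hσ1' hσβ hν hν1 hνB' d d').congr fun h z => ?_
      simp only [mterm, msym, mms, Bool.false_eq_true, if_false, if_true, lintegral_dirac]
    · refine (leibBd_comm_main hα hβ hη hη1.le hA hA2.le hB hB2.le hea heb hδ hηδ hfam
        hσ hσ1 hσα hσA hσB d d').congr fun h z => ?_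
      simp only [mterm, msym, mms, Bool.false_eq_true, if_false, if_true, lintegral_dirac]
    · refine (leibBd_comm_comm hα hβ hη hη1.le hA hA2.le hB hB2.le hea heb hδ hηδ hfam
        hσ hσ1 hσα hσA hσB hδ' hηδ' hfam' hσ' hσ1' hσβ hν hν1 hνB' d d').congr fun h z => ?_
      simp only [mterm, msym, mms, if_true]
  obtain ⟨K₀, hK₀, hsum⟩ := leibBd_sum hA hA2.le hB hB2.le
    (fun i h => measurable_mterm (α := α) (β := β) hfam.meas hfam'.meas i h) hterm
  refine ⟨K₀, hK₀, fun h R hR => le_trans (nrm2_mono hA.le hB.le fun z => ?_) (hsum h R hR)⟩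
  beta_reduce
  rw [Fintype.sum_prod_type]
  exact enorm_fracD_mul_le (fun i : Bool × Bool => mms i.1) (fun i : Bool × Bool => mms i.1)
    (measurable_msym hfam.meas false) (measurable_msym hfam.meas true)
    (measurable_msym hfam'.meas false) (measurable_msym hfam'.meas true) hα.le hβ.le hK hK' hb hb'
    hs hs' (h false) (h true) z

end Assembly

section Exponents

lemma LqNorm_eq_nrm {X : Type*} [MeasurableSpace X] (μ : Measure X) {t : ℝ≥0∞} (ht : t ≠ 0)
    (φ : X → ℝ≥0∞) : LqNorm μ t φ = nrm μ t⁻¹.toReal φ := by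
  unfold LqNorm
  split_ifs with h
  · simp [h, nrm_zero]
  · rw [nrm_pos (ENNReal.toReal_ne_zero.2 ⟨ENNReal.inv_ne_zero.2 h, ENNReal.inv_ne_top.2 ht⟩)]
    simp

lemma mixedNorm_eq_nrm2 {a b : ℝ≥0∞} (ha : a ≠ 0) (hb : b ≠ 0) (h : ℝ × ℝ → ℂ) :
    mixedNorm a b h = nrm2 volume volume a⁻¹.toReal b⁻¹.toReal fun z => ‖h z‖ₑ := by
  simp only [mixedNorm, nrm2, LqNorm_eq_nrm _ ha, LqNorm_eq_nrm _ hb]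
  rfl

/-- A family of reciprocal exponents given by its values. -/
noncomputable def expFam (p q : Bool → Bool → ℝ≥0∞) (s a b : Bool) : ℝ :=
  if s then (q (!a) (!b))⁻¹.toReal else (p a b)⁻¹.toReal

lemma expPair_expFam {p q : Bool → Bool → ℝ≥0∞} {s : ℝ≥0∞} (hp : ∀ a b, 1 < p a b)
    (hq : ∀ a b, 1 < q a b) (h : ∀ a b, (p a b)⁻¹ + (q a b)⁻¹ = s⁻¹) :
    ExpPair (expFam p q) s⁻¹.toReal := by
  have key : ∀ x : ℝ≥0∞, 1 < x → x⁻¹.toReal < 1 := fun x hx => by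
    rw [← ENNReal.toReal_one]
    exact ENNReal.toReal_strict_mono ENNReal.one_ne_top (ENNReal.inv_lt_one.2 hx)
  have ht : ∀ x : ℝ≥0∞, 1 < x → x⁻¹ ≠ ⊤ := fun x hx =>
    ENNReal.inv_ne_top.2 (zero_lt_one.trans hx).ne'
  refine ⟨fun s a b => ?_, fun s a b => ?_, fun a b => ?_⟩
  · unfold expFam; split_ifs <;> exact ENNReal.toReal_nonneg
  · unfold expFam; split_ifs
    · exact key _ (hq _ _)
    · exact key _ (hp _ _)
  · simp only [expFam, Bool.false_eq_true, if_false, if_true, Bool.not_not]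
    rw [← ENNReal.toReal_add (ht _ (hp a b)) (ht _ (hq a b)), h a b]

lemma toReal_inv_lt {x : ℝ} (hx : 0 < x) {s : ℝ≥0∞} (h : ENNReal.ofReal (1 / x) < s) :
    s⁻¹.toReal < x := by
  have : s⁻¹ < ENNReal.ofReal x := by
    rw [ENNReal.inv_lt_iff_inv_lt, ← ENNReal.ofReal_inv_of_pos hx, ← one_div]
    exact h
  rw [← ENNReal.toReal_ofReal hx.le]
  exact ENNReal.toReal_strict_mono ENNReal.ofReal_ne_top this

/-- Values of a function of two booleans. -/
def tbl (x y z w : ℝ≥0∞) (a b : Bool) : ℝ≥0∞ :=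
  if a then (if b then x else z) else (if b then w else y)

end Exponents

/-- The biparameter Leibniz rule in mixed-norm spaces. -/
theorem biparameter_leibniz_rule
    (α β : ℝ) (hα : 0 < α) (hβ : 0 < β)
    (s₁ s₂ : ℝ≥0∞)
    (hs₁ : ENNReal.ofReal (1 / (1 + α)) < s₁) (hs₁' : s₁ < ∞)
    (hs₂α : ENNReal.ofReal (1 / (1 + α)) < s₂)
    (hs₂β : ENNReal.ofReal (1 / (1 + β)) < s₂) (hs₂' : s₂ < ∞)
    (p₁ p₂ p₃ p₄ p₅ p₆ p₇ p₈ q₁ q₂ q₃ q₄ q₅ q₆ q₇ q₈ : ℝ≥0∞)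
    (hp₁ : 1 < p₁) (hp₂ : 1 < p₂) (hp₃ : 1 < p₃) (hp₄ : 1 < p₄)
    (hp₅ : 1 < p₅) (hp₆ : 1 < p₆) (hp₇ : 1 < p₇) (hp₈ : 1 < p₈)
    (hq₁ : 1 < q₁) (hq₂ : 1 < q₂) (hq₃ : 1 < q₃) (hq₄ : 1 < q₄)
    (hq₅ : 1 < q₅) (hq₆ : 1 < q₆) (hq₇ : 1 < q₇) (hq₈ : 1 < q₈)
    (hH₁ : p₁⁻¹ + q₁⁻¹ = s₁⁻¹) (hH₃ : p₃⁻¹ + q₃⁻¹ = s₁⁻¹)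
    (hH₅ : p₅⁻¹ + q₅⁻¹ = s₁⁻¹) (hH₇ : p₇⁻¹ + q₇⁻¹ = s₁⁻¹)
    (hH₂ : p₂⁻¹ + q₂⁻¹ = s₂⁻¹) (hH₄ : p₄⁻¹ + q₄⁻¹ = s₂⁻¹)
    (hH₆ : p₆⁻¹ + q₆⁻¹ = s₂⁻¹) (hH₈ : p₈⁻¹ + q₈⁻¹ = s₂⁻¹) :
    ∃ C : ℝ≥0, ∀ f g : SchwartzMap (ℝ × ℝ) ℂ,
      mixedNorm s₁ s₂ (fracD α β (fun z => f z * g z)) ≤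
        (C : ℝ≥0∞) *
          (mixedNorm p₁ p₂ (fracD α β (⇑f)) * mixedNorm q₁ q₂ (⇑g) +
            mixedNorm p₃ p₄ (⇑f) * mixedNorm q₃ q₄ (fracD α β (⇑g)) +
            mixedNorm p₅ p₆ (fracD α 0 (⇑f)) * mixedNorm q₅ q₆ (fracD 0 β (⇑g)) +
            mixedNorm p₇ p₈ (fracD 0 β (⇑f)) * mixedNorm q₇ q₈ (fracD α 0 (⇑g))) := by
  have hz : ∀ {x : ℝ≥0∞}, 1 < x → x ≠ 0 := fun hx => (zero_lt_one.trans hx).ne'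
  have hpos : ∀ {x : ℝ≥0∞} {y : ℝ}, ENNReal.ofReal y < x → x < ∞ → 0 < x⁻¹.toReal :=
    fun h h' => ENNReal.toReal_pos (ENNReal.inv_ne_zero.2 h'.ne)
      (ENNReal.inv_ne_top.2 (pos_of_gt h).ne')
  have hea : ExpPair (expFam (tbl p₁ p₃ p₅ p₇) (tbl q₁ q₃ q₅ q₇)) s₁⁻¹.toReal := by
    refine expPair_expFam ?_ ?_ ?_ <;> rintro (_ | _) (_ | _) <;> simpa [tbl]
  have heb : ExpPair (expFam (tbl p₂ p₄ p₆ p₈) (tbl q₂ q₄ q₆ q₈)) s₂⁻¹.toReal := by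
    refine expPair_expFam ?_ ?_ ?_ <;> rintro (_ | _) (_ | _) <;> simpa [tbl]
  obtain ⟨K, hK, h⟩ := leibBd_fracD hα hβ (hpos hs₁ hs₁')
    (toReal_inv_lt (by linarith) hs₁) (hpos hs₂α hs₂') (toReal_inv_lt (by linarith) hs₂α)
    (toReal_inv_lt (by linarith) hs₂β) hea heb
  refine ⟨K.toNNReal, fun f g => ?_⟩
  rw [ENNReal.coe_toNNReal hK, mixedNorm_eq_nrm2 (pos_of_gt hs₁).ne' (pos_of_gt hs₂α).ne']
  refine h (fun s => if s then g else f) _ fun a b => ?_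
  have e : ∀ s a b, fnm α β (expFam (tbl p₁ p₃ p₅ p₇) (tbl q₁ q₃ q₅ q₇))
      (expFam (tbl p₂ p₄ p₆ p₈) (tbl q₂ q₄ q₆ q₈)) (fun s => if s then g else f) s a b =
      if s then mixedNorm (tbl q₁ q₃ q₅ q₇ (!a) (!b)) (tbl q₂ q₄ q₆ q₈ (!a) (!b))
        (fracD (selD a α) (selD b β) g) else mixedNorm (tbl p₁ p₃ p₅ p₇ a b) (tbl p₂ p₄ p₆ p₈ a b)
        (fracD (selD a α) (selD b β) f) := by
    rintro s a b
    have h0 : ∀ {x y z w : ℝ≥0∞}, 1 < x → 1 < y → 1 < z → 1 < w → ∀ a b, tbl x y z w a b ≠ 0 := by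
      intro x y z w hx hy hz hw a b
      unfold tbl
      split_ifs <;> exact (zero_lt_one.trans (by assumption)).ne'
    rw [mixedNorm_eq_nrm2 (h0 hq₁ hq₃ hq₅ hq₇ _ _) (h0 hq₂ hq₄ hq₆ hq₈ _ _),
      mixedNorm_eq_nrm2 (h0 hp₁ hp₃ hp₅ hp₇ _ _) (h0 hp₂ hp₄ hp₆ hp₈ _ _)]
    cases s <;> rfl
  rw [e, e]
  simp only [Bool.false_eq_true, if_false, if_true, Bool.not_not]
  cases a <;> cases b <;> simp only [tbl, selD, Bool.not_false, Bool.not_true, Bool.false_eq_true,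
    if_false, if_true, fracD_zero]
  · exact le_add_self.trans (le_self_add.trans le_self_add)
  · exact le_add_self
  · exact le_add_self.trans le_self_add
  · exact le_self_add.trans (le_self_add.trans le_self_add)
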